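/- Suppose ℳ and ℳ' are practical for κ, the pair ℳ ⊆ ℳ' has the δ-cover and δ-approximation properties for some regular cardinal δ of ℳ', ℳ and ℳ' have the same ordinals, and ℳ^ω ⊆ ℳ holds in ℳ'. If κ > δ is α-iterable in ℳ', then κ was already α-iterable in ℳ. -/

import Mathlib

noncomputable section

namespace MPaper

open ZFSet

attribute [local instance] Classical.propDecidable

/-! ### Basic set-theoretic vocabulary over `ZFSet` -/

/-- The (external) cardinality of a ZFC set. -/
def zcard (x : ZFSet) : Cardinal := Cardinal.mk x.toSet

/-- `x` is a von Neumann ordinal: a transitive set of transitive sets. -/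
def IsOrd (x : ZFSet) : Prop := x.IsTransitive ∧ ∀ y ∈ x, ZFSet.IsTransitive y

/-- `κ` is a cardinal: an ordinal not equinumerous with any of its members. -/
def IsCard (κ : ZFSet) : Prop := IsOrd κ ∧ ∀ α ∈ κ, zcard α < zcard κ

/-- The ordinal `κ⁺`, the cardinal successor of `κ`. -/
def cardSuccOrd (κ : ZFSet) : Ordinal := (Order.succ (zcard κ)).ord

/-- `f` is a set-coded function with domain `d` (a set of Kuratowski pairs). -/
def IsZFunc (d f : ZFSet) : Prop :=
  (∀ p ∈ f, ∃ a ∈ d, ∃ b, p = ZFSet.pair a b) ∧ ∀ a ∈ d, ∃! b, ZFSet.pair a b ∈ f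

/-- Application of a set-coded function. -/
def fapp (f a : ZFSet) : ZFSet :=
  ⋃₀ (ZFSet.sep (fun b => ZFSet.pair a b ∈ f) (⋃₀ (⋃₀ f)))

/-- `f` maps `d` into `y`. -/
def MapsInto (f d y : ZFSet) : Prop := ∀ a ∈ d, fapp f a ∈ y

/-- `f` maps `d` onto `y`. -/
def SurjOnto (f d y : ZFSet) : Prop := MapsInto f d y ∧ ∀ b ∈ y, ∃ a ∈ d, fapp f a = b

/-- `f` is injective on `d`. -/
def InjOnZ (f d : ZFSet) : Prop := ∀ a ∈ d, ∀ b ∈ d, fapp f a = fapp f b → a = b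

/-- `f` is a bijection from `d` onto `y`. -/
def IsBij (f d y : ZFSet) : Prop := IsZFunc d f ∧ SurjOnto f d y ∧ InjOnZ f d

/-- The tail `κ ∖ α = {ξ ∈ κ | α ≤ ξ}` (for ordinals `α ∈ κ`). -/
def tailSet (κ α : ZFSet) : ZFSet := ZFSet.sep (fun ξ => ξ ∉ α) κ

/-- The relative complement `κ ∖ A`. -/
def compl (κ A : ZFSet) : ZFSet := ZFSet.sep (fun ξ => ξ ∉ A) κ

/-! ### First-order satisfaction in ∈-structures -/

/-- First order formulas in the language of set theory, with variables indexed by `ℕ`. -/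
inductive Fml : Type
  | mem : ℕ → ℕ → Fml
  | eq : ℕ → ℕ → Fml
  | impl : Fml → Fml → Fml
  | neg : Fml → Fml
  | all : ℕ → Fml → Fml

/-- Tarskian satisfaction of a formula in the ∈-structure with domain `D`. -/
def Sat (D : Set ZFSet) : Fml → (ℕ → ZFSet) → Prop
  | .mem i j, v => v i ∈ v j
  | .eq i j, v => v i = v j
  | .impl φ ψ, v => Sat D φ v → Sat D ψ v
  | .neg φ, v => ¬ Sat D φ v
  | .all n φ, v => ∀ x ∈ D, Sat D φ (Function.update v n x)

/-- `D` is an elementary substructure of `E` (as ∈-structures). -/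
def ElemSub (D E : Set ZFSet) : Prop :=
  D ⊆ E ∧ ∀ (φ : Fml) (v : ℕ → ZFSet), (∀ n, v n ∈ D) → (Sat D φ v ↔ Sat E φ v)

/-- `r` is a well-ordering of `x` (coded as a set of Kuratowski pairs). -/
def IsWellOrderOn (x r : ZFSet) : Prop :=
  (∀ p ∈ r, ∃ a ∈ x, ∃ b ∈ x, p = ZFSet.pair a b) ∧
  (∀ a ∈ x, ∀ b ∈ x, a = b ∨ ZFSet.pair a b ∈ r ∨ ZFSet.pair b a ∈ r) ∧
  (∀ a ∈ x, ∀ b ∈ x, ∀ c ∈ x,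
    ZFSet.pair a b ∈ r → ZFSet.pair b c ∈ r → ZFSet.pair a c ∈ r) ∧
  (∀ a ∈ x, ZFSet.pair a a ∉ r) ∧
  (∀ S : Set ZFSet, S ⊆ x.toSet → S.Nonempty → ∃ a ∈ S, ∀ b ∈ S, ZFSet.pair b a ∉ r)

/-- A transitive model of `ZFC⁻` (ZFC minus power set): a transitive set closed under
pairing and union, containing `ω`, satisfying the separation and collection schemes for
first-order formulas, and choice in the guise of the well-ordering principle.
(Extensionality and foundation hold automatically in transitive sets.) -/
def IsTransModel (M : ZFSet) : Prop :=
  M.IsTransitive ∧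
  ZFSet.omega ∈ M ∧
  (∀ x ∈ M, ∀ y ∈ M, ({x, y} : ZFSet) ∈ M) ∧
  (∀ x ∈ M, (⋃₀ x : ZFSet) ∈ M) ∧
  (∀ (φ : Fml) (v : ℕ → ZFSet), (∀ n, v n ∈ M) → ∀ a ∈ M,
    ∃ b ∈ M, ∀ x, x ∈ b ↔ x ∈ a ∧ Sat M.toSet φ (Function.update v 0 x)) ∧
  (∀ (φ : Fml) (v : ℕ → ZFSet), (∀ n, v n ∈ M) → ∀ a ∈ M,
    (∀ x ∈ a, ∃ y ∈ M, Sat M.toSet φ (Function.update (Function.update v 0 x) 1 y)) →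
    ∃ b ∈ M, ∀ x ∈ a, ∃ y ∈ b, Sat M.toSet φ (Function.update (Function.update v 0 x) 1 y)) ∧
  (∀ x ∈ M, ∃ r ∈ M, IsWellOrderOn x r)

/-! ### Weak κ-models, κ-models, M-ultrafilters -/

/-- A weak `κ`-model: a transitive model of ZFC⁻ of size `κ` with `κ ∈ M`. -/
def IsWeakModel (κ M : ZFSet) : Prop :=
  IsTransModel M ∧ κ ∈ M ∧ zcard M = zcard κ

/-- `M` is closed under `<κ`-sequences (of its elements). -/
def SeqClosed (κ M : ZFSet) : Prop :=
  ∀ γ ∈ κ, ∀ f : ZFSet, IsZFunc γ f → (∀ a ∈ γ, fapp f a ∈ M) → f ∈ M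

/-- A `κ`-model: a weak `κ`-model closed under `<κ`-sequences. -/
def IsKappaModel (κ M : ZFSet) : Prop := IsWeakModel κ M ∧ SeqClosed κ M

/-- `U` is an `M`-ultrafilter on `κ`: `⟨M, ∈, U⟩` thinks `U` is a normal ultrafilter on `κ`
containing all tail sets. -/
def IsMUltrafilter (κ M U : ZFSet) : Prop :=
  (∀ A ∈ U, A ∈ M ∧ A ⊆ κ) ∧
  (∀ α ∈ κ, tailSet κ α ∈ U) ∧
  (∅ : ZFSet) ∉ U ∧
  (∀ A ∈ U, ∀ B ∈ U, A ∩ B ∈ U) ∧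
  (∀ A ∈ U, ∀ B, B ∈ M → B ⊆ κ → A ⊆ B → B ∈ U) ∧
  (∀ B, B ∈ M → B ⊆ κ → B ∈ U ∨ compl κ B ∈ U) ∧
  (∀ f ∈ M, IsZFunc κ f → ZFSet.sep (fun ξ => fapp f ξ ∈ ξ) κ ∈ U →
    ∃ γ ∈ κ, ZFSet.sep (fun ξ => fapp f ξ = γ) κ ∈ U)

/-- `U` is weakly amenable for `M`: for every `X ∈ M` of size at most `κ` in `M`,
the intersection `X ∩ U` belongs to `M`. -/
def WeaklyAmenable (κ M U : ZFSet) : Prop :=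
  ∀ X ∈ M, (∃ f ∈ M.toSet, IsZFunc κ f ∧ ∀ y ∈ X, ∃ ξ ∈ κ, fapp f ξ = y) →
    X ∩ U ∈ M

/-- `U` is `ω₁`-intersecting: every countable collection of its members has a common element. -/
def OmegaOneIntersecting (U : ZFSet) : Prop :=
  ∀ s : ℕ → ZFSet, (∀ n, s n ∈ U) → ∃ x, ∀ n, x ∈ s n

/-- `M` contains (its version of) `V_κ`, i.e. the set of all sets of rank `< κ`. -/
def HasVkappa (κ M : ZFSet) : Prop :=
  ∃ v ∈ M.toSet, ∀ x, x ∈ v ↔ ZFSet.rank x < ZFSet.rank κ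

/-! ### Small universe measures and the associated models `M_U`, `N_U` -/

/-- `M` is the minimal model associated to `U` (the collection of Mostowski collapses of
well-founded relations on `κ` coded by sets in `U` and their complements): a weak `κ`-model
with `V_κ ∈ M` for which `U` is an `M`-ultrafilter, contained in every transitive
ZFC⁻-model `M'` with `κ ∈ M'` for which `U` is an `M'`-ultrafilter. -/
def IsMUModel (κ U M : ZFSet) : Prop :=
  IsWeakModel κ M ∧ HasVkappa κ M ∧ IsMUltrafilter κ M U ∧
  ∀ M', IsTransModel M' → κ ∈ M' → IsMUltrafilter κ M' U → M ⊆ M'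

/-- A small universe measure on `κ`: a set `U` of subsets of `κ` of size `κ` whose associated
minimal model `M_U` exists (is a weak `κ`-model with `V_κ ∈ M_U` and `U` an `M_U`-ultrafilter). -/
def IsSUMeasure (κ U : ZFSet) : Prop :=
  zcard U = zcard κ ∧ (∀ A ∈ U, A ⊆ κ) ∧ ∃ M, IsMUModel κ U M

/-- The minimal model `M_U` associated to a small universe measure `U`. -/
def MU (κ U : ZFSet) : ZFSet :=
  if h : ∃ M, IsMUModel κ U M then h.choose else ∅

/-- `j : M → N` is (up to isomorphism) the ultrapower embedding of `M` by the
`M`-ultrafilter `U` on `κ`, with `N` transitive (so the ultrapower is well-founded):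
`j` is elementary, every element of `N` has the form `j(f)(κ)` for `f : κ → M` in `M`,
and `U` is the `M`-ultrafilter derived from `j` with seed `κ`. -/
def IsUltrapowerEmb (κ M U N : ZFSet) (j : ZFSet → ZFSet) : Prop :=
  N.IsTransitive ∧
  (∀ x ∈ M, j x ∈ N) ∧
  (∀ (φ : Fml) (v : ℕ → ZFSet), (∀ n, v n ∈ M) →
    (Sat M.toSet φ v ↔ Sat N.toSet φ (fun n => j (v n)))) ∧
  (∀ a ∈ N, ∃ f ∈ M.toSet, IsZFunc κ f ∧ MapsInto f κ M ∧ fapp (j f) κ = a) ∧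
  (∀ A ∈ M, A ⊆ κ → (A ∈ U ↔ κ ∈ j A))

/-- The ultrapower of `M_U` by `U` is well-founded. -/
def UltrapowerWF (κ U : ZFSet) : Prop :=
  ∃ (N : ZFSet) (j : ZFSet → ZFSet), IsUltrapowerEmb κ (MU κ U) U N j

/-- A choice of transitive collapse of the ultrapower of `M_U` by `U`, with its embedding. -/
def upData (κ U : ZFSet) : ZFSet × (ZFSet → ZFSet) :=
  if h : ∃ p : ZFSet × (ZFSet → ZFSet), IsUltrapowerEmb κ (MU κ U) U p.1 p.2
  then h.choose else (∅, id)

/-- `N_U`: the transitive collapse of the ultrapower of `M_U` by `U` (when well-founded). -/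
def NU (κ U : ZFSet) : ZFSet := (upData κ U).1

/-- The ultrapower embedding `j_U : M_U → N_U`. -/
def jU (κ U : ZFSet) : ZFSet → ZFSet := (upData κ U).2

/-- `M_U⋆ = V_{j(κ)}^{N_U}`, the rank-initial segment of `N_U` below `j_U(κ)`. -/
def MUstar (κ U : ZFSet) : ZFSet :=
  ZFSet.sep (fun x => ZFSet.rank x < ZFSet.rank (jU κ U κ)) (NU κ U)

/-! ### Hereditary size, `H_{κ⁺}`, elementarity -/

/-- `x` has hereditary size at most `κ`. -/
def HeredLE (κ : ZFSet) : ZFSet → Prop :=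
  WellFounded.fix ZFSet.mem_wf
    (fun x ih => zcard x ≤ zcard κ ∧ ∀ y, ∀ h : y ∈ x, ih y h)

/-- The class `H_{κ⁺}` of sets of hereditary size at most `κ`. -/
def Hclass (κ : ZFSet) : Set ZFSet := { x | HeredLE κ x }

/-! ### The measures witnessing Ramsey and Ramsey-like cardinals -/

/-- A Ramsey measure on `κ`: a weakly amenable `ω₁`-intersecting small universe measure. -/
def IsRamseyMeasure (κ U : ZFSet) : Prop :=
  IsSUMeasure κ U ∧ WeaklyAmenable κ (MU κ U) U ∧ OmegaOneIntersecting U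

/-- A strong Ramsey measure on `κ`: a weakly amenable small universe measure whose
minimal model `M_U` is a `κ`-model. -/
def IsStrongRamseyMeasure (κ U : ZFSet) : Prop :=
  IsSUMeasure κ U ∧ WeaklyAmenable κ (MU κ U) U ∧ SeqClosed κ (MU κ U)

/-- A super Ramsey measure on `κ`: a strong Ramsey measure with `M_U ≺ H_{κ⁺}`. -/
def IsSuperRamseyMeasure (κ U : ZFSet) : Prop :=
  IsStrongRamseyMeasure κ U ∧ ElemSub (MU κ U).toSet (Hclass κ)

/-- `I` certifies `U`: `I` is an unbounded subset of `κ` and the sets in `U` are exactly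
the subsets of `κ` in `M_U` containing a tail of `I`. -/
def Certifies (κ U : ZFSet) (I : Set ZFSet) : Prop :=
  (∀ ξ ∈ I, ξ ∈ κ) ∧ (∀ α ∈ κ, ∃ ξ ∈ I, ξ ∉ α) ∧
  ∀ X ∈ (MU κ U).toSet, X ⊆ κ →
    (X ∈ U ↔ ∃ α ∈ κ.toSet, ∀ ξ ∈ I, ξ ∉ α → ξ ∈ X)

/-- A certified Ramsey measure on `κ`: a weakly amenable small universe measure which is
certified by some unbounded `I ⊆ κ`. -/
def IsCertifiedRamseyMeasure (κ U : ZFSet) : Prop :=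
  IsSUMeasure κ U ∧ WeaklyAmenable κ (MU κ U) U ∧ ∃ I : Set ZFSet, Certifies κ U I

/-! ### Relativized (internal) versions of the measure predicates -/

/-- `ω₁`-intersecting from the point of view of the transitive model `N`: every
`ω`-sequence of members of `U` lying in `N` has a common element. -/
def OmegaOneIntersectingIn (N U : ZFSet) : Prop :=
  ∀ f ∈ N.toSet, IsZFunc ZFSet.omega f → (∀ n ∈ ZFSet.omega, fapp f n ∈ U) →
    ∃ x, ∀ n ∈ ZFSet.omega, x ∈ fapp f n

/-- `N ⊨ U is a Ramsey measure on κ`, for a transitive ZFC⁻-model `N`: all components are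
absolute except `ω₁`-intersectingness, which is evaluated using sequences in `N`. -/
def RamseyMeasureIn (N κ U : ZFSet) : Prop :=
  U ∈ N ∧ IsSUMeasure κ U ∧ WeaklyAmenable κ (MU κ U) U ∧ OmegaOneIntersectingIn N U

/-- `N ⊨ U is a strong Ramsey measure on κ`: closure of `M_U` under `<κ`-sequences is
evaluated using the sequences lying in `N`. -/
def StrongRamseyMeasureIn (N κ U : ZFSet) : Prop :=
  U ∈ N ∧ IsSUMeasure κ U ∧ WeaklyAmenable κ (MU κ U) U ∧
  ∀ f ∈ N.toSet, ∀ γ ∈ κ, IsZFunc γ f → (∀ a ∈ γ, fapp f a ∈ MU κ U) → f ∈ MU κ U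

/-- The class `H_{κ⁺}` as computed in `N`. -/
def HclassIn (N κ : ZFSet) : Set ZFSet := { x | x ∈ N ∧ HeredLE κ x }

/-- `N ⊨ U is a super Ramsey measure on κ`. -/
def SuperRamseyMeasureIn (N κ U : ZFSet) : Prop :=
  StrongRamseyMeasureIn N κ U ∧ ElemSub (MU κ U).toSet (HclassIn N κ)

/-- `N ⊨ U is a certified Ramsey measure on κ` (the certifying set is required to lie in `N`). -/
def CertifiedRamseyMeasureIn (N κ U : ZFSet) : Prop :=
  U ∈ N ∧ IsSUMeasure κ U ∧ WeaklyAmenable κ (MU κ U) U ∧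
  ∃ I ∈ N.toSet, Certifies κ U I.toSet

/-! ### Goodness, witness collections, and the M-order -/

/-- `U` is `A`-good: `A ∈ M_U`. -/
def AGood (κ A U : ZFSet) : Prop := A ∈ MU κ U

/-- A witness collection of `Pm`-measures on `κ`: a collection of `Pm`-measures containing
an `A`-good one for every `A ⊆ κ`. -/
def IsWitness (Pm : ZFSet → ZFSet → Prop) (κ : ZFSet) (𝒰 : Set ZFSet) : Prop :=
  (∀ U ∈ 𝒰, Pm κ U) ∧ ∀ A : ZFSet, A ⊆ κ → ∃ U ∈ 𝒰, AGood κ A U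

/-- The M-order on witness collections of `Pm`-measures on `κ`; `PmIn N κ U` is the
relativization `N ⊨ U is a Pm-measure on κ`.  `MOrder Pm PmIn κ 𝒰 𝒲` says `𝒰 ◁ 𝒲`. -/
def MOrder (Pm : ZFSet → ZFSet → Prop) (PmIn : ZFSet → ZFSet → ZFSet → Prop)
    (κ : ZFSet) (𝒰 𝒲 : Set ZFSet) : Prop :=
  IsWitness Pm κ 𝒰 ∧ IsWitness Pm κ 𝒲 ∧
  (∀ W ∈ 𝒲, ∀ A ∈ (NU κ W).toSet, A ⊆ κ →
    ∃ U ∈ 𝒰, U ∈ NU κ W ∧ AGood κ A U ∧ PmIn (NU κ W) κ U) ∧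
  (∀ U ∈ 𝒰, ∃ W ∈ 𝒲, U ∈ NU κ W)

/-! ### Ranks -/

/-- The rank of a point in an arbitrary binary relation (`0` at non-accessible points). -/
def relRank {X : Type*} (r : X → X → Prop) (x : X) : Ordinal :=
  if h : Acc r x then h.rank else 0

/-- The M-rank `o_Pm(κ)`: the strict supremum of the M-ranks of all witness collections of
`Pm`-measures on `κ` (and `0` if there are none). -/
def oRank (Pm : ZFSet → ZFSet → Prop) (PmIn : ZFSet → ZFSet → ZFSet → Prop)
    (κ : ZFSet) : Ordinal :=
  sSup { o : Ordinal |
    ∃ 𝒰 : Set ZFSet, IsWitness Pm κ 𝒰 ∧ o = relRank (MOrder Pm PmIn κ) 𝒰 + 1 }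

/-- `N ⊨ o_Pm(κ) ≥ α`, defined by the recursion: for every `A ⊆ κ` in `N` and every `β < α`
there is an `A`-good `Pm`-measure `W` in `N` (in the sense of `N`) whose ultrapower satisfies
`o_Pm(κ) ≥ β`. -/
def oGEin (PmIn : ZFSet → ZFSet → ZFSet → Prop) (κ : ZFSet) : Ordinal → ZFSet → Prop :=
  WellFounded.fix wellFounded_lt fun α ih N =>
    ∀ A ∈ N.toSet, A ⊆ κ → ∀ β, ∀ h : β < α,
      ∃ W ∈ N.toSet, PmIn N κ W ∧ AGood κ A W ∧ ih β h (NU κ W)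

/-- `N ⊨ o_Pm(κ) = α`. -/
def oEQin (PmIn : ZFSet → ZFSet → ZFSet → Prop) (κ : ZFSet) (α : Ordinal) (N : ZFSet) : Prop :=
  oGEin PmIn κ α N ∧ ¬ oGEin PmIn κ (α + 1) N

/-! ### The M-order and M-rank relativized to a model `ℳ` -/

/-- A witness collection (coded as a set) of `Pm`-measures in the sense of the model `ℳ`. -/
def IsWitnessIn (PmIn : ZFSet → ZFSet → ZFSet → Prop) (ℳ κ 𝒰 : ZFSet) : Prop :=
  𝒰 ∈ ℳ ∧ (∀ U ∈ 𝒰, PmIn ℳ κ U) ∧ ∀ A ∈ ℳ.toSet, A ⊆ κ → ∃ U ∈ 𝒰.toSet, AGood κ A U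

/-- The M-order on witness collections as computed in `ℳ`. -/
def MOrderIn (PmIn : ZFSet → ZFSet → ZFSet → Prop) (ℳ κ : ZFSet) (𝒰 𝒲 : ZFSet) : Prop :=
  IsWitnessIn PmIn ℳ κ 𝒰 ∧ IsWitnessIn PmIn ℳ κ 𝒲 ∧
  (∀ W ∈ 𝒲, ∀ A ∈ (NU κ W).toSet, A ⊆ κ →
    ∃ U ∈ 𝒰.toSet, U ∈ NU κ W ∧ AGood κ A U ∧ PmIn (NU κ W) κ U) ∧
  (∀ U ∈ 𝒰, ∃ W ∈ 𝒲.toSet, U ∈ NU κ W)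

/-- The M-rank `o_Pm(κ)` as computed in `ℳ`. -/
def oRankIn (PmIn : ZFSet → ZFSet → ZFSet → Prop) (ℳ κ : ZFSet) : Ordinal :=
  sSup { o : Ordinal |
    ∃ 𝒰 : ZFSet, IsWitnessIn PmIn ℳ κ 𝒰 ∧ o = relRank (MOrderIn PmIn ℳ κ) 𝒰 + 1 }

/-! ### Practical models, cover and approximation properties -/

/-- `ℳ` is practical for `κ`: a transitive ZFC⁻-model containing `κ` in which
`V_{κ+3}` exists. -/
def Practical (κ ℳ : ZFSet) : Prop :=
  IsTransModel ℳ ∧ κ ∈ ℳ ∧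
  ∃ v ∈ ℳ.toSet, ∀ x, x ∈ v ↔ (x ∈ ℳ ∧ ZFSet.rank x < ZFSet.rank κ + 3)

/-- `x` has size less than `δ` as witnessed inside the class `D`:
some `f ∈ D` injects `x` into an ordinal `γ ∈ δ`. -/
def SizeLTin (D : Set ZFSet) (x δ : ZFSet) : Prop :=
  ∃ γ ∈ δ.toSet, ∃ f ∈ D, IsZFunc x f ∧ MapsInto f x γ ∧ InjOnZ f x

/-- The pair `D ⊆ D'` has the `δ`-cover property. -/
def CoverProperty (δ : ZFSet) (D D' : Set ZFSet) : Prop :=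
  ∀ X ∈ D', X.toSet ⊆ D → SizeLTin D' X δ →
    ∃ Y ∈ D, X ⊆ Y ∧ SizeLTin D Y δ

/-- The pair `D ⊆ D'` has the `δ`-approximation property. -/
def ApproxProperty (δ : ZFSet) (D D' : Set ZFSet) : Prop :=
  ∀ X ∈ D', X.toSet ⊆ D → (∀ x ∈ D, SizeLTin D x δ → X ∩ x ∈ D) → X ∈ D

/-- `δ` is a cardinal from the point of view of the class `D`. -/
def IsCardIn (D : Set ZFSet) (δ : ZFSet) : Prop :=
  IsOrd δ ∧ δ ∈ D ∧ ∀ γ ∈ δ, ¬ ∃ f ∈ D, IsZFunc γ f ∧ SurjOnto f γ δ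

/-- `δ` is a regular (infinite) cardinal from the point of view of the class `D`. -/
def IsRegularIn (D : Set ZFSet) (δ : ZFSet) : Prop :=
  IsCardIn D δ ∧ ZFSet.omega ⊆ δ ∧
  ∀ γ ∈ δ, ∀ f ∈ D, IsZFunc γ f → MapsInto f γ δ →
    ∃ β ∈ δ, ∀ a ∈ γ, fapp f a ∈ β

/-- `H_λ` as computed in the model `V`: the members of `V` having, in `V`,
a transitive superset of size `< λ`. -/
def HIn (V lam : ZFSet) : Set ZFSet :=
  { x | x ∈ V ∧ ∃ t ∈ V.toSet, x ⊆ t ∧ t.IsTransitive ∧ SizeLTin V.toSet t lam }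

/-- `V` and `V'` have the same ordinals. -/
def SameOrdinals (D D' : Set ZFSet) : Prop :=
  ∀ α, IsOrd α → (α ∈ D ↔ α ∈ D')

/-- Every `ω`-sequence of elements of `ℳ` lying in `ℳ'` is an element of `ℳ`. -/
def OmegaSeqClosedPair (ℳ ℳ' : ZFSet) : Prop :=
  ∀ f ∈ ℳ'.toSet, IsZFunc ZFSet.omega f → (∀ n ∈ ZFSet.omega, fapp f n ∈ ℳ) → f ∈ ℳ

/-! ### Large cardinal properties -/

/-- `κ` is Ramsey: every `A ⊆ κ` belongs to a weak `κ`-model `M` carrying a weakly amenable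
`ω₁`-intersecting `M`-ultrafilter on `κ`. -/
def IsRamseyCard (κ : ZFSet) : Prop :=
  IsCard κ ∧ ∀ A : ZFSet, A ⊆ κ →
    ∃ M, IsWeakModel κ M ∧ A ∈ M ∧
      ∃ U, IsMUltrafilter κ M U ∧ WeaklyAmenable κ M U ∧ OmegaOneIntersecting U

/-- `κ` is strongly Ramsey: the model `M` can moreover be taken to be a `κ`-model. -/
def IsStronglyRamseyCard (κ : ZFSet) : Prop :=
  IsCard κ ∧ ∀ A : ZFSet, A ⊆ κ →
    ∃ M, IsKappaModel κ M ∧ A ∈ M ∧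
      ∃ U, IsMUltrafilter κ M U ∧ WeaklyAmenable κ M U ∧ OmegaOneIntersecting U

/-- `κ` is super Ramsey: the model `M` can moreover be taken to be a `κ`-model
elementary in `H_{κ⁺}`. -/
def IsSuperRamseyCard (κ : ZFSet) : Prop :=
  IsCard κ ∧ ∀ A : ZFSet, A ⊆ κ →
    ∃ M, IsKappaModel κ M ∧ ElemSub M.toSet (Hclass κ) ∧ A ∈ M ∧
      ∃ U, IsMUltrafilter κ M U ∧ WeaklyAmenable κ M U ∧ OmegaOneIntersecting U

/-- `κ` is weakly super Ramsey: the model `M` is a weak `κ`-model elementary in `H_{κ⁺}`. -/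
def IsWeaklySuperRamseyCard (κ : ZFSet) : Prop :=
  IsCard κ ∧ ∀ A : ZFSet, A ⊆ κ →
    ∃ M, IsWeakModel κ M ∧ ElemSub M.toSet (Hclass κ) ∧ A ∈ M ∧
      ∃ U, IsMUltrafilter κ M U ∧ WeaklyAmenable κ M U ∧ OmegaOneIntersecting U

/-- `κ` is measurable: there is a `κ`-complete nonprincipal ultrafilter on (all) subsets
of `κ`. -/
def IsMeasurableCard (κ : ZFSet) : Prop :=
  IsCard κ ∧ ZFSet.omega ∈ κ ∧
  ∃ 𝒰 : Set ZFSet,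
    (∀ A ∈ 𝒰, A ⊆ κ) ∧ (∅ : ZFSet) ∉ 𝒰 ∧ κ ∈ 𝒰 ∧
    (∀ A ∈ 𝒰, ∀ B : ZFSet, B ⊆ κ → A ⊆ B → B ∈ 𝒰) ∧
    (∀ A : ZFSet, A ⊆ κ → (A ∈ 𝒰 ∨ compl κ A ∈ 𝒰)) ∧
    (∀ γ ∈ κ.toSet, ∀ s : ZFSet → ZFSet, (∀ i ∈ γ, s i ∈ 𝒰) →
      ZFSet.sep (fun ξ => ∀ i ∈ γ, ξ ∈ s i) κ ∈ 𝒰)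

/-! ### Relativized large-cardinal properties -/

/-- `N ⊨ κ is Ramsey` (for a transitive model `N`): the witnessing models and ultrafilters
lie in `N`, smallness of the models is witnessed in `N`, and `ω₁`-intersectingness is
evaluated using the sequences in `N`. -/
def RamseyCardIn (N κ : ZFSet) : Prop :=
  ∀ A ∈ N.toSet, A ⊆ κ →
    ∃ M ∈ N.toSet, A ∈ M ∧ IsTransModel M ∧ κ ∈ M ∧
      (∃ f ∈ N.toSet, IsZFunc κ f ∧ SurjOnto f κ M) ∧
      ∃ U ∈ N.toSet, IsMUltrafilter κ M U ∧ WeaklyAmenable κ M U ∧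
        OmegaOneIntersectingIn N U

/-- `N ⊨ κ is strongly Ramsey`. -/
def StronglyRamseyCardIn (N κ : ZFSet) : Prop :=
  ∀ A ∈ N.toSet, A ⊆ κ →
    ∃ M ∈ N.toSet, A ∈ M ∧ IsTransModel M ∧ κ ∈ M ∧
      (∃ f ∈ N.toSet, IsZFunc κ f ∧ SurjOnto f κ M) ∧
      (∀ f ∈ N.toSet, ∀ γ ∈ κ, IsZFunc γ f → (∀ a ∈ γ, fapp f a ∈ M) → f ∈ M) ∧
      ∃ U ∈ N.toSet, IsMUltrafilter κ M U ∧ WeaklyAmenable κ M U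

/-- `N ⊨ κ is super Ramsey`. -/
def SuperRamseyCardIn (N κ : ZFSet) : Prop :=
  ∀ A ∈ N.toSet, A ⊆ κ →
    ∃ M ∈ N.toSet, A ∈ M ∧ IsTransModel M ∧ κ ∈ M ∧
      (∃ f ∈ N.toSet, IsZFunc κ f ∧ SurjOnto f κ M) ∧
      (∀ f ∈ N.toSet, ∀ γ ∈ κ, IsZFunc γ f → (∀ a ∈ γ, fapp f a ∈ M) → f ∈ M) ∧
      ElemSub M.toSet (HclassIn N κ) ∧
      ∃ U ∈ N.toSet, IsMUltrafilter κ M U ∧ WeaklyAmenable κ M U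

/-! ### ω-special models -/

/-- A weak `κ`-model `M` is `ω`-special: it is the union of a chain
`M₀ ≺ M₁ ≺ ⋯` of elementary substructures of `M` with each `Mₙ ∈ M` and `|Mₙ|^M = κ`. -/
def OmegaSpecial (κ M : ZFSet) : Prop :=
  ∃ s : ℕ → ZFSet,
    (∀ n, s n ∈ M) ∧
    (∀ n, (s n).toSet ⊆ (s (n + 1)).toSet) ∧
    (∀ n, ElemSub (s n).toSet M.toSet) ∧
    (∀ n, ∃ f ∈ M.toSet, IsBij f κ (s n)) ∧
    (∀ x, x ∈ M ↔ ∃ n, x ∈ s n)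

/-! ### Iterated ultrapowers and α-iterability -/

/-- `U` is an `α`-iterable `M`-ultrafilter on `κ`: there is a coherent system of transitive
models `Mod β` (`β ≤ α`), with commuting elementary embeddings `e β γ : Mod β → Mod γ`,
critical sequence `cr β` and ultrafilter sequence `Us β`, starting at `(M, κ, U)`, where each
successor step is given by an ultrapower and each limit step is a (collapsed) direct limit. -/
def IsAlphaIterable (κ M U : ZFSet) (α : Ordinal) : Prop :=
  ∃ (Mod : Ordinal → ZFSet) (cr : Ordinal → ZFSet) (Us : Ordinal → ZFSet)
    (e : Ordinal → Ordinal → ZFSet → ZFSet),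
    Mod 0 = M ∧ cr 0 = κ ∧ Us 0 = U ∧
    (∀ β ≤ α, (Mod β).IsTransitive) ∧
    (∀ β ≤ α, ∀ x ∈ Mod β, e β β x = x) ∧
    (∀ β γ ρ : Ordinal, β ≤ γ → γ ≤ ρ → ρ ≤ α →
      ∀ x ∈ Mod β, e γ ρ (e β γ x) = e β ρ x) ∧
    (∀ β γ : Ordinal, β ≤ γ → γ ≤ α →
      (∀ x ∈ Mod β, e β γ x ∈ Mod γ) ∧
      ∀ (φ : Fml) (v : ℕ → ZFSet), (∀ n, v n ∈ Mod β) →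
        (Sat (Mod β).toSet φ v ↔ Sat (Mod γ).toSet φ (fun n => e β γ (v n)))) ∧
    (∀ β : Ordinal, β + 1 ≤ α →
      IsUltrapowerEmb (cr β) (Mod β) (Us β) (Mod (β + 1)) (e β (β + 1)) ∧
      cr (β + 1) = e β (β + 1) (cr β) ∧
      (∀ A, A ∈ Us (β + 1) ↔
        ∃ X ∈ (Mod β).toSet, X ∩ Us β ∈ Mod β ∧ A ∈ e β (β + 1) (X ∩ Us β))) ∧
    (∀ lam : Ordinal, lam ≤ α → lam ≠ 0 → (∀ β < lam, β + 1 < lam) →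
      (∀ x ∈ Mod lam, ∃ β < lam, ∃ y ∈ (Mod β).toSet, e β lam y = x) ∧
      cr lam = e 0 lam κ ∧
      (∀ A, A ∈ Us lam ↔ ∃ β < lam, ∃ B, B ∈ Us β ∧ e β lam B = A))

/-- `N ⊨ κ is α-iterable`: every `A ⊆ κ` in `N` belongs to a weak `κ`-model `M ∈ N` for
which there is a weakly amenable `α`-iterable `M`-ultrafilter `U ∈ N` on `κ`. -/
def AlphaIterableCardIn (N κ : ZFSet) (α : Ordinal) : Prop :=
  ∀ A ∈ N.toSet, A ⊆ κ →
    ∃ M ∈ N.toSet, A ∈ M ∧ IsTransModel M ∧ κ ∈ M ∧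
      (∃ f ∈ N.toSet, IsZFunc κ f ∧ SurjOnto f κ M) ∧
      ∃ U ∈ N.toSet, IsMUltrafilter κ M U ∧ WeaklyAmenable κ M U ∧
        IsAlphaIterable κ M U α

/-! ### Forcing -/

/-- `R` codes a partial order (of forcing conditions) on `P`: `pair p q ∈ R` means `p ≤ q`. -/
def IsPoset (P R : ZFSet) : Prop :=
  (∀ p ∈ R, ∃ a ∈ P, ∃ b ∈ P, p = ZFSet.pair a b) ∧
  (∀ p ∈ P, ZFSet.pair p p ∈ R) ∧
  (∀ p ∈ P, ∀ q ∈ P, ∀ r ∈ P,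
    ZFSet.pair p q ∈ R → ZFSet.pair q r ∈ R → ZFSet.pair p r ∈ R)

/-- `G` is an `ℳ`-generic filter on the poset `(P, R)`. -/
def IsGenericFilter (ℳ P R : ZFSet) (G : Set ZFSet) : Prop :=
  G ⊆ P.toSet ∧ G.Nonempty ∧
  (∀ p ∈ G, ∀ q ∈ G, ∃ r ∈ G, ZFSet.pair r p ∈ R ∧ ZFSet.pair r q ∈ R) ∧
  (∀ p ∈ G, ∀ q ∈ P.toSet, ZFSet.pair p q ∈ R → q ∈ G) ∧
  ∀ Dset ∈ ℳ.toSet, Dset ⊆ P →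
    (∀ p ∈ P.toSet, ∃ q ∈ Dset.toSet, ZFSet.pair q p ∈ R) →
    ∃ q ∈ G, q ∈ Dset

/-- `ℳ'` is the generic extension `ℳ[G]`: the least transitive ZFC⁻-model containing `ℳ`
and (a set coding) `G`, with the same ordinals as `ℳ`. -/
def IsGenericExt (ℳ ℳ' : ZFSet) (G : Set ZFSet) : Prop :=
  IsTransModel ℳ' ∧ ℳ ⊆ ℳ' ∧ (∃ g ∈ ℳ'.toSet, g.toSet = G) ∧
  SameOrdinals ℳ.toSet ℳ'.toSet ∧
  ∀ N', IsTransModel N' → ℳ ⊆ N' → (∃ g ∈ N'.toSet, g.toSet = G) → ℳ' ⊆ N'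

/-- `f ∈ D` is a cofinal map from `γ` into the ordinal `α`. -/
def CofinalMapIn (D : Set ZFSet) (γ α f : ZFSet) : Prop :=
  f ∈ D ∧ IsZFunc γ f ∧ MapsInto f γ α ∧
  ∀ b ∈ α, ∃ a ∈ γ, b ∈ fapp f a ∨ b = fapp f a

/-- `γ` is the cofinality of the ordinal `α` as computed in `D`. -/
def IsCofIn (D : Set ZFSet) (α γ : ZFSet) : Prop :=
  IsOrd γ ∧ (∃ f, CofinalMapIn D γ α f) ∧ ∀ γ' ∈ γ, ¬ ∃ f, CofinalMapIn D γ' α f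

/-- The pair `ℳ ⊆ ℳ'` preserves all cofinalities. -/
def PreservesCofinalities (ℳ ℳ' : ZFSet) : Prop :=
  ∀ α ∈ ℳ.toSet, IsOrd α → ∀ γ, (IsCofIn ℳ.toSet α γ ↔ IsCofIn ℳ'.toSet α γ)

set_option linter.unusedVariables false
set_option linter.style.longLine false
set_option synthInstance.maxHeartbeats 400000
set_option synthInstance.maxSize 4000

/-! ## Toolkit: uniformly definable predicates -/

/-- A class of sets is transitive. -/
def TrS (D : Set ZFSet) : Prop := ∀ x ∈ D, ∀ y ∈ x, y ∈ D

/-- Sequence extension. -/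
def cons' (x : ZFSet) (v : ℕ → ZFSet) : ℕ → ZFSet
  | 0 => x
  | n + 1 => v n

@[simp] theorem cons'_zero (x : ZFSet) (v : ℕ → ZFSet) : cons' x v 0 = x := rfl
@[simp] theorem cons'_succ (x : ZFSet) (v : ℕ → ZFSet) (n : ℕ) : cons' x v (n+1) = v n := rfl

theorem cons'_mem {D : Set ZFSet} {x : ZFSet} {v : ℕ → ZFSet} (hx : x ∈ D) (hv : ∀ n, v n ∈ D) :
    ∀ n, cons' x v n ∈ D := by
  intro n; cases n with
  | zero => exact hx
  | succ n => exact hv n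

/-- bound on variables -/
def Fml.bd : Fml → ℕ
  | .mem i j => max i j + 1
  | .eq i j => max i j + 1
  | .impl φ ψ => max φ.bd ψ.bd
  | .neg φ => φ.bd
  | .all n φ => max (n+1) φ.bd

theorem sat_congr (D : Set ZFSet) (φ : Fml) : ∀ (v w : ℕ → ZFSet), (∀ n < φ.bd, v n = w n) →
    (Sat D φ v ↔ Sat D φ w) := by
  induction φ with
  | mem i j => intro v w h; simp only [Sat, Fml.bd] at *; rw [h i (by omega), h j (by omega)]
  | eq i j => intro v w h; simp only [Sat, Fml.bd] at *; rw [h i (by omega), h j (by omega)]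
  | impl φ ψ h1 h2 =>
    intro v w h; simp only [Sat, Fml.bd] at *
    rw [h1 v w fun n hn => h n (by omega), h2 v w fun n hn => h n (by omega)]
  | neg φ h1 => intro v w h; simp only [Sat, Fml.bd] at *; rw [h1 v w h]
  | all k φ h1 =>
    intro v w h; simp only [Sat, Fml.bd] at *
    refine forall₂_congr fun x _ => h1 _ _ fun n hn => ?_
    by_cases hnk : n = k
    · subst hnk; simp
    · simp [Function.update_of_ne hnk, h n (by omega)]

/-- renaming -/
def Fml.ren (σ : ℕ → ℕ) : Fml → Fml
  | .mem i j => .mem (σ i) (σ j)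
  | .eq i j => .eq (σ i) (σ j)
  | .impl φ ψ => .impl (φ.ren σ) (ψ.ren σ)
  | .neg φ => .neg (φ.ren σ)
  | .all n φ => .all (σ n) (φ.ren σ)

theorem sat_ren (D : Set ZFSet) (σ : ℕ → ℕ) (hσ : Function.Injective σ) (φ : Fml) :
    ∀ (v : ℕ → ZFSet), Sat D (φ.ren σ) v ↔ Sat D φ (fun n => v (σ n)) := by
  induction φ with
  | mem i j => intro v; rfl
  | eq i j => intro v; rfl
  | impl φ ψ h1 h2 => intro v; simp only [Sat, Fml.ren]; rw [h1, h2]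
  | neg φ h1 => intro v; simp only [Sat, Fml.ren]; rw [h1]
  | all k φ h1 =>
    intro v; simp only [Sat, Fml.ren]
    refine forall₂_congr fun x _ => ?_
    rw [h1]
    have : (fun n => Function.update v (σ k) x (σ n)) = Function.update (fun n => v (σ n)) k x := by
      funext n
      by_cases hnk : n = k
      · subst hnk; simp
      · rw [Function.update_of_ne hnk, Function.update_of_ne (fun h => hnk (hσ h))]
    rw [this]

/-- the cyclic shift -/
def cyc (N n : ℕ) : ℕ := if n = 0 then N else if n ≤ N then n - 1 else n

theorem cyc_inj (N : ℕ) : Function.Injective (cyc N) := by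
  intro a b h
  simp only [cyc] at h
  split_ifs at h <;> omega

/-- quantify over a fresh variable placed in position 0 -/
def Fml.allc (φ : Fml) : Fml := .all φ.bd (φ.ren (cyc φ.bd))

theorem sat_allc (D : Set ZFSet) (φ : Fml) (v : ℕ → ZFSet) :
    Sat D φ.allc v ↔ ∀ x ∈ D, Sat D φ (cons' x v) := by
  simp only [Fml.allc, Sat]
  refine forall₂_congr fun x _ => ?_
  rw [sat_ren _ _ (cyc_inj _)]
  apply sat_congr
  intro n hn
  cases n with
  | zero => simp [cyc]
  | succ n =>
    have h1 : cyc φ.bd (n+1) = n := by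
      simp only [cyc]; rw [if_neg (by omega), if_pos (by omega)]; omega
    rw [h1, Function.update_of_ne (by omega)]; rfl

/-- Uniformly definable predicates. -/
class UDef (P : Set ZFSet → (ℕ → ZFSet) → Prop) : Prop where
  out : ∃ φ : Fml, ∀ D, TrS D → ∀ v : ℕ → ZFSet, (∀ n, v n ∈ D) → (Sat D φ v ↔ P D v)

namespace UDef

instance mem (i j : ℕ) : UDef (fun _ v => v i ∈ v j) :=
  ⟨.mem i j, fun _ _ _ _ => Iff.rfl⟩

instance eq (i j : ℕ) : UDef (fun _ v => v i = v j) :=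
  ⟨.eq i j, fun _ _ _ _ => Iff.rfl⟩

instance not {P : Set ZFSet → (ℕ → ZFSet) → Prop} [h : UDef P] : UDef (fun D v => ¬ P D v) := by
  obtain ⟨φ, hφ⟩ := h.out
  exact ⟨.neg φ, fun D hD v hv => by simp only [Sat]; rw [hφ D hD v hv]⟩

instance imp {P Q : Set ZFSet → (ℕ → ZFSet) → Prop} [h : UDef P] [h' : UDef Q] :
    UDef (fun D v => P D v → Q D v) := by
  obtain ⟨φ, hφ⟩ := h.out
  obtain ⟨ψ, hψ⟩ := h'.out
  exact ⟨.impl φ ψ, fun D hD v hv => by simp only [Sat]; rw [hφ D hD v hv, hψ D hD v hv]⟩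

theorem congr {P Q : Set ZFSet → (ℕ → ZFSet) → Prop} (h : UDef P)
    (hPQ : ∀ D, TrS D → ∀ v : ℕ → ZFSet, (∀ n, v n ∈ D) → (P D v ↔ Q D v)) : UDef Q := by
  obtain ⟨φ, hφ⟩ := h.out
  exact ⟨φ, fun D hD v hv => (hφ D hD v hv).trans (hPQ D hD v hv)⟩

instance and {P Q : Set ZFSet → (ℕ → ZFSet) → Prop} [h : UDef P] [h' : UDef Q] :
    UDef (fun D v => P D v ∧ Q D v) :=
  (inferInstance : UDef (fun D v => ¬ (P D v → ¬ Q D v))).congr fun D _ v _ => by tauto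

instance or {P Q : Set ZFSet → (ℕ → ZFSet) → Prop} [h : UDef P] [h' : UDef Q] :
    UDef (fun D v => P D v ∨ Q D v) :=
  (inferInstance : UDef (fun D v => (¬ P D v → Q D v))).congr fun D _ v _ => by tauto

instance iff {P Q : Set ZFSet → (ℕ → ZFSet) → Prop} [h : UDef P] [h' : UDef Q] :
    UDef (fun D v => P D v ↔ Q D v) :=
  (inferInstance : UDef (fun D v => (P D v → Q D v) ∧ (Q D v → P D v))).congr
    fun D _ v _ => by tauto

instance allD (Q : Set ZFSet → ZFSet → (ℕ → ZFSet) → Prop)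
    [h : UDef (fun D v => Q D (v 0) (fun n => v (n+1)))] :
    UDef (fun D v => ∀ x ∈ D, Q D x v) := by
  obtain ⟨φ, hφ⟩ := h.out
  refine ⟨φ.allc, fun D hD v hv => ?_⟩
  rw [sat_allc]
  refine forall₂_congr fun x hx => ?_
  rw [hφ D hD _ (cons'_mem hx hv)]
  rfl

instance exD (Q : Set ZFSet → ZFSet → (ℕ → ZFSet) → Prop)
    [h : UDef (fun D v => Q D (v 0) (fun n => v (n+1)))] :
    UDef (fun D v => ∃ x ∈ D, Q D x v) :=
  (not (h := allD (fun D x v => ¬ Q D x v) (h := not (h := h)))).congr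
    fun D _ v _ => by push Not; rfl

instance ball (i : ℕ) (Q : Set ZFSet → ZFSet → (ℕ → ZFSet) → Prop)
    [h : UDef (fun D v => Q D (v 0) (fun n => v (n+1)))] :
    UDef (fun D v => ∀ x ∈ v i, Q D x v) :=
  (allD (fun D x v => x ∈ v i → Q D x v) (h := imp (h := mem 0 (i+1)) (h' := h))).congr
    fun D hD v hv =>
    ⟨fun H x hx => H x (hD _ (hv i) _ hx) hx, fun H x _ hx => H x hx⟩

instance bex (i : ℕ) (Q : Set ZFSet → ZFSet → (ℕ → ZFSet) → Prop)
    [h : UDef (fun D v => Q D (v 0) (fun n => v (n+1)))] :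
    UDef (fun D v => ∃ x ∈ v i, Q D x v) :=
  (not (h := ball i (fun D x v => ¬ Q D x v) (h := not (h := h)))).congr
    fun D _ v _ => by push Not; rfl

instance const (p : Prop) : UDef (fun _ _ => p) := by
  by_cases hp : p
  · exact (eq 0 0).congr fun D _ v _ => by simp [hp]
  · exact (not (h := eq 0 0)).congr fun D _ v _ => by simp [hp]


end UDef

@[simp] theorem mem_toSet {x y : ZFSet} : x ∈ y.toSet ↔ x ∈ y := Iff.rfl

/-! ## Derived definability instances -/

namespace UDef

instance congrEqSymm (i : ℕ) (T : (ℕ → ZFSet) → ZFSet)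
    [h : UDef (fun _ v => v i = T v)] : UDef (fun _ v => T v = v i) :=
  h.congr fun _ _ _ _ => eq_comm

instance sub (i j : ℕ) : UDef (fun _ v => v i ⊆ v j) :=
  (inferInstance : UDef (fun _ v => ∀ x ∈ v i, x ∈ v j)).congr fun _ _ _ _ => Iff.rfl

instance eqEmpty (i : ℕ) : UDef (fun _ v => v i = ∅) :=
  (inferInstance : UDef (fun _ v => ∀ x ∈ v i, ¬ x = x)).congr fun D _ v _ => by
    rw [ZFSet.eq_empty]; simp

instance memEmpty (i : ℕ) : UDef (fun _ v => (∅ : ZFSet) ∈ v i) :=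
  (inferInstance : UDef (fun _ v => ∃ x ∈ v i, x = ∅)).congr fun D _ v _ => by
    simp

instance eqUpair (i j k : ℕ) : UDef (fun _ v => v k = ({v i, v j} : ZFSet)) :=
  (inferInstance : UDef (fun _ v => v i ∈ v k ∧ v j ∈ v k ∧ ∀ x ∈ v k, x = v i ∨ x = v j)).congr
    fun D _ v _ => by
    constructor
    · rintro ⟨h1, h2, h3⟩
      ext x; rw [ZFSet.mem_pair]
      exact ⟨h3 x, fun h => by rcases h with h | h <;> simpa [h]⟩
    · intro h; rw [h]; simp

instance eqSing (i k : ℕ) : UDef (fun _ v => v k = ({v i} : ZFSet)) :=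
  (inferInstance : UDef (fun _ v => v k = ({v i, v i} : ZFSet))).congr
    fun D _ v _ => by simp

theorem eqPair0 (i j k : ℕ) : UDef (fun _ v => v k = pair (v i) (v j)) :=
  (inferInstance : UDef (fun _ v => (∃ a ∈ v k, a = {v i}) ∧ (∃ a ∈ v k, a = {v i, v j}) ∧
    ∀ x ∈ v k, x = {v i} ∨ x = {v i, v j})).congr
    fun D _ v _ => by
    constructor
    · rintro ⟨⟨a, h1, rfl⟩, ⟨b, h2, rfl⟩, h3⟩
      ext x; rw [ZFSet.pair, ZFSet.mem_pair]
      exact ⟨h3 x, fun h => by rcases h with h | h <;> simpa [h]⟩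
    · intro h; rw [h]; simp [ZFSet.pair]

theorem mem_of_pair_left {a b : ZFSet} : ∃ z ∈ pair a b, a ∈ z := ⟨{a}, by simp [ZFSet.pair]⟩
theorem mem_of_pair_right {a b : ZFSet} : ∃ z ∈ pair a b, b ∈ z :=
  ⟨{a, b}, by simp [ZFSet.pair]⟩

instance eqPair (k : ℕ) (S T : (ℕ → ZFSet) → ZFSet)
    [hS : UDef (fun _ v => v 0 = S (fun n => v (n+1)))]
    [hT : UDef (fun _ v => v 0 = T (fun n => v (n+1)))] :
    UDef (fun _ v => v k = pair (S v) (T v)) := by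
  obtain ⟨φ, hφ⟩ := hS.out
  obtain ⟨ψ, hψ⟩ := hT.out
  refine (bex k (fun D z v => ∃ s ∈ z, ∃ z' ∈ v k, ∃ t ∈ z', Sat D φ (cons' s v) ∧
    Sat D ψ (cons' t v) ∧ v k = pair s t) (h := bex 0 (fun D s v => ∃ z' ∈ v (k+1), ∃ t ∈ z', Sat D φ (cons' s (fun n => v (n+1))) ∧
    Sat D ψ (cons' t (fun n => v (n+1))) ∧ v (k+1) = pair s t) (h := bex (k+2) (fun D z' v => ∃ t ∈ z', Sat D φ (cons' (v 0) (fun n => v (n+2))) ∧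
    Sat D ψ (cons' t (fun n => v (n+2))) ∧ v (k+2) = pair (v 0) t) (h := ?_)))).congr ?_
  · have : UDef (fun D v => ∃ t ∈ v 0, Sat D φ (cons' (v 1) (fun n => v (n+3))) ∧
      Sat D ψ (cons' t (fun n => v (n+3))) ∧ v (k+3) = pair (v 1) t) := by
      refine bex 0 (fun D t v => Sat D φ (cons' (v 1) (fun n => v (n+3))) ∧
        Sat D ψ (cons' t (fun n => v (n+3))) ∧ v (k+3) = pair (v 1) t) (h := ?_)
      have hS2 : UDef (fun D v => Sat D φ (cons' (v 2) (fun n => v (n + 4)))) := by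
        have hinj : Function.Injective (fun n : ℕ => if n = 0 then 2 else n + 3) := by
          intro a b h; simp only at h; split_ifs at h <;> omega
        refine ⟨φ.ren (fun n : ℕ => if n = 0 then 2 else n + 3), fun D hD v hv => ?_⟩
        rw [sat_ren _ _ hinj]
        apply sat_congr
        intro n _
        cases n <;> rfl
      have hT2 : UDef (fun D v => Sat D ψ (cons' (v 0) (fun n => v (n + 4)))) := by
        have hinj : Function.Injective (fun n : ℕ => if n = 0 then 0 else n + 3) := by
          intro a b h; simp only at h; split_ifs at h <;> omega
        refine ⟨ψ.ren (fun n : ℕ => if n = 0 then 0 else n + 3), fun D hD v hv => ?_⟩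
        rw [sat_ren _ _ hinj]
        apply sat_congr
        intro n _
        cases n <;> rfl
      have hp := eqPair0 2 0 (k+4)
      exact and (h := hS2) (h' := and (h := hT2) (h' := hp))
    exact this
  · intro D hD v hv
    constructor
    · rintro ⟨z, hz, s, hs, z', hz', t, ht, h1, h2, h3⟩
      have hzD := hD _ (hv k) _ hz
      have hz'D := hD _ (hv k) _ hz'
      have h1 := (hφ D hD _ (cons'_mem (hD _ hzD _ hs) hv)).1 h1
      have h2 := (hψ D hD _ (cons'_mem (hD _ hz'D _ ht) hv)).1 h2
      simp only [cons'_zero, cons'_succ] at h1 h2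
      rw [h3, h1, h2]
    · intro h
      obtain ⟨z, hz, hs⟩ := mem_of_pair_left (a := S v) (b := T v)
      obtain ⟨z', hz', ht⟩ := mem_of_pair_right (a := S v) (b := T v)
      rw [← h] at hz hz'
      have hzD := hD _ (hv k) _ hz
      have hz'D := hD _ (hv k) _ hz'
      exact ⟨z, hz, _, hs, z', hz', _, ht,
        (hφ D hD _ (cons'_mem (hD _ hzD _ hs) hv)).2 rfl,
        (hψ D hD _ (cons'_mem (hD _ hz'D _ ht) hv)).2 rfl, h⟩

instance memPair (k : ℕ) (S T : (ℕ → ZFSet) → ZFSet)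
    [hS : UDef (fun _ v => v 0 = pair (S (fun n => v (n+1))) (T (fun n => v (n+1))))] :
    UDef (fun _ v => pair (S v) (T v) ∈ v k) :=
  (bex k (fun D z v => z = pair (S v) (T v)) (h := hS)).congr fun D _ v _ => by
    simp

instance isTransitive (i : ℕ) : UDef (fun _ v => (v i).IsTransitive) :=
  (inferInstance : UDef (fun _ v => ∀ x ∈ v i, x ⊆ v i)).congr fun _ _ _ _ => Iff.rfl

instance isOrd (i : ℕ) : UDef (fun _ v => IsOrd (v i)) := by
  unfold IsOrd; infer_instance

theorem ex_pair_iff {p : ZFSet} {Q : ZFSet → ZFSet → Prop} :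
    (∃ a b, p = pair a b ∧ Q a b) ↔ ∃ z ∈ p, ∃ a ∈ z, ∃ z' ∈ p, ∃ b ∈ z', p = pair a b ∧ Q a b := by
  constructor
  · rintro ⟨a, b, rfl, hq⟩
    obtain ⟨z, hz, hs⟩ := mem_of_pair_left (a := a) (b := b)
    obtain ⟨z', hz', ht⟩ := mem_of_pair_right (a := a) (b := b)
    exact ⟨z, hz, a, hs, z', hz', b, ht, rfl, hq⟩
  · rintro ⟨z, hz, a, hs, z', hz', b, ht, h, hq⟩
    exact ⟨a, b, h, hq⟩

instance isZFunc (i j : ℕ) : UDef (fun _ v => IsZFunc (v i) (v j)) :=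
  (inferInstance : UDef (fun _ v => (∀ p ∈ v j, ∃ a ∈ v i, ∃ z ∈ p, ∃ b ∈ z, p = pair a b) ∧
    ∀ a ∈ v i, ∃ p ∈ v j, ∃ z ∈ p, ∃ b ∈ z, p = pair a b ∧
      ∀ q ∈ v j, ∀ z' ∈ q, ∀ b' ∈ z', q = pair a b' → b' = b)).congr fun D _ v _ => by
    unfold IsZFunc
    refine and_congr ?_ ?_
    · refine forall₂_congr fun p hp => exists_congr fun a => and_congr_right fun ha => ?_
      constructor
      · rintro ⟨z, hz, b, hb, h⟩; exact ⟨b, h⟩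
      · rintro ⟨b, rfl⟩
        obtain ⟨z', hz', ht⟩ := mem_of_pair_right (a := a) (b := b)
        exact ⟨z', hz', b, ht, rfl⟩
    · refine forall₂_congr fun a ha => ?_
      constructor
      · rintro ⟨p, hp, z, hz, b, hb, rfl, h⟩
        refine ⟨b, hp, fun b' hb' => ?_⟩
        obtain ⟨z', hz', ht⟩ := mem_of_pair_right (a := a) (b := b')
        exact h _ hb' z' hz' b' ht rfl
      · rintro ⟨b, hb, h⟩
        obtain ⟨z', hz', ht⟩ := mem_of_pair_right (a := a) (b := b)
        refine ⟨_, hb, z', hz', b, ht, rfl, ?_⟩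
        rintro _ hq z'' _ b' _ rfl
        exact h _ hq

/-- Satisfaction in a set is definable. -/
instance satIn (φ : Fml) : ∀ (i : ℕ) (ρ : ℕ → ℕ),
    UDef (fun _ v => Sat (v i).toSet φ (fun n => v (ρ n))) := by
  induction φ with
  | mem a b => intro i ρ; exact mem _ _
  | eq a b => intro i ρ; exact eq _ _
  | impl φ ψ h1 h2 => intro i ρ; exact imp (h := h1 i ρ) (h' := h2 i ρ)
  | neg φ h1 => intro i ρ; exact not (h := h1 i ρ)
  | all k φ h1 =>
    intro i ρ
    have h := h1 (i+1) (fun n => if n = k then 0 else ρ n + 1)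
    refine (ball i (fun D x v => Sat (v i).toSet φ
      (fun n => cons' x v (if n = k then 0 else ρ n + 1))) (h := ?_)).congr fun D _ v _ => ?_
    · refine h.congr fun D _ v _ => ?_
      have : (fun n => v (if n = k then 0 else ρ n + 1)) = fun n =>
          cons' (v 0) (fun n => v (n+1)) (if n = k then 0 else ρ n + 1) := by
        funext n; split_ifs <;> rfl
      rw [this]
    · simp only [Sat]
      refine forall₂_congr fun x hx => ?_
      have : (fun n => cons' x v (if n = k then 0 else ρ n + 1)) =
          Function.update (fun n => v (ρ n)) k x := by
        funext n
        by_cases hn : n = k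
        · subst hn; simp
        · simp [hn]
      rw [this]

/-- Satisfaction in the structure itself. -/
instance satD (φ : Fml) : ∀ (ρ : ℕ → ℕ), UDef (fun D v => Sat D φ (fun n => v (ρ n))) := by
  induction φ with
  | mem a b => intro ρ; exact mem _ _
  | eq a b => intro ρ; exact eq _ _
  | impl φ ψ h1 h2 => intro ρ; exact imp (h := h1 ρ) (h' := h2 ρ)
  | neg φ h1 => intro ρ; exact not (h := h1 ρ)
  | all k φ h1 =>
    intro ρ
    have h := h1 (fun n => if n = k then 0 else ρ n + 1)
    refine (allD (fun D x v => Sat D φ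
      (fun n => cons' x v (if n = k then 0 else ρ n + 1))) (h := ?_)).congr fun D _ v _ => ?_
    · refine h.congr fun D _ v _ => ?_
      have : (fun n => v (if n = k then 0 else ρ n + 1)) = fun n =>
          cons' (v 0) (fun n => v (n+1)) (if n = k then 0 else ρ n + 1) := by
        funext n; split_ifs <;> rfl
      rw [this]
    · simp only [Sat]
      refine forall₂_congr fun x hx => ?_
      have : (fun n => cons' x v (if n = k then 0 else ρ n + 1)) =
          Function.update (fun n => v (ρ n)) k x := by
        funext n
        by_cases hn : n = k
        · subst hn; simp
        · simp [hn]
      rw [this]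

/-- Universal closure. -/
theorem allv (P : Set ZFSet → (ℕ → ZFSet) → Prop) [h : UDef P] :
    UDef (fun D _ => ∀ w : ℕ → ZFSet, (∀ n, w n ∈ D) → P D w) := by
  obtain ⟨φ, hφ⟩ := h.out
  have key : ∀ (N : ℕ), ∃ ψ : Fml, ∀ D, TrS D → ∀ v : ℕ → ZFSet, (∀ n, v n ∈ D) → (Sat D ψ v ↔
      ∀ w : ℕ → ZFSet, (∀ n, w n ∈ D) → Sat D φ (fun n => if n < N then w n else v (n - N))) := by
    intro N
    induction N with
    | zero => exact ⟨φ, fun D hD v hv => by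
        simp only [Nat.not_lt_zero, if_false, Nat.sub_zero]
        exact ⟨fun h _ _ => h, fun h => h v hv⟩⟩
    | succ N ih =>
      obtain ⟨ψ, hψ⟩ := ih
      refine ⟨ψ.allc, fun D hD v hv => ?_⟩
      rw [sat_allc]
      constructor
      · intro H w hw
        have := (hψ D hD _ (cons'_mem (hw N) hv)).1 (H _ (hw N)) w hw
        convert this using 2 with n
        by_cases h1 : n < N
        · simp [h1, Nat.lt_succ_of_lt h1]
        · by_cases h2 : n = N
          · subst h2; simp
          · rw [if_neg (by omega), if_neg h1]
            obtain ⟨k, rfl⟩ : ∃ k, n = N + 1 + k := ⟨n - (N+1), by omega⟩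
            rw [show N + 1 + k - N = k + 1 by omega, cons'_succ]
            congr 1; omega
      · intro H x hx
        rw [hψ D hD _ (cons'_mem hx hv)]
        intro w hw
        have := H (fun n => if n = N then x else w n) (fun n => by
          show (if n = N then x else w n) ∈ D
          split_ifs; exacts [hx, hw n])
        convert this using 2 with n
        by_cases h1 : n < N
        · simp [h1, Nat.lt_succ_of_lt h1, h1.ne]
        · by_cases h2 : n = N
          · subst h2; simp
          · rw [if_neg h1, if_neg (show ¬ n < N+1 by omega)]
            obtain ⟨k, rfl⟩ : ∃ k, n = N + 1 + k := ⟨n - (N+1), by omega⟩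
            rw [show N + 1 + k - N = k + 1 by omega, cons'_succ]
            congr 1; omega
  obtain ⟨ψ, hψ⟩ := key φ.bd
  refine ⟨ψ, fun D hD v hv => ?_⟩
  rw [hψ D hD v hv]
  refine forall₂_congr fun w hw => ?_
  rw [← hφ D hD w hw]
  apply sat_congr
  intro n hn; simp [hn]

end UDef

/-! ## Elementary maps -/

/-- `j : M → N` elementary between transitive sets. -/
structure El (M N : ZFSet) (j : ZFSet → ZFSet) : Prop where
  trM : M.IsTransitive
  trN : N.IsTransitive
  maps : ∀ x ∈ M, j x ∈ N
  el : ∀ (φ : Fml) (v : ℕ → ZFSet), (∀ n, v n ∈ M) →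
    (Sat M.toSet φ v ↔ Sat N.toSet φ (fun n => j (v n)))

theorem trS_of {M : ZFSet} (h : M.IsTransitive) : TrS M.toSet :=
  fun x hx _ hy => mem_toSet.2 (h x (mem_toSet.1 hx) hy)

theorem El.trv {M N : ZFSet} {j : ZFSet → ZFSet} (hj : El M N j)
    (P : Set ZFSet → (ℕ → ZFSet) → Prop) [h : UDef P] (v : ℕ → ZFSet) (hv : ∀ n, v n ∈ M) :
    P M.toSet v ↔ P N.toSet (fun n => j (v n)) := by
  obtain ⟨φ, hφ⟩ := h.out
  rw [← hφ _ (trS_of hj.trM) v (fun n => mem_toSet.2 (hv n)), hj.el φ v hv,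
    hφ _ (trS_of hj.trN) _ (fun n => mem_toSet.2 (hj.maps _ (hv n)))]

theorem El.tr1 {M N : ZFSet} {j : ZFSet → ZFSet} (hj : El M N j) (P : ZFSet → Prop)
    [UDef (fun _ v => P (v 0))] {p1 : ZFSet} (h1 : p1 ∈ M) : P p1 ↔ P (j p1) :=
  hj.trv (fun _ v => P (v 0)) (fun _ => p1) (fun _ => h1)

theorem El.tr2 {M N : ZFSet} {j : ZFSet → ZFSet} (hj : El M N j) (P : ZFSet → ZFSet → Prop)
    [UDef (fun _ v => P (v 0) (v 1))] {p1 p2 : ZFSet} (h1 : p1 ∈ M) (h2 : p2 ∈ M) : P p1 p2 ↔ P (j p1) (j p2) :=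
  hj.trv (fun _ v => P (v 0) (v 1)) (cons' p1 (fun _ => p2)) (cons'_mem (mem_toSet.2 h1) (fun _ => h2))

theorem El.tr3 {M N : ZFSet} {j : ZFSet → ZFSet} (hj : El M N j) (P : ZFSet → ZFSet → ZFSet → Prop)
    [UDef (fun _ v => P (v 0) (v 1) (v 2))] {p1 p2 p3 : ZFSet} (h1 : p1 ∈ M) (h2 : p2 ∈ M) (h3 : p3 ∈ M) : P p1 p2 p3 ↔ P (j p1) (j p2) (j p3) :=
  hj.trv (fun _ v => P (v 0) (v 1) (v 2)) (cons' p1 (cons' p2 (fun _ => p3))) (cons'_mem (mem_toSet.2 h1) (cons'_mem (mem_toSet.2 h2) (fun _ => h3)))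

theorem El.tr4 {M N : ZFSet} {j : ZFSet → ZFSet} (hj : El M N j) (P : ZFSet → ZFSet → ZFSet → ZFSet → Prop)
    [UDef (fun _ v => P (v 0) (v 1) (v 2) (v 3))] {p1 p2 p3 p4 : ZFSet} (h1 : p1 ∈ M) (h2 : p2 ∈ M) (h3 : p3 ∈ M) (h4 : p4 ∈ M) : P p1 p2 p3 p4 ↔ P (j p1) (j p2) (j p3) (j p4) :=
  hj.trv (fun _ v => P (v 0) (v 1) (v 2) (v 3)) (cons' p1 (cons' p2 (cons' p3 (fun _ => p4)))) (cons'_mem (mem_toSet.2 h1) (cons'_mem (mem_toSet.2 h2) (cons'_mem (mem_toSet.2 h3) (fun _ => h4))))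

theorem El.tr5 {M N : ZFSet} {j : ZFSet → ZFSet} (hj : El M N j) (P : ZFSet → ZFSet → ZFSet → ZFSet → ZFSet → Prop)
    [UDef (fun _ v => P (v 0) (v 1) (v 2) (v 3) (v 4))] {p1 p2 p3 p4 p5 : ZFSet} (h1 : p1 ∈ M) (h2 : p2 ∈ M) (h3 : p3 ∈ M) (h4 : p4 ∈ M) (h5 : p5 ∈ M) : P p1 p2 p3 p4 p5 ↔ P (j p1) (j p2) (j p3) (j p4) (j p5) :=
  hj.trv (fun _ v => P (v 0) (v 1) (v 2) (v 3) (v 4)) (cons' p1 (cons' p2 (cons' p3 (cons' p4 (fun _ => p5))))) (cons'_mem (mem_toSet.2 h1) (cons'_mem (mem_toSet.2 h2) (cons'_mem (mem_toSet.2 h3) (cons'_mem (mem_toSet.2 h4) (fun _ => h5)))))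

theorem El.tr6 {M N : ZFSet} {j : ZFSet → ZFSet} (hj : El M N j) (P : ZFSet → ZFSet → ZFSet → ZFSet → ZFSet → ZFSet → Prop)
    [UDef (fun _ v => P (v 0) (v 1) (v 2) (v 3) (v 4) (v 5))] {p1 p2 p3 p4 p5 p6 : ZFSet} (h1 : p1 ∈ M) (h2 : p2 ∈ M) (h3 : p3 ∈ M) (h4 : p4 ∈ M) (h5 : p5 ∈ M) (h6 : p6 ∈ M) : P p1 p2 p3 p4 p5 p6 ↔ P (j p1) (j p2) (j p3) (j p4) (j p5) (j p6) :=
  hj.trv (fun _ v => P (v 0) (v 1) (v 2) (v 3) (v 4) (v 5)) (cons' p1 (cons' p2 (cons' p3 (cons' p4 (cons' p5 (fun _ => p6)))))) (cons'_mem (mem_toSet.2 h1) (cons'_mem (mem_toSet.2 h2) (cons'_mem (mem_toSet.2 h3) (cons'_mem (mem_toSet.2 h4) (cons'_mem (mem_toSet.2 h5) (fun _ => h6))))))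

theorem El.tr7 {M N : ZFSet} {j : ZFSet → ZFSet} (hj : El M N j) (P : ZFSet → ZFSet → ZFSet → ZFSet → ZFSet → ZFSet → ZFSet → Prop)
    [UDef (fun _ v => P (v 0) (v 1) (v 2) (v 3) (v 4) (v 5) (v 6))] {p1 p2 p3 p4 p5 p6 p7 : ZFSet} (h1 : p1 ∈ M) (h2 : p2 ∈ M) (h3 : p3 ∈ M) (h4 : p4 ∈ M) (h5 : p5 ∈ M) (h6 : p6 ∈ M) (h7 : p7 ∈ M) : P p1 p2 p3 p4 p5 p6 p7 ↔ P (j p1) (j p2) (j p3) (j p4) (j p5) (j p6) (j p7) :=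
  hj.trv (fun _ v => P (v 0) (v 1) (v 2) (v 3) (v 4) (v 5) (v 6)) (cons' p1 (cons' p2 (cons' p3 (cons' p4 (cons' p5 (cons' p6 (fun _ => p7))))))) (cons'_mem (mem_toSet.2 h1) (cons'_mem (mem_toSet.2 h2) (cons'_mem (mem_toSet.2 h3) (cons'_mem (mem_toSet.2 h4) (cons'_mem (mem_toSet.2 h5) (cons'_mem (mem_toSet.2 h6) (fun _ => h7)))))))

theorem El.tr8 {M N : ZFSet} {j : ZFSet → ZFSet} (hj : El M N j) (P : ZFSet → ZFSet → ZFSet → ZFSet → ZFSet → ZFSet → ZFSet → ZFSet → Prop)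
    [UDef (fun _ v => P (v 0) (v 1) (v 2) (v 3) (v 4) (v 5) (v 6) (v 7))] {p1 p2 p3 p4 p5 p6 p7 p8 : ZFSet} (h1 : p1 ∈ M) (h2 : p2 ∈ M) (h3 : p3 ∈ M) (h4 : p4 ∈ M) (h5 : p5 ∈ M) (h6 : p6 ∈ M) (h7 : p7 ∈ M) (h8 : p8 ∈ M) : P p1 p2 p3 p4 p5 p6 p7 p8 ↔ P (j p1) (j p2) (j p3) (j p4) (j p5) (j p6) (j p7) (j p8) :=
  hj.trv (fun _ v => P (v 0) (v 1) (v 2) (v 3) (v 4) (v 5) (v 6) (v 7)) (cons' p1 (cons' p2 (cons' p3 (cons' p4 (cons' p5 (cons' p6 (cons' p7 (fun _ => p8)))))))) (cons'_mem (mem_toSet.2 h1) (cons'_mem (mem_toSet.2 h2) (cons'_mem (mem_toSet.2 h3) (cons'_mem (mem_toSet.2 h4) (cons'_mem (mem_toSet.2 h5) (cons'_mem (mem_toSet.2 h6) (cons'_mem (mem_toSet.2 h7) (fun _ => h8))))))))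

/-! ## Model closure -/

theorem sepv {M : ZFSet} (hM : IsTransModel M) (P : Set ZFSet → (ℕ → ZFSet) → Prop) [h : UDef P]
    (v : ℕ → ZFSet) (hv : ∀ n, v n ∈ M) {a : ZFSet} (ha : a ∈ M) :
    ZFSet.sep (fun x => P M.toSet (cons' x v)) a ∈ M := by
  obtain ⟨φ, hφ⟩ := h.out
  obtain ⟨b, hb, h1⟩ := hM.2.2.2.2.1 φ (cons' a v) (cons'_mem (D := M.toSet) (mem_toSet.2 ha) hv) a ha
  convert hb using 1
  ext x
  rw [ZFSet.mem_sep, h1]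
  refine and_congr_right fun hx => ?_
  have : Function.update (cons' a v) 0 x = cons' x v := by
    funext n; cases n <;> simp
  rw [this, hφ _ (trS_of hM.1)]
  exact cons'_mem (mem_toSet.2 (hM.1 a ha hx)) hv

theorem collv {M : ZFSet} (hM : IsTransModel M) (P : Set ZFSet → (ℕ → ZFSet) → Prop) [h : UDef P]
    (v : ℕ → ZFSet) (hv : ∀ n, v n ∈ M) {a : ZFSet} (ha : a ∈ M)
    (H : ∀ x ∈ a, ∃ y ∈ M, P M.toSet (cons' x (cons' y v))) :
    ∃ b ∈ M, ∀ x ∈ a, ∃ y ∈ b, P M.toSet (cons' x (cons' y v)) := by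
  obtain ⟨φ, hφ⟩ := h.out
  have key : ∀ x ∈ a, ∀ y ∈ M, (Sat M.toSet φ (Function.update (Function.update
      (cons' a (cons' a v)) 0 x) 1 y) ↔ P M.toSet (cons' x (cons' y v))) := by
    intro x hx y hy
    have : Function.update (Function.update (cons' a (cons' a v)) 0 x) 1 y =
        cons' x (cons' y v) := by
      funext n
      rcases n with _ | _ | n
      · simp
      · simp
      · rw [Function.update_of_ne (by omega), Function.update_of_ne (by omega)]; rfl
    rw [this, hφ _ (trS_of hM.1)]
    exact cons'_mem (mem_toSet.2 (hM.1 a ha hx)) (cons'_mem (mem_toSet.2 hy) hv)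
  obtain ⟨b, hb, h1⟩ := hM.2.2.2.2.2.1 φ (cons' a (cons' a v))
    (cons'_mem (D := M.toSet) (mem_toSet.2 ha) (cons'_mem (mem_toSet.2 ha) hv)) a ha
    (fun x hx => by
      obtain ⟨y, hy, hxy⟩ := H x hx
      exact ⟨y, hy, (key x hx y hy).2 hxy⟩)
  refine ⟨b, hb, fun x hx => ?_⟩
  obtain ⟨y, hy, hxy⟩ := h1 x hx
  exact ⟨y, hy, (key x hx y (hM.1 b hb hy)).1 hxy⟩

theorem sep0 {M : ZFSet} (hM : IsTransModel M) {P : ZFSet → Prop}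
    [UDef (fun _ v => P (v 0))] {a  : ZFSet} (ha : a ∈ M)  :
    ZFSet.sep (fun x => P x ) a ∈ M :=
  sepv hM (fun _ v => P (v 0)) (fun _ => a) (fun _ => ha) ha

theorem sepD0 {M : ZFSet} (hM : IsTransModel M) (P : Set ZFSet → ZFSet → Prop)
    [UDef (fun D v => P D (v 0))] {a  : ZFSet} (ha : a ∈ M)  :
    ZFSet.sep (fun x => P M.toSet x ) a ∈ M :=
  sepv hM (fun D v => P D (v 0)) (fun _ => a) (fun _ => ha) ha

theorem collD0 {M : ZFSet} (hM : IsTransModel M) (P : Set ZFSet → ZFSet → ZFSet → Prop)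
    [UDef (fun D v => P D (v 0) (v 1))] {a  : ZFSet} (ha : a ∈ M) 
    (H : ∀ x ∈ a, ∃ y ∈ M, P M.toSet x y ) :
    ∃ b ∈ M, ∀ x ∈ a, ∃ y ∈ b, P M.toSet x y  :=
  collv hM (fun D v => P D (v 0) (v 1)) (fun _ => a) (fun _ => ha) ha H

theorem sep1 {M : ZFSet} (hM : IsTransModel M) {P : ZFSet → ZFSet → Prop}
    [UDef (fun _ v => P (v 0) (v 1))] {a p1 : ZFSet} (ha : a ∈ M) (h1 : p1 ∈ M) :
    ZFSet.sep (fun x => P x p1) a ∈ M :=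
  sepv hM (fun _ v => P (v 0) (v 1)) (cons' p1 (fun _ => a)) (cons'_mem (mem_toSet.2 h1) (fun _ => ha)) ha

theorem sepD1 {M : ZFSet} (hM : IsTransModel M) (P : Set ZFSet → ZFSet → ZFSet → Prop)
    [UDef (fun D v => P D (v 0) (v 1))] {a p1 : ZFSet} (ha : a ∈ M) (h1 : p1 ∈ M) :
    ZFSet.sep (fun x => P M.toSet x p1) a ∈ M :=
  sepv hM (fun D v => P D (v 0) (v 1)) (cons' p1 (fun _ => a)) (cons'_mem (mem_toSet.2 h1) (fun _ => ha)) ha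

theorem collD1 {M : ZFSet} (hM : IsTransModel M) (P : Set ZFSet → ZFSet → ZFSet → ZFSet → Prop)
    [UDef (fun D v => P D (v 0) (v 1) (v 2))] {a p1 : ZFSet} (ha : a ∈ M) (h1 : p1 ∈ M)
    (H : ∀ x ∈ a, ∃ y ∈ M, P M.toSet x y p1) :
    ∃ b ∈ M, ∀ x ∈ a, ∃ y ∈ b, P M.toSet x y p1 :=
  collv hM (fun D v => P D (v 0) (v 1) (v 2)) (cons' p1 (fun _ => a)) (cons'_mem (mem_toSet.2 h1) (fun _ => ha)) ha H

theorem sep2 {M : ZFSet} (hM : IsTransModel M) {P : ZFSet → ZFSet → ZFSet → Prop}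
    [UDef (fun _ v => P (v 0) (v 1) (v 2))] {a p1 p2 : ZFSet} (ha : a ∈ M) (h1 : p1 ∈ M) (h2 : p2 ∈ M) :
    ZFSet.sep (fun x => P x p1 p2) a ∈ M :=
  sepv hM (fun _ v => P (v 0) (v 1) (v 2)) (cons' p1 (cons' p2 (fun _ => a))) (cons'_mem (mem_toSet.2 h1) (cons'_mem (mem_toSet.2 h2) (fun _ => ha))) ha

theorem sepD2 {M : ZFSet} (hM : IsTransModel M) (P : Set ZFSet → ZFSet → ZFSet → ZFSet → Prop)
    [UDef (fun D v => P D (v 0) (v 1) (v 2))] {a p1 p2 : ZFSet} (ha : a ∈ M) (h1 : p1 ∈ M) (h2 : p2 ∈ M) :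
    ZFSet.sep (fun x => P M.toSet x p1 p2) a ∈ M :=
  sepv hM (fun D v => P D (v 0) (v 1) (v 2)) (cons' p1 (cons' p2 (fun _ => a))) (cons'_mem (mem_toSet.2 h1) (cons'_mem (mem_toSet.2 h2) (fun _ => ha))) ha

theorem collD2 {M : ZFSet} (hM : IsTransModel M) (P : Set ZFSet → ZFSet → ZFSet → ZFSet → ZFSet → Prop)
    [UDef (fun D v => P D (v 0) (v 1) (v 2) (v 3))] {a p1 p2 : ZFSet} (ha : a ∈ M) (h1 : p1 ∈ M) (h2 : p2 ∈ M)
    (H : ∀ x ∈ a, ∃ y ∈ M, P M.toSet x y p1 p2) :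
    ∃ b ∈ M, ∀ x ∈ a, ∃ y ∈ b, P M.toSet x y p1 p2 :=
  collv hM (fun D v => P D (v 0) (v 1) (v 2) (v 3)) (cons' p1 (cons' p2 (fun _ => a))) (cons'_mem (mem_toSet.2 h1) (cons'_mem (mem_toSet.2 h2) (fun _ => ha))) ha H

theorem sep3 {M : ZFSet} (hM : IsTransModel M) {P : ZFSet → ZFSet → ZFSet → ZFSet → Prop}
    [UDef (fun _ v => P (v 0) (v 1) (v 2) (v 3))] {a p1 p2 p3 : ZFSet} (ha : a ∈ M) (h1 : p1 ∈ M) (h2 : p2 ∈ M) (h3 : p3 ∈ M) :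
    ZFSet.sep (fun x => P x p1 p2 p3) a ∈ M :=
  sepv hM (fun _ v => P (v 0) (v 1) (v 2) (v 3)) (cons' p1 (cons' p2 (cons' p3 (fun _ => a)))) (cons'_mem (mem_toSet.2 h1) (cons'_mem (mem_toSet.2 h2) (cons'_mem (mem_toSet.2 h3) (fun _ => ha)))) ha

theorem sepD3 {M : ZFSet} (hM : IsTransModel M) (P : Set ZFSet → ZFSet → ZFSet → ZFSet → ZFSet → Prop)
    [UDef (fun D v => P D (v 0) (v 1) (v 2) (v 3))] {a p1 p2 p3 : ZFSet} (ha : a ∈ M) (h1 : p1 ∈ M) (h2 : p2 ∈ M) (h3 : p3 ∈ M) :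
    ZFSet.sep (fun x => P M.toSet x p1 p2 p3) a ∈ M :=
  sepv hM (fun D v => P D (v 0) (v 1) (v 2) (v 3)) (cons' p1 (cons' p2 (cons' p3 (fun _ => a)))) (cons'_mem (mem_toSet.2 h1) (cons'_mem (mem_toSet.2 h2) (cons'_mem (mem_toSet.2 h3) (fun _ => ha)))) ha

theorem collD3 {M : ZFSet} (hM : IsTransModel M) (P : Set ZFSet → ZFSet → ZFSet → ZFSet → ZFSet → ZFSet → Prop)
    [UDef (fun D v => P D (v 0) (v 1) (v 2) (v 3) (v 4))] {a p1 p2 p3 : ZFSet} (ha : a ∈ M) (h1 : p1 ∈ M) (h2 : p2 ∈ M) (h3 : p3 ∈ M)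
    (H : ∀ x ∈ a, ∃ y ∈ M, P M.toSet x y p1 p2 p3) :
    ∃ b ∈ M, ∀ x ∈ a, ∃ y ∈ b, P M.toSet x y p1 p2 p3 :=
  collv hM (fun D v => P D (v 0) (v 1) (v 2) (v 3) (v 4)) (cons' p1 (cons' p2 (cons' p3 (fun _ => a)))) (cons'_mem (mem_toSet.2 h1) (cons'_mem (mem_toSet.2 h2) (cons'_mem (mem_toSet.2 h3) (fun _ => ha)))) ha H

theorem sep4 {M : ZFSet} (hM : IsTransModel M) {P : ZFSet → ZFSet → ZFSet → ZFSet → ZFSet → Prop}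
    [UDef (fun _ v => P (v 0) (v 1) (v 2) (v 3) (v 4))] {a p1 p2 p3 p4 : ZFSet} (ha : a ∈ M) (h1 : p1 ∈ M) (h2 : p2 ∈ M) (h3 : p3 ∈ M) (h4 : p4 ∈ M) :
    ZFSet.sep (fun x => P x p1 p2 p3 p4) a ∈ M :=
  sepv hM (fun _ v => P (v 0) (v 1) (v 2) (v 3) (v 4)) (cons' p1 (cons' p2 (cons' p3 (cons' p4 (fun _ => a))))) (cons'_mem (mem_toSet.2 h1) (cons'_mem (mem_toSet.2 h2) (cons'_mem (mem_toSet.2 h3) (cons'_mem (mem_toSet.2 h4) (fun _ => ha))))) ha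

theorem sepD4 {M : ZFSet} (hM : IsTransModel M) (P : Set ZFSet → ZFSet → ZFSet → ZFSet → ZFSet → ZFSet → Prop)
    [UDef (fun D v => P D (v 0) (v 1) (v 2) (v 3) (v 4))] {a p1 p2 p3 p4 : ZFSet} (ha : a ∈ M) (h1 : p1 ∈ M) (h2 : p2 ∈ M) (h3 : p3 ∈ M) (h4 : p4 ∈ M) :
    ZFSet.sep (fun x => P M.toSet x p1 p2 p3 p4) a ∈ M :=
  sepv hM (fun D v => P D (v 0) (v 1) (v 2) (v 3) (v 4)) (cons' p1 (cons' p2 (cons' p3 (cons' p4 (fun _ => a))))) (cons'_mem (mem_toSet.2 h1) (cons'_mem (mem_toSet.2 h2) (cons'_mem (mem_toSet.2 h3) (cons'_mem (mem_toSet.2 h4) (fun _ => ha))))) ha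

theorem collD4 {M : ZFSet} (hM : IsTransModel M) (P : Set ZFSet → ZFSet → ZFSet → ZFSet → ZFSet → ZFSet → ZFSet → Prop)
    [UDef (fun D v => P D (v 0) (v 1) (v 2) (v 3) (v 4) (v 5))] {a p1 p2 p3 p4 : ZFSet} (ha : a ∈ M) (h1 : p1 ∈ M) (h2 : p2 ∈ M) (h3 : p3 ∈ M) (h4 : p4 ∈ M)
    (H : ∀ x ∈ a, ∃ y ∈ M, P M.toSet x y p1 p2 p3 p4) :
    ∃ b ∈ M, ∀ x ∈ a, ∃ y ∈ b, P M.toSet x y p1 p2 p3 p4 :=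
  collv hM (fun D v => P D (v 0) (v 1) (v 2) (v 3) (v 4) (v 5)) (cons' p1 (cons' p2 (cons' p3 (cons' p4 (fun _ => a))))) (cons'_mem (mem_toSet.2 h1) (cons'_mem (mem_toSet.2 h2) (cons'_mem (mem_toSet.2 h3) (cons'_mem (mem_toSet.2 h4) (fun _ => ha))))) ha H

theorem sep5 {M : ZFSet} (hM : IsTransModel M) {P : ZFSet → ZFSet → ZFSet → ZFSet → ZFSet → ZFSet → Prop}
    [UDef (fun _ v => P (v 0) (v 1) (v 2) (v 3) (v 4) (v 5))] {a p1 p2 p3 p4 p5 : ZFSet} (ha : a ∈ M) (h1 : p1 ∈ M) (h2 : p2 ∈ M) (h3 : p3 ∈ M) (h4 : p4 ∈ M) (h5 : p5 ∈ M) :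
    ZFSet.sep (fun x => P x p1 p2 p3 p4 p5) a ∈ M :=
  sepv hM (fun _ v => P (v 0) (v 1) (v 2) (v 3) (v 4) (v 5)) (cons' p1 (cons' p2 (cons' p3 (cons' p4 (cons' p5 (fun _ => a)))))) (cons'_mem (mem_toSet.2 h1) (cons'_mem (mem_toSet.2 h2) (cons'_mem (mem_toSet.2 h3) (cons'_mem (mem_toSet.2 h4) (cons'_mem (mem_toSet.2 h5) (fun _ => ha)))))) ha

theorem sepD5 {M : ZFSet} (hM : IsTransModel M) (P : Set ZFSet → ZFSet → ZFSet → ZFSet → ZFSet → ZFSet → ZFSet → Prop)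
    [UDef (fun D v => P D (v 0) (v 1) (v 2) (v 3) (v 4) (v 5))] {a p1 p2 p3 p4 p5 : ZFSet} (ha : a ∈ M) (h1 : p1 ∈ M) (h2 : p2 ∈ M) (h3 : p3 ∈ M) (h4 : p4 ∈ M) (h5 : p5 ∈ M) :
    ZFSet.sep (fun x => P M.toSet x p1 p2 p3 p4 p5) a ∈ M :=
  sepv hM (fun D v => P D (v 0) (v 1) (v 2) (v 3) (v 4) (v 5)) (cons' p1 (cons' p2 (cons' p3 (cons' p4 (cons' p5 (fun _ => a)))))) (cons'_mem (mem_toSet.2 h1) (cons'_mem (mem_toSet.2 h2) (cons'_mem (mem_toSet.2 h3) (cons'_mem (mem_toSet.2 h4) (cons'_mem (mem_toSet.2 h5) (fun _ => ha)))))) ha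

theorem collD5 {M : ZFSet} (hM : IsTransModel M) (P : Set ZFSet → ZFSet → ZFSet → ZFSet → ZFSet → ZFSet → ZFSet → ZFSet → Prop)
    [UDef (fun D v => P D (v 0) (v 1) (v 2) (v 3) (v 4) (v 5) (v 6))] {a p1 p2 p3 p4 p5 : ZFSet} (ha : a ∈ M) (h1 : p1 ∈ M) (h2 : p2 ∈ M) (h3 : p3 ∈ M) (h4 : p4 ∈ M) (h5 : p5 ∈ M)
    (H : ∀ x ∈ a, ∃ y ∈ M, P M.toSet x y p1 p2 p3 p4 p5) :
    ∃ b ∈ M, ∀ x ∈ a, ∃ y ∈ b, P M.toSet x y p1 p2 p3 p4 p5 :=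
  collv hM (fun D v => P D (v 0) (v 1) (v 2) (v 3) (v 4) (v 5) (v 6)) (cons' p1 (cons' p2 (cons' p3 (cons' p4 (cons' p5 (fun _ => a)))))) (cons'_mem (mem_toSet.2 h1) (cons'_mem (mem_toSet.2 h2) (cons'_mem (mem_toSet.2 h3) (cons'_mem (mem_toSet.2 h4) (cons'_mem (mem_toSet.2 h5) (fun _ => ha)))))) ha H

theorem sep6 {M : ZFSet} (hM : IsTransModel M) {P : ZFSet → ZFSet → ZFSet → ZFSet → ZFSet → ZFSet → ZFSet → Prop}
    [UDef (fun _ v => P (v 0) (v 1) (v 2) (v 3) (v 4) (v 5) (v 6))] {a p1 p2 p3 p4 p5 p6 : ZFSet} (ha : a ∈ M) (h1 : p1 ∈ M) (h2 : p2 ∈ M) (h3 : p3 ∈ M) (h4 : p4 ∈ M) (h5 : p5 ∈ M) (h6 : p6 ∈ M) :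
    ZFSet.sep (fun x => P x p1 p2 p3 p4 p5 p6) a ∈ M :=
  sepv hM (fun _ v => P (v 0) (v 1) (v 2) (v 3) (v 4) (v 5) (v 6)) (cons' p1 (cons' p2 (cons' p3 (cons' p4 (cons' p5 (cons' p6 (fun _ => a))))))) (cons'_mem (mem_toSet.2 h1) (cons'_mem (mem_toSet.2 h2) (cons'_mem (mem_toSet.2 h3) (cons'_mem (mem_toSet.2 h4) (cons'_mem (mem_toSet.2 h5) (cons'_mem (mem_toSet.2 h6) (fun _ => ha))))))) ha

theorem sepD6 {M : ZFSet} (hM : IsTransModel M) (P : Set ZFSet → ZFSet → ZFSet → ZFSet → ZFSet → ZFSet → ZFSet → ZFSet → Prop)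
    [UDef (fun D v => P D (v 0) (v 1) (v 2) (v 3) (v 4) (v 5) (v 6))] {a p1 p2 p3 p4 p5 p6 : ZFSet} (ha : a ∈ M) (h1 : p1 ∈ M) (h2 : p2 ∈ M) (h3 : p3 ∈ M) (h4 : p4 ∈ M) (h5 : p5 ∈ M) (h6 : p6 ∈ M) :
    ZFSet.sep (fun x => P M.toSet x p1 p2 p3 p4 p5 p6) a ∈ M :=
  sepv hM (fun D v => P D (v 0) (v 1) (v 2) (v 3) (v 4) (v 5) (v 6)) (cons' p1 (cons' p2 (cons' p3 (cons' p4 (cons' p5 (cons' p6 (fun _ => a))))))) (cons'_mem (mem_toSet.2 h1) (cons'_mem (mem_toSet.2 h2) (cons'_mem (mem_toSet.2 h3) (cons'_mem (mem_toSet.2 h4) (cons'_mem (mem_toSet.2 h5) (cons'_mem (mem_toSet.2 h6) (fun _ => ha))))))) ha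

theorem collD6 {M : ZFSet} (hM : IsTransModel M) (P : Set ZFSet → ZFSet → ZFSet → ZFSet → ZFSet → ZFSet → ZFSet → ZFSet → ZFSet → Prop)
    [UDef (fun D v => P D (v 0) (v 1) (v 2) (v 3) (v 4) (v 5) (v 6) (v 7))] {a p1 p2 p3 p4 p5 p6 : ZFSet} (ha : a ∈ M) (h1 : p1 ∈ M) (h2 : p2 ∈ M) (h3 : p3 ∈ M) (h4 : p4 ∈ M) (h5 : p5 ∈ M) (h6 : p6 ∈ M)
    (H : ∀ x ∈ a, ∃ y ∈ M, P M.toSet x y p1 p2 p3 p4 p5 p6) :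
    ∃ b ∈ M, ∀ x ∈ a, ∃ y ∈ b, P M.toSet x y p1 p2 p3 p4 p5 p6 :=
  collv hM (fun D v => P D (v 0) (v 1) (v 2) (v 3) (v 4) (v 5) (v 6) (v 7)) (cons' p1 (cons' p2 (cons' p3 (cons' p4 (cons' p5 (cons' p6 (fun _ => a))))))) (cons'_mem (mem_toSet.2 h1) (cons'_mem (mem_toSet.2 h2) (cons'_mem (mem_toSet.2 h3) (cons'_mem (mem_toSet.2 h4) (cons'_mem (mem_toSet.2 h5) (cons'_mem (mem_toSet.2 h6) (fun _ => ha))))))) ha H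

theorem sep7 {M : ZFSet} (hM : IsTransModel M) {P : ZFSet → ZFSet → ZFSet → ZFSet → ZFSet → ZFSet → ZFSet → ZFSet → Prop}
    [UDef (fun _ v => P (v 0) (v 1) (v 2) (v 3) (v 4) (v 5) (v 6) (v 7))] {a p1 p2 p3 p4 p5 p6 p7 : ZFSet} (ha : a ∈ M) (h1 : p1 ∈ M) (h2 : p2 ∈ M) (h3 : p3 ∈ M) (h4 : p4 ∈ M) (h5 : p5 ∈ M) (h6 : p6 ∈ M) (h7 : p7 ∈ M) :
    ZFSet.sep (fun x => P x p1 p2 p3 p4 p5 p6 p7) a ∈ M :=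
  sepv hM (fun _ v => P (v 0) (v 1) (v 2) (v 3) (v 4) (v 5) (v 6) (v 7)) (cons' p1 (cons' p2 (cons' p3 (cons' p4 (cons' p5 (cons' p6 (cons' p7 (fun _ => a)))))))) (cons'_mem (mem_toSet.2 h1) (cons'_mem (mem_toSet.2 h2) (cons'_mem (mem_toSet.2 h3) (cons'_mem (mem_toSet.2 h4) (cons'_mem (mem_toSet.2 h5) (cons'_mem (mem_toSet.2 h6) (cons'_mem (mem_toSet.2 h7) (fun _ => ha)))))))) ha

theorem sepD7 {M : ZFSet} (hM : IsTransModel M) (P : Set ZFSet → ZFSet → ZFSet → ZFSet → ZFSet → ZFSet → ZFSet → ZFSet → ZFSet → Prop)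
    [UDef (fun D v => P D (v 0) (v 1) (v 2) (v 3) (v 4) (v 5) (v 6) (v 7))] {a p1 p2 p3 p4 p5 p6 p7 : ZFSet} (ha : a ∈ M) (h1 : p1 ∈ M) (h2 : p2 ∈ M) (h3 : p3 ∈ M) (h4 : p4 ∈ M) (h5 : p5 ∈ M) (h6 : p6 ∈ M) (h7 : p7 ∈ M) :
    ZFSet.sep (fun x => P M.toSet x p1 p2 p3 p4 p5 p6 p7) a ∈ M :=
  sepv hM (fun D v => P D (v 0) (v 1) (v 2) (v 3) (v 4) (v 5) (v 6) (v 7)) (cons' p1 (cons' p2 (cons' p3 (cons' p4 (cons' p5 (cons' p6 (cons' p7 (fun _ => a)))))))) (cons'_mem (mem_toSet.2 h1) (cons'_mem (mem_toSet.2 h2) (cons'_mem (mem_toSet.2 h3) (cons'_mem (mem_toSet.2 h4) (cons'_mem (mem_toSet.2 h5) (cons'_mem (mem_toSet.2 h6) (cons'_mem (mem_toSet.2 h7) (fun _ => ha)))))))) ha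

theorem collD7 {M : ZFSet} (hM : IsTransModel M) (P : Set ZFSet → ZFSet → ZFSet → ZFSet → ZFSet → ZFSet → ZFSet → ZFSet → ZFSet → ZFSet → Prop)
    [UDef (fun D v => P D (v 0) (v 1) (v 2) (v 3) (v 4) (v 5) (v 6) (v 7) (v 8))] {a p1 p2 p3 p4 p5 p6 p7 : ZFSet} (ha : a ∈ M) (h1 : p1 ∈ M) (h2 : p2 ∈ M) (h3 : p3 ∈ M) (h4 : p4 ∈ M) (h5 : p5 ∈ M) (h6 : p6 ∈ M) (h7 : p7 ∈ M)
    (H : ∀ x ∈ a, ∃ y ∈ M, P M.toSet x y p1 p2 p3 p4 p5 p6 p7) :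
    ∃ b ∈ M, ∀ x ∈ a, ∃ y ∈ b, P M.toSet x y p1 p2 p3 p4 p5 p6 p7 :=
  collv hM (fun D v => P D (v 0) (v 1) (v 2) (v 3) (v 4) (v 5) (v 6) (v 7) (v 8)) (cons' p1 (cons' p2 (cons' p3 (cons' p4 (cons' p5 (cons' p6 (cons' p7 (fun _ => a)))))))) (cons'_mem (mem_toSet.2 h1) (cons'_mem (mem_toSet.2 h2) (cons'_mem (mem_toSet.2 h3) (cons'_mem (mem_toSet.2 h4) (cons'_mem (mem_toSet.2 h5) (cons'_mem (mem_toSet.2 h6) (cons'_mem (mem_toSet.2 h7) (fun _ => ha)))))))) ha H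

theorem sep8 {M : ZFSet} (hM : IsTransModel M) {P : ZFSet → ZFSet → ZFSet → ZFSet → ZFSet → ZFSet → ZFSet → ZFSet → ZFSet → Prop}
    [UDef (fun _ v => P (v 0) (v 1) (v 2) (v 3) (v 4) (v 5) (v 6) (v 7) (v 8))] {a p1 p2 p3 p4 p5 p6 p7 p8 : ZFSet} (ha : a ∈ M) (h1 : p1 ∈ M) (h2 : p2 ∈ M) (h3 : p3 ∈ M) (h4 : p4 ∈ M) (h5 : p5 ∈ M) (h6 : p6 ∈ M) (h7 : p7 ∈ M) (h8 : p8 ∈ M) :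
    ZFSet.sep (fun x => P x p1 p2 p3 p4 p5 p6 p7 p8) a ∈ M :=
  sepv hM (fun _ v => P (v 0) (v 1) (v 2) (v 3) (v 4) (v 5) (v 6) (v 7) (v 8)) (cons' p1 (cons' p2 (cons' p3 (cons' p4 (cons' p5 (cons' p6 (cons' p7 (cons' p8 (fun _ => a))))))))) (cons'_mem (mem_toSet.2 h1) (cons'_mem (mem_toSet.2 h2) (cons'_mem (mem_toSet.2 h3) (cons'_mem (mem_toSet.2 h4) (cons'_mem (mem_toSet.2 h5) (cons'_mem (mem_toSet.2 h6) (cons'_mem (mem_toSet.2 h7) (cons'_mem (mem_toSet.2 h8) (fun _ => ha))))))))) ha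

theorem sepD8 {M : ZFSet} (hM : IsTransModel M) (P : Set ZFSet → ZFSet → ZFSet → ZFSet → ZFSet → ZFSet → ZFSet → ZFSet → ZFSet → ZFSet → Prop)
    [UDef (fun D v => P D (v 0) (v 1) (v 2) (v 3) (v 4) (v 5) (v 6) (v 7) (v 8))] {a p1 p2 p3 p4 p5 p6 p7 p8 : ZFSet} (ha : a ∈ M) (h1 : p1 ∈ M) (h2 : p2 ∈ M) (h3 : p3 ∈ M) (h4 : p4 ∈ M) (h5 : p5 ∈ M) (h6 : p6 ∈ M) (h7 : p7 ∈ M) (h8 : p8 ∈ M) :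
    ZFSet.sep (fun x => P M.toSet x p1 p2 p3 p4 p5 p6 p7 p8) a ∈ M :=
  sepv hM (fun D v => P D (v 0) (v 1) (v 2) (v 3) (v 4) (v 5) (v 6) (v 7) (v 8)) (cons' p1 (cons' p2 (cons' p3 (cons' p4 (cons' p5 (cons' p6 (cons' p7 (cons' p8 (fun _ => a))))))))) (cons'_mem (mem_toSet.2 h1) (cons'_mem (mem_toSet.2 h2) (cons'_mem (mem_toSet.2 h3) (cons'_mem (mem_toSet.2 h4) (cons'_mem (mem_toSet.2 h5) (cons'_mem (mem_toSet.2 h6) (cons'_mem (mem_toSet.2 h7) (cons'_mem (mem_toSet.2 h8) (fun _ => ha))))))))) ha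

theorem collD8 {M : ZFSet} (hM : IsTransModel M) (P : Set ZFSet → ZFSet → ZFSet → ZFSet → ZFSet → ZFSet → ZFSet → ZFSet → ZFSet → ZFSet → ZFSet → Prop)
    [UDef (fun D v => P D (v 0) (v 1) (v 2) (v 3) (v 4) (v 5) (v 6) (v 7) (v 8) (v 9))] {a p1 p2 p3 p4 p5 p6 p7 p8 : ZFSet} (ha : a ∈ M) (h1 : p1 ∈ M) (h2 : p2 ∈ M) (h3 : p3 ∈ M) (h4 : p4 ∈ M) (h5 : p5 ∈ M) (h6 : p6 ∈ M) (h7 : p7 ∈ M) (h8 : p8 ∈ M)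
    (H : ∀ x ∈ a, ∃ y ∈ M, P M.toSet x y p1 p2 p3 p4 p5 p6 p7 p8) :
    ∃ b ∈ M, ∀ x ∈ a, ∃ y ∈ b, P M.toSet x y p1 p2 p3 p4 p5 p6 p7 p8 :=
  collv hM (fun D v => P D (v 0) (v 1) (v 2) (v 3) (v 4) (v 5) (v 6) (v 7) (v 8) (v 9)) (cons' p1 (cons' p2 (cons' p3 (cons' p4 (cons' p5 (cons' p6 (cons' p7 (cons' p8 (fun _ => a))))))))) (cons'_mem (mem_toSet.2 h1) (cons'_mem (mem_toSet.2 h2) (cons'_mem (mem_toSet.2 h3) (cons'_mem (mem_toSet.2 h4) (cons'_mem (mem_toSet.2 h5) (cons'_mem (mem_toSet.2 h6) (cons'_mem (mem_toSet.2 h7) (cons'_mem (mem_toSet.2 h8) (fun _ => ha))))))))) ha H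

/-! ## Renaming variables in definable predicates -/

theorem UDef.comp {P : Set ZFSet → (ℕ → ZFSet) → Prop} (h : UDef P) (ρ : ℕ → ℕ) :
    UDef (fun D v => P D (fun n => v (ρ n))) := by
  obtain ⟨φ, hφ⟩ := h.out
  exact (UDef.satD φ ρ).congr fun D hD v hv => hφ D hD _ fun n => hv _

/-! ## Function application -/

theorem fapp_eq {d f a b : ZFSet} (hf : IsZFunc d f) (h : pair a b ∈ f) : fapp f a = b := by
  have ha : a ∈ d := by
    obtain ⟨a', ha', b', h'⟩ := hf.1 _ h
    rw [pair_inj] at h'; rw [h'.1]; exact ha'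
  obtain ⟨c, hc, hu⟩ := hf.2 a ha
  have hb : ∀ b', pair a b' ∈ f → b' = b := fun b' hb' => (hu b' hb').trans (hu b h).symm
  ext x
  simp only [fapp, mem_sUnion, mem_sep]
  constructor
  · rintro ⟨z, ⟨_, hz⟩, hx⟩
    rw [← hb z hz]; exact hx
  · intro hx
    exact ⟨b, ⟨⟨{a, b}, ⟨_, h, by simp [ZFSet.pair]⟩, by simp⟩, h⟩, hx⟩

theorem fapp_mem {d f a : ZFSet} (hf : IsZFunc d f) (ha : a ∈ d) : pair a (fapp f a) ∈ f := by
  obtain ⟨b, hb, _⟩ := hf.2 a ha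
  rw [fapp_eq hf hb]; exact hb

theorem fapp_iff {d f a b : ZFSet} (hf : IsZFunc d f) (ha : a ∈ d) :
    pair a b ∈ f ↔ fapp f a = b :=
  ⟨fapp_eq hf, fun h => h ▸ fapp_mem hf ha⟩

theorem dom_of {d f a b : ZFSet} (hf : IsZFunc d f) (h : pair a b ∈ f) : a ∈ d := by
  obtain ⟨a', ha', b', h'⟩ := hf.1 _ h
  rw [pair_inj] at h'; rw [h'.1]; exact ha'

theorem func_ext {d f g : ZFSet} (hf : IsZFunc d f) (hg : IsZFunc d g)
    (h : ∀ a ∈ d, fapp f a = fapp g a) : f = g := by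
  ext p
  constructor
  · intro hp
    obtain ⟨a, ha, b, rfl⟩ := hf.1 p hp
    rw [fapp_iff hg ha, ← h a ha]; exact fapp_eq hf hp
  · intro hp
    obtain ⟨a, ha, b, rfl⟩ := hg.1 p hp
    rw [fapp_iff hf ha, h a ha]; exact fapp_eq hg hp

theorem isZFunc_of {d f : ZFSet} (G : ZFSet → ZFSet)
    (h : ∀ p, p ∈ f ↔ ∃ a ∈ d, p = pair a (G a)) : IsZFunc d f := by
  refine ⟨fun p hp => ?_, fun a ha => ⟨G a, (h _).2 ⟨a, ha, rfl⟩, fun b hb => ?_⟩⟩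
  · obtain ⟨a, ha, rfl⟩ := (h p).1 hp
    exact ⟨a, ha, _, rfl⟩
  · obtain ⟨a', _, h'⟩ := (h _).1 hb
    rw [pair_inj] at h'; rw [h'.1]; exact h'.2

/-! ## Closure properties of models -/

namespace IsTransModel
theorem tr {M : ZFSet} (hM : IsTransModel M) : M.IsTransitive := hM.1

theorem trans {M : ZFSet} (hM : IsTransModel M) {x y : ZFSet} (hx : x ∈ M) (hy : y ∈ x) : y ∈ M := hM.1 x hx hy

theorem omega_mem {M : ZFSet} (hM : IsTransModel M) : omega ∈ M := hM.2.1

theorem upair {M : ZFSet} (hM : IsTransModel M) {x y : ZFSet} (hx : x ∈ M) (hy : y ∈ M) : ({x, y} : ZFSet) ∈ M := hM.2.2.1 x hx y hy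

theorem sing {M : ZFSet} (hM : IsTransModel M) {x : ZFSet} (hx : x ∈ M) : ({x} : ZFSet) ∈ M := by
  have := upair hM hx hx
  rwa [show ({x, x} : ZFSet) = {x} by ext; simp] at this

theorem pair_mem {M : ZFSet} (hM : IsTransModel M) {x y : ZFSet} (hx : x ∈ M) (hy : y ∈ M) : pair x y ∈ M :=
  upair hM (sing hM hx) (upair hM hx hy)

theorem sUnion_mem {M : ZFSet} (hM : IsTransModel M) {x : ZFSet} (hx : x ∈ M) : (⋃₀ x : ZFSet) ∈ M := hM.2.2.2.1 x hx

theorem union_mem {M : ZFSet} (hM : IsTransModel M) {x y : ZFSet} (hx : x ∈ M) (hy : y ∈ M) : x ∪ y ∈ M :=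
  sUnion_mem hM (upair hM hx hy)

theorem empty_mem {M : ZFSet} (hM : IsTransModel M) : (∅ : ZFSet) ∈ M := trans hM (omega_mem hM) omega_zero

theorem insert_mem {M : ZFSet} (hM : IsTransModel M) {x y : ZFSet} (hx : x ∈ M) (hy : y ∈ M) : insert x y ∈ M := by
  have := union_mem hM (sing hM hx) hy
  rwa [show ({x} ∪ y : ZFSet) = insert x y by ext; simp] at this

theorem inter_mem {M : ZFSet} (hM : IsTransModel M) {x y : ZFSet} (hx : x ∈ M) (hy : y ∈ M) : x ∩ y ∈ M := by
  have := sep1 hM (P := fun z y => z ∈ y) hx hy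
  rwa [show ZFSet.sep (fun z => z ∈ y) x = x ∩ y by ext; simp] at this

theorem of_pair_left {M : ZFSet} (hM : IsTransModel M) {x y : ZFSet} (h : pair x y ∈ M) : x ∈ M := by
  obtain ⟨z, hz, hx⟩ := UDef.mem_of_pair_left (a := x) (b := y)
  exact trans hM (trans hM h hz) hx

theorem of_pair_right {M : ZFSet} (hM : IsTransModel M) {x y : ZFSet} (h : pair x y ∈ M) : y ∈ M := by
  obtain ⟨z, hz, hx⟩ := UDef.mem_of_pair_right (a := x) (b := y)
  exact trans hM (trans hM h hz) hx

theorem fapp_memM {M : ZFSet} (hM : IsTransModel M) {d f a : ZFSet} (hf : f ∈ M) (h : IsZFunc d f) (ha : a ∈ d) : fapp f a ∈ M :=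
  of_pair_right hM (trans hM hf (fapp_mem h ha))

/-- Replacement: the image of `a` under a definable function exists. -/
theorem replv {M : ZFSet} (hM : IsTransModel M) (P : Set ZFSet → (ℕ → ZFSet) → Prop) [h : UDef P]
    (v : ℕ → ZFSet) (hv : ∀ n, v n ∈ M) {a : ZFSet} (ha : a ∈ M) (G : ZFSet → ZFSet)
    (hG : ∀ x ∈ a, G x ∈ M) (H : ∀ x ∈ a, ∀ y ∈ M, P M.toSet (cons' x (cons' y v)) ↔ y = G x) :
    (∃ b ∈ M, ∀ y, y ∈ b ↔ ∃ x ∈ a, y = G x) ∧ (∃ f ∈ M, ∀ p, p ∈ f ↔ ∃ x ∈ a, p = pair x (G x)) := by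
  have hp : UDef (fun D w => ∃ x ∈ w 2, P D (cons' x (cons' (w 0) (fun n => w (n+3))))) := by
    refine UDef.bex 2 (fun D x w => P D (cons' x (cons' (w 0) (fun n => w (n+3))))) (h := ?_)
    have := h.comp (fun n => if n = 0 then 0 else if n = 1 then 1 else n + 2)
    refine this.congr fun D _ w _ => ?_
    have : (fun n => w (if n = 0 then 0 else if n = 1 then 1 else n + 2)) =
      cons' (w 0) (cons' (w 1) fun n => w (n + 3 + 1)) := by
      funext n; rcases n with _ | _ | n <;> simp
    rw [this]
  obtain ⟨b, hb, hb'⟩ := collv hM P v hv ha (fun x hx => ⟨G x, hG x hx, (H x hx _ (hG x hx)).2 rfl⟩)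
  have h1 : ∃ b ∈ M, ∀ y, y ∈ b ↔ ∃ x ∈ a, y = G x := by
    refine ⟨_, sepv hM _ (h := hp) (cons' a (cons' a v)) (cons'_mem (D := M.toSet) ha (cons'_mem ha hv)) hb, fun y => ?_⟩
    rw [mem_sep]
    show y ∈ b ∧ (∃ x ∈ a, P M.toSet (cons' x (cons' y v))) ↔ _
    constructor
    · rintro ⟨hy, x, hx, hxy⟩
      exact ⟨x, hx, (H x hx y (trans hM hb hy)).1 hxy⟩
    · rintro ⟨x, hx, rfl⟩
      obtain ⟨y, hy, hxy⟩ := hb' x hx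
      have := (H x hx y (trans hM hb hy)).1 hxy
      exact ⟨this ▸ hy, x, hx, (H x hx _ (hG x hx)).2 rfl⟩
  refine ⟨h1, ?_⟩
  obtain ⟨c, hc, hc'⟩ := h1
  -- the graph
  have hq : UDef (fun D w => ∃ y ∈ w 2, w 1 = pair (w 0) y ∧ P D (cons' (w 0) (cons' y (fun n => w (n+3))))) := by
    refine UDef.bex 2 (fun D y w => w 1 = pair (w 0) y ∧ P D (cons' (w 0) (cons' y (fun n => w (n+3))))) (h := ?_)
    refine UDef.and (h := inferInstance) (h' := ?_)
    have := h.comp (fun n => if n = 0 then 1 else if n = 1 then 0 else n + 2)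
    refine this.congr fun D _ w _ => ?_
    have : (fun n => w (if n = 0 then 1 else if n = 1 then 0 else n + 2)) =
      cons' (w 1) (cons' (w 0) fun n => w (n + 3 + 1)) := by
      funext n; rcases n with _ | _ | n <;> simp
    rw [this]
  have key : ∀ x ∈ a, ∀ y, (∃ z ∈ c, y = pair x z ∧ P M.toSet (cons' x (cons' z v))) ↔ y = pair x (G x) := by
    intro x hx y
    constructor
    · rintro ⟨z, hz, rfl, h⟩
      rw [(H x hx z (trans hM hc hz)).1 h]
    · rintro rfl
      exact ⟨_, (hc' _).2 ⟨x, hx, rfl⟩, rfl, (H x hx _ (hG x hx)).2 rfl⟩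
  obtain ⟨b2, hb2, hb2'⟩ := collv hM _ (h := hq) (cons' c v) (cons'_mem (D := M.toSet) hc hv) ha
    (fun x hx => ⟨pair x (G x), pair_mem hM (trans hM ha hx) (hG x hx), (key x hx _).2 rfl⟩)
  have hr : UDef (fun D w => ∃ x ∈ w 2, ∃ y ∈ w 1, w 0 = pair x y ∧ P D (cons' x (cons' y (fun n => w (n+3))))) := by
    refine UDef.bex 2 (fun D x w => ∃ y ∈ w 1, w 0 = pair x y ∧ P D (cons' x (cons' y (fun n => w (n+3))))) (h := ?_)
    refine UDef.bex 2 (fun D y w => w 1 = pair (w 0) y ∧ P D (cons' (w 0) (cons' y (fun n => w (n+4))))) (h := ?_)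
    refine UDef.and (h := inferInstance) (h' := ?_)
    have := h.comp (fun n => if n = 0 then 1 else if n = 1 then 0 else n + 3)
    refine this.congr fun D _ w _ => ?_
    have : (fun n => w (if n = 0 then 1 else if n = 1 then 0 else n + 3)) =
      cons' (w 1) (cons' (w 0) fun n => w (n + 4 + 1)) := by
      funext n; rcases n with _ | _ | n <;> simp
    rw [this]
  refine ⟨_, sepv hM _ (h := hr) (cons' c (cons' a v)) (cons'_mem (D := M.toSet) hc (cons'_mem ha hv)) hb2, fun p => ?_⟩
  rw [mem_sep]
  show p ∈ b2 ∧ (∃ x ∈ a, ∃ y ∈ c, p = pair x y ∧ P M.toSet (cons' x (cons' y v))) ↔ _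
  constructor
  · rintro ⟨hy, x, hx, h⟩
    exact ⟨x, hx, (key x hx _).1 h⟩
  · rintro ⟨x, hx, rfl⟩
    obtain ⟨y, hy, hxy⟩ := hb2' x hx
    have := (key x hx y).1 hxy
    exact ⟨this ▸ hy, x, hx, (key x hx _).2 rfl⟩
end IsTransModel

theorem replD0 {M : ZFSet} (hM : IsTransModel M) (P : Set ZFSet → ZFSet → ZFSet → Prop)
    [UDef (fun D v => P D (v 0) (v 1))] {a : ZFSet} (ha : a ∈ M)  (G : ZFSet → ZFSet)
    (hG : ∀ x ∈ a, G x ∈ M) (H : ∀ x ∈ a, ∀ y ∈ M, P M.toSet x y  ↔ y = G x) :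
    (∃ b ∈ M, ∀ y, y ∈ b ↔ ∃ x ∈ a, y = G x) ∧ (∃ f ∈ M, IsZFunc a f ∧ ∀ x ∈ a, fapp f x = G x) :=
  (IsTransModel.replv hM (fun D v => P D (v 0) (v 1)) (fun _ => a) (fun _ => ha) ha G hG H).imp id
    fun ⟨f, hf, h⟩ => ⟨f, hf, isZFunc_of G h, fun x hx => fapp_eq (isZFunc_of G h) ((h _).2 ⟨x, hx, rfl⟩)⟩

theorem replD1 {M : ZFSet} (hM : IsTransModel M) (P : Set ZFSet → ZFSet → ZFSet → ZFSet → Prop)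
    [UDef (fun D v => P D (v 0) (v 1) (v 2))] {a p1 : ZFSet} (ha : a ∈ M) (h1 : p1 ∈ M) (G : ZFSet → ZFSet)
    (hG : ∀ x ∈ a, G x ∈ M) (H : ∀ x ∈ a, ∀ y ∈ M, P M.toSet x y p1 ↔ y = G x) :
    (∃ b ∈ M, ∀ y, y ∈ b ↔ ∃ x ∈ a, y = G x) ∧ (∃ f ∈ M, IsZFunc a f ∧ ∀ x ∈ a, fapp f x = G x) :=
  (IsTransModel.replv hM (fun D v => P D (v 0) (v 1) (v 2)) (cons' p1 (fun _ => a)) (cons'_mem (mem_toSet.2 h1) (fun _ => ha)) ha G hG H).imp id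
    fun ⟨f, hf, h⟩ => ⟨f, hf, isZFunc_of G h, fun x hx => fapp_eq (isZFunc_of G h) ((h _).2 ⟨x, hx, rfl⟩)⟩

theorem replD2 {M : ZFSet} (hM : IsTransModel M) (P : Set ZFSet → ZFSet → ZFSet → ZFSet → ZFSet → Prop)
    [UDef (fun D v => P D (v 0) (v 1) (v 2) (v 3))] {a p1 p2 : ZFSet} (ha : a ∈ M) (h1 : p1 ∈ M) (h2 : p2 ∈ M) (G : ZFSet → ZFSet)
    (hG : ∀ x ∈ a, G x ∈ M) (H : ∀ x ∈ a, ∀ y ∈ M, P M.toSet x y p1 p2 ↔ y = G x) :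
    (∃ b ∈ M, ∀ y, y ∈ b ↔ ∃ x ∈ a, y = G x) ∧ (∃ f ∈ M, IsZFunc a f ∧ ∀ x ∈ a, fapp f x = G x) :=
  (IsTransModel.replv hM (fun D v => P D (v 0) (v 1) (v 2) (v 3)) (cons' p1 (cons' p2 (fun _ => a))) (cons'_mem (mem_toSet.2 h1) (cons'_mem (mem_toSet.2 h2) (fun _ => ha))) ha G hG H).imp id
    fun ⟨f, hf, h⟩ => ⟨f, hf, isZFunc_of G h, fun x hx => fapp_eq (isZFunc_of G h) ((h _).2 ⟨x, hx, rfl⟩)⟩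

theorem replD3 {M : ZFSet} (hM : IsTransModel M) (P : Set ZFSet → ZFSet → ZFSet → ZFSet → ZFSet → ZFSet → Prop)
    [UDef (fun D v => P D (v 0) (v 1) (v 2) (v 3) (v 4))] {a p1 p2 p3 : ZFSet} (ha : a ∈ M) (h1 : p1 ∈ M) (h2 : p2 ∈ M) (h3 : p3 ∈ M) (G : ZFSet → ZFSet)
    (hG : ∀ x ∈ a, G x ∈ M) (H : ∀ x ∈ a, ∀ y ∈ M, P M.toSet x y p1 p2 p3 ↔ y = G x) :
    (∃ b ∈ M, ∀ y, y ∈ b ↔ ∃ x ∈ a, y = G x) ∧ (∃ f ∈ M, IsZFunc a f ∧ ∀ x ∈ a, fapp f x = G x) :=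
  (IsTransModel.replv hM (fun D v => P D (v 0) (v 1) (v 2) (v 3) (v 4)) (cons' p1 (cons' p2 (cons' p3 (fun _ => a)))) (cons'_mem (mem_toSet.2 h1) (cons'_mem (mem_toSet.2 h2) (cons'_mem (mem_toSet.2 h3) (fun _ => ha)))) ha G hG H).imp id
    fun ⟨f, hf, h⟩ => ⟨f, hf, isZFunc_of G h, fun x hx => fapp_eq (isZFunc_of G h) ((h _).2 ⟨x, hx, rfl⟩)⟩

theorem replD4 {M : ZFSet} (hM : IsTransModel M) (P : Set ZFSet → ZFSet → ZFSet → ZFSet → ZFSet → ZFSet → ZFSet → Prop)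
    [UDef (fun D v => P D (v 0) (v 1) (v 2) (v 3) (v 4) (v 5))] {a p1 p2 p3 p4 : ZFSet} (ha : a ∈ M) (h1 : p1 ∈ M) (h2 : p2 ∈ M) (h3 : p3 ∈ M) (h4 : p4 ∈ M) (G : ZFSet → ZFSet)
    (hG : ∀ x ∈ a, G x ∈ M) (H : ∀ x ∈ a, ∀ y ∈ M, P M.toSet x y p1 p2 p3 p4 ↔ y = G x) :
    (∃ b ∈ M, ∀ y, y ∈ b ↔ ∃ x ∈ a, y = G x) ∧ (∃ f ∈ M, IsZFunc a f ∧ ∀ x ∈ a, fapp f x = G x) :=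
  (IsTransModel.replv hM (fun D v => P D (v 0) (v 1) (v 2) (v 3) (v 4) (v 5)) (cons' p1 (cons' p2 (cons' p3 (cons' p4 (fun _ => a))))) (cons'_mem (mem_toSet.2 h1) (cons'_mem (mem_toSet.2 h2) (cons'_mem (mem_toSet.2 h3) (cons'_mem (mem_toSet.2 h4) (fun _ => ha))))) ha G hG H).imp id
    fun ⟨f, hf, h⟩ => ⟨f, hf, isZFunc_of G h, fun x hx => fapp_eq (isZFunc_of G h) ((h _).2 ⟨x, hx, rfl⟩)⟩

theorem replD5 {M : ZFSet} (hM : IsTransModel M) (P : Set ZFSet → ZFSet → ZFSet → ZFSet → ZFSet → ZFSet → ZFSet → ZFSet → Prop)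
    [UDef (fun D v => P D (v 0) (v 1) (v 2) (v 3) (v 4) (v 5) (v 6))] {a p1 p2 p3 p4 p5 : ZFSet} (ha : a ∈ M) (h1 : p1 ∈ M) (h2 : p2 ∈ M) (h3 : p3 ∈ M) (h4 : p4 ∈ M) (h5 : p5 ∈ M) (G : ZFSet → ZFSet)
    (hG : ∀ x ∈ a, G x ∈ M) (H : ∀ x ∈ a, ∀ y ∈ M, P M.toSet x y p1 p2 p3 p4 p5 ↔ y = G x) :
    (∃ b ∈ M, ∀ y, y ∈ b ↔ ∃ x ∈ a, y = G x) ∧ (∃ f ∈ M, IsZFunc a f ∧ ∀ x ∈ a, fapp f x = G x) :=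
  (IsTransModel.replv hM (fun D v => P D (v 0) (v 1) (v 2) (v 3) (v 4) (v 5) (v 6)) (cons' p1 (cons' p2 (cons' p3 (cons' p4 (cons' p5 (fun _ => a)))))) (cons'_mem (mem_toSet.2 h1) (cons'_mem (mem_toSet.2 h2) (cons'_mem (mem_toSet.2 h3) (cons'_mem (mem_toSet.2 h4) (cons'_mem (mem_toSet.2 h5) (fun _ => ha)))))) ha G hG H).imp id
    fun ⟨f, hf, h⟩ => ⟨f, hf, isZFunc_of G h, fun x hx => fapp_eq (isZFunc_of G h) ((h _).2 ⟨x, hx, rfl⟩)⟩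

theorem replD6 {M : ZFSet} (hM : IsTransModel M) (P : Set ZFSet → ZFSet → ZFSet → ZFSet → ZFSet → ZFSet → ZFSet → ZFSet → ZFSet → Prop)
    [UDef (fun D v => P D (v 0) (v 1) (v 2) (v 3) (v 4) (v 5) (v 6) (v 7))] {a p1 p2 p3 p4 p5 p6 : ZFSet} (ha : a ∈ M) (h1 : p1 ∈ M) (h2 : p2 ∈ M) (h3 : p3 ∈ M) (h4 : p4 ∈ M) (h5 : p5 ∈ M) (h6 : p6 ∈ M) (G : ZFSet → ZFSet)
    (hG : ∀ x ∈ a, G x ∈ M) (H : ∀ x ∈ a, ∀ y ∈ M, P M.toSet x y p1 p2 p3 p4 p5 p6 ↔ y = G x) :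
    (∃ b ∈ M, ∀ y, y ∈ b ↔ ∃ x ∈ a, y = G x) ∧ (∃ f ∈ M, IsZFunc a f ∧ ∀ x ∈ a, fapp f x = G x) :=
  (IsTransModel.replv hM (fun D v => P D (v 0) (v 1) (v 2) (v 3) (v 4) (v 5) (v 6) (v 7)) (cons' p1 (cons' p2 (cons' p3 (cons' p4 (cons' p5 (cons' p6 (fun _ => a))))))) (cons'_mem (mem_toSet.2 h1) (cons'_mem (mem_toSet.2 h2) (cons'_mem (mem_toSet.2 h3) (cons'_mem (mem_toSet.2 h4) (cons'_mem (mem_toSet.2 h5) (cons'_mem (mem_toSet.2 h6) (fun _ => ha))))))) ha G hG H).imp id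
    fun ⟨f, hf, h⟩ => ⟨f, hf, isZFunc_of G h, fun x hx => fapp_eq (isZFunc_of G h) ((h _).2 ⟨x, hx, rfl⟩)⟩


namespace UDef

theorem mem_fapp {f a x : ZFSet} : x ∈ fapp f a ↔ ∃ p ∈ f, ∃ z ∈ p, ∃ b ∈ z, pair a b ∈ f ∧ x ∈ b := by
  simp only [fapp, mem_sUnion, mem_sep]
  constructor
  · rintro ⟨b, ⟨⟨z, ⟨p, hp, hz⟩, hb⟩, h⟩, hx⟩; exact ⟨p, hp, z, hz, b, hb, h, hx⟩
  · rintro ⟨p, hp, z, hz, b, hb, h, hx⟩; exact ⟨b, ⟨⟨z, ⟨p, hp, hz⟩, hb⟩, h⟩, hx⟩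

instance memFapp (i j k : ℕ) : UDef (fun _ v => v k ∈ fapp (v i) (v j)) :=
  (inferInstance : UDef (fun _ v => ∃ p ∈ v i, ∃ z ∈ p, ∃ b ∈ z, pair (v j) b ∈ v i ∧ v k ∈ b)).congr
    fun D _ v _ => mem_fapp.symm

instance eqFapp (i j k : ℕ) : UDef (fun _ v => v k = fapp (v i) (v j)) :=
  (inferInstance : UDef (fun _ v => (∀ x ∈ v k, x ∈ fapp (v i) (v j)) ∧
    ∀ p ∈ v i, ∀ z ∈ p, ∀ b ∈ z, pair (v j) b ∈ v i → b ⊆ v k)).congr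
    fun D _ v _ => by
      constructor
      · rintro ⟨h1, h2⟩
        ext x
        refine ⟨h1 x, fun hx => ?_⟩
        obtain ⟨p, hp, z, hz, b, hb, h, hx⟩ := mem_fapp.1 hx
        exact h2 p hp z hz b hb h hx
      · intro h
        refine ⟨fun x hx => h ▸ hx, fun p hp z hz b hb hh x hx => ?_⟩
        rw [h, mem_fapp]
        exact ⟨p, hp, z, hz, b, hb, hh, hx⟩

instance fappMem (i j k : ℕ) : UDef (fun _ v => fapp (v i) (v j) ∈ v k) :=
  (inferInstance : UDef (fun _ v => ∃ y ∈ v k, y = fapp (v i) (v j))).congr fun D _ v _ => by simp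

instance eqUnion (i k : ℕ) : UDef (fun _ v => v k = (⋃₀ (v i) : ZFSet)) :=
  (inferInstance : UDef (fun _ v => (∀ x ∈ v k, ∃ y ∈ v i, x ∈ y) ∧ ∀ y ∈ v i, y ⊆ v k)).congr fun D _ v _ => by
    constructor
    · rintro ⟨h1, h2⟩
      ext x
      rw [mem_sUnion]
      exact ⟨h1 x, fun ⟨y, hy, hx⟩ => h2 y hy hx⟩
    · intro h
      rw [h]
      exact ⟨fun x hx => mem_sUnion.1 hx, fun y hy x hx => mem_sUnion.2 ⟨y, hy, hx⟩⟩

instance eqSucc (i k : ℕ) : UDef (fun _ v => v k = insert (v i) (v i)) :=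
  (inferInstance : UDef (fun _ v => v i ∈ v k ∧ v i ⊆ v k ∧ ∀ x ∈ v k, x = v i ∨ x ∈ v i)).congr fun D _ v _ => by
    constructor
    · rintro ⟨h1, h2, h3⟩
      ext x
      rw [mem_insert_iff]
      exact ⟨h3 x, fun h => h.elim (fun h => h ▸ h1) (fun h => h2 h)⟩
    · intro h
      rw [h]
      exact ⟨by simp, fun x hx => by simp [hx], fun x hx => by simpa using hx⟩
end UDef

namespace IsTransModel

theorem prod_mem {M : ZFSet} (hM : IsTransModel M) {a b : ZFSet} (ha : a ∈ M) (hb : b ∈ M) : ZFSet.prod a b ∈ M := by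
  have h1 : ∀ x ∈ a, ∃ c ∈ M, ∀ p, p ∈ c ↔ ∃ y ∈ b, p = pair x y := fun x hx =>
    (replD1 hM (fun _ y p x => p = pair x y) hb (hM.trans ha hx) (fun y => pair x y)
      (fun y hy => hM.pair_mem (hM.trans ha hx) (hM.trans hb hy)) (fun _ _ _ _ => Iff.rfl)).1
  obtain ⟨c, hc, h2⟩ := collD1 hM (fun _ x c b => (∀ p ∈ c, ∃ y ∈ b, p = pair x y) ∧ ∀ y ∈ b, pair x y ∈ c) ha hb
    (fun x hx => by
      obtain ⟨c, hc, h⟩ := h1 x hx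
      exact ⟨c, hc, fun p hp => (h p).1 hp, fun y hy => (h _).2 ⟨y, hy, rfl⟩⟩)
  have := sep2 hM (P := fun p a b => ∃ x ∈ a, ∃ y ∈ b, p = pair x y) (hM.sUnion_mem hc) ha hb
  convert this using 1
  ext p
  simp only [mem_prod, mem_sep, mem_sUnion]
  constructor
  · rintro ⟨x, hx, y, hy, rfl⟩
    obtain ⟨c', hc', h⟩ := h2 x hx
    exact ⟨⟨c', hc', h.2 y hy⟩, x, hx, y, hy, rfl⟩
  · rintro ⟨_, h⟩; exact h

end IsTransModel

/-- domain of a relation -/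
def dom (f : ZFSet) : ZFSet := ZFSet.sep (fun a => ∃ b, pair a b ∈ f) (⋃₀ (⋃₀ f))
/-- range of a relation -/
def ran (f : ZFSet) : ZFSet := ZFSet.sep (fun b => ∃ a, pair a b ∈ f) (⋃₀ (⋃₀ f))

theorem mem_dom {f a : ZFSet} : a ∈ dom f ↔ ∃ b, pair a b ∈ f := by
  simp only [dom, mem_sep, mem_sUnion]
  refine ⟨fun h => h.2, fun ⟨b, h⟩ => ⟨⟨{a}, ⟨_, h, by simp [ZFSet.pair]⟩, by simp⟩, b, h⟩⟩
theorem mem_ran {f b : ZFSet} : b ∈ ran f ↔ ∃ a, pair a b ∈ f := by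
  simp only [ran, mem_sep, mem_sUnion]
  refine ⟨fun h => h.2, fun ⟨a, h⟩ => ⟨⟨{a,b}, ⟨_, h, by simp [ZFSet.pair]⟩, by simp⟩, a, h⟩⟩

theorem mem_ran' {d f b : ZFSet} (hf : IsZFunc d f) : b ∈ ran f ↔ ∃ a ∈ d, fapp f a = b := by
  rw [mem_ran]
  exact ⟨fun ⟨a, h⟩ => ⟨a, dom_of hf h, fapp_eq hf h⟩, fun ⟨a, ha, h⟩ => ⟨a, h ▸ fapp_mem hf ha⟩⟩

theorem dom_eq {d f : ZFSet} (hf : IsZFunc d f) : dom f = d := by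
  ext a; rw [mem_dom]
  exact ⟨fun ⟨b, h⟩ => dom_of hf h, fun ha => ⟨_, fapp_mem hf ha⟩⟩

namespace UDef
instance eqRan (i k : ℕ) : UDef (fun _ v => v k = ran (v i)) :=
  (inferInstance : UDef (fun _ v => (∀ b ∈ v k, ∃ p ∈ v i, ∃ z ∈ p, ∃ a ∈ z, p = pair a b) ∧
    ∀ p ∈ v i, ∀ z ∈ p, ∀ a ∈ z, ∀ z' ∈ p, ∀ b ∈ z', p = pair a b → b ∈ v k)).congr fun D _ v _ => by
    have e1 : ∀ b, b ∈ ran (v i) ↔ ∃ p ∈ v i, ∃ z ∈ p, ∃ a ∈ z, p = pair a b := fun b => by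
      rw [mem_ran]
      constructor
      · rintro ⟨a, h⟩
        obtain ⟨z, hz, ha⟩ := mem_of_pair_left (a := a) (b := b)
        exact ⟨_, h, z, hz, a, ha, rfl⟩
      · rintro ⟨p, hp, z, hz, a, ha, rfl⟩; exact ⟨a, hp⟩
    constructor
    · rintro ⟨h1, h2⟩
      ext b
      refine ⟨fun h => (e1 b).2 (h1 b h), fun h => ?_⟩
      obtain ⟨p, hp, z, hz, a, ha, rfl⟩ := (e1 b).1 h
      obtain ⟨z', hz', hb⟩ := mem_of_pair_right (a := a) (b := b)
      exact h2 _ hp z hz a ha z' hz' b hb rfl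
    · intro h
      rw [h]
      refine ⟨fun b hb => (e1 b).1 hb, ?_⟩
      rintro p hp z hz a ha z' hz' b hb rfl
      exact mem_ran.2 ⟨a, hp⟩

instance eqDom (i k : ℕ) : UDef (fun _ v => v k = dom (v i)) :=
  (inferInstance : UDef (fun _ v => (∀ b ∈ v k, ∃ p ∈ v i, ∃ z ∈ p, ∃ a ∈ z, p = pair b a) ∧
    ∀ p ∈ v i, ∀ z ∈ p, ∀ a ∈ z, ∀ z' ∈ p, ∀ b ∈ z', p = pair b a → b ∈ v k)).congr fun D _ v _ => by
    have e1 : ∀ b, b ∈ dom (v i) ↔ ∃ p ∈ v i, ∃ z ∈ p, ∃ a ∈ z, p = pair b a := fun b => by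
      rw [mem_dom]
      constructor
      · rintro ⟨a, h⟩
        obtain ⟨z, hz, ha⟩ := mem_of_pair_right (a := b) (b := a)
        exact ⟨_, h, z, hz, a, ha, rfl⟩
      · rintro ⟨p, hp, z, hz, a, ha, rfl⟩; exact ⟨a, hp⟩
    constructor
    · rintro ⟨h1, h2⟩
      ext b
      refine ⟨fun h => (e1 b).2 (h1 b h), fun h => ?_⟩
      obtain ⟨p, hp, z, hz, a, ha, rfl⟩ := (e1 b).1 h
      obtain ⟨z', hz', hb⟩ := mem_of_pair_left (a := b) (b := a)
      exact h2 _ hp z hz a ha z' hz' b hb rfl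
    · intro h
      rw [h]
      refine ⟨fun b hb => (e1 b).1 hb, ?_⟩
      rintro p hp z hz a ha z' hz' b hb rfl
      exact mem_dom.2 ⟨a, hp⟩

end UDef

namespace IsTransModel
theorem ran_mem {M : ZFSet} (hM : IsTransModel M) {f : ZFSet} (hf : f ∈ M) : ran f ∈ M := by
  have := sepD1 hM (fun D b f => ∃ a ∈ D, pair a b ∈ f) (hM.sUnion_mem (hM.sUnion_mem hf)) hf
  convert this using 1
  ext b
  simp only [ran, mem_sep]
  exact and_congr_right fun _ => ⟨fun ⟨a, h⟩ => ⟨a, hM.of_pair_left (hM.trans hf h), h⟩, fun ⟨a, _, h⟩ => ⟨a, h⟩⟩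
theorem dom_mem {M : ZFSet} (hM : IsTransModel M) {f : ZFSet} (hf : f ∈ M) : dom f ∈ M := by
  have := sepD1 hM (fun D b f => ∃ a ∈ D, pair b a ∈ f) (hM.sUnion_mem (hM.sUnion_mem hf)) hf
  convert this using 1
  ext b
  simp only [dom, mem_sep]
  exact and_congr_right fun _ => ⟨fun ⟨a, h⟩ => ⟨a, hM.of_pair_right (hM.trans hf h), h⟩, fun ⟨a, _, h⟩ => ⟨a, h⟩⟩
theorem dom_mem' {M : ZFSet} (hM : IsTransModel M) {d f : ZFSet} (hf : f ∈ M) (h : IsZFunc d f) : d ∈ M :=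
  dom_eq h ▸ dom_mem hM hf
end IsTransModel

/-! ## Well-founded recursion inside a model -/

/-- restriction of `h` to the `E`-predecessors of `η` -/
def prestr (E h η : ZFSet) : ZFSet := ZFSet.sep (fun p => ∃ ζ b, pair ζ η ∈ E ∧ p = pair ζ b) h

theorem mem_prestr {E h η ζ b : ZFSet} : pair ζ b ∈ prestr E h η ↔ pair ζ b ∈ h ∧ pair ζ η ∈ E := by
  simp only [prestr, mem_sep, and_congr_right_iff]
  intro _
  constructor
  · rintro ⟨ζ', b', h1, h2⟩
    rw [pair_inj] at h2; rw [h2.1]; exact h1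
  · intro h; exact ⟨ζ, b, h, rfl⟩

theorem prestr_isF {E h η e : ZFSet} (hh : IsZFunc e h) : IsZFunc (dom (prestr E h η)) (prestr E h η) := by
  refine ⟨fun p hp => ?_, fun a ha => ?_⟩
  · have hp' := hp
    simp only [prestr, mem_sep] at hp'
    obtain ⟨h1, ζ, b, h2, rfl⟩ := hp'
    exact ⟨ζ, mem_dom.2 ⟨b, hp⟩, b, rfl⟩
  · obtain ⟨b, hb⟩ := mem_dom.1 ha
    refine ⟨b, hb, fun y hy => ?_⟩
    have h1 := (mem_prestr.1 hb).1
    have h2 := (mem_prestr.1 hy).1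
    rw [← fapp_eq hh h1, ← fapp_eq hh h2]

theorem prestr_congr {E h h' η : ZFSet} (H : ∀ ζ, pair ζ η ∈ E → ∀ b, pair ζ b ∈ h ↔ pair ζ b ∈ h') :
    prestr E h η = prestr E h' η := by
  ext p
  constructor
  · intro hp
    have hp' := hp
    simp only [prestr, mem_sep] at hp'
    obtain ⟨h1, ζ, b, h2, rfl⟩ := hp'
    exact mem_prestr.2 ⟨(H ζ h2 b).1 h1, h2⟩
  · intro hp
    have hp' := hp
    simp only [prestr, mem_sep] at hp'
    obtain ⟨h1, ζ, b, h2, rfl⟩ := hp'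
    exact mem_prestr.2 ⟨(H ζ h2 b).2 h1, h2⟩

theorem prestr_mem {D E h η : ZFSet} (hD : IsTransModel D) (hE : E ∈ D) (hh : h ∈ D) (hη : η ∈ D) :
    prestr E h η ∈ D := by
  have := sepD2 hD (fun D p E η => ∃ ζ ∈ D, ∃ b ∈ D, pair ζ η ∈ E ∧ p = pair ζ b) hh hE hη
  convert this using 1
  ext p
  simp only [prestr, mem_sep]
  refine and_congr_right fun hp => ⟨?_, ?_⟩
  · rintro ⟨ζ, b, h1, rfl⟩
    have := hD.trans hh hp
    exact ⟨ζ, hD.of_pair_left this, b, hD.of_pair_right this, h1, rfl⟩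
  · rintro ⟨ζ, _, b, _, h1, h2⟩; exact ⟨ζ, b, h1, h2⟩

/-- well-foundedness of the relation coded by `E` on `d` -/
def WFOn (d E : ZFSet) : Prop := WellFounded (fun a b => a ∈ d ∧ pair a b ∈ E)

/-- `h` is an attempt with domain `e`. -/
def Attempt (d E : ZFSet) (G : ZFSet → ZFSet → ZFSet) (e h : ZFSet) : Prop :=
  e ⊆ d ∧ IsZFunc e h ∧ (∀ η ∈ e, ∀ ζ ∈ d, pair ζ η ∈ E → ζ ∈ e) ∧
    ∀ η ∈ e, fapp h η = G η (prestr E h η)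

theorem Attempt.agree {d E : ZFSet} {G : ZFSet → ZFSet → ZFSet} (hwf : WFOn d E) {e h e' h' : ZFSet}
    (H : Attempt d E G e h) (H' : Attempt d E G e' h') : ∀ η, η ∈ e → η ∈ e' → fapp h η = fapp h' η := by
  intro η
  induction η using hwf.induction with
  | _ η ih =>
    intro h1 h2
    rw [H.2.2.2 η h1, H'.2.2.2 η h2]
    congr 1
    apply prestr_congr
    intro ζ hζ b
    constructor
    · intro hb
      have hζe := dom_of H.2.1 hb
      have hζe' := H'.2.2.1 η h2 ζ (H.1 hζe) hζ
      rw [fapp_iff H'.2.1 hζe', ← ih ζ ⟨H.1 hζe, hζ⟩ hζe hζe', fapp_eq H.2.1 hb]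
    · intro hb
      have hζe' := dom_of H'.2.1 hb
      have hζe := H.2.2.1 η h1 ζ (H'.1 hζe') hζ
      rw [fapp_iff H.2.1 hζe, ih ζ ⟨H.1 hζe, hζ⟩ hζe hζe', fapp_eq H'.2.1 hb]

theorem Attempt.union {d E : ZFSet} {G : ZFSet → ZFSet → ZFSet} (hwf : WFOn d E) (C : ZFSet)
    (H : ∀ h ∈ C, ∃ e, Attempt d E G e h) :
    ∃ e, Attempt d E G e (⋃₀ C : ZFSet) ∧ ∀ x, x ∈ e ↔ ∃ h ∈ C, ∃ b, pair x b ∈ h := by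
  have e1 : ∀ x, x ∈ dom (⋃₀ C : ZFSet) ↔ ∃ h ∈ C, ∃ b, pair x b ∈ h := by
    intro x
    rw [mem_dom]
    simp only [mem_sUnion]
    exact ⟨fun ⟨b, h, hh, hb⟩ => ⟨h, hh, b, hb⟩, fun ⟨h, hh, b, hb⟩ => ⟨b, h, hh, hb⟩⟩
  have key : ∀ h ∈ C, ∀ x b b', pair x b ∈ h → pair x b' ∈ (⋃₀ C : ZFSet) → b' = b := by
    intro h hh x b b' hb hb'
    obtain ⟨h', hh', hb'⟩ := mem_sUnion.1 hb'
    obtain ⟨e, He⟩ := H h hh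
    obtain ⟨e', He'⟩ := H h' hh'
    rw [← fapp_eq He.2.1 hb, ← fapp_eq He'.2.1 hb']
    exact He'.agree hwf He x (dom_of He'.2.1 hb') (dom_of He.2.1 hb)
  have hF : IsZFunc (dom (⋃₀ C : ZFSet)) (⋃₀ C : ZFSet) := by
    refine ⟨fun p hp => ?_, fun a ha => ?_⟩
    · obtain ⟨h, hh, hp'⟩ := mem_sUnion.1 hp
      obtain ⟨e, He⟩ := H h hh
      obtain ⟨a, ha, b, rfl⟩ := He.2.1.1 p hp'
      exact ⟨a, mem_dom.2 ⟨b, hp⟩, b, rfl⟩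
    · obtain ⟨h, hh, b, hb⟩ := (e1 a).1 ha
      exact ⟨b, mem_sUnion.2 ⟨h, hh, hb⟩, fun b' hb' => key h hh a b b' hb hb'⟩
  refine ⟨dom (⋃₀ C : ZFSet), ⟨?_, hF, ?_, ?_⟩, e1⟩
  · intro x hx
    obtain ⟨h, hh, b, hb⟩ := (e1 x).1 hx
    obtain ⟨e, He⟩ := H h hh
    exact He.1 (dom_of He.2.1 hb)
  · intro η hη ζ hζ hE
    obtain ⟨h, hh, b, hb⟩ := (e1 η).1 hη
    obtain ⟨e, He⟩ := H h hh
    exact (e1 ζ).2 ⟨h, hh, _, fapp_mem He.2.1 (He.2.2.1 η (dom_of He.2.1 hb) ζ hζ hE)⟩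
  · intro η hη
    obtain ⟨h, hh, b, hb⟩ := (e1 η).1 hη
    obtain ⟨e, He⟩ := H h hh
    have : fapp (⋃₀ C : ZFSet) η = fapp h η := by
      rw [fapp_eq hF (mem_sUnion.2 ⟨h, hh, hb⟩), fapp_eq He.2.1 hb]
    rw [this, He.2.2.2 η (dom_of He.2.1 hb)]
    congr 1
    apply prestr_congr
    intro ζ hζ b'
    refine ⟨fun hb' => mem_sUnion.2 ⟨h, hh, hb'⟩, fun hb' => ?_⟩
    obtain ⟨h', hh', hb''⟩ := mem_sUnion.1 hb'
    obtain ⟨e', He'⟩ := H h' hh'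
    have hζd := He'.1 (dom_of He'.2.1 hb'')
    have := fapp_mem He.2.1 (He.2.2.1 η (dom_of He.2.1 hb) ζ hζd hζ)
    rw [key h hh ζ _ b' this hb']; exact this

theorem wfrec {D d E p1 p2 : ZFSet} (hD : IsTransModel D) (Φ : Set ZFSet → ZFSet → ZFSet → ZFSet → ZFSet → ZFSet → Prop)
    [hU : UDef (fun D v => Φ D (v 0) (v 1) (v 2) (v 3) (v 4))] (hd : d ∈ D) (hE : E ∈ D) (h1 : p1 ∈ D) (h2 : p2 ∈ D)
    (hwf : WFOn d E) (G : ZFSet → ZFSet → ZFSet)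
    (hG : ∀ ξ ∈ d, ∀ g ∈ D, IsZFunc (dom g) g → G ξ g ∈ D ∧ ∀ y ∈ D, Φ D.toSet ξ g y p1 p2 ↔ y = G ξ g) :
    ∃ f ∈ D, IsZFunc d f ∧ ∀ ξ ∈ d, fapp f ξ = G ξ (prestr E f ξ) := by
  have inst : ∀ i j k l m, UDef (fun D v => Φ D (v i) (v j) (v k) (v l) (v m)) := fun i j k l m =>
    hU.comp (fun n => match n with | 0 => i | 1 => j | 2 => k | 3 => l | _ => m)
  -- definable version of attempts
  let AttD : Set ZFSet → ZFSet → ZFSet → ZFSet → ZFSet → ZFSet → Prop := fun D h d E p1 p2 =>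
    ∃ e ∈ D, e ⊆ d ∧ IsZFunc e h ∧ (∀ η ∈ e, ∀ ζ ∈ d, pair ζ η ∈ E → ζ ∈ e) ∧
      ∀ η ∈ e, ∃ g ∈ D, (∀ p ∈ g, p ∈ h ∧ ∃ ζ ∈ D, ∃ b ∈ D, pair ζ η ∈ E ∧ p = pair ζ b) ∧
        (∀ p ∈ h, (∃ ζ ∈ D, ∃ b ∈ D, pair ζ η ∈ E ∧ p = pair ζ b) → p ∈ g) ∧
        ∃ y ∈ D, y = fapp h η ∧ Φ D η g y p1 p2
  have instA : ∀ i j k l m, UDef (fun D v => AttD D (v i) (v j) (v k) (v l) (v m)) := by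
    intro i j k l m
    simp only [AttD]
    infer_instance
  have hA : ∀ h ∈ D, AttD D.toSet h d E p1 p2 ↔ ∃ e, Attempt d E G e h := by
    intro h hh
    have hg : ∀ η ∈ D, ∀ g, ((∀ p ∈ g, p ∈ h ∧ ∃ ζ ∈ D.toSet, ∃ b ∈ D.toSet, pair ζ η ∈ E ∧ p = pair ζ b) ∧
        (∀ p ∈ h, (∃ ζ ∈ D.toSet, ∃ b ∈ D.toSet, pair ζ η ∈ E ∧ p = pair ζ b) → p ∈ g)) ↔ g = prestr E h η := by
      intro η hη g
      constructor
      · rintro ⟨a1, a2⟩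
        ext p
        simp only [prestr, mem_sep]
        constructor
        · intro hp
          obtain ⟨b1, ζ, _, b, _, b2, b3⟩ := a1 p hp
          exact ⟨b1, ζ, b, b2, b3⟩
        · rintro ⟨b1, ζ, b, b2, rfl⟩
          have := hD.trans hh b1
          exact a2 _ b1 ⟨ζ, hD.of_pair_left this, b, hD.of_pair_right this, b2, rfl⟩
      · rintro rfl
        refine ⟨fun p hp => ?_, ?_⟩
        · simp only [prestr, mem_sep] at hp
          obtain ⟨b1, ζ, b, b2, rfl⟩ := hp
          have := hD.trans hh b1
          exact ⟨b1, ζ, hD.of_pair_left this, b, hD.of_pair_right this, b2, rfl⟩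
        · rintro p hp ⟨ζ, _, b, _, b2, rfl⟩
          exact mem_prestr.2 ⟨hp, b2⟩
    constructor
    · rintro ⟨e, he, hed, hf, hcl, hrec⟩
      refine ⟨e, hed, hf, hcl, fun η hη => ?_⟩
      obtain ⟨g, hgD, g1, g2, y, hy, hyh, hΦ⟩ := hrec η hη
      have hηD := hD.trans hd (hed hη)
      have hgg := (hg η hηD g).1 ⟨g1, g2⟩
      have := ((hG η (hed hη) g hgD (by rw [hgg]; exact prestr_isF hf)).2 y hy).1 hΦ
      rw [← hyh, this, hgg]
    · rintro ⟨e, hed, hf, hcl, hrec⟩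
      refine ⟨e, hD.dom_mem' hh hf, hed, hf, hcl, fun η hη => ?_⟩
      have hηD := hD.trans hd (hed hη)
      have := (hg η hηD _).2 rfl
      refine ⟨_, prestr_mem hD hE hh hηD, this.1, this.2, fapp h η, hD.fapp_memM hh hf hη, rfl, ?_⟩
      rw [(hG η (hed hη) _ (prestr_mem hD hE hh hηD) (prestr_isF hf)).2 _ (hD.fapp_memM hh hf hη)]
      exact hrec η hη
  -- collecting attempts
  have coll : ∀ s ∈ D, s ⊆ d → (∀ x ∈ s, ∃ h ∈ D, ∃ e, Attempt d E G e h ∧ x ∈ e) →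
      ∃ h ∈ D, ∃ e, Attempt d E G e h ∧ s ⊆ e := by
    intro s hs hsd H
    obtain ⟨b, hb, hb'⟩ := collD4 hD (fun D x h d E p1 p2 => AttD D h d E p1 p2 ∧ ∃ y ∈ D, pair x y ∈ h) hs hd hE h1 h2
      (fun x hx => by
        obtain ⟨h, hh, e, He, hxe⟩ := H x hx
        exact ⟨h, hh, (hA h hh).2 ⟨e, He⟩, fapp h x, hD.fapp_memM hh He.2.1 hxe, fapp_mem He.2.1 hxe⟩)
    have hC := sepD4 hD (fun D h d E p1 p2 => AttD D h d E p1 p2) hb hd hE h1 h2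
    set C := ZFSet.sep (fun h => AttD D.toSet h d E p1 p2) b with hCdef
    obtain ⟨e, He, hx⟩ := Attempt.union (G := G) hwf C (fun h hh => by
      rw [hCdef, mem_sep] at hh
      exact (hA h (hD.trans hb hh.1)).1 hh.2)
    refine ⟨_, hD.sUnion_mem hC, e, He, fun x hxs => ?_⟩
    obtain ⟨h, hh, a1, y, _, a2⟩ := hb' x hxs
    rw [hx]
    exact ⟨h, by rw [hCdef, mem_sep]; exact ⟨hh, a1⟩, y, a2⟩
  -- all points are covered
  have all : ∀ ξ, ξ ∈ d → ∃ h ∈ D, ∃ e, Attempt d E G e h ∧ ξ ∈ e := by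
    intro ξ
    induction ξ using hwf.induction with
    | _ ξ ih =>
      intro hξ
      have hξD := hD.trans hd hξ
      obtain ⟨h, hh, e, He, hs⟩ := coll (ZFSet.sep (fun ζ => pair ζ ξ ∈ E) d)
        (sep2 hD (P := fun ζ ξ E => pair ζ ξ ∈ E) hd hξD hE) (fun x hx => (mem_sep.1 hx).1)
        (fun x hx => ih x (mem_sep.1 hx) (mem_sep.1 hx).1)
      by_cases hξe : ξ ∈ e
      · exact ⟨h, hh, e, He, hξe⟩
      have hgD := prestr_mem hD hE hh hξD
      have hGD := (hG ξ hξ _ hgD (prestr_isF He.2.1)).1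
      set y := G ξ (prestr E h ξ) with hy
      have hF : IsZFunc (insert ξ e) (insert (pair ξ y) h) := by
        refine ⟨fun p hp => ?_, fun a ha => ?_⟩
        · rcases mem_insert_iff.1 hp with rfl | hp
          · exact ⟨ξ, by simp, y, rfl⟩
          · obtain ⟨a, ha, b, rfl⟩ := He.2.1.1 p hp
            exact ⟨a, by simp [ha], b, rfl⟩
        · rcases mem_insert_iff.1 ha with rfl | ha
          · refine ⟨y, by simp, fun b hb => ?_⟩
            rcases mem_insert_iff.1 hb with hb | hb
            · exact (pair_inj.1 hb).2
            · exact absurd (dom_of He.2.1 hb) hξe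
          · refine ⟨fapp h a, by simp [fapp_mem He.2.1 ha], fun b hb => ?_⟩
            rcases mem_insert_iff.1 hb with hb | hb
            · rw [(pair_inj.1 hb).1] at ha; exact absurd ha hξe
            · exact (fapp_eq He.2.1 hb).symm
      have hself : pair ξ ξ ∉ E := fun hh => hwf.asymmetric ξ ξ ⟨hξ, hh⟩ ⟨hξ, hh⟩
      have hcong : ∀ η, pair ξ η ∉ E → prestr E (insert (pair ξ y) h) η = prestr E h η := by
        intro η hη
        apply prestr_congr
        intro ζ hζ b
        rw [mem_insert_iff]
        refine ⟨fun hh => hh.elim (fun hh => ?_) id, Or.inr⟩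
        rw [(pair_inj.1 hh).1] at hζ
        exact absurd hζ hη
      refine ⟨_, hD.insert_mem (hD.pair_mem hξD hGD) hh, insert ξ e, ⟨?_, hF, ?_, ?_⟩, by simp⟩
      · intro x hx
        rcases mem_insert_iff.1 hx with rfl | hx
        · exact hξ
        · exact He.1 hx
      · intro η hη ζ hζ hE'
        rcases mem_insert_iff.1 hη with rfl | hη
        · exact mem_insert_iff.2 (Or.inr (hs (mem_sep.2 ⟨hζ, hE'⟩)))
        · exact mem_insert_iff.2 (Or.inr (He.2.2.1 η hη ζ hζ hE'))
      · intro η hη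
        rcases mem_insert_iff.1 hη with rfl | hη
        · rw [hcong _ hself, fapp_eq hF (by simp : pair η y ∈ _)]
        · rw [hcong _ (fun hh => hξe (He.2.2.1 η hη ξ hξ hh)),
            fapp_eq hF (show pair η (fapp h η) ∈ _ by simp [fapp_mem He.2.1 hη]), He.2.2.2 η hη]
  obtain ⟨h, hh, e, He, hde⟩ := coll d hd (fun x hx => hx) all
  have : e = d := by
    ext x; exact ⟨fun hx => He.1 hx, fun hx => hde hx⟩
  subst this
  exact ⟨h, hh, He.2.1, He.2.2.2⟩

/-! ## Mostowski collapse, choice, recursion on `ω` -/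

/-- `f` is the Mostowski collapse of `E` on `d` -/
def IsColl (d E : ZFSet) (ρ : ZFSet → ZFSet) : Prop :=
  ∀ ξ ∈ d, ∀ z, z ∈ ρ ξ ↔ ∃ ζ ∈ d, pair ζ ξ ∈ E ∧ z = ρ ζ

theorem IsColl.unique {d E : ZFSet} {ρ ρ' : ZFSet → ZFSet} (hwf : WFOn d E) (h : IsColl d E ρ) (h' : IsColl d E ρ') :
    ∀ ξ ∈ d, ρ ξ = ρ' ξ := by
  intro ξ
  induction ξ using hwf.induction with
  | _ ξ ih =>
    intro hξ
    ext z
    rw [h ξ hξ, h' ξ hξ]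
    refine exists_congr fun ζ => and_congr_right fun hζ => and_congr_right fun hE => ?_
    rw [ih ζ ⟨hζ, hE⟩ hζ]

theorem most {D d E : ZFSet} (hD : IsTransModel D) (hd : d ∈ D) (hE : E ∈ D) (hwf : WFOn d E) :
    ∃ f ∈ D, IsZFunc d f ∧ IsColl d E (fapp f) := by
  obtain ⟨f, hf, h1, h2⟩ := wfrec hD (fun _ ξ g y _ _ => y = ran g) hd hE hd hd hwf (fun _ g => ran g)
    (fun ξ hξ g hg _ => ⟨hD.ran_mem hg, fun _ _ => Iff.rfl⟩)
  refine ⟨f, hf, h1, fun ξ hξ z => ?_⟩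
  rw [h2 ξ hξ, mem_ran]
  constructor
  · rintro ⟨ζ, h⟩
    have := mem_prestr.1 h
    exact ⟨ζ, dom_of h1 this.1, this.2, (fapp_eq h1 this.1).symm⟩
  · rintro ⟨ζ, hζ, hE', rfl⟩
    exact ⟨ζ, mem_prestr.2 ⟨fapp_mem h1 hζ, hE'⟩⟩

theorem choicev {M : ZFSet} (hM : IsTransModel M) (P : Set ZFSet → (ℕ → ZFSet) → Prop) [h : UDef P]
    (v : ℕ → ZFSet) (hv : ∀ n, v n ∈ M) {a : ZFSet} (ha : a ∈ M)
    (H : ∀ x ∈ a, ∃ y ∈ M, P M.toSet (cons' x (cons' y v))) :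
    ∃ f ∈ M, IsZFunc a f ∧ ∀ x ∈ a, fapp f x ∈ M ∧ P M.toSet (cons' x (cons' (fapp f x) v)) := by
  obtain ⟨b, hb, hb'⟩ := collv hM P v hv ha H
  obtain ⟨r, hr, hwo⟩ := hM.2.2.2.2.2.2 b hb
  have hmin : ∀ x ∈ a, ∃ y, y ∈ b ∧ P M.toSet (cons' x (cons' y v)) ∧
      ∀ y' ∈ b, P M.toSet (cons' x (cons' y' v)) → pair y' y ∉ r := by
    intro x hx
    obtain ⟨y, hy, h'⟩ := hwo.2.2.2.2 {y | y ∈ b ∧ P M.toSet (cons' x (cons' y v))} (fun y hy => hy.1)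
      (by obtain ⟨y, hy⟩ := hb' x hx; exact ⟨y, hy⟩)
    exact ⟨y, hy.1, hy.2, fun y' h1 h2 => h' y' ⟨h1, h2⟩⟩
  choose! G hG1 hG2 hG3 using hmin
  have hq : UDef (fun D w => w 1 ∈ w 2 ∧ P D (cons' (w 0) (cons' (w 1) (fun n => w (n+4)))) ∧
      ∀ y' ∈ w 2, P D (cons' (w 0) (cons' y' (fun n => w (n+4)))) → pair y' (w 1) ∉ w 3) := by
    refine UDef.and (h := inferInstance) (h' := UDef.and (h := ?_) (h' := ?_))
    · refine (h.comp (fun n => if n = 0 then 0 else if n = 1 then 1 else n + 2)).congr fun D _ w _ => ?_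
      have : (fun n => w (if n = 0 then 0 else if n = 1 then 1 else n + 2)) =
        cons' (w 0) (cons' (w 1) fun n => w (n + 4)) := by
        funext n; rcases n with _ | _ | n <;> simp
      rw [this]
    · refine UDef.ball 2 (fun D y' w => P D (cons' (w 0) (cons' y' (fun n => w (n+4)))) → pair y' (w 1) ∉ w 3) (h := ?_)
      refine UDef.imp (h := ?_) (h' := inferInstance)
      refine (h.comp (fun n => if n = 0 then 1 else if n = 1 then 0 else n + 3)).congr fun D _ w _ => ?_
      have : (fun n => w (if n = 0 then 1 else if n = 1 then 0 else n + 3)) =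
        cons' (w 1) (cons' (w 0) fun n => w (n + 4 + 1)) := by
        funext n; rcases n with _ | _ | n <;> simp
      rw [this]
  obtain ⟨f, hf, h'⟩ := (hM.replv _ (h := hq) (cons' b (cons' r v))
    (cons'_mem (D := M.toSet) hb (cons'_mem hr hv)) ha G (fun x hx => hM.trans hb (hG1 x hx))
    (fun x hx y hy => by
      show (y ∈ b ∧ P M.toSet (cons' x (cons' y v)) ∧
        ∀ y' ∈ b, P M.toSet (cons' x (cons' y' v)) → pair y' y ∉ r) ↔ _
      constructor
      · rintro ⟨a1, a2, a3⟩
        rcases hwo.2.1 y a1 (G x) (hG1 x hx) with h | h | h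
        · exact h
        · exact absurd h (hG3 x hx y a1 a2)
        · exact absurd h (a3 _ (hG1 x hx) (hG2 x hx))
      · rintro rfl; exact ⟨hG1 x hx, hG2 x hx, hG3 x hx⟩)).2
  have hF := isZFunc_of G h'
  have e : ∀ x ∈ a, fapp f x = G x := fun x hx => fapp_eq hF ((h' _).2 ⟨x, hx, rfl⟩)
  exact ⟨f, hf, hF, fun x hx => by rw [e x hx]; exact ⟨hM.trans hb (hG1 x hx), hG2 x hx⟩⟩

theorem choiceD0 {M : ZFSet} (hM : IsTransModel M) (P : Set ZFSet → ZFSet → ZFSet → Prop)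
    [UDef (fun D v => P D (v 0) (v 1))] {a : ZFSet} (ha : a ∈ M) 
    (H : ∀ x ∈ a, ∃ y ∈ M, P M.toSet x y ) :
    ∃ f ∈ M, IsZFunc a f ∧ ∀ x ∈ a, fapp f x ∈ M ∧ P M.toSet x (fapp f x)  :=
  choicev hM (fun D v => P D (v 0) (v 1)) (fun _ => a) (fun _ => ha) ha H

theorem choiceD1 {M : ZFSet} (hM : IsTransModel M) (P : Set ZFSet → ZFSet → ZFSet → ZFSet → Prop)
    [UDef (fun D v => P D (v 0) (v 1) (v 2))] {a p1 : ZFSet} (ha : a ∈ M) (h1 : p1 ∈ M)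
    (H : ∀ x ∈ a, ∃ y ∈ M, P M.toSet x y p1) :
    ∃ f ∈ M, IsZFunc a f ∧ ∀ x ∈ a, fapp f x ∈ M ∧ P M.toSet x (fapp f x) p1 :=
  choicev hM (fun D v => P D (v 0) (v 1) (v 2)) (cons' p1 (fun _ => a)) (cons'_mem (mem_toSet.2 h1) (fun _ => ha)) ha H

theorem choiceD2 {M : ZFSet} (hM : IsTransModel M) (P : Set ZFSet → ZFSet → ZFSet → ZFSet → ZFSet → Prop)
    [UDef (fun D v => P D (v 0) (v 1) (v 2) (v 3))] {a p1 p2 : ZFSet} (ha : a ∈ M) (h1 : p1 ∈ M) (h2 : p2 ∈ M)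
    (H : ∀ x ∈ a, ∃ y ∈ M, P M.toSet x y p1 p2) :
    ∃ f ∈ M, IsZFunc a f ∧ ∀ x ∈ a, fapp f x ∈ M ∧ P M.toSet x (fapp f x) p1 p2 :=
  choicev hM (fun D v => P D (v 0) (v 1) (v 2) (v 3)) (cons' p1 (cons' p2 (fun _ => a))) (cons'_mem (mem_toSet.2 h1) (cons'_mem (mem_toSet.2 h2) (fun _ => ha))) ha H

theorem choiceD3 {M : ZFSet} (hM : IsTransModel M) (P : Set ZFSet → ZFSet → ZFSet → ZFSet → ZFSet → ZFSet → Prop)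
    [UDef (fun D v => P D (v 0) (v 1) (v 2) (v 3) (v 4))] {a p1 p2 p3 : ZFSet} (ha : a ∈ M) (h1 : p1 ∈ M) (h2 : p2 ∈ M) (h3 : p3 ∈ M)
    (H : ∀ x ∈ a, ∃ y ∈ M, P M.toSet x y p1 p2 p3) :
    ∃ f ∈ M, IsZFunc a f ∧ ∀ x ∈ a, fapp f x ∈ M ∧ P M.toSet x (fapp f x) p1 p2 p3 :=
  choicev hM (fun D v => P D (v 0) (v 1) (v 2) (v 3) (v 4)) (cons' p1 (cons' p2 (cons' p3 (fun _ => a)))) (cons'_mem (mem_toSet.2 h1) (cons'_mem (mem_toSet.2 h2) (cons'_mem (mem_toSet.2 h3) (fun _ => ha)))) ha H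

theorem choiceD4 {M : ZFSet} (hM : IsTransModel M) (P : Set ZFSet → ZFSet → ZFSet → ZFSet → ZFSet → ZFSet → ZFSet → Prop)
    [UDef (fun D v => P D (v 0) (v 1) (v 2) (v 3) (v 4) (v 5))] {a p1 p2 p3 p4 : ZFSet} (ha : a ∈ M) (h1 : p1 ∈ M) (h2 : p2 ∈ M) (h3 : p3 ∈ M) (h4 : p4 ∈ M)
    (H : ∀ x ∈ a, ∃ y ∈ M, P M.toSet x y p1 p2 p3 p4) :
    ∃ f ∈ M, IsZFunc a f ∧ ∀ x ∈ a, fapp f x ∈ M ∧ P M.toSet x (fapp f x) p1 p2 p3 p4 :=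
  choicev hM (fun D v => P D (v 0) (v 1) (v 2) (v 3) (v 4) (v 5)) (cons' p1 (cons' p2 (cons' p3 (cons' p4 (fun _ => a))))) (cons'_mem (mem_toSet.2 h1) (cons'_mem (mem_toSet.2 h2) (cons'_mem (mem_toSet.2 h3) (cons'_mem (mem_toSet.2 h4) (fun _ => ha))))) ha H

theorem choiceD5 {M : ZFSet} (hM : IsTransModel M) (P : Set ZFSet → ZFSet → ZFSet → ZFSet → ZFSet → ZFSet → ZFSet → ZFSet → Prop)
    [UDef (fun D v => P D (v 0) (v 1) (v 2) (v 3) (v 4) (v 5) (v 6))] {a p1 p2 p3 p4 p5 : ZFSet} (ha : a ∈ M) (h1 : p1 ∈ M) (h2 : p2 ∈ M) (h3 : p3 ∈ M) (h4 : p4 ∈ M) (h5 : p5 ∈ M)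
    (H : ∀ x ∈ a, ∃ y ∈ M, P M.toSet x y p1 p2 p3 p4 p5) :
    ∃ f ∈ M, IsZFunc a f ∧ ∀ x ∈ a, fapp f x ∈ M ∧ P M.toSet x (fapp f x) p1 p2 p3 p4 p5 :=
  choicev hM (fun D v => P D (v 0) (v 1) (v 2) (v 3) (v 4) (v 5) (v 6)) (cons' p1 (cons' p2 (cons' p3 (cons' p4 (cons' p5 (fun _ => a)))))) (cons'_mem (mem_toSet.2 h1) (cons'_mem (mem_toSet.2 h2) (cons'_mem (mem_toSet.2 h3) (cons'_mem (mem_toSet.2 h4) (cons'_mem (mem_toSet.2 h5) (fun _ => ha)))))) ha H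

theorem choiceD6 {M : ZFSet} (hM : IsTransModel M) (P : Set ZFSet → ZFSet → ZFSet → ZFSet → ZFSet → ZFSet → ZFSet → ZFSet → ZFSet → Prop)
    [UDef (fun D v => P D (v 0) (v 1) (v 2) (v 3) (v 4) (v 5) (v 6) (v 7))] {a p1 p2 p3 p4 p5 p6 : ZFSet} (ha : a ∈ M) (h1 : p1 ∈ M) (h2 : p2 ∈ M) (h3 : p3 ∈ M) (h4 : p4 ∈ M) (h5 : p5 ∈ M) (h6 : p6 ∈ M)
    (H : ∀ x ∈ a, ∃ y ∈ M, P M.toSet x y p1 p2 p3 p4 p5 p6) :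
    ∃ f ∈ M, IsZFunc a f ∧ ∀ x ∈ a, fapp f x ∈ M ∧ P M.toSet x (fapp f x) p1 p2 p3 p4 p5 p6 :=
  choicev hM (fun D v => P D (v 0) (v 1) (v 2) (v 3) (v 4) (v 5) (v 6) (v 7)) (cons' p1 (cons' p2 (cons' p3 (cons' p4 (cons' p5 (cons' p6 (fun _ => a))))))) (cons'_mem (mem_toSet.2 h1) (cons'_mem (mem_toSet.2 h2) (cons'_mem (mem_toSet.2 h3) (cons'_mem (mem_toSet.2 h4) (cons'_mem (mem_toSet.2 h5) (cons'_mem (mem_toSet.2 h6) (fun _ => ha))))))) ha H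


/-- von Neumann naturals -/
def nn : ℕ → ZFSet
  | 0 => ∅
  | n+1 => insert (nn n) (nn n)

theorem nn_eq (n : ℕ) : nn n = mk (PSet.ofNat n) := by
  induction n with
  | zero => rfl
  | succ n ih => rw [nn, ih]; rfl

theorem mem_omega {x : ZFSet} : x ∈ omega ↔ ∃ n, x = nn n := by
  constructor
  · intro h
    induction x using Quotient.inductionOn with
    | _ x =>
      obtain ⟨⟨n⟩, hn⟩ := (h : x ∈ PSet.omega)
      exact ⟨n, by rw [nn_eq]; exact ZFSet.sound hn⟩
  · rintro ⟨n, rfl⟩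
    induction n with
    | zero => exact omega_zero
    | succ n ih => exact omega_succ ih

theorem nn_mem (n : ℕ) : nn n ∈ omega := mem_omega.2 ⟨n, rfl⟩

theorem isOrd_iff {x : ZFSet} : IsOrd x ↔ x.IsOrdinal := by
  rw [isOrdinal_iff_forall_mem_isTransitive]; rfl

theorem isOrd_nn (n : ℕ) : (nn n).IsOrdinal := by
  induction n with
  | zero => exact isOrdinal_empty
  | succ n ih => exact isOrdinal_succ ih

theorem isOrd_omega : omega.IsOrdinal := by
  rw [isOrdinal_iff_forall_mem_isTransitive]
  refine ⟨fun x hx => ?_, fun x hx => ?_⟩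
  · obtain ⟨n, rfl⟩ := mem_omega.1 hx
    clear hx
    induction n with
    | zero => intro y hy; exact absurd hy (notMem_empty y)
    | succ n ih =>
      intro y hy
      rcases mem_insert_iff.1 hy with rfl | hy
      · exact nn_mem n
      · exact ih hy
  · obtain ⟨n, rfl⟩ := mem_omega.1 hx
    exact (isOrd_nn n).isTransitive

theorem nn_inj {m n : ℕ} (h : nn m = nn n) : m = n := by
  have key : ∀ m n, m < n → nn m ∈ nn n := by
    intro m n hmn
    induction n with
    | zero => omega
    | succ n ih =>
      rcases Nat.lt_succ_iff_lt_or_eq.1 hmn with h | rfl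
      · exact mem_insert_iff.2 (Or.inr (ih h))
      · exact mem_insert _ _
  rcases lt_trichotomy m n with h' | h' | h'
  · exact absurd (h ▸ key m n h') (mem_irrefl _)
  · exact h'
  · exact absurd (h ▸ key n m h') (mem_irrefl _)

theorem succ_inj' {x y : ZFSet} (h : insert x x = (insert y y : ZFSet)) : x = y := by
  have h1 : x ∈ (insert y y : ZFSet) := h ▸ mem_insert x x
  have h2 : y ∈ (insert x x : ZFSet) := h ▸ mem_insert y y
  rcases mem_insert_iff.1 h1 with h1 | h1
  · exact h1
  rcases mem_insert_iff.1 h2 with h2 | h2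
  · exact h2.symm
  exact absurd h2 (mem_asymm h1)

theorem eq_omega {w : ZFSet} : w = omega ↔ ∅ ∈ w ∧ (∀ x ∈ w, ∃ y ∈ w, y = insert x x) ∧ ∀ x ∈ w, x = ∅ ∨ ∃ y ∈ w, x = insert y y := by
  constructor
  · rintro rfl
    refine ⟨omega_zero, fun x hx => ⟨_, omega_succ hx, rfl⟩, fun x hx => ?_⟩
    obtain ⟨n, rfl⟩ := mem_omega.1 hx
    cases n with
    | zero => exact Or.inl rfl
    | succ n => exact Or.inr ⟨nn n, nn_mem n, rfl⟩
  · rintro ⟨h1, h2, h3⟩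
    ext x
    constructor
    · induction x using ZFSet.inductionOn with
      | _ x ih =>
        intro hx
        rcases h3 x hx with rfl | ⟨y, hy, rfl⟩
        · exact omega_zero
        · exact omega_succ (ih y (mem_insert _ _) hy)
    · intro hx
      obtain ⟨n, rfl⟩ := mem_omega.1 hx
      clear hx
      induction n with
      | zero => exact h1
      | succ n ih => obtain ⟨y, hy, rfl⟩ := h2 _ ih; exact hy

instance UDef.eqOmega (i : ℕ) : UDef (fun _ v => v i = omega) :=
  (inferInstance : UDef (fun _ v => ∅ ∈ v i ∧ (∀ x ∈ v i, ∃ y ∈ v i, y = insert x x) ∧ ∀ x ∈ v i, x = ∅ ∨ ∃ y ∈ v i, x = insert y y)).congr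
    fun D _ v _ => eq_omega.symm

instance UDef.omegaMem (i : ℕ) : UDef (fun _ v => omega ∈ v i) :=
  (inferInstance : UDef (fun _ v => ∃ w ∈ v i, w = omega)).congr fun D _ v _ => by simp

theorem iter {D S F x0 : ZFSet} (hD : IsTransModel D) (hF : F ∈ D) (hF1 : IsZFunc S F)
    (hF2 : MapsInto F S S) (h0 : x0 ∈ S) :
    ∃ s ∈ D, IsZFunc omega s ∧ fapp s ∅ = x0 ∧ (∀ n, fapp s (nn n) ∈ S) ∧
      ∀ n, fapp s (nn (n+1)) = fapp F (fapp s (nn n)) := by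
  have hS := hD.dom_mem' hF hF1
  have hE := sep0 hD (P := fun p => ∃ z ∈ p, ∃ a ∈ z, ∃ z' ∈ p, ∃ b ∈ z', p = pair a b ∧ b = insert a a) (hD.prod_mem hD.omega_mem hD.omega_mem)
  set E := ZFSet.sep (fun p => ∃ z ∈ p, ∃ a ∈ z, ∃ z' ∈ p, ∃ b ∈ z', p = pair a b ∧ b = insert a a) (ZFSet.prod omega omega) with hEd
  have hE' : ∀ a b, pair a b ∈ E ↔ a ∈ omega ∧ b = insert a a := by
    intro a b
    rw [hEd, mem_sep, ← UDef.ex_pair_iff (Q := fun a b => b = insert a a), pair_mem_prod]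
    constructor
    · rintro ⟨⟨h1, h2⟩, a', b', h3, h4⟩
      obtain ⟨rfl, rfl⟩ := pair_inj.1 h3
      exact ⟨h1, h4⟩
    · rintro ⟨h1, rfl⟩
      exact ⟨⟨h1, omega_succ h1⟩, a, _, rfl, rfl⟩
  have hwf : WFOn omega E := by
    refine Subrelation.wf ?_ mem_wf
    rintro a b ⟨h1, h2⟩
    rw [((hE' a b).1 h2).2]; exact mem_insert _ _
  obtain ⟨s, hs, hs1, hs2⟩ := wfrec hD (fun D ξ g y F x0 => (ξ = ∅ ∧ y = x0) ∨ (ξ ≠ ∅ ∧ ∃ w ∈ D, ∃ w' ∈ D, w' = ran g ∧ w = ⋃₀ w' ∧ y = fapp F w)) hD.omega_mem hE hF (hD.trans hS h0) hwf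
    (fun ξ g => if ξ = ∅ then x0 else fapp F (⋃₀ ran g)) (by
      intro ξ hξ g hg hgf
      have hw := hD.sUnion_mem (hD.ran_mem hg)
      have hf : fapp F (⋃₀ ran g) ∈ D := by
        by_cases hh : (⋃₀ ran g : ZFSet) ∈ S
        · exact hD.fapp_memM hF hF1 hh
        · have : fapp F (⋃₀ ran g) = ∅ := by
            ext x
            rw [UDef.mem_fapp]
            constructor
            · rintro ⟨p, hp, z, hz, b, hb, hx, _⟩
              exact absurd (dom_of hF1 hx) hh
            · intro hx; exact absurd hx (notMem_empty _)
          rw [this]; exact hD.empty_mem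
      constructor
      · split_ifs
        · exact hD.trans hS h0
        · exact hf
      · intro y hy
        split_ifs with h
        · simp [h]
        · simp only [h, false_and, false_or, ne_eq, not_false_eq_true, true_and]
          constructor
          · rintro ⟨w, _, w', _, rfl, rfl, h⟩; exact h
          · rintro rfl; exact ⟨_, hw, _, hD.ran_mem hg, rfl, rfl, rfl⟩)
  have hsucc : ∀ n, fapp s (nn (n+1)) = fapp F (fapp s (nn n)) := by
    intro n
    rw [hs2 _ (nn_mem (n+1)), if_neg]
    · congr 1
      have : ran (prestr E s (nn (n+1))) = {fapp s (nn n)} := by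
        ext z
        rw [mem_ran, mem_singleton]
        constructor
        · rintro ⟨a, ha⟩
          rw [mem_prestr, hE'] at ha
          rw [← fapp_eq hs1 ha.1, succ_inj' ha.2.2]
        · rintro rfl
          exact ⟨nn n, mem_prestr.2 ⟨fapp_mem hs1 (nn_mem n), (hE' _ _).2 ⟨nn_mem n, rfl⟩⟩⟩
      rw [this]; simp
    · intro h
      have := mem_insert (nn n) (nn n)
      rw [show insert (nn n) (nn n) = nn (n+1) from rfl, h] at this
      exact notMem_empty _ this
  have hz : fapp s ∅ = x0 := by rw [hs2 _ omega_zero, if_pos rfl]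
  refine ⟨s, hs, hs1, hz, fun n => ?_, hsucc⟩
  induction n with
  | zero => rw [nn, hz]; exact h0
  | succ n ih => rw [hsucc]; exact hF2 _ ih

/-! ## Ordinal enumerations -/

theorem ordEnum {D Y : ZFSet} (hD : IsTransModel D) (hY : Y ∈ D) :
    ∃ θ ∈ D, θ.IsOrdinal ∧ ∃ e ∈ D, IsZFunc Y e ∧ (∀ a ∈ Y, fapp e a ∈ θ) ∧
      (∀ b ∈ θ, ∃ a ∈ Y, fapp e a = b) ∧ ∀ a ∈ Y, ∀ b ∈ Y, fapp e a = fapp e b → a = b := by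
  obtain ⟨r, hr, hwo⟩ := hD.2.2.2.2.2.2 Y hY
  have hwf : WFOn Y r := by
    rw [WFOn, WellFounded.wellFounded_iff_has_min]
    intro S ⟨s, hs⟩
    by_cases h : (S ∩ Y.toSet).Nonempty
    · obtain ⟨a, ha, h⟩ := hwo.2.2.2.2 (S ∩ Y.toSet) Set.inter_subset_right h
      exact ⟨a, ha.1, fun x hx hx' => h x ⟨hx, hx'.1⟩ hx'.2⟩
    · exact ⟨s, hs, fun x hx hx' => h ⟨x, hx, hx'.1⟩⟩
  obtain ⟨f, hf, hf1, hf2⟩ := most hD hY hr hwf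
  have htr : ∀ ξ ∈ Y, (fapp f ξ).IsTransitive := by
    intro ξ hξ z hz w hw
    obtain ⟨ζ, hζ, h1, rfl⟩ := (hf2 ξ hξ z).1 hz
    obtain ⟨η, hη, h2, rfl⟩ := (hf2 ζ hζ w).1 hw
    exact (hf2 ξ hξ _).2 ⟨η, hη, hwo.2.2.1 η hη ζ hζ ξ hξ h2 h1, rfl⟩
  refine ⟨ran f, hD.ran_mem hf, ?_, f, hf, hf1, fun a ha => (mem_ran' hf1).2 ⟨a, ha, rfl⟩, fun b hb => (mem_ran' hf1).1 hb, ?_⟩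
  · rw [isOrdinal_iff_forall_mem_isTransitive]
    refine ⟨fun z hz w hw => ?_, fun z hz => ?_⟩
    · obtain ⟨ξ, hξ, rfl⟩ := (mem_ran' hf1).1 hz
      obtain ⟨ζ, hζ, h1, rfl⟩ := (hf2 ξ hξ w).1 hw
      exact (mem_ran' hf1).2 ⟨ζ, hζ, rfl⟩
    · obtain ⟨ξ, hξ, rfl⟩ := (mem_ran' hf1).1 hz
      exact htr ξ hξ
  · intro a ha b hb hab
    rcases hwo.2.1 a ha b hb with h | h | h
    · exact h
    · have : fapp f a ∈ fapp f b := (hf2 b hb _).2 ⟨a, ha, h, rfl⟩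
      rw [hab] at this; exact absurd this (mem_irrefl _)
    · have : fapp f b ∈ fapp f a := (hf2 a ha _).2 ⟨b, hb, h, rfl⟩
      rw [hab] at this; exact absurd this (mem_irrefl _)

/-! ## First-order axiomatization of being a model -/

/-- the sentence form of choice -/
def ACs (D : Set ZFSet) : Prop :=
  ∀ x ∈ D, ∃ θ ∈ D, ∃ e ∈ D, ∃ r ∈ D, IsOrd θ ∧ IsZFunc x e ∧ (∀ a ∈ x, fapp e a ∈ θ) ∧
    (∀ a ∈ x, ∀ b ∈ x, (∃ c ∈ θ, c = fapp e a ∧ c = fapp e b) → a = b) ∧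
    (∀ p ∈ r, ∃ a ∈ x, ∃ b ∈ x, p = pair a b) ∧
    (∀ a ∈ x, ∀ b ∈ x, pair a b ∈ r ↔ ∃ c ∈ θ, c = fapp e b ∧ fapp e a ∈ c)

instance : UDef (fun D _ => ACs D) := by unfold ACs; infer_instance

theorem ACs_of {D : ZFSet} (hD : IsTransModel D) : ACs D.toSet := by
  intro x hx
  obtain ⟨θ, hθ, ho, e, he, h1, h2, h3, h4⟩ := ordEnum hD hx
  have hr := sep2 hD (P := fun p e θ => ∃ z ∈ p, ∃ a ∈ z, ∃ z' ∈ p, ∃ b ∈ z', p = pair a b ∧ ∃ c ∈ θ, c = fapp e b ∧ fapp e a ∈ c)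
    (hD.prod_mem hx hx) he hθ
  refine ⟨θ, hθ, e, he, _, hr, isOrd_iff.2 ho, h1, h2, ?_, ?_, ?_⟩
  · rintro a ha b hb ⟨c, _, h5, h6⟩
    exact h4 a ha b hb (h5.symm.trans h6)
  · intro p hp
    exact mem_prod.1 (mem_sep.1 hp).1
  · intro a ha b hb
    rw [mem_sep, ← UDef.ex_pair_iff (Q := fun a b => ∃ c ∈ θ, c = fapp e b ∧ fapp e a ∈ c), pair_mem_prod]
    constructor
    · rintro ⟨_, a', b', h, h'⟩
      obtain ⟨rfl, rfl⟩ := pair_inj.1 h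
      exact h'
    · intro h; exact ⟨⟨ha, hb⟩, a, b, rfl, h⟩

theorem wo_of_ACs {D : ZFSet} (h : ACs D.toSet) : ∀ x ∈ D, ∃ r ∈ D, IsWellOrderOn x r := by
  intro x hx
  obtain ⟨θ, hθ, e, he, r, hr, h1, h2, h3, h4, h5, h6⟩ := h x hx
  rw [isOrd_iff] at h1
  have h6' : ∀ a ∈ x, ∀ b ∈ x, (pair a b ∈ r ↔ fapp e a ∈ fapp e b) := by
    intro a ha b hb
    rw [h6 a ha b hb]
    exact ⟨fun ⟨c, _, hc, h⟩ => hc ▸ h, fun h => ⟨_, h3 b hb, rfl, h⟩⟩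
  refine ⟨r, hr, h5, ?_, ?_, ?_, ?_⟩
  · intro a ha b hb
    rw [h6' a ha b hb, h6' b hb a ha]
    rcases (h1.mem (h3 a ha)).mem_trichotomous (h1.mem (h3 b hb)) with h | h | h
    · exact Or.inr (Or.inl h)
    · exact Or.inl (h4 a ha b hb ⟨_, h3 a ha, rfl, h⟩)
    · exact Or.inr (Or.inr h)
  · intro a ha b hb c hc hab hbc
    rw [h6' a ha b hb] at hab
    rw [h6' b hb c hc] at hbc
    rw [h6' a ha c hc]
    exact (h1.mem (h3 c hc)).mem_trans hab hbc
  · intro a ha h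
    rw [h6' a ha a ha] at h
    exact mem_irrefl _ h
  · intro S hS hne
    obtain ⟨a, ha, hmin⟩ := (InvImage.wf (fapp e) mem_wf).has_min S hne
    refine ⟨a, ha, fun b hb h => hmin b hb ?_⟩
    exact (h6' b (hS hb) a (hS ha)).1 h

theorem UDef.transfer.{u} {M M' : ZFSet.{u}} (hM : M.IsTransitive) (hM' : M'.IsTransitive) (h0 : ∅ ∈ M) (h0' : ∅ ∈ M')
    (H : ∀ σ, Sat M.toSet σ (fun _ => ∅) → Sat M'.toSet σ (fun _ => ∅))
    (P : Set ZFSet.{u} → (ℕ → ZFSet.{u}) → Prop) [h : UDef P] : P M.toSet (fun _ => ∅) → P M'.toSet (fun _ => ∅) := by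
  obtain ⟨φ, hφ⟩ := h.out
  rw [← hφ _ (trS_of hM) _ (fun _ => h0), ← hφ _ (trS_of hM') _ (fun _ => h0')]
  exact H φ

theorem satUpd0 (φ : Fml) : UDef (fun D v => Sat D φ (Function.update (fun n => v (n+2)) 0 (v 0))) := by
  refine (UDef.satD φ (fun n => if n = 0 then 0 else n + 2)).congr fun D _ v _ => ?_
  rw [show (fun n => v (if n = 0 then 0 else n + 2)) = (Function.update (fun n => v (n+2)) 0 (v 0)) by
    funext n; cases n <;> simp]

theorem satUpd1 (φ : Fml) (k : ℕ) : UDef (fun D v => Sat D φ (Function.update (Function.update (fun n => v (n+2+k)) 0 (v 1)) 1 (v 0))) := by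
  refine (UDef.satD φ (fun n => if n = 0 then 1 else if n = 1 then 0 else n + 2 + k)).congr fun D _ v _ => ?_
  rw [show (fun n => v (if n = 0 then 1 else if n = 1 then 0 else n + 2 + k)) =
    (Function.update (Function.update (fun n => v (n+2+k)) 0 (v 1)) 1 (v 0)) by
    funext n; rcases n with _ | _ | n <;> simp]

theorem transModel_transfer.{u} {M M' : ZFSet.{u}} (hM : IsTransModel M) (hM' : M'.IsTransitive) (h0' : ∅ ∈ M')
    (H : ∀ σ, Sat M.toSet σ (fun _ => ∅) → Sat M'.toSet σ (fun _ => ∅)) : IsTransModel M' := by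
  have h0 := hM.empty_mem
  have T := fun (P : Set ZFSet.{u} → (ℕ → ZFSet.{u}) → Prop) (h : UDef P) => UDef.transfer hM.1 hM' h0 h0' H P
  refine ⟨hM', ?_, ?_, ?_, ?_, ?_, ?_⟩
  · obtain ⟨w, hw, rfl⟩ := T (fun D v => ∃ w ∈ D, w = omega) inferInstance ⟨_, hM.omega_mem, rfl⟩
    exact hw
  · intro x hx y hy
    obtain ⟨w, hw, rfl⟩ := T (fun D v => ∀ x ∈ D, ∀ y ∈ D, ∃ w ∈ D, w = {x, y}) inferInstance
      (fun x hx y hy => ⟨_, hM.upair hx hy, rfl⟩) x hx y hy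
    exact hw
  · intro x hx
    obtain ⟨w, hw, rfl⟩ := T (fun D v => ∀ x ∈ D, ∃ w ∈ D, w = ⋃₀ x) inferInstance
      (fun x hx => ⟨_, hM.sUnion_mem hx, rfl⟩) x hx
    exact hw
  · intro φ v hv a ha
    have inst : UDef (fun D v => ∃ b ∈ D, ∀ x ∈ D, x ∈ b ↔ x ∈ v 0 ∧ Sat D φ (Function.update (fun n => v (n+1)) 0 x)) := by
      refine UDef.exD (fun D b v => ∀ x ∈ D, x ∈ b ↔ x ∈ v 0 ∧ Sat D φ (Function.update (fun n => v (n+1)) 0 x)) (h := ?_)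
      refine UDef.allD (fun D x v => x ∈ v 0 ↔ x ∈ v 1 ∧ Sat D φ (Function.update (fun n => v (n+2)) 0 x)) (h := ?_)
      refine UDef.iff (h := inferInstance) (h' := UDef.and (h := inferInstance) (h' := ?_))
      refine ((satUpd0 φ).comp (fun n => if n = 0 then 0 else n + 1)).congr fun D _ v _ => ?_
      rfl
    have := T _ (UDef.allv _ (h := inst)) (fun w hw => by
      obtain ⟨b, hb, h⟩ := hM.2.2.2.2.1 φ (fun n => w (n+1)) (fun n => hw _) (w 0) (hw 0)
      exact ⟨b, hb, fun x _ => h x⟩) (cons' a v) (cons'_mem ha hv)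
    obtain ⟨b, hb, h⟩ := this
    refine ⟨b, hb, fun x => ⟨fun hx => (h x (hM' b hb hx)).1 hx, fun hx => (h x (hM' a ha hx.1)).2 hx⟩⟩
  · intro φ v hv a ha hyp
    have inst : UDef (fun D v => (∀ x ∈ v 0, ∃ y ∈ D, Sat D φ (Function.update (Function.update (fun n => v (n+1)) 0 x) 1 y)) →
        ∃ b ∈ D, ∀ x ∈ v 0, ∃ y ∈ b, Sat D φ (Function.update (Function.update (fun n => v (n+1)) 0 x) 1 y)) := by
      refine UDef.imp (h := ?_) (h' := ?_)
      · refine UDef.ball 0 (fun D x v => ∃ y ∈ D, Sat D φ (Function.update (Function.update (fun n => v (n+1)) 0 x) 1 y)) (h := ?_)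
        refine UDef.exD (fun D y v => Sat D φ (Function.update (Function.update (fun n => v (n+2)) 0 (v 0)) 1 y)) (h := ?_)
        exact (satUpd1 φ 1).congr fun D _ v _ => Iff.rfl
      · refine UDef.exD (fun D b v => ∀ x ∈ v 0, ∃ y ∈ b, Sat D φ (Function.update (Function.update (fun n => v (n+1)) 0 x) 1 y)) (h := ?_)
        refine UDef.ball 1 (fun D x v => ∃ y ∈ v 0, Sat D φ (Function.update (Function.update (fun n => v (n+2)) 0 x) 1 y)) (h := ?_)
        refine UDef.bex 1 (fun D y v => Sat D φ (Function.update (Function.update (fun n => v (n+3)) 0 (v 0)) 1 y)) (h := ?_)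
        exact (satUpd1 φ 2).congr fun D _ v _ => Iff.rfl
    exact T _ (UDef.allv _ (h := inst)) (fun w hw hyp => hM.2.2.2.2.2.1 φ (fun n => w (n+1)) (fun n => hw _) (w 0) (hw 0) hyp)
      (cons' a v) (cons'_mem ha hv) hyp
  · exact wo_of_ACs (T (fun D _ => ACs D) inferInstance (ACs_of hM))

/-! ## Gödel pairing -/

def mlt (a b c d : ZFSet) : Prop := (a ∈ c ∨ a ∈ d) ∧ (b ∈ c ∨ b ∈ d)
def glt (a b c d : ZFSet) : Prop := mlt a b c d ∨ (¬ mlt c d a b ∧ (a ∈ c ∨ (a = c ∧ b ∈ d)))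

/-- the graph of the Gödel order -/
def gE (κ : ZFSet) : ZFSet :=
  ZFSet.sep (fun x => ∃ a ∈ κ, ∃ b ∈ κ, ∃ c ∈ κ, ∃ d ∈ κ, x = pair (pair a b) (pair c d) ∧ glt a b c d)
    (prod (prod κ κ) (prod κ κ))

theorem mem_gE {κ a b c d : ZFSet} (ha : a ∈ κ) (hb : b ∈ κ) (hc : c ∈ κ) (hd : d ∈ κ) :
    pair (pair a b) (pair c d) ∈ gE κ ↔ glt a b c d := by
  rw [gE, mem_sep]
  constructor
  · rintro ⟨_, a', ha', b', hb', c', hc', d', hd', h, h'⟩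
    rw [pair_inj, pair_inj, pair_inj] at h
    obtain ⟨⟨rfl, rfl⟩, rfl, rfl⟩ := h
    exact h'
  · intro h
    refine ⟨?_, a, ha, b, hb, c, hc, d, hd, rfl, h⟩
    simp [ha, hb, hc, hd]

theorem gE_mem {D κ : ZFSet} (hD : IsTransModel D) (hκ : κ ∈ D) : gE κ ∈ D := by
  have hd := hD.prod_mem hκ hκ
  exact sep1 hD (P := fun x κ => ∃ a ∈ κ, ∃ b ∈ κ, ∃ c ∈ κ, ∃ d ∈ κ, x = pair (pair a b) (pair c d) ∧
    (((a ∈ c ∨ a ∈ d) ∧ (b ∈ c ∨ b ∈ d)) ∨ (¬ ((c ∈ a ∨ c ∈ b) ∧ (d ∈ a ∨ d ∈ b)) ∧ (a ∈ c ∨ (a = c ∧ b ∈ d)))))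
    (hD.prod_mem hd hd) hκ

theorem mlt_iff {a b c d : ZFSet} (ha : a.IsOrdinal) (hb : b.IsOrdinal) (hc : c.IsOrdinal) (hd : d.IsOrdinal) :
    mlt a b c d ↔ max (rank a) (rank b) < max (rank c) (rank d) := by
  rw [mlt, ← IsOrdinal.rank_lt_iff_mem ha hc, ← IsOrdinal.rank_lt_iff_mem ha hd, ← IsOrdinal.rank_lt_iff_mem hb hc, ← IsOrdinal.rank_lt_iff_mem hb hd,
    max_lt_iff, lt_max_iff, lt_max_iff]

theorem rank_inj {a b : ZFSet} (ha : a.IsOrdinal) (hb : b.IsOrdinal) : rank a = rank b ↔ a = b := by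
  refine ⟨fun h => ?_, fun h => h ▸ rfl⟩
  rcases ha.mem_trichotomous hb with h' | h' | h'
  · exact absurd (rank_lt_of_mem h') (by simp [h])
  · exact h'
  · exact absurd (rank_lt_of_mem h') (by simp [h])

def gkey (p : Ordinal × Ordinal) : Ordinal ×ₗ Ordinal ×ₗ Ordinal := toLex (max p.1 p.2, toLex (p.1, p.2))

theorem glt_iff {a b c d : ZFSet} (ha : a.IsOrdinal) (hb : b.IsOrdinal) (hc : c.IsOrdinal) (hd : d.IsOrdinal) :
    glt a b c d ↔ gkey (rank a, rank b) < gkey (rank c, rank d) := by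
  rw [glt, mlt_iff ha hb hc hd, mlt_iff hc hd ha hb, gkey, gkey, Prod.Lex.lt_iff, Prod.Lex.lt_iff,
    ← IsOrdinal.rank_lt_iff_mem ha hc, ← IsOrdinal.rank_lt_iff_mem hb hd, ← rank_inj ha hc]
  simp only [ofLex_toLex]
  constructor
  · rintro (h | ⟨h1, h2⟩)
    · exact Or.inl h
    · rcases lt_or_eq_of_le (not_lt.1 h1) with h | h
      · exact Or.inl h
      · exact Or.inr ⟨h, h2⟩
  · rintro (h | ⟨h1, h2⟩)
    · exact Or.inl h
    · exact Or.inr ⟨by rw [h1]; exact lt_irrefl _, h2⟩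

theorem zcard_le_of_subset {a b : ZFSet} (h : a ⊆ b) : zcard a ≤ zcard b :=
  Cardinal.mk_le_mk_of_subset (fun x hx => h hx)

theorem IsCard.succ_mem {κ : ZFSet} (hκ : IsCard κ) (hω : omega ⊆ κ) {a : ZFSet} (ha : a ∈ κ) : insert a a ∈ κ := by
  have ho := isOrd_iff.1 hκ.1
  have hs := isOrdinal_succ (ho.mem ha)
  rcases hs.mem_or_subset ho with h | h
  · exact h
  exfalso
  have h1 := hκ.2 a ha
  by_cases hfin : Set.Finite a.toSet
  · have : Set.Finite (κ.toSet) := by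
      refine ((hfin.insert a)).subset fun x hx => ?_
      have := h hx
      rw [mem_insert_iff] at this
      exact this
    have h2 : Set.Infinite (omega.toSet) :=
      Set.infinite_of_injective_forall_mem (f := nn) (fun a b h => nn_inj h) (fun n => nn_mem n)
    exact h2 (this.subset fun x hx => hω hx)
  · have h2 : zcard κ ≤ zcard (insert a a : ZFSet) := zcard_le_of_subset h
    have h3 : zcard (insert a a : ZFSet) = zcard a := by
      have : (insert a a : ZFSet).toSet = insert a a.toSet := by
        ext x; exact mem_insert_iff
      rw [zcard, this, Cardinal.mk_insert (s := a.toSet) (fun h => mem_irrefl a h), zcard]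
      exact Cardinal.add_one_eq (Cardinal.aleph0_le_mk_iff.2 (Set.infinite_coe_iff.2 hfin))
    rw [h3] at h2
    exact absurd h1 (not_lt.2 h2)

theorem GP {κ D₀ : ZFSet} (hκ : IsCard κ) (hω : omega ⊆ κ) (hD₀ : IsTransModel D₀) (hκ₀ : κ ∈ D₀) :
    ∃ p, (∀ D, IsTransModel D → κ ∈ D → p ∈ D) ∧ IsZFunc (prod κ κ) p ∧
      (∀ a ∈ κ, ∀ b ∈ κ, fapp p (pair a b) ∈ κ) ∧
      (∀ a ∈ κ, ∀ b ∈ κ, ∀ c ∈ κ, ∀ d ∈ κ, fapp p (pair a b) = fapp p (pair c d) → a = c ∧ b = d) ∧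
      (∀ lam ∈ κ, ∃ ν ∈ κ, ∀ a ∈ lam, ∀ b ∈ lam, fapp p (pair a b) ∈ ν) := by
  have ho := isOrd_iff.1 hκ.1
  have hwf : WFOn (prod κ κ) (gE κ) := by
    let r : ZFSet → Ordinal ×ₗ Ordinal ×ₗ Ordinal := fun x =>
      if h : ∃ a b, x = pair a b then gkey (rank h.choose, rank h.choose_spec.choose) else gkey (0, 0)
    have hr : ∀ a b, r (pair a b) = gkey (rank a, rank b) := by
      intro a b
      have h : ∃ a' b', pair a b = pair a' b' := ⟨a, b, rfl⟩
      have h' : r (pair a b) = gkey (rank h.choose, rank h.choose_spec.choose) := dif_pos h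
      have h2 := pair_inj.1 h.choose_spec.choose_spec
      rw [h']
      exact congrArg gkey (Prod.ext (congrArg rank h2.1.symm) (congrArg rank h2.2.symm))
    refine Subrelation.wf (r := InvImage (· < ·) r) ?_ (InvImage.wf r wellFounded_lt)
    rintro x y ⟨hx, hxy⟩
    obtain ⟨_, a, ha, b, hb, c, hc, d, hd, h, h'⟩ := mem_sep.1 hxy
    obtain ⟨rfl, rfl⟩ := pair_inj.1 h
    rw [InvImage, hr, hr]
    exact (glt_iff (ho.mem ha) (ho.mem hb) (ho.mem hc) (ho.mem hd)).1 h'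
  obtain ⟨p, hp, hp1, hp2⟩ := most hD₀ (hD₀.prod_mem hκ₀ hκ₀) (gE_mem hD₀ hκ₀) hwf
  have hpair : ∀ {a b}, a ∈ κ → b ∈ κ → pair a b ∈ prod κ κ := fun ha hb => pair_mem_prod.2 ⟨ha, hb⟩
  have hm : ∀ a ∈ κ, ∀ b ∈ κ, ∀ z, z ∈ fapp p (pair a b) ↔ ∃ c ∈ κ, ∃ d ∈ κ, glt c d a b ∧ z = fapp p (pair c d) := by
    intro a ha b hb z
    rw [hp2 _ (hpair ha hb)]
    constructor
    · rintro ⟨ζ, hζ, h1, h2⟩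
      obtain ⟨c, hc, d, hd, rfl⟩ := mem_prod.1 hζ
      exact ⟨c, hc, d, hd, (mem_gE hc hd ha hb).1 h1, h2⟩
    · rintro ⟨c, hc, d, hd, h1, h2⟩
      exact ⟨_, hpair hc hd, (mem_gE hc hd ha hb).2 h1, h2⟩
  have hG : ∀ {a b c d}, a ∈ κ → b ∈ κ → c ∈ κ → d ∈ κ → (glt a b c d ↔ gkey (rank a, rank b) < gkey (rank c, rank d)) :=
    fun ha hb hc hd => glt_iff (ho.mem ha) (ho.mem hb) (ho.mem hc) (ho.mem hd)
  have htr : ∀ a ∈ κ, ∀ b ∈ κ, (fapp p (pair a b)).IsTransitive := by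
    intro a ha b hb z hz w hw
    obtain ⟨c, hc, d, hd, h1, rfl⟩ := (hm a ha b hb z).1 hz
    obtain ⟨c', hc', d', hd', h2, rfl⟩ := (hm c hc d hd w).1 hw
    rw [hG hc hd ha hb] at h1
    rw [hG hc' hd' hc hd] at h2
    exact (hm a ha b hb _).2 ⟨c', hc', d', hd', (hG hc' hd' ha hb).2 (h2.trans h1), rfl⟩
  have hord : ∀ a ∈ κ, ∀ b ∈ κ, (fapp p (pair a b)).IsOrdinal := by
    intro a ha b hb
    rw [isOrdinal_iff_forall_mem_isTransitive]
    refine ⟨htr a ha b hb, fun z hz => ?_⟩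
    obtain ⟨c, hc, d, hd, h1, rfl⟩ := (hm a ha b hb z).1 hz
    exact htr c hc d hd
  have hsm : ∀ a ∈ κ, ∀ b ∈ κ, fapp p (pair a b) ∈ κ := by
    intro a ha b hb
    rcases (hord a ha b hb).mem_or_subset ho with h | h
    · exact h
    exfalso
    obtain ⟨μ, hμ, haμ, hbμ, hωμ⟩ : ∃ μ ∈ κ, a ∈ μ ∧ b ∈ μ ∧ True := by
      rcases (ho.mem ha).mem_or_subset (ho.mem hb) with h | h
      · exact ⟨_, hκ.succ_mem hω hb, mem_insert_of_mem _ h, mem_insert _ _, trivial⟩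
      · refine ⟨_, hκ.succ_mem hω ha, mem_insert _ _, ?_, trivial⟩
        rcases ((ho.mem hb).subset_iff_eq_or_mem (ho.mem ha)).1 h with rfl | h
        · exact mem_insert _ _
        · exact mem_insert_of_mem _ h
    have hoμ := ho.mem hμ
    -- every predecessor lies in μ × μ
    have hsub : (fapp p (pair a b)).toSet ⊆ (fun x : ZFSet × ZFSet => fapp p (pair x.1 x.2)) '' (μ.toSet ×ˢ μ.toSet) := by
      intro z hz
      obtain ⟨c, hc, d, hd, h1, rfl⟩ := (hm a ha b hb z).1 hz
      rw [hG hc hd ha hb] at h1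
      have h2 : max (rank c) (rank d) ≤ max (rank a) (rank b) := by
        rw [gkey, gkey, Prod.Lex.lt_iff] at h1
        rcases h1 with h | h
        · exact le_of_lt h
        · exact le_of_eq h.1
      have h3 : max (rank a) (rank b) < rank μ := max_lt (rank_lt_of_mem haμ) (rank_lt_of_mem hbμ)
      have h4 := max_lt_iff.1 (h2.trans_lt h3)
      exact ⟨(c, d), ⟨(IsOrdinal.rank_lt_iff_mem (ho.mem hc) hoμ).1 h4.1, (IsOrdinal.rank_lt_iff_mem (ho.mem hd) hoμ).1 h4.2⟩, rfl⟩
    have hc1 : zcard κ ≤ zcard μ * zcard μ := by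
      refine (zcard_le_of_subset h).trans ((Cardinal.mk_le_mk_of_subset hsub).trans ?_)
      refine Cardinal.mk_image_le.trans ?_
      rw [Cardinal.mk_setProd]; simp [zcard]
    have hinf : Cardinal.aleph0 ≤ zcard κ := by
      have h2 : Set.Infinite (omega.toSet) :=
        Set.infinite_of_injective_forall_mem (f := nn) (fun a b h => nn_inj h) (fun n => nn_mem n)
      exact (Cardinal.aleph0_le_mk_iff.2 (Set.infinite_coe_iff.2 h2)).trans (zcard_le_of_subset hω)
    exact absurd (Cardinal.mul_lt_of_lt hinf (hκ.2 μ hμ) (hκ.2 μ hμ)) (not_lt.2 hc1)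
  refine ⟨p, ?_, hp1, hsm, ?_, ?_⟩
  · intro D hD hκD
    obtain ⟨q, hq, hq1, hq2⟩ := most hD (hD.prod_mem hκD hκD) (gE_mem hD hκD) hwf
    rw [func_ext hp1 hq1 (IsColl.unique hwf hp2 hq2)]
    exact hq
  · intro a ha b hb c hc d hd h
    rcases lt_trichotomy (gkey (rank a, rank b)) (gkey (rank c, rank d)) with h' | h' | h'
    · have := (hm c hc d hd _).2 ⟨a, ha, b, hb, (hG ha hb hc hd).2 h', rfl⟩
      rw [h] at this; exact absurd this (mem_irrefl _)
    · simp only [gkey, EmbeddingLike.apply_eq_iff_eq, Prod.mk.injEq] at h'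
      exact ⟨(rank_inj (ho.mem ha) (ho.mem hc)).1 h'.2.1, (rank_inj (ho.mem hb) (ho.mem hd)).1 h'.2.2⟩
    · have := (hm a ha b hb _).2 ⟨c, hc, d, hd, (hG hc hd ha hb).2 h', rfl⟩
      rw [h] at this; exact absurd this (mem_irrefl _)
  · intro lam hlam
    refine ⟨_, hsm lam hlam lam hlam, fun a ha b hb => ?_⟩
    have ha' := ho.mem_trans ha hlam
    have hb' := ho.mem_trans hb hlam
    refine (hm lam hlam lam hlam _).2 ⟨a, ha', b, hb', Or.inl ⟨Or.inl ha, Or.inl hb⟩, rfl⟩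

/-! ## Smallness -/

theorem fapp_out {d f a : ZFSet} (hf : IsZFunc d f) (ha : a ∉ d) : fapp f a = ∅ := by
  rw [ZFSet.eq_empty]
  intro y hy
  rw [fapp, mem_sUnion] at hy
  obtain ⟨b, hb, _⟩ := hy
  exact ha (dom_of hf (mem_sep.1 hb).2)

theorem IsTransModel.fappD {D d f : ZFSet} (hD : IsTransModel D) (hf : f ∈ D) (h : IsZFunc d f) (a : ZFSet) : fapp f a ∈ D := by
  by_cases ha : a ∈ d
  · exact hD.fapp_memM hf h ha
  · rw [fapp_out h ha]; exact hD.empty_mem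

def Im (D : Set ZFSet) (lam Y : ZFSet) : Prop := ∃ f ∈ D, IsZFunc lam f ∧ ∀ y ∈ Y, ∃ ξ ∈ lam, y = fapp f ξ
def Sm (D : Set ZFSet) (L Y : ZFSet) : Prop := ∃ lam ∈ L, Im D lam Y
def HS (D : Set ZFSet) (L x : ZFSet) : Prop := ∃ T ∈ D, T.IsTransitive ∧ x ∈ T ∧ Sm D L T

instance UDef.im (i j : ℕ) : UDef (fun D v => Im D (v i) (v j)) := by unfold Im; infer_instance
instance UDef.sm (i j : ℕ) : UDef (fun D v => Sm D (v i) (v j)) := by unfold Sm; infer_instance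
instance UDef.hs (i j : ℕ) : UDef (fun D v => HS D (v i) (v j)) := by unfold HS; infer_instance

theorem Im.sub {D : Set ZFSet} {lam Y Y' : ZFSet} (h : Im D lam Y) (hs : Y' ⊆ Y) : Im D lam Y' := by
  obtain ⟨f, hf, h1, h2⟩ := h
  exact ⟨f, hf, h1, fun y hy => h2 y (hs hy)⟩

theorem Im.mono {D lam μ Y : ZFSet} (hD : IsTransModel D) (h : Im D.toSet lam Y) (hs : lam ⊆ μ) (hμ : μ ∈ D) : Im D.toSet μ Y := by
  obtain ⟨f, hf, h1, h2⟩ := h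
  obtain ⟨g, hg, hg1, hg2⟩ := (replD1 hD (fun _ x y f => y = fapp f x) hμ hf (fun x => fapp f x) (fun x _ => hD.fappD hf h1 x)
    (fun x _ y _ => Iff.rfl)).2
  refine ⟨g, hg, hg1, fun y hy => ?_⟩
  obtain ⟨ξ, hξ, rfl⟩ := h2 y hy
  exact ⟨ξ, hs hξ, (hg2 ξ (hs hξ)).symm⟩

theorem Im.self {D lam : ZFSet} (hD : IsTransModel D) (hl : lam ∈ D) : Im D.toSet lam lam := by
  obtain ⟨g, hg, hg1, hg2⟩ := (replD0 hD (fun _ x y => y = x) hl (fun x => x) (fun x hx => hD.trans hl hx)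
    (fun x _ y _ => Iff.rfl)).2
  exact ⟨g, hg, hg1, fun y hy => ⟨y, hy, (hg2 y hy).symm⟩⟩

theorem Im.comp {D lam Y G : ZFSet} (hD : IsTransModel D) (hl : lam ∈ D) (h : Im D.toSet lam Y) (hG : G ∈ D) (hG1 : IsZFunc Y G) :
    Im D.toSet lam (ran G) := by
  obtain ⟨f, hf, h1, h2⟩ := h
  obtain ⟨g, hg, hg1, hg2⟩ := (replD2 hD (fun D x y f G => ∃ z ∈ D, z = fapp f x ∧ y = fapp G z) hl hf hG (fun x => fapp G (fapp f x))
    (fun x _ => hD.fappD hG hG1 _)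
    (fun x _ y _ => ⟨fun ⟨z, _, hz, h⟩ => hz ▸ h, fun h => ⟨_, hD.fappD hf h1 x, rfl, h⟩⟩)).2
  refine ⟨g, hg, hg1, fun y hy => ?_⟩
  obtain ⟨b, hb, rfl⟩ := (mem_ran' hG1).1 hy
  obtain ⟨ξ, hξ, rfl⟩ := h2 b hb
  exact ⟨ξ, hξ, (hg2 ξ hξ).symm⟩

structure SmS (D L : ZFSet) : Prop where
  hD : IsTransModel D
  hL : L ∈ D
  reg : ∀ lam ∈ L, ∀ f ∈ D, IsZFunc lam f → (∀ ξ ∈ lam, fapp f ξ ∈ L) → ∃ μ ∈ L, ∀ ξ ∈ lam, fapp f ξ ⊆ μ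
  prod : ∀ lam ∈ L, ∀ μ ∈ L, ∃ ν ∈ L, Im D.toSet ν (ZFSet.prod lam μ)
  om : ∃ lam ∈ L, omega ⊆ lam

theorem Sm.sub {D : Set ZFSet} {L Y Y' : ZFSet} (h : Sm D L Y) (hs : Y' ⊆ Y) : Sm D L Y' := by
  obtain ⟨l, hl, h⟩ := h
  exact ⟨l, hl, h.sub hs⟩

namespace SmS
variable {D L : ZFSet}

theorem comp (S : SmS D L) {Y G : ZFSet} (h : Sm D.toSet L Y) (hG : G ∈ D) (hG1 : IsZFunc Y G) : Sm D.toSet L (ran G) := by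
  obtain ⟨l, hl, h⟩ := h
  exact ⟨l, hl, h.comp S.hD (S.hD.trans S.hL hl) hG hG1⟩

theorem union (S : SmS D L) {Y F : ZFSet} (h : Sm D.toSet L Y) (hF : F ∈ D) (hF1 : IsZFunc Y F)
    (hF2 : ∀ y ∈ Y, Sm D.toSet L (fapp F y)) : Sm D.toSet L (⋃₀ (ran F) : ZFSet) := by
  have hD := S.hD
  have hL := S.hL
  obtain ⟨l, hl, f, hf, hf1, hf2⟩ := h
  have hlD := hD.trans hL hl
  have hYD : Y ∈ D := hD.dom_mem' hF hF1
  obtain ⟨h, hh, hh1, hh2⟩ := choiceD4 hD (fun D x m L f Y F => m ∈ L ∧ ∀ z ∈ D, z = fapp f x → z ∈ Y → ∀ w ∈ D, w = fapp F z → Im D m w)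
    hlD hL hf hYD hF (fun x hx => by
      by_cases hc : fapp f x ∈ Y
      · obtain ⟨m, hm, h⟩ := hF2 _ hc
        refine ⟨m, hD.trans hL hm, hm, ?_⟩
        rintro z _ rfl _ w _ rfl
        exact h
      · refine ⟨l, hlD, hl, ?_⟩
        rintro z _ rfl h
        exact absurd h hc)
  obtain ⟨μ, hμ, hreg⟩ := S.reg l hl h hh hh1 (fun ξ hξ => (hh2 ξ hξ).2.1)
  have hμD := hD.trans hL hμ
  have him : ∀ ξ ∈ l, fapp f ξ ∈ Y → Im D.toSet μ (fapp F (fapp f ξ)) := fun ξ hξ hY =>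
    ((hh2 ξ hξ).2.2 _ (hD.trans hYD hY) rfl hY _ (hD.fappD hF hF1 _) rfl).mono hD (hreg ξ hξ) hμD
  obtain ⟨g, hg, hg1, hg2⟩ := choiceD4 hD (fun D x g μ f Y F => IsZFunc μ g ∧ ∀ z ∈ D, z = fapp f x → z ∈ Y → ∀ w ∈ D, w = fapp F z →
      ∀ y ∈ w, ∃ η ∈ μ, y = fapp g η)
    hlD hμD hf hYD hF (fun x hx => by
      by_cases hc : fapp f x ∈ Y
      · obtain ⟨g, hg, hg1, hg2⟩ := him x hx hc
        refine ⟨g, hg, hg1, ?_⟩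
        rintro z _ rfl _ w _ rfl
        exact hg2
      · obtain ⟨g, hg, hg1, _⟩ := Im.self hD hμD
        refine ⟨g, hg, hg1, ?_⟩
        rintro z _ rfl h
        exact absurd h hc)
  obtain ⟨ν, hν, q, hq, hq1, hq2⟩ := S.prod l hl μ hμ
  have hνD := hD.trans hL hν
  obtain ⟨r, hr, hr1, hr2⟩ := choiceD4 hD (fun D ζ y q l μ g => ∀ a ∈ l, ∀ b ∈ μ, ∀ z ∈ D, z = pair a b → z = fapp q ζ →
      ∀ w ∈ D, w = fapp g a → y = fapp w b)
    hνD hq hlD hμD hg (fun ζ hζ => by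
      by_cases hc : ∃ a ∈ l, ∃ b ∈ μ, fapp q ζ = pair a b
      · obtain ⟨a, ha, b, hb, hab⟩ := hc
        refine ⟨fapp (fapp g a) b, hD.fappD (hD.fappD hg hg1 a) (hg2 a ha).2.1 b, ?_⟩
        rintro a' ha' b' hb' z hz rfl h w hw rfl
        rw [hab] at h
        obtain ⟨rfl, rfl⟩ := pair_inj.1 h
        rfl
      · refine ⟨∅, hD.empty_mem, ?_⟩
        rintro a' ha' b' hb' z hz rfl h w hw rfl
        exact absurd ⟨a', ha', b', hb', h.symm⟩ hc)
  refine ⟨ν, hν, r, hr, hr1, fun y hy => ?_⟩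
  obtain ⟨w, hw, hyw⟩ := mem_sUnion.1 hy
  obtain ⟨b, hb, rfl⟩ := (mem_ran' hF1).1 hw
  obtain ⟨ξ, hξ, rfl⟩ := hf2 b hb
  obtain ⟨η, hη, hη'⟩ := (hg2 ξ hξ).2.2 _ (hD.trans hYD hb) rfl hb _ (hD.fappD hF hF1 _) rfl y hyw
  obtain ⟨ζ, hζ, hζ'⟩ := hq2 (pair ξ η) (pair_mem_prod.2 ⟨hξ, hη⟩)
  refine ⟨ζ, hζ, ?_⟩
  rw [(hr2 ζ hζ).2 ξ hξ η hη _ (hD.pair_mem (hD.trans hlD hξ) (hD.trans hμD hη)) rfl hζ' _ (hD.fappD hg hg1 _) rfl]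
  exact hη'

theorem upair (S : SmS D L) {a b : ZFSet} (ha : a ∈ D) (hb : b ∈ D) : Sm D.toSet L {a, b} := by
  have hD := S.hD
  obtain ⟨l, hl, hω⟩ := S.om
  obtain ⟨f, hf, hf1, hf2⟩ := choiceD2 hD (fun D x y a b => (x = ∅ → y = a) ∧ (¬ x = ∅ → y = b)) (hD.trans S.hL hl) ha hb (fun x _ => by
    by_cases hx : x = ∅
    · exact ⟨a, ha, by simp [hx], by simp [hx]⟩
    · exact ⟨b, hb, by simp [hx], by simp [hx]⟩)
  have h0 : nn 0 ∈ l := hω (nn_mem 0)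
  have h1 : nn 1 ∈ l := hω (nn_mem 1)
  refine ⟨l, hl, f, hf, hf1, fun y hy => ?_⟩
  rw [ZFSet.mem_pair] at hy
  rcases hy with rfl | rfl
  · exact ⟨_, h0, ((hf2 _ h0).2.1 rfl).symm⟩
  · refine ⟨_, h1, ((hf2 _ h1).2.2 ?_).symm⟩
    intro h
    have : nn 1 = nn 0 := h
    exact absurd (nn_inj this) (by simp)

theorem sing (S : SmS D L) {a : ZFSet} (ha : a ∈ D) : Sm D.toSet L {a} := by
  have := S.upair ha ha
  simpa using this

theorem un (S : SmS D L) {A B : ZFSet} (hA : A ∈ D) (hB : B ∈ D) (h1 : Sm D.toSet L A) (h2 : Sm D.toSet L B) : Sm D.toSet L (A ∪ B) := by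
  have hD := S.hD
  obtain ⟨g, hg, hg1, hg2⟩ := (replD0 hD (fun _ x y => y = x) (hD.upair hA hB) (fun x => x) (fun x hx => hD.trans (hD.upair hA hB) hx)
    (fun x _ y _ => Iff.rfl)).2
  refine (S.union (S.upair hA hB) hg hg1 ?_).sub ?_
  · intro y hy
    rw [hg2 y hy]
    rcases ZFSet.mem_pair.1 hy with rfl | rfl <;> assumption
  · intro x hx
    rw [mem_sUnion]
    rcases ZFSet.mem_union.1 hx with h | h
    · exact ⟨A, (mem_ran' hg1).2 ⟨A, by simp, hg2 _ (by simp)⟩, h⟩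
    · exact ⟨B, (mem_ran' hg1).2 ⟨B, by simp, hg2 _ (by simp)⟩, h⟩

theorem prod2 (S : SmS D L) {A B : ZFSet} (hA : A ∈ D) (hB : B ∈ D) (h1 : Sm D.toSet L A) (h2 : Sm D.toSet L B) : Sm D.toSet L (ZFSet.prod A B) := by
  have hD := S.hD
  obtain ⟨F, hF, hF1, hF2⟩ := choiceD1 hD (fun D a y B => ∀ b ∈ B, pair a b ∈ y ∧ Im D B y) hA hB (fun a ha => by
    have ha' := hD.trans hA ha
    have hp : ∀ b ∈ B, pair a b ∈ D := fun b hb => hD.pair_mem ha' (hD.trans hB hb)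
    obtain ⟨g, hg, hg1, hg2⟩ := (replD1 hD (fun _ x y a => y = pair a x) hB ha' (fun x => pair a x) hp (fun x _ y _ => Iff.rfl)).2
    refine ⟨ran g, hD.ran_mem hg, fun b hb => ⟨(mem_ran' hg1).2 ⟨b, hb, hg2 b hb⟩, (Im.self hD hB).comp hD hB hg hg1⟩⟩)
  have key : Sm D.toSet L (⋃₀ (ran F) : ZFSet) ∨ B = ∅ := by
    by_cases hb : B = ∅
    · exact Or.inr hb
    · left
      obtain ⟨b, hb⟩ : ∃ b, b ∈ B := by
        by_contra hn
        push Not at hn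
        exact hb ((ZFSet.eq_empty _).2 hn)
      refine S.union h1 hF hF1 fun a ha => ?_
      obtain ⟨g, hg, hg1, hg2⟩ := ((hF2 a ha).2 b hb).2
      refine (S.comp h2 hg hg1).sub fun y hy => ?_
      obtain ⟨ξ, hξ, rfl⟩ := hg2 y hy
      exact (mem_ran' hg1).2 ⟨ξ, hξ, rfl⟩
  rcases key with h | rfl
  · refine h.sub fun x hx => ?_
    obtain ⟨a, ha, b, hb, rfl⟩ := mem_prod.1 hx
    exact mem_sUnion.2 ⟨_, (mem_ran' hF1).2 ⟨a, ha, rfl⟩, ((hF2 a ha).2 b hb).1⟩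
  · refine h2.sub fun x hx => ?_
    obtain ⟨a, ha, b, hb, rfl⟩ := mem_prod.1 hx
    exact absurd hb (notMem_empty _)

theorem hs_of (S : SmS D L) {x : ZFSet} (hx : x ∈ D) (h : ∀ y ∈ x, HS D.toSet L y) (hs : Sm D.toSet L x) : HS D.toSet L x := by
  have hD := S.hD
  obtain ⟨F, hF, hF1, hF2⟩ := choiceD1 hD (fun D a T L => T.IsTransitive ∧ a ∈ T ∧ Sm D L T) hx S.hL (fun a ha => by
    obtain ⟨T, hT, h⟩ := h a ha
    exact ⟨T, hT, h⟩)
  have h1 := S.union hs hF hF1 (fun y hy => (hF2 y hy).2.2.2)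
  have hu := hD.sUnion_mem (hD.ran_mem hF)
  refine ⟨⋃₀ (ran F) ∪ {x}, hD.union_mem hu (hD.sing hx), ?_, by simp, S.un hu (hD.sing hx) h1 (S.sing hx)⟩
  intro y hy z hz
  rw [ZFSet.mem_union] at hy ⊢
  left
  rw [mem_sUnion] at hy ⊢
  rcases hy with ⟨w, hw, hyw⟩ | hy
  · obtain ⟨b, hb, rfl⟩ := (mem_ran' hF1).1 hw
    exact ⟨_, hw, (hF2 b hb).2.1 y hyw hz⟩
  · rw [mem_singleton] at hy
    subst hy
    exact ⟨_, (mem_ran' hF1).2 ⟨z, hz, rfl⟩, (hF2 z hz).2.2.1⟩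

theorem hs_mem {x y : ZFSet} (h : HS D.toSet L x) (hy : y ∈ x) : HS D.toSet L y := by
  obtain ⟨T, hT, h1, h2, h3⟩ := h
  exact ⟨T, hT, h1, h1 x h2 hy, h3⟩

theorem hs_sm {x : ZFSet} (h : HS D.toSet L x) : Sm D.toSet L x := by
  obtain ⟨T, hT, h1, h2, h3⟩ := h
  exact h3.sub (h1 x h2)

theorem hs_D (hD : IsTransModel D) {x : ZFSet} (h : HS D.toSet L x) : x ∈ D := by
  obtain ⟨T, hT, h1, h2, h3⟩ := h
  exact hD.trans hT h2

theorem hs_upair (S : SmS D L) {x y : ZFSet} (hx : HS D.toSet L x) (hy : HS D.toSet L y) : HS D.toSet L {x, y} := by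
  have h1 := hs_D S.hD hx
  have h2 := hs_D S.hD hy
  refine S.hs_of (S.hD.upair h1 h2) ?_ (S.upair h1 h2)
  intro z hz
  rcases ZFSet.mem_pair.1 hz with rfl | rfl <;> assumption

theorem hs_pair (S : SmS D L) {x y : ZFSet} (hx : HS D.toSet L x) (hy : HS D.toSet L y) : HS D.toSet L (pair x y) := by
  have h := S.hs_upair hx hx
  rw [ZFSet.pair]
  refine S.hs_upair ?_ (S.hs_upair hx hy)
  simpa using h

theorem hs_sub (S : SmS D L) {x y : ZFSet} (hx : HS D.toSet L x) (hy : y ∈ D) (h : y ⊆ x) : HS D.toSet L y :=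
  S.hs_of hy (fun z hz => hs_mem hx (h hz)) ((hs_sm hx).sub h)

theorem hs_lam (S : SmS D L) {l : ZFSet} (hl : l ∈ L) (ht : l.IsTransitive) : HS D.toSet L l := by
  have hlD := S.hD.trans S.hL hl
  refine ⟨l ∪ {l}, S.hD.union_mem hlD (S.hD.sing hlD), ?_, by simp, S.un hlD (S.hD.sing hlD) ⟨l, hl, Im.self S.hD hlD⟩ (S.sing hlD)⟩
  intro y hy z hz
  rw [ZFSet.mem_union] at hy ⊢
  left
  rcases hy with h | h
  · exact ht y h hz
  · rw [mem_singleton] at h; subst h; exact hz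

/-- functions on small sets -/
theorem hs_func (S : SmS D L) {d f : ZFSet} (hd : HS D.toSet L d) (hf : f ∈ D) (hf1 : IsZFunc d f)
    (h : ∀ a ∈ d, HS D.toSet L (fapp f a)) : HS D.toSet L f := by
  have hdD := hs_D S.hD hd
  refine S.hs_of hf ?_ ?_
  · intro p hp
    obtain ⟨a, ha, b, rfl⟩ := hf1.1 p hp
    have := h a ha
    rw [fapp_eq hf1 hp] at this
    exact S.hs_pair (hs_mem hd ha) this
  · refine (S.prod2 hdD (S.hD.ran_mem hf) (hs_sm hd) (S.comp (hs_sm hd) hf hf1)).sub ?_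
    intro p hp
    obtain ⟨a, ha, b, rfl⟩ := hf1.1 p hp
    exact pair_mem_prod.2 ⟨ha, mem_ran.2 ⟨a, hp⟩⟩

theorem hs_ran (S : SmS D L) {d f : ZFSet} (hd : HS D.toSet L d) (hf : f ∈ D) (hf1 : IsZFunc d f)
    (h : ∀ a ∈ d, HS D.toSet L (fapp f a)) : HS D.toSet L (ran f) := by
  refine S.hs_of (S.hD.ran_mem hf) ?_ (S.comp (hs_sm hd) hf hf1)
  intro y hy
  obtain ⟨a, ha, rfl⟩ := (mem_ran' hf1).1 hy
  exact h a ha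

theorem model (S : SmS D L) {H : ZFSet} (hH : H ∈ D) (hH' : ∀ x, x ∈ H ↔ HS D.toSet L x) : IsTransModel H := by
  have hD := S.hD
  have hHD : ∀ x, x ∈ H → x ∈ D := fun x hx => hD.trans hH hx
  refine ⟨?_, ?_, ?_, ?_, ?_, ?_, ?_⟩
  · intro x hx y hy
    rw [hH'] at hx ⊢
    exact hs_mem hx hy
  · rw [hH']
    have ho : omega.IsTransitive := isOrd_omega.1
    obtain ⟨l, hl, hω⟩ := S.om
    have hω' := hD.omega_mem
    have h1 : Sm D.toSet L omega := (show Sm D.toSet L l from ⟨l, hl, Im.self hD (hD.trans S.hL hl)⟩).sub hω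
    refine ⟨omega ∪ {omega}, hD.union_mem hω' (hD.sing hω'), ?_, by simp, S.un hω' (hD.sing hω') h1 (S.sing hω')⟩
    intro y hy z hz
    rw [ZFSet.mem_union] at hy ⊢
    left
    rcases hy with h | h
    · exact ho y h hz
    · rw [mem_singleton] at h; subst h; exact hz
  · intro x hx y hy
    rw [hH'] at *
    exact S.hs_upair hx hy
  · intro x hx
    rw [hH'] at *
    obtain ⟨T, hT, h1, h2, h3⟩ := hx
    have hxD := hD.trans hT h2
    refine S.hs_of (hD.sUnion_mem hxD) ?_ (h3.sub ?_)
    · intro y hy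
      obtain ⟨z, hz, hyz⟩ := mem_sUnion.1 hy
      exact ⟨T, hT, h1, h1 z (h1 x h2 hz) hyz, h3⟩
    · intro y hy
      obtain ⟨z, hz, hyz⟩ := mem_sUnion.1 hy
      exact h1 z (h1 x h2 hz) hyz
  · intro φ v hv a ha
    have inst : UDef (fun D w => Sat (w 1).toSet φ (fun n => w (if n = 0 then 0 else n + 2))) := inferInstance
    have h := sepv hD (fun D w => Sat (w 1).toSet φ (fun n => w (if n = 0 then 0 else n + 2))) (cons' H v)
      (cons'_mem (D := D.toSet) hH (fun n => hHD _ (hv n))) (hHD a ha)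
    have e : ∀ x, (fun n => cons' x (cons' H v) (if n = 0 then 0 else n + 2)) = Function.update v 0 x := by
      intro x; funext n; cases n <;> rfl
    refine ⟨_, (hH' _).2 (S.hs_sub ((hH' _).1 ha) h (fun x hx => (mem_sep.1 hx).1)), fun x => ?_⟩
    rw [mem_sep, e]; rfl
  · intro φ v hv a ha hyp
    have inst : UDef (fun D w => w 1 ∈ w 2 ∧ Sat (w 2).toSet φ (fun n => w (if n = 0 then 0 else if n = 1 then 1 else n + 3))) := inferInstance
    have e : ∀ x y, (fun n => cons' x (cons' y (cons' H v)) (if n = 0 then 0 else if n = 1 then 1 else n + 3)) =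
        Function.update (Function.update v 0 x) 1 y := by
      intro x y; funext n; rcases n with _ | _ | n <;> rfl
    obtain ⟨f, hf, hf1, hf2⟩ := choicev hD (fun D w => w 1 ∈ w 2 ∧ Sat (w 2).toSet φ (fun n => w (if n = 0 then 0 else if n = 1 then 1 else n + 3))) (cons' H v)
      (cons'_mem (D := D.toSet) hH (fun n => hHD _ (hv n))) (hHD a ha) (fun x hx => by
        obtain ⟨y, hy, h⟩ := hyp x hx
        refine ⟨y, hHD y hy, hy, ?_⟩
        rw [e]; exact h)
    refine ⟨ran f, (hH' _).2 (S.hs_ran ((hH' _).1 ha) hf hf1 fun x hx => (hH' _).1 (hf2 x hx).2.1), fun x hx => ?_⟩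
    refine ⟨fapp f x, (mem_ran' hf1).2 ⟨x, hx, rfl⟩, ?_⟩
    have := (hf2 x hx).2.2
    rw [e] at this
    exact this
  · intro x hx
    have hxD := hHD x hx
    obtain ⟨r, hr, hwo⟩ := hD.2.2.2.2.2.2 x hxD
    refine ⟨r, ?_, hwo⟩
    rw [hH'] at hx ⊢
    refine S.hs_of hr ?_ ((S.prod2 hxD hxD (hs_sm hx) (hs_sm hx)).sub ?_)
    · intro p hp
      obtain ⟨a, ha, b, hb, rfl⟩ := hwo.1 p hp
      exact S.hs_pair (hs_mem hx ha) (hs_mem hx hb)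
    · intro p hp
      obtain ⟨a, ha, b, hb, rfl⟩ := hwo.1 p hp
      exact pair_mem_prod.2 ⟨ha, hb⟩

end SmS

/-! ## Hereditarily small sets, coding -/

instance UDef.fappMemFapp (i j k l : ℕ) : UDef (fun _ v => fapp (v i) (v j) ∈ fapp (v k) (v l)) :=
  (inferInstance : UDef (fun _ v => ∃ p ∈ v k, ∃ z ∈ p, ∃ b ∈ z, pair (v l) b ∈ v k ∧ fapp (v i) (v j) ∈ b)).congr
    fun D _ v _ => mem_fapp.symm

instance UDef.fappEqFapp (i j k l : ℕ) : UDef (fun _ v => fapp (v i) (v j) = fapp (v k) (v l)) :=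
  (inferInstance : UDef (fun _ v => (∀ p ∈ v i, ∀ z ∈ p, ∀ b ∈ z, pair (v j) b ∈ v i → ∀ x ∈ b, x ∈ fapp (v k) (v l)) ∧
    (∀ p ∈ v k, ∀ z ∈ p, ∀ b ∈ z, pair (v l) b ∈ v k → ∀ x ∈ b, x ∈ fapp (v i) (v j)))).congr
    fun D _ v _ => by
      constructor
      · rintro ⟨h1, h2⟩
        ext x
        constructor
        · intro hx
          obtain ⟨p, hp, z, hz, b, hb, h, hx⟩ := mem_fapp.1 hx
          exact h1 p hp z hz b hb h x hx
        · intro hx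
          obtain ⟨p, hp, z, hz, b, hb, h, hx⟩ := mem_fapp.1 hx
          exact h2 p hp z hz b hb h x hx
      · intro h
        refine ⟨fun p hp z hz b hb h1 x hx => ?_, fun p hp z hz b hb h1 x hx => ?_⟩
        · rw [← h]; exact mem_fapp.2 ⟨p, hp, z, hz, b, hb, h1, hx⟩
        · rw [h]; exact mem_fapp.2 ⟨p, hp, z, hz, b, hb, h1, hx⟩

instance UDef.fappSub (i j k : ℕ) : UDef (fun _ v => fapp (v i) (v j) ⊆ v k) :=
  (inferInstance : UDef (fun _ v => ∀ p ∈ v i, ∀ z ∈ p, ∀ b ∈ z, pair (v j) b ∈ v i → b ⊆ v k)).congr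
    fun D _ v _ => by
      constructor
      · intro h x hx
        obtain ⟨p, hp, z, hz, b, hb, h', hx⟩ := mem_fapp.1 hx
        exact h p hp z hz b hb h' hx
      · intro h p hp z hz b hb h1 x hx
        exact h (mem_fapp.2 ⟨p, hp, z, hz, b, hb, h1, hx⟩)

theorem fapp_elD {D : Set ZFSet} (hD : TrS D) {f a x : ZFSet} (hf : f ∈ D) (h : x ∈ fapp f a) : x ∈ D := by
  obtain ⟨p, hp, z, hz, b, hb, _, hx⟩ := UDef.mem_fapp.1 h
  exact hD _ (hD _ (hD _ (hD _ hf _ hp) _ hz) _ hb) _ hx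

instance UDef.ballFapp (i j : ℕ) (Q : Set ZFSet → ZFSet → (ℕ → ZFSet) → Prop)
    [h : UDef (fun D v => Q D (v 0) (fun n => v (n+1)))] :
    UDef (fun D v => ∀ x ∈ fapp (v i) (v j), Q D x v) :=
  (UDef.allD (fun D x v => x ∈ fapp (v i) (v j) → Q D x v) (h := UDef.imp (h := UDef.memFapp (i+1) (j+1) 0) (h' := h))).congr
    fun D hD v hv => ⟨fun H x hx => H x (fapp_elD hD (hv i) hx) hx, fun H x _ hx => H x hx⟩

instance UDef.bexFapp (i j : ℕ) (Q : Set ZFSet → ZFSet → (ℕ → ZFSet) → Prop)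
    [h : UDef (fun D v => Q D (v 0) (fun n => v (n+1)))] :
    UDef (fun D v => ∃ x ∈ fapp (v i) (v j), Q D x v) :=
  (UDef.not (h := UDef.ballFapp i j (fun D x v => ¬ Q D x v) (h := UDef.not (h := h)))).congr
    fun D _ v _ => by push Not; rfl

theorem sm_sing {D : Set ZFSet} {l T : ZFSet} : Sm D {l} T ↔ Im D l T := by
  constructor
  · rintro ⟨m, hm, h⟩
    rw [mem_singleton] at hm; subst hm; exact h
  · exact fun h => ⟨l, by simp, h⟩

def CollB (D : Set ZFSet) (l c s : ZFSet) : Prop :=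
  ∀ ξ ∈ l, ∀ w ∈ D, w = fapp s ξ → ((∀ z ∈ w, ∃ ζ ∈ l, pair ζ ξ ∈ c ∧ z = fapp s ζ) ∧ ∀ ζ ∈ l, pair ζ ξ ∈ c → fapp s ζ ∈ w)

instance UDef.collB (i j k : ℕ) : UDef (fun D v => CollB D (v i) (v j) (v k)) := by unfold CollB; infer_instance

theorem collB_iff {D l c s : ZFSet} (hD : IsTransModel D) (hs : s ∈ D) (h : IsZFunc l s) :
    CollB D.toSet l c s ↔ IsColl l c (fapp s) := by
  constructor
  · intro H ξ hξ z
    obtain ⟨h1, h2⟩ := H ξ hξ _ (hD.fappD hs h ξ) rfl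
    constructor
    · exact h1 z
    · rintro ⟨ζ, hζ, h, rfl⟩
      exact h2 ζ hζ h
  · rintro H ξ hξ w hw rfl
    refine ⟨fun z hz => (H ξ hξ z).1 hz, fun ζ hζ hc => (H ξ hξ _).2 ⟨ζ, hζ, hc, rfl⟩⟩

theorem IsColl.wf {d E : ZFSet} {ρ : ZFSet → ZFSet} (h : IsColl d E ρ) (hd : ∀ a b, pair a b ∈ E → b ∈ d) : WFOn d E := by
  refine Subrelation.wf (r := InvImage (· ∈ ·) ρ) ?_ (InvImage.wf ρ ZFSet.mem_wf)
  rintro a b ⟨ha, hab⟩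
  exact (h b (hd _ _ hab) _).2 ⟨a, ha, hab, rfl⟩

/-- surjective enumeration of a nonempty set -/
theorem Im.surj {D l T t : ZFSet} (hD : IsTransModel D) (hl : l ∈ D) (hT : T ∈ D) (ht : t ∈ T) (h : Im D.toSet l T) :
    ∃ s ∈ D, IsZFunc l s ∧ SurjOnto s l T := by
  obtain ⟨f, hf, hf1, hf2⟩ := h
  obtain ⟨s, hs, hs1, hs2⟩ := choiceD3 hD (fun D x y f T t => y ∈ T ∧ (fapp f x ∈ T → y = fapp f x)) hl hf hT (hD.trans hT ht) (fun x hx => by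
    by_cases hc : fapp f x ∈ T
    · exact ⟨_, hD.trans hT hc, hc, fun _ => rfl⟩
    · exact ⟨t, hD.trans hT ht, ht, fun h => absurd h hc⟩)
  refine ⟨s, hs, hs1, fun a ha => (hs2 a ha).2.1, fun b hb => ?_⟩
  obtain ⟨ξ, hξ, rfl⟩ := hf2 b hb
  exact ⟨ξ, hξ, (hs2 ξ hξ).2.2 hb⟩

theorem coll_of_surj {l T s E : ZFSet} (hT : T.IsTransitive) (hs : SurjOnto s l T)
    (hE : ∀ ζ ∈ l, ∀ ξ ∈ l, (pair ζ ξ ∈ E ↔ fapp s ζ ∈ fapp s ξ)) : IsColl l E (fapp s) := by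
  intro ξ hξ z
  constructor
  · intro hz
    obtain ⟨ζ, hζ, rfl⟩ := hs.2 z (hT _ (hs.1 ξ hξ) hz)
    exact ⟨ζ, hζ, (hE _ hζ _ hξ).2 hz, rfl⟩
  · rintro ⟨ζ, hζ, h, rfl⟩
    exact (hE _ hζ _ hξ).1 h

theorem hset {D l P : ZFSet} (hD : IsTransModel D) (hl : l ∈ D) (hP : P ∈ D) (hP' : ∀ c, c ∈ P ↔ c ∈ D ∧ c ⊆ ZFSet.prod l l) :
    ∃ C ∈ D, IsZFunc P C ∧ (∀ c ∈ P, IsZFunc l (fapp C c)) ∧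
      ∀ x, HS D.toSet {l} x → ∃ c ∈ P, ∃ ξ ∈ l, x = fapp (fapp C c) ξ := by
  obtain ⟨C, hC, hC1, hC2⟩ := choiceD1 hD (fun D c y l => IsZFunc l y ∧ ((∃ s ∈ D, IsZFunc l s ∧ CollB D l c s) → CollB D l c y)) hP hl (fun c hc => by
    by_cases h : ∃ s ∈ D.toSet, IsZFunc l s ∧ CollB D.toSet l c s
    · obtain ⟨s, hs, h1, h2⟩ := h
      exact ⟨s, hs, h1, fun _ => h2⟩
    · obtain ⟨s, hs, h1, h2⟩ := Im.self hD hl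
      exact ⟨s, hs, h1, fun h' => absurd h' h⟩)
  refine ⟨C, hC, hC1, fun c hc => (hC2 c hc).2.1, ?_⟩
  rintro x ⟨T, hT, hTt, hx, hsm⟩
  obtain ⟨s, hs, hs1, hs2⟩ := (sm_sing.1 hsm).surj hD hl hT hx
  set E := ZFSet.sep (fun e => ∃ ζ ∈ l, ∃ ξ ∈ l, e = pair ζ ξ ∧ fapp s ζ ∈ fapp s ξ) (ZFSet.prod l l) with hE
  have hED : E ∈ D := sep2 hD (P := fun e l s => ∃ ζ ∈ l, ∃ ξ ∈ l, e = pair ζ ξ ∧ fapp s ζ ∈ fapp s ξ) (hD.prod_mem hl hl) hl hs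
  have hE' : ∀ ζ ∈ l, ∀ ξ ∈ l, (pair ζ ξ ∈ E ↔ fapp s ζ ∈ fapp s ξ) := by
    intro ζ hζ ξ hξ
    rw [hE, mem_sep]
    constructor
    · rintro ⟨_, a, _, b, _, h, h'⟩
      obtain ⟨rfl, rfl⟩ := pair_inj.1 h
      exact h'
    · exact fun h => ⟨pair_mem_prod.2 ⟨hζ, hξ⟩, ζ, hζ, ξ, hξ, rfl, h⟩
  have hEP : E ∈ P := (hP' E).2 ⟨hED, fun z hz => (mem_sep.1 hz).1⟩
  have hco := coll_of_surj hTt hs2 hE'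
  have hwf : WFOn l E := hco.wf (fun a b h => (pair_mem_prod.1 (mem_sep.1 h).1).2)
  have hcy := (hC2 E hEP).2.2 ⟨s, hs, hs1, (collB_iff hD hs hs1).2 hco⟩
  rw [collB_iff hD (hC2 E hEP).1 (hC2 E hEP).2.1] at hcy
  obtain ⟨ξ, hξ, h⟩ := hs2.2 x hx
  exact ⟨E, hEP, ξ, hξ, by rw [← h, hco.unique hwf hcy ξ hξ]⟩

theorem hset' {D l P : ZFSet} (hD : IsTransModel D) (hl : l ∈ D) (hP : P ∈ D) (hP' : ∀ c, c ∈ P ↔ c ∈ D ∧ c ⊆ ZFSet.prod l l) :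
    ∃ H ∈ D, ∀ x, x ∈ H ↔ HS D.toSet {l} x := by
  obtain ⟨C, hC, hC1, hC2, hC3⟩ := hset hD hl hP hP'
  have hfD : ∀ c ∈ P, ∀ ξ, fapp (fapp C c) ξ ∈ D := fun c hc ξ => hD.fappD (hD.fappD hC hC1 c) (hC2 c hc) ξ
  obtain ⟨f, hf, hf1, hf2⟩ := choiceD1 hD (fun D c y C => ∀ w ∈ D, w = fapp C c → ∀ z ∈ w, ∀ a ∈ D, ∀ b ∈ D, z = pair a b → b ∈ y) hP hC (fun c hc => by
    refine ⟨ran (fapp C c), hD.ran_mem (hD.fappD hC hC1 c), ?_⟩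
    rintro w hw rfl z hz a ha b hb rfl
    exact mem_ran.2 ⟨a, hz⟩)
  refine ⟨_, sepD1 hD (fun D x L => HS D L x) (a := (⋃₀ ran f : ZFSet)) (hD.sUnion_mem (hD.ran_mem hf)) (hD.sing hl), fun x => ?_⟩
  rw [mem_sep]
  refine ⟨fun h => h.2, fun h => ⟨?_, h⟩⟩
  obtain ⟨c, hc, ξ, hξ, rfl⟩ := hC3 x h
  exact mem_sUnion.2 ⟨fapp f c, (mem_ran' hf1).2 ⟨c, hc, rfl⟩,
    (hf2 c hc).2 _ (hD.fappD hC hC1 c) rfl _ (fapp_mem (hC2 c hc) hξ) _ (hD.trans hl hξ) _ (hfD c hc ξ) rfl⟩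

structure CodeP (κ p : ZFSet) : Prop where
  mem : ∀ D, IsTransModel D → κ ∈ D → p ∈ D
  fn : IsZFunc (ZFSet.prod κ κ) p
  maps : ∀ a ∈ κ, ∀ b ∈ κ, fapp p (pair a b) ∈ κ
  inj : ∀ a ∈ κ, ∀ b ∈ κ, ∀ c ∈ κ, ∀ d ∈ κ, fapp p (pair a b) = fapp p (pair c d) → a = c ∧ b = d
  bdd : ∀ lam ∈ κ, ∃ ν ∈ κ, ∀ a ∈ lam, ∀ b ∈ lam, fapp p (pair a b) ∈ ν

/-- `c` codes (via `s`) a transitive set -/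
def Codes (κ p c s : ZFSet) : Prop := c ⊆ κ ∧ IsZFunc κ s ∧
  ∀ ξ ∈ κ, ∀ z, z ∈ fapp s ξ ↔ ∃ ζ ∈ κ, fapp p (pair ζ ξ) ∈ c ∧ z = fapp s ζ

theorem decode {κ p c s D : ZFSet} (hp : CodeP κ p) (hD : IsTransModel D) (hκ : κ ∈ D) (hc : c ∈ D) (h : Codes κ p c s) : s ∈ D := by
  obtain ⟨h1, h2, h3⟩ := h
  set E := ZFSet.sep (fun e => fapp p e ∈ c) (ZFSet.prod κ κ) with hE
  have hED : E ∈ D := sep2 hD (P := fun e p c => fapp p e ∈ c) (hD.prod_mem hκ hκ) (hp.mem D hD hκ) hc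
  have hco : IsColl κ E (fapp s) := by
    intro ξ hξ z
    rw [h3 ξ hξ z]
    constructor
    · rintro ⟨ζ, hζ, h, h'⟩
      exact ⟨ζ, hζ, mem_sep.2 ⟨pair_mem_prod.2 ⟨hζ, hξ⟩, h⟩, h'⟩
    · rintro ⟨ζ, hζ, h, h'⟩
      exact ⟨ζ, hζ, (mem_sep.1 h).2, h'⟩
  have hwf : WFOn κ E := hco.wf (fun a b h => (pair_mem_prod.1 (mem_sep.1 h).1).2)
  obtain ⟨f, hf, hf1, hf2⟩ := most hD hκ hED hwf
  rw [func_ext h2 hf1 (hco.unique hwf hf2)]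
  exact hf

theorem code {κ p T D x : ZFSet} (hp : CodeP κ p) (hD : IsTransModel D) (hκ : κ ∈ D) (hT : T ∈ D) (hTt : T.IsTransitive) (hx : x ∈ T)
    (h : Im D.toSet κ T) : ∃ c ∈ D, ∃ s ∈ D, Codes κ p c s ∧ SurjOnto s κ T := by
  obtain ⟨s, hs, hs1, hs2⟩ := h.surj hD hκ hT hx
  have hpD := hp.mem D hD hκ
  have hc := sepD3 hD (fun D e κ p s => ∃ ζ ∈ κ, ∃ ξ ∈ κ, (∃ z ∈ D, z = pair ζ ξ ∧ e = fapp p z) ∧ fapp s ζ ∈ fapp s ξ) hκ hκ hpD hs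
  refine ⟨_, hc, s, hs, ⟨fun z hz => (mem_sep.1 hz).1, hs1, ?_⟩, hs2⟩
  intro ξ hξ z
  constructor
  · intro hz
    obtain ⟨ζ, hζ, rfl⟩ := hs2.2 z (hTt _ (hs2.1 ξ hξ) hz)
    exact ⟨ζ, hζ, mem_sep.2 ⟨hp.maps _ hζ _ hξ, ζ, hζ, ξ, hξ, ⟨_, hD.pair_mem (hD.trans hκ hζ) (hD.trans hκ hξ), rfl, rfl⟩, hz⟩, rfl⟩
  · rintro ⟨ζ, hζ, h, rfl⟩
    obtain ⟨_, a, ha, b, hb, ⟨z, _, rfl, he⟩, h⟩ := mem_sep.1 h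
    obtain ⟨rfl, rfl⟩ := hp.inj _ hζ _ hξ _ ha _ hb he
    exact h

/-! ## One ultrapower step -/

theorem hs_code {κ p D x : ZFSet} (hp : CodeP κ p) (hD : IsTransModel D) (hκ : κ ∈ D) (h : HS D.toSet {κ} x) :
    ∃ c ∈ D, c ⊆ κ ∧ ∀ M, IsTransModel M → κ ∈ M → c ∈ M → x ∈ M := by
  obtain ⟨T, hT, hTt, hx, hsm⟩ := h
  obtain ⟨c, hc, s, hs, h1, h2⟩ := code hp hD hκ hT hTt hx (sm_sing.1 hsm)
  refine ⟨c, hc, h1.1, fun M hM hκM hcM => ?_⟩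
  have hsM := decode hp hM hκM hcM h1
  obtain ⟨ξ, hξ, rfl⟩ := h2.2 x hx
  exact hM.fapp_memM hsM h1.2.1 hξ

theorem smS_sing {κ p D : ZFSet} (hp : CodeP κ p) (hD : IsTransModel D) (hκ : κ ∈ D) (hω : omega ⊆ κ) : SmS D {κ} := by
  refine ⟨hD, hD.sing hκ, ?_, ?_, ⟨κ, by simp, hω⟩⟩
  · intro l hl f hf hf1 h
    refine ⟨κ, by simp, fun ξ hξ => ?_⟩
    have := h ξ hξ
    rw [mem_singleton] at this
    rw [this]
  · intro l hl m hm
    rw [mem_singleton] at hl hm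
    subst hm; subst hl
    refine ⟨l, by simp, ?_⟩
    obtain ⟨f, hf, hf1, hf2⟩ := choiceD2 hD (fun D x y p l => ∀ a ∈ l, ∀ b ∈ l, ∀ z ∈ D, z = pair a b → x = fapp p z → y = z) hκ (hp.mem D hD hκ) hκ (fun x hx => by
      by_cases hc : ∃ a ∈ l, ∃ b ∈ l, x = fapp p (pair a b)
      · obtain ⟨a, ha, b, hb, rfl⟩ := hc
        refine ⟨pair a b, hD.pair_mem (hD.trans hκ ha) (hD.trans hκ hb), ?_⟩
        rintro a' ha' b' hb' z hz rfl h
        obtain ⟨rfl, rfl⟩ := hp.inj _ ha _ hb _ ha' _ hb' h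
        rfl
      · refine ⟨∅, hD.empty_mem, ?_⟩
        rintro a' ha' b' hb' z hz rfl h
        exact absurd ⟨a', ha', b', hb', h⟩ hc)
    refine ⟨f, hf, hf1, fun y hy => ?_⟩
    obtain ⟨a, ha, b, hb, rfl⟩ := mem_prod.1 hy
    exact ⟨_, hp.maps _ ha _ hb, ((hf2 _ (hp.maps _ ha _ hb)).2 a ha b hb _ (hD.pair_mem (hD.trans hκ ha) (hD.trans hκ hb)) rfl rfl).symm⟩

structure Wit (κ M U N : ZFSet) (j : ZFSet → ZFSet) : Prop where
  hM : IsTransModel M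
  hκ : κ ∈ M
  ord : κ.IsOrdinal
  hU : IsMUltrafilter κ M U
  wa : WeaklyAmenable κ M U
  el : El M N j
  gen : ∀ a ∈ N, ∃ f ∈ M, IsZFunc κ f ∧ fapp (j f) κ = a
  ui : ∀ A ∈ M, A ⊆ κ → (A ∈ U ↔ κ ∈ j A)

namespace Wit
variable {κ M U N : ZFSet} {j : ZFSet → ZFSet}

theorem kU (h : Wit κ M U N j) (h0 : ∅ ∈ κ) : κ ∈ U := by
  have h1 := h.hU.2.1 ∅ h0
  exact h.hU.2.2.2.2.1 _ h1 κ h.hκ (fun x hx => hx) (fun x hx => (mem_sep.1 hx).1)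

theorem kj (h : Wit κ M U N j) (h0 : ∅ ∈ κ) : κ ∈ j κ := (h.ui κ h.hκ (fun x hx => hx)).1 (h.kU h0)

theorem los (h : Wit κ M U N j) (h0 : ∅ ∈ κ) (P : ZFSet → ZFSet → ZFSet → Prop) [UDef (fun _ v => P (v 0) (v 1) (v 2))]
    {p q : ZFSet} (hp : p ∈ M) (hq : q ∈ M) : ZFSet.sep (fun ξ => P ξ p q) κ ∈ U ↔ P κ (j p) (j q) := by
  have hB : ZFSet.sep (fun ξ => P ξ p q) κ ∈ M := sep2 h.hM (P := P) h.hκ hp hq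
  rw [h.ui _ hB (fun x hx => (mem_sep.1 hx).1)]
  have I : UDef (fun _ v => P (v 0) (v 1) (v 2)) := inferInstance
  have I1 : UDef (fun D v => P (v 0) (v (2 + 1)) (v (3 + 1))) := UDef.comp I (fun n => if n = 0 then 0 else n + 2)
  have I2 : UDef (fun _ v => ∀ x ∈ v 1, (x ∈ v 0 ↔ P x (v 2) (v 3))) := inferInstance
  have := (h.el.tr4 (fun b κ p q => ∀ x ∈ κ, (x ∈ b ↔ P x p q)) hB h.hκ hp hq).1 (fun x hx => by rw [mem_sep]; simp [hx])
  exact this κ (h.kj h0)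

theorem Nmod (h : Wit κ M U N j) : IsTransModel N := by
  have h0 : j ∅ = ∅ := (h.el.tr1 (fun x => x = ∅) h.hM.empty_mem).1 rfl
  refine transModel_transfer h.hM h.el.trN (h0 ▸ h.el.maps _ h.hM.empty_mem) fun σ hσ => ?_
  have := (h.el.el σ (fun _ => ∅) (fun _ => h.hM.empty_mem)).1 hσ
  simpa [h0] using this

theorem fixed (h : Wit κ M U N j) (h0 : ∅ ∈ κ) (ξ : ZFSet) : ξ ∈ κ → j ξ = ξ := by
  induction ξ using ZFSet.inductionOn with
  | _ ξ ih =>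
    intro hξ
    have hξM := h.hM.trans h.hκ hξ
    ext a
    constructor
    · intro ha
      have haN := h.el.trN _ (h.el.maps _ hξM) ha
      obtain ⟨f, hf, hf1, rfl⟩ := h.gen a haN
      have hB : ZFSet.sep (fun η => fapp f η ∈ ξ) κ ∈ U :=
        (h.los h0 (fun η f ξ => fapp f η ∈ ξ) hf hξM).2 ha
      have hR : ZFSet.sep (fun η => fapp f η ∈ η) κ ∈ U := by
        refine h.hU.2.2.2.2.1 _ (h.hU.2.2.2.1 _ hB _ (h.hU.2.1 ξ hξ)) _ ?_ (fun x hx => (mem_sep.1 hx).1) ?_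
        · exact sep1 h.hM (P := fun η f => fapp f η ∈ η) h.hκ hf
        · intro η hη
          rw [ZFSet.mem_inter] at hη
          obtain ⟨h1, h2⟩ := hη
          obtain ⟨h1, h3⟩ := mem_sep.1 h1
          have h4 : η ∉ ξ := (mem_sep.1 h2).2
          refine mem_sep.2 ⟨h1, ?_⟩
          have oη := h.ord.mem h1
          have oξ := h.ord.mem hξ
          rcases oη.mem_trichotomous oξ with h5 | h5 | h5
          · exact absurd h5 h4
          · rw [h5] at h3 ⊢; exact h3
          · exact oη.isTransitive _ h5 h3
      obtain ⟨γ, hγ, hG⟩ := h.hU.2.2.2.2.2.2 f hf hf1 hR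
      have e : fapp (j f) κ = j γ := (h.los h0 (fun η f γ => fapp f η = γ) hf (h.hM.trans h.hκ hγ)).1 hG
      have hγξ : γ ∈ ξ := by
        by_contra hn
        refine h.hU.2.2.1 ?_
        have := h.hU.2.2.2.1 _ hB _ hG
        convert this using 1
        symm
        rw [ZFSet.eq_empty]
        intro y hy
        rw [ZFSet.mem_inter, mem_sep, mem_sep] at hy
        exact hn (hy.2.2 ▸ hy.1.2)
      rw [e, ih γ hγξ hγ]
      exact hγξ
    · intro ha
      have haκ := h.ord.isTransitive _ hξ ha
      have := (h.el.tr2 (fun a b => a ∈ b) (h.hM.trans h.hκ haκ) hξM).1 ha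
      rwa [ih a ha haκ] at this

theorem jsub (h : Wit κ M U N j) (h0 : ∅ ∈ κ) {x ξ : ZFSet} (hx : x ∈ M) (hξ : ξ ∈ κ) : ξ ∈ j x ↔ ξ ∈ x := by
  have := h.el.tr2 (fun a b => a ∈ b) (h.hM.trans h.hκ hξ) hx
  rw [h.fixed h0 ξ hξ] at this
  exact this.symm

theorem jbdd (h : Wit κ M U N j) (h0 : ∅ ∈ κ) {x l : ZFSet} (hx : x ∈ M) (hl : l ∈ κ) (hxl : x ⊆ l) : j x = x := by
  have h1 := (h.el.tr2 (fun a b => a ⊆ b) hx (h.hM.trans h.hκ hl)).1 hxl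
  rw [h.fixed h0 l hl] at h1
  ext a
  constructor
  · intro ha
    exact (h.jsub h0 hx (h.ord.isTransitive _ hl (h1 ha))).1 ha
  · intro ha
    exact (h.jsub h0 hx (h.ord.isTransitive _ hl (hxl ha))).2 ha

theorem subM (h : Wit κ M U N j) (h0 : ∅ ∈ κ) {x : ZFSet} (hx : x ∈ N) (hxκ : x ⊆ κ) : x ∈ M := by
  obtain ⟨f, hf, hf1, rfl⟩ := h.gen x hx
  have hm : ∀ ξ ∈ κ, ZFSet.sep (fun η => ξ ∈ fapp f η) κ ∈ M := fun ξ hξ =>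
    sep2 h.hM (P := fun η ξ f => ξ ∈ fapp f η) h.hκ (h.hM.trans h.hκ hξ) hf
  obtain ⟨G, hG, hG1, hG2⟩ := (replD2 h.hM (fun D ξ y κ f => y ⊆ κ ∧ ∀ η ∈ κ, (η ∈ y ↔ ξ ∈ fapp f η)) h.hκ h.hκ hf
    (fun ξ => ZFSet.sep (fun η => ξ ∈ fapp f η) κ) hm (fun ξ hξ y hy => by
      constructor
      · rintro ⟨h1, h2⟩
        ext z
        rw [mem_sep]
        exact ⟨fun hz => ⟨h1 hz, (h2 z (h1 hz)).1 hz⟩, fun hz => (h2 z hz.1).2 hz.2⟩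
      · rintro rfl
        exact ⟨fun z hz => (mem_sep.1 hz).1, fun η hη => by rw [mem_sep]; simp [hη]⟩)).2
  have hr := h.hM.ran_mem hG
  have hw := h.wa (ran G) hr ⟨G, hG, hG1, fun y hy => (mem_ran' hG1).1 hy⟩
  have : fapp (j f) κ = ZFSet.sep (fun ξ => fapp G ξ ∈ ran G ∩ U) κ := by
    ext ξ
    rw [mem_sep, ZFSet.mem_inter]
    have key : ∀ ξ ∈ κ, (ξ ∈ fapp (j f) κ ↔ fapp G ξ ∈ U) := by
      intro ξ hξ
      rw [hG2 ξ hξ]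
      have := h.los h0 (fun η ξ f => ξ ∈ fapp f η) (h.hM.trans h.hκ hξ) hf
      rw [h.fixed h0 ξ hξ] at this
      exact this.symm
    constructor
    · intro hξ
      exact ⟨hxκ hξ, (mem_ran' hG1).2 ⟨ξ, hxκ hξ, rfl⟩, (key ξ (hxκ hξ)).1 hξ⟩
    · rintro ⟨h1, _, h2⟩
      exact (key ξ h1).2 h2
  rw [this]
  exact sep2 h.hM (P := fun ξ G r => fapp G ξ ∈ r) h.hκ hG hw

theorem Nmem (h : Wit κ M U N j) (h0 : ∅ ∈ κ) {D : ZFSet} (hD : IsTransModel D) (hMD : M ∈ D) (hUD : U ∈ D) : N ∈ D := by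
  have hκD := hD.trans hMD h.hκ
  have hF := sep1 hD (P := fun f κ => IsZFunc κ f) hMD hκD
  set F := ZFSet.sep (fun f => IsZFunc κ f) M with hFd
  have hE := sepD2 hD (fun D e κ U => ∃ f ∈ D, ∃ g ∈ D, e = pair f g ∧ ∃ b ∈ U, ∀ x ∈ κ, (x ∈ b ↔ fapp f x ∈ fapp g x)) (hD.prod_mem hF hF) hκD hUD
  set E := ZFSet.sep (fun e => ∃ f ∈ D.toSet, ∃ g ∈ D.toSet, e = pair f g ∧ ∃ b ∈ U, ∀ x ∈ κ, (x ∈ b ↔ fapp f x ∈ fapp g x)) (F.prod F) with hEd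
  have hE' : ∀ f ∈ F, ∀ g ∈ F, (pair f g ∈ E ↔ fapp (j f) κ ∈ fapp (j g) κ) := by
    intro f hf g hg
    have hfM := (mem_sep.1 hf).1
    have hgM := (mem_sep.1 hg).1
    rw [← h.los h0 (fun x f g => fapp f x ∈ fapp g x) hfM hgM, hEd, mem_sep]
    constructor
    · rintro ⟨_, f', _, g', _, e, b, hb, h'⟩
      obtain ⟨rfl, rfl⟩ := pair_inj.1 e
      convert hb using 1
      ext x
      rw [mem_sep]
      exact ⟨fun hx => (h' x hx.1).2 hx.2, fun hx => ⟨(h.hU.1 b hb).2 hx, (h' x ((h.hU.1 b hb).2 hx)).1 hx⟩⟩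
    · intro h'
      exact ⟨pair_mem_prod.2 ⟨hf, hg⟩, f, hD.trans hMD hfM, g, hD.trans hMD hgM, rfl, _, h', fun x hx => by rw [mem_sep]; simp [hx]⟩
  have hFN : ∀ f ∈ F, fapp (j f) κ ∈ N := by
    intro f hf
    obtain ⟨hfM, hf1⟩ := mem_sep.1 hf
    have := (h.el.tr2 (fun κ f => IsZFunc κ f) h.hκ hfM).1 hf1
    exact h.Nmod.fapp_memM (h.el.maps _ hfM) this (h.kj h0)
  have hco : IsColl F E (fun f => fapp (j f) κ) := by
    intro g hg z
    constructor
    · intro hz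
      obtain ⟨f, hf, hf1, rfl⟩ := h.gen z (h.el.trN _ (hFN g hg) hz)
      have hfF : f ∈ F := mem_sep.2 ⟨hf, hf1⟩
      exact ⟨f, hfF, (hE' f hfF g hg).2 hz, rfl⟩
    · rintro ⟨f, hf, h1, rfl⟩
      exact (hE' f hf g hg).1 h1
  have hwf : WFOn F E := hco.wf (fun a b h => (pair_mem_prod.1 (mem_sep.1 h).1).2)
  obtain ⟨ρ, hρ, hρ1, hρ2⟩ := most hD hF hE hwf
  have : N = ran ρ := by
    ext a
    rw [mem_ran' hρ1]
    constructor
    · intro ha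
      obtain ⟨f, hf, hf1, rfl⟩ := h.gen a ha
      have hfF : f ∈ F := mem_sep.2 ⟨hf, hf1⟩
      exact ⟨f, hfF, hρ2.unique hwf hco f hfF⟩
    · rintro ⟨f, hf, rfl⟩
      rw [hρ2.unique hwf hco f hf]
      exact hFN f hf
  rw [this]
  exact hD.ran_mem hρ

end Wit

/-! ## Consequences in `ℳ'` -/

structure Cx (κ p D' : ZFSet) : Prop where
  hD : IsTransModel D'
  hκ : κ ∈ D'
  ord : κ.IsOrdinal
  suc : ∀ a ∈ κ, insert a a ∈ κ
  hω : omega ⊆ κ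
  cp : CodeP κ p
  wit : ∀ A ∈ D', A ⊆ κ → ∃ M U N j, Wit κ M U N j ∧ A ∈ M

namespace Cx
variable {κ p D' : ZFSet}

theorem h0 (C : Cx κ p D') : ∅ ∈ κ := C.hω (nn_mem 0)

theorem wit' (C : Cx κ p D') {x : ZFSet} (hx : HS D'.toSet {κ} x) : ∃ M U N j, Wit κ M U N j ∧ x ∈ M := by
  obtain ⟨c, hc, hc1, hc2⟩ := hs_code C.cp C.hD C.hκ hx
  obtain ⟨M, U, N, j, hw, hcM⟩ := C.wit c hc hc1
  exact ⟨M, U, N, j, hw, hc2 M hw.hM hw.hκ hcM⟩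

theorem S (C : Cx κ p D') : SmS D' {κ} := smS_sing C.cp C.hD C.hκ C.hω

theorem hsκ (C : Cx κ p D') : HS D'.toSet {κ} κ := C.S.hs_lam (by simp) C.ord.isTransitive

theorem reg (C : Cx κ p D') {l f : ZFSet} (hl : l ∈ κ) (hf : f ∈ D') (hf1 : IsZFunc l f) (hf2 : ∀ ξ ∈ l, fapp f ξ ∈ κ) :
    ∃ μ ∈ κ, ∀ ξ ∈ l, fapp f ξ ⊆ μ := by
  have hfs : HS D'.toSet {κ} f := C.S.hs_func (SmS.hs_mem C.hsκ hl) hf hf1 fun ξ hξ => SmS.hs_mem C.hsκ (hf2 ξ hξ)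
  obtain ⟨M, U, N, j, hw, hfM⟩ := C.wit' hfs
  by_contra hn
  have hn' : ¬ ∃ μ ∈ κ, ∀ ξ ∈ l, ∃ w ∈ κ, w = fapp f ξ ∧ w ⊆ μ := by
    rintro ⟨μ, hμ, h⟩
    refine hn ⟨μ, hμ, fun ξ hξ => ?_⟩
    obtain ⟨w, _, rfl, h⟩ := h ξ hξ
    exact h
  have hlM := hw.hM.trans hw.hκ hl
  rw [hw.el.tr3 (fun κ l f => ∃ μ ∈ κ, ∀ ξ ∈ l, ∃ w ∈ κ, w = fapp f ξ ∧ w ⊆ μ) hw.hκ hlM hfM] at hn'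
  refine hn' ⟨κ, hw.kj C.h0, fun ξ hξ => ?_⟩
  rw [hw.fixed C.h0 l hl] at hξ
  have e := (hw.el.tr3 (fun y f ξ => y = fapp f ξ) (hw.hM.fapp_memM hfM hf1 hξ) hfM (hw.hM.trans hlM hξ)).1 rfl
  have hξκ := C.ord.isTransitive _ hl hξ
  rw [hw.fixed C.h0 _ (hf2 ξ hξ), hw.fixed C.h0 _ hξκ] at e
  exact ⟨fapp f ξ, by rw [hw.jsub C.h0 hw.hκ (hf2 ξ hξ)]; exact hf2 ξ hξ, e, C.ord.isTransitive _ (hf2 ξ hξ)⟩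

theorem noinj (C : Cx κ p D') {l F : ZFSet} (hl : l ∈ κ) (hF : F ∈ D') (hF1 : IsZFunc κ F) (hF2 : ∀ ξ ∈ κ, fapp F ξ ⊆ l)
    (hF3 : ∀ ξ ∈ κ, ∀ η ∈ κ, fapp F ξ = fapp F η → ξ = η) : False := by
  have hfs : HS D'.toSet {κ} F := C.S.hs_func C.hsκ hF hF1 fun ξ hξ =>
    C.S.hs_sub (SmS.hs_mem C.hsκ hl) (C.hD.fappD hF hF1 ξ) (hF2 ξ hξ)
  obtain ⟨M, U, N, j, hw, hFM⟩ := C.wit' hfs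
  have hlM := hw.hM.trans hw.hκ hl
  have hjF := (hw.el.tr2 (fun κ f => IsZFunc κ f) hw.hκ hFM).1 hF1
  have hjF2 := (hw.el.tr3 (fun κ F l => ∀ ξ ∈ κ, fapp F ξ ⊆ l) hw.hκ hFM hlM).1 hF2 κ (hw.kj C.h0)
  rw [hw.fixed C.h0 l hl] at hjF2
  have hjF3 := (hw.el.tr2 (fun κ F => ∀ ξ ∈ κ, ∀ η ∈ κ, fapp F ξ = fapp F η → ξ = η) hw.hκ hFM).1 hF3
  have haN := hw.Nmod.fapp_memM (hw.el.maps _ hFM) hjF (hw.kj C.h0)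
  have haM := hw.subM C.h0 haN (fun x hx => C.ord.isTransitive _ hl (hjF2 hx))
  have hja := hw.jbdd C.h0 haM hl hjF2
  have h1 := (hw.el.tr3 (fun κ F a => ∃ η ∈ κ, a = fapp F η) hw.hκ hFM haM).2 ⟨κ, hw.kj C.h0, hja⟩
  obtain ⟨η, hη, e⟩ := h1
  have h2 := (hw.el.tr3 (fun a F η => a = fapp F η) haM hFM (hw.hM.trans hw.hκ hη)).1 e
  rw [hja, hw.fixed C.h0 η hη] at h2
  have := hjF3 κ (hw.kj C.h0) η (by rw [hw.jsub C.h0 hw.hκ hη]; exact hη) h2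
  rw [← this] at hη
  exact ZFSet.mem_irrefl _ hη

theorem app (C : Cx κ p D') {D δ : ZFSet} (hD : IsTransModel D) (hsub : D ⊆ D') (hκD : κ ∈ D) (happ : ApproxProperty δ D.toSet D'.toSet)
    (hδ : δ ∈ κ) {X : ZFSet} (hX : X ∈ D') (hXκ : X ⊆ κ) (h : ∀ α ∈ κ, X ∩ α ∈ D) : X ∈ D := by
  refine happ X hX (fun x hx => hD.trans hκD (hXκ hx)) ?_
  rintro x hx ⟨γ, hγ, f, hf, hf1, hf2, hf3⟩
  change x ∈ D at hx
  change f ∈ D at hf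
  have hγκ : γ ∈ κ := C.ord.isTransitive _ hδ hγ
  obtain ⟨g, hg, hg1, hg2⟩ := choiceD3 hD (fun D ξ y x κ f => y ∈ κ ∧ ∀ a ∈ x, a ∈ κ → ξ = fapp f a → y = a) (hD.trans hκD hγκ) hx hκD hf (fun ξ hξ => by
    by_cases hc : ∃ a ∈ x, a ∈ κ ∧ ξ = fapp f a
    · obtain ⟨a, ha, haκ, rfl⟩ := hc
      exact ⟨a, hD.trans hx ha, haκ, fun b hb hbκ e => hf3 _ ha _ hb e⟩
    · exact ⟨∅, hD.empty_mem, C.h0, fun b hb hbκ e => absurd ⟨b, hb, hbκ, e⟩ hc⟩)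
  obtain ⟨μ, hμ, hb⟩ := C.reg hγκ (hsub hg) hg1 (fun ξ hξ => (hg2 ξ hξ).2.1)
  have hμ' := C.suc μ hμ
  have : X ∩ x = X ∩ (insert μ μ) ∩ x := by
    ext z
    simp only [ZFSet.mem_inter]
    constructor
    · rintro ⟨h1, h2⟩
      refine ⟨⟨h1, ?_⟩, h2⟩
      have hzκ := hXκ h1
      have e := (hg2 _ (hf2 z h2)).2.2 z h2 hzκ rfl
      have := hb _ (hf2 z h2)
      rw [e] at this
      have oz := C.ord.mem hzκ
      have oμ := C.ord.mem hμ
      rw [ZFSet.mem_insert_iff]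
      rcases oz.mem_trichotomous oμ with h | h | h
      · exact Or.inr h
      · exact Or.inl h
      · exact absurd (this h) (ZFSet.mem_irrefl _)
    · rintro ⟨⟨h1, _⟩, h2⟩
      exact ⟨h1, h2⟩
  rw [this]
  exact hD.inter_mem (h _ hμ') hx

theorem powsm (C : Cx κ p D') {D : ZFSet} (hD : IsTransModel D) (hsub : D ⊆ D') (hκD : κ ∈ D) {l Y : ZFSet} (hl : l ∈ κ) (hY : Y ∈ D)
    (hYl : ∀ y ∈ Y, y ⊆ l) : ∃ μ ∈ κ, Im D.toSet μ Y := by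
  obtain ⟨θ, hθ, oθ, e, he, he1, he2, he3, he4⟩ := ordEnum hD hY
  have hinv : ∀ t ∈ D, t ⊆ θ → ∃ g ∈ D, IsZFunc t g ∧ ∀ ξ ∈ t, fapp g ξ ∈ Y ∧ fapp e (fapp g ξ) = ξ := by
    intro t ht htθ
    obtain ⟨g, hg, hg1, hg2⟩ := choiceD2 hD (fun D ξ y Y e => y ∈ Y ∧ ξ = fapp e y) ht hY he (fun ξ hξ => by
      obtain ⟨a, ha, rfl⟩ := he3 ξ (htθ hξ)
      exact ⟨a, hD.trans hY ha, ha, rfl⟩)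
    exact ⟨g, hg, hg1, fun ξ hξ => ⟨(hg2 ξ hξ).2.1, (hg2 ξ hξ).2.2.symm⟩⟩
  have hθκ : θ ∈ κ := by
    by_contra hn
    have hκθ : κ ⊆ θ := by
      rcases oθ.mem_trichotomous C.ord with h | h | h
      · exact absurd h hn
      · rw [h]
      · exact oθ.isTransitive _ h
    obtain ⟨g, hg, hg1, hg2⟩ := hinv κ hκD hκθ
    refine C.noinj hl (hsub hg) hg1 (fun ξ hξ => hYl _ (hg2 ξ hξ).1) (fun ξ hξ η hη h => ?_)
    rw [← (hg2 ξ hξ).2, ← (hg2 η hη).2, h]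
  refine ⟨θ, hθκ, ?_⟩
  obtain ⟨g, hg, hg1, hg2⟩ := hinv θ hθ (fun x hx => hx)
  refine ⟨g, hg, hg1, fun y hy => ⟨fapp e y, he2 y hy, ?_⟩⟩
  exact he4 _ hy _ (hg2 _ (he2 y hy)).1 (hg2 _ (he2 y hy)).2.symm

theorem powsm2 (C : Cx κ p D') {D : ZFSet} (hD : IsTransModel D) (hsub : D ⊆ D') (hκD : κ ∈ D) {l Y : ZFSet} (hl : l ∈ κ) (hY : Y ∈ D)
    (hYl : ∀ y ∈ Y, y ⊆ ZFSet.prod l l) : ∃ μ ∈ κ, Im D.toSet μ Y := by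
  have hpD := C.cp.mem D hD hκD
  obtain ⟨ν, hν, hpν⟩ := C.cp.bdd l hl
  have hνD := hD.trans hκD hν
  have hlκ := C.ord.isTransitive _ hl
  obtain ⟨q, hq, hq1, hq2⟩ := (replD2 hD (fun D y z ν p => z ⊆ ν ∧ ∀ ζ ∈ ν, (ζ ∈ z ↔ ∃ e ∈ y, ζ = fapp p e)) hY hνD hpD
    (fun y => ZFSet.sep (fun ζ => ∃ e ∈ y, ζ = fapp p e) ν)
    (fun y hy => sep2 hD (P := fun ζ y p => ∃ e ∈ y, ζ = fapp p e) hνD (hD.trans hY hy) hpD) (fun y hy z hz => by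
      constructor
      · rintro ⟨h1, h2⟩
        ext w
        rw [mem_sep]
        exact ⟨fun hw => ⟨h1 hw, (h2 w (h1 hw)).1 hw⟩, fun hw => (h2 w hw.1).2 hw.2⟩
      · rintro rfl
        exact ⟨fun z hz => (mem_sep.1 hz).1, fun η hη => by rw [mem_sep]; simp [hη]⟩)).2
  obtain ⟨μ, hμ, him⟩ := C.powsm hD hsub hκD hν (hD.ran_mem hq) (fun y hy => by
    obtain ⟨a, ha, rfl⟩ := (mem_ran' hq1).1 hy
    rw [hq2 a ha]
    exact fun z hz => (mem_sep.1 hz).1)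
  have hinj : ∀ a ∈ Y, ∀ b ∈ Y, fapp q a = fapp q b → a ⊆ b := by
    intro a ha b hb h e he
    obtain ⟨ξ, hξ, η, hη, rfl⟩ := mem_prod.1 (hYl a ha he)
    have h1 : fapp p (pair ξ η) ∈ fapp q a := by
      rw [hq2 a ha, mem_sep]
      exact ⟨hpν _ hξ _ hη, _, he, rfl⟩
    rw [h, hq2 b hb, mem_sep] at h1
    obtain ⟨_, e', he', h2⟩ := h1
    obtain ⟨ξ', hξ', η', hη', rfl⟩ := mem_prod.1 (hYl b hb he')
    obtain ⟨rfl, rfl⟩ := C.cp.inj _ (hlκ hξ) _ (hlκ hη) _ (hlκ hξ') _ (hlκ hη') h2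
    exact he'
  obtain ⟨g, hg, hg1, hg2⟩ := choiceD2 hD (fun D z y Y q => y ∈ Y ∧ z = fapp q y) (hD.ran_mem hq) hY hq (fun z hz => by
    obtain ⟨a, ha, rfl⟩ := (mem_ran' hq1).1 hz
    exact ⟨a, hD.trans hY ha, ha, rfl⟩)
  refine ⟨μ, hμ, (him.comp hD (hD.trans hκD hμ) hg hg1).sub fun y hy => ?_⟩
  have hr : fapp q y ∈ ran q := (mem_ran' hq1).2 ⟨y, hy, rfl⟩
  refine (mem_ran' hg1).2 ⟨fapp q y, hr, ?_⟩
  have h1 := (hg2 _ hr).2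
  have e := h1.2
  refine ZFSet.ext fun t => ⟨fun ht => hinj _ h1.1 _ hy e.symm ht, fun ht => hinj _ hy _ h1.1 e ht⟩

end Cx

/-! ## The model `V₀` -/

/-- the ground model data -/
structure Gd (κ p D D' δ : ZFSet) : Prop where
  C : Cx κ p D'
  hD : IsTransModel D
  sub : D ⊆ D'
  hκ : κ ∈ D
  ap : ApproxProperty δ D.toSet D'.toSet
  hδ : δ ∈ κ
  hωδ : omega ⊆ δ
  pw : ∃ P ∈ D, ∀ c, c ∈ P ↔ c ∈ D ∧ c ⊆ ZFSet.prod κ κ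

def PowM (D : ZFSet) : Prop := ∀ x ∈ D, ∃ P ∈ D, ∀ y ∈ D, (y ∈ P ↔ y ⊆ x)

namespace Gd
variable {κ p D D' δ : ZFSet}

theorem app (G : Gd κ p D D' δ) {X : ZFSet} (hX : X ∈ D') (hXκ : X ⊆ κ) (h : ∀ α ∈ κ, X ∩ α ∈ D) : X ∈ D :=
  G.C.app G.hD G.sub G.hκ G.ap G.hδ hX hXκ h

theorem S (G : Gd κ p D D' δ) : SmS D κ := by
  have hD := G.hD
  refine ⟨hD, G.hκ, fun l hl f hf hf1 hf2 => G.C.reg hl (G.sub hf) hf1 hf2, ?_, ⟨δ, G.hδ, G.hωδ⟩⟩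
  have key : ∀ l ∈ κ, ∃ ν ∈ κ, Im D.toSet ν (ZFSet.prod l l) := by
    intro l hl
    have hlκ := G.C.ord.isTransitive _ hl
    have hlD := hD.trans G.hκ hl
    obtain ⟨ν, hν, hb⟩ := G.C.cp.bdd l hl
    refine ⟨ν, hν, ?_⟩
    obtain ⟨f, hf, hf1, hf2⟩ := choiceD2 hD (fun D x y p l => ∀ a ∈ l, ∀ b ∈ l, ∀ z ∈ D, z = pair a b → x = fapp p z → y = z)
      (hD.trans G.hκ hν) (G.C.cp.mem D hD G.hκ) hlD (fun x hx => by
      by_cases hc : ∃ a ∈ l, ∃ b ∈ l, x = fapp p (pair a b)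
      · obtain ⟨a, ha, b, hb, rfl⟩ := hc
        refine ⟨pair a b, hD.pair_mem (hD.trans hlD ha) (hD.trans hlD hb), ?_⟩
        rintro a' ha' b' hb' z hz rfl h
        obtain ⟨rfl, rfl⟩ := G.C.cp.inj _ (hlκ ha) _ (hlκ hb) _ (hlκ ha') _ (hlκ hb') h
        rfl
      · refine ⟨∅, hD.empty_mem, ?_⟩
        rintro a' ha' b' hb' z hz rfl h
        exact absurd ⟨a', ha', b', hb', h⟩ hc)
    refine ⟨f, hf, hf1, fun y hy => ?_⟩
    obtain ⟨a, ha, b, hb', rfl⟩ := mem_prod.1 hy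
    exact ⟨_, hb _ ha _ hb', ((hf2 _ (hb _ ha _ hb')).2 a ha b hb' _ (hD.pair_mem (hD.trans hlD ha) (hD.trans hlD hb')) rfl rfl).symm⟩
  intro l hl m hm
  have ol := G.C.ord.mem hl
  have om := G.C.ord.mem hm
  rcases ol.subset_total om with h | h
  · obtain ⟨ν, hν, hi⟩ := key m hm
    refine ⟨ν, hν, hi.sub fun z hz => ?_⟩
    obtain ⟨a, ha, b, hb', rfl⟩ := mem_prod.1 hz
    exact pair_mem_prod.2 ⟨h ha, hb'⟩
  · obtain ⟨ν, hν, hi⟩ := key l hl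
    refine ⟨ν, hν, hi.sub fun z hz => ?_⟩
    obtain ⟨a, ha, b, hb', rfl⟩ := mem_prod.1 hz
    exact pair_mem_prod.2 ⟨ha, h hb'⟩

theorem Sκ (G : Gd κ p D D' δ) : SmS D {κ} := smS_sing G.C.cp G.hD G.hκ G.C.hω

theorem hs_up (G : Gd κ p D D' δ) {x : ZFSet} (h : HS D.toSet κ x) : HS D.toSet {κ} x := by
  obtain ⟨T, hT, h1, h2, l, hl, h3⟩ := h
  exact ⟨T, hT, h1, h2, κ, by simp, h3.mono G.hD (G.C.ord.isTransitive _ hl) G.hκ⟩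

theorem v0 (G : Gd κ p D D' δ) : ∃ V ∈ D, (∀ x, x ∈ V ↔ HS D.toSet κ x) := by
  obtain ⟨P, hP, hP'⟩ := G.pw
  obtain ⟨H, hH, hH'⟩ := hset' G.hD G.hκ hP hP'
  refine ⟨_, sepD1 G.hD (fun D x κ => HS D κ x) hH G.hκ, fun x => ?_⟩
  rw [mem_sep]
  exact ⟨fun h => h.2, fun h => ⟨(hH' x).2 (G.hs_up h), h⟩⟩

theorem v0_im (G : Gd κ p D D' δ) {V : ZFSet} (hV : V ∈ D) (hV' : ∀ x, x ∈ V ↔ HS D.toSet κ x) : Im D.toSet κ V := by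
  obtain ⟨P, hP, hP'⟩ := G.pw
  have hD := G.hD
  rw [← sm_sing]
  have hm : ∀ l ∈ κ, ZFSet.sep (fun x => HS D.toSet {l} x) V ∈ D := fun l hl =>
    sepD1 hD (fun D x L => HS D L x) hV (hD.sing (hD.trans G.hκ hl))
  obtain ⟨F, hF, hF1, hF2⟩ := (replD1 hD (fun D l y V => ∃ L ∈ D, L = {l} ∧ y ⊆ V ∧ ∀ x ∈ V, (x ∈ y ↔ HS D L x)) G.hκ hV
    (fun l => ZFSet.sep (fun x => HS D.toSet {l} x) V) hm (fun l hl y hy => by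
      constructor
      · rintro ⟨_, _, rfl, h1, h2⟩
        ext w
        rw [mem_sep]
        exact ⟨fun hw => ⟨h1 hw, (h2 w (h1 hw)).1 hw⟩, fun hw => (h2 w hw.1).2 hw.2⟩
      · rintro rfl
        exact ⟨_, hD.sing (hD.trans G.hκ hl), rfl, fun z hz => (mem_sep.1 hz).1, fun η hη => by rw [mem_sep]; simp [hη]⟩)).2
  refine (G.Sκ.union ⟨κ, by simp, Im.self hD G.hκ⟩ hF hF1 fun l hl => ?_).sub ?_
  · rw [hF2 l hl]
    have hlD := hD.trans G.hκ hl
    have hlκ := G.C.ord.isTransitive _ hl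
    have hQ : ZFSet.sep (fun c => c ⊆ l.prod l) P ∈ D := sep1 hD (P := fun c q => c ⊆ q) hP (hD.prod_mem hlD hlD)
    obtain ⟨Co, hCo, hC1, hC2, hC3⟩ := hset hD hlD hQ (fun c => by
      rw [mem_sep, hP']
      constructor
      · exact fun h => ⟨h.1.1, h.2⟩
      · refine fun h => ⟨⟨h.1, fun z hz => ?_⟩, h.2⟩
        obtain ⟨a, ha, b, hb', rfl⟩ := mem_prod.1 (h.2 hz)
        exact pair_mem_prod.2 ⟨hlκ ha, hlκ hb'⟩)
    set Q := ZFSet.sep (fun c => c ⊆ l.prod l) P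
    obtain ⟨μ, hμ, hi⟩ := G.C.powsm2 hD G.sub G.hκ hl hQ (fun y hy => (mem_sep.1 hy).2)
    have h1 : Sm D.toSet {κ} Q := sm_sing.2 (hi.mono hD (G.C.ord.isTransitive _ hμ) G.hκ)
    have h2 : Sm D.toSet {κ} l := sm_sing.2 ((Im.self hD hlD).mono hD hlκ G.hκ)
    have h3 := G.Sκ.prod2 hQ hlD h1 h2
    obtain ⟨g, hg, hg1, hg2⟩ := choiceD3 hD (fun D e y Q l Co => ∀ c ∈ Q, ∀ ξ ∈ l, e = pair c ξ → ∀ w ∈ D, w = fapp Co c → y = fapp w ξ)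
      (hD.prod_mem hQ hlD) hQ hlD hCo (fun e he => by
        obtain ⟨c, hc, ξ, hξ, rfl⟩ := mem_prod.1 he
        refine ⟨fapp (fapp Co c) ξ, hD.fappD (hD.fappD hCo hC1 c) (hC2 c hc) ξ, ?_⟩
        rintro c' hc' ξ' hξ' h w hw rfl
        obtain ⟨rfl, rfl⟩ := pair_inj.1 h
        rfl)
    refine (G.Sκ.comp h3 hg hg1).sub fun x hx => ?_
    obtain ⟨c, hc, ξ, hξ, rfl⟩ := hC3 x (mem_sep.1 hx).2
    have hpm : pair c ξ ∈ ZFSet.prod Q l := pair_mem_prod.2 ⟨hc, hξ⟩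
    exact (mem_ran' hg1).2 ⟨pair c ξ, hpm, (hg2 _ hpm).2 c hc ξ hξ rfl _ (hD.fappD hCo hC1 c) rfl⟩
  · intro x hx
    obtain ⟨T, hT, h1, h2, l, hl, h3⟩ := (hV' x).1 hx
    refine mem_sUnion.2 ⟨_, (mem_ran' hF1).2 ⟨l, hl, hF2 l hl⟩, mem_sep.2 ⟨hx, T, hT, h1, h2, l, by simp, h3⟩⟩

theorem v0_pow (G : Gd κ p D D' δ) {V : ZFSet} (hV : V ∈ D) (hV' : ∀ x, x ∈ V ↔ HS D.toSet κ x) : PowM V := by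
  have hD := G.hD
  obtain ⟨PP, hPP, hPP'⟩ := G.pw
  intro x hx
  have hxD := hD.trans hV hx
  have hx' := (hV' x).1 hx
  have hP : ZFSet.sep (fun y => y ⊆ x) V ∈ D := sep1 hD (P := fun y x => y ⊆ x) hV hxD
  refine ⟨_, (hV' _).2 (G.S.hs_of hP (fun y hy => (hV' y).1 (mem_sep.1 hy).1) ?_), fun y hy => by rw [mem_sep]; simp [hy]⟩
  obtain ⟨μ, hμ, f, hf, hf1, hf2⟩ := SmS.hs_sm hx'
  have hμD := hD.trans G.hκ hμ
  -- subsets of μ, as elements of V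
  have hY : ZFSet.sep (fun y => y ⊆ μ) V ∈ D := sep1 hD (P := fun y x => y ⊆ x) hV hμD
  obtain ⟨ν, hν, hi⟩ := G.C.powsm hD G.sub G.hκ hμ hY (fun y hy => (mem_sep.1 hy).2)
  obtain ⟨g, hg, hg1, hg2⟩ := (replD2 hD (fun D b y x f => y ⊆ x ∧ ∀ z ∈ x, (z ∈ y ↔ ∃ ξ ∈ b, z = fapp f ξ)) hY hxD hf
    (fun b => ZFSet.sep (fun z => ∃ ξ ∈ b, z = fapp f ξ) x)
    (fun b hb => sep2 hD (P := fun z b f => ∃ ξ ∈ b, z = fapp f ξ) hxD (hD.trans hY hb) hf) (fun b hb y hy => by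
      constructor
      · rintro ⟨h1, h2⟩
        ext w
        rw [mem_sep]
        exact ⟨fun hw => ⟨h1 hw, (h2 w (h1 hw)).1 hw⟩, fun hw => (h2 w hw.1).2 hw.2⟩
      · rintro rfl
        exact ⟨fun z hz => (mem_sep.1 hz).1, fun η hη => by rw [mem_sep]; simp [hη]⟩)).2
  refine ⟨ν, hν, (hi.comp hD (hD.trans G.hκ hν) hg hg1).sub fun y hy => ?_⟩
  obtain ⟨hyV, hyx⟩ := mem_sep.1 hy
  have hyD := hD.trans hV hyV
  have hbD : ZFSet.sep (fun ξ => fapp f ξ ∈ y) μ ∈ D := sep2 hD (P := fun ξ f y => fapp f ξ ∈ y) hμD hf hyD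
  have hb : ZFSet.sep (fun ξ => fapp f ξ ∈ y) μ ∈ ZFSet.sep (fun y => y ⊆ μ) V := by
    refine mem_sep.2 ⟨(hV' _).2 (G.S.hs_sub (G.S.hs_lam hμ (G.C.ord.mem hμ).isTransitive) hbD ?_), ?_⟩ <;> exact fun z hz => (mem_sep.1 hz).1
  refine (mem_ran' hg1).2 ⟨_, hb, ?_⟩
  rw [hg2 _ hb]
  ext z
  rw [mem_sep]
  constructor
  · rintro ⟨_, ξ, hξ, rfl⟩
    exact (mem_sep.1 hξ).2
  · intro hz
    obtain ⟨ξ, hξ, rfl⟩ := hf2 z (hyx hz)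
    exact ⟨hyx hz, ξ, mem_sep.2 ⟨hξ, hz⟩, rfl⟩

theorem v0_bdd (G : Gd κ p D D' δ) {V : ZFSet} (hV' : ∀ x, x ∈ V ↔ HS D.toSet κ x) {x l : ZFSet} (hl : l ∈ κ) (hx : x ∈ D) (hxl : x ⊆ l) : x ∈ V :=
  (hV' _).2 (G.S.hs_sub (G.S.hs_lam hl (G.C.ord.mem hl).isTransitive) hx hxl)

end Gd

/-! ## The models `W` and `H` -/

structure Big (κ D D' M U W H : ZFSet) : Prop where
  hW : IsTransModel W
  pow : PowM W
  hWD' : W ∈ D'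
  hHW : H ∈ W
  hH' : ∀ x, x ∈ H ↔ HS W.toSet {κ} x
  hH : IsTransModel H
  hκ : κ ∈ H
  HM : H ⊆ M
  HD : H ⊆ D
  subs : ∀ X, X ⊆ κ → X ∈ M → X ∈ D → X ∈ W

theorem El.modelEl {M N V : ZFSet.{u}} {j : ZFSet.{u} → ZFSet.{u}} (hj : El M N j) (h0 : ∅ ∈ M) (hV : V ∈ M) (hV' : IsTransModel V) : IsTransModel (j V) := by
  have hj0 : j ∅ = ∅ := (hj.tr1 (fun x => x = ∅) h0).1 rfl
  refine transModel_transfer hV' ((hj.tr1 (fun x => x.IsTransitive) hV).1 hV'.1) ?_ fun σ hσ => ?_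
  · have := (hj.tr2 (fun x y => x ∈ y) h0 hV).1 hV'.empty_mem
    rwa [hj0] at this
  · have I : UDef (fun D v => Sat (v 0).toSet σ (fun n => v ((fun _ => 1) n))) := inferInstance
    have I' : UDef (fun D v => Sat (v 0).toSet σ (fun n => v 1)) := I
    have := (hj.tr2 (fun V x => Sat V.toSet σ (fun _ => x)) hV h0).1 hσ
    rwa [hj0] at this

theorem Gd.big {κ p D D' δ M U N V : ZFSet} {j : ZFSet → ZFSet} (G : Gd κ p D D' δ) (w : Wit κ M U N j) (hMD' : M ∈ D') (hUD' : U ∈ D')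
    (hV : V ∈ D) (hV' : ∀ x, x ∈ V ↔ HS D.toSet κ x) (hVM : V ∈ M) : ∃ H, Big κ D D' M U (j V) H := by
  have h0 := G.C.h0
  have hVmod : IsTransModel V := G.S.model hV hV'
  have hW : IsTransModel (j V) := w.el.modelEl w.hM.empty_mem hVM hVmod
  have hWN := w.el.maps V hVM
  have hpow : PowM (j V) := (w.el.tr1 (fun V => ∀ x ∈ V, ∃ P ∈ V, ∀ y ∈ V, (y ∈ P ↔ y ⊆ x)) hVM).1 (G.v0_pow hV hV')
  have hN := w.Nmem h0 G.C.hD hMD' hUD'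
  have hWD' := G.C.hD.trans hN hWN
  have hκW : κ ∈ j V := by
    have h1 : κ ⊆ V := fun l hl => (hV' l).2 (G.S.hs_lam hl (G.C.ord.mem hl).isTransitive)
    exact (w.el.tr2 (fun a b => a ⊆ b) w.hκ hVM).1 h1 (w.kj h0)
  obtain ⟨P, hP, hP'⟩ := hpow _ (hW.prod_mem hκW hκW)
  have hPsub : ∀ c, c ∈ P ↔ c ∈ j V ∧ c ⊆ ZFSet.prod κ κ := fun c =>
    ⟨fun h => ⟨hW.trans hP h, (hP' c (hW.trans hP h)).1 h⟩, fun h => (hP' c h.1).2 h.2⟩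
  obtain ⟨H, hH, hH'⟩ := hset' hW hκW hP hPsub
  have hS := smS_sing G.C.cp hW hκW G.C.hω
  have hsubs : ∀ x, x ∈ j V → x ⊆ κ → x ∈ M ∧ x ∈ D := by
    intro x hx hxκ
    have hxM := w.subM h0 (w.el.trN _ hWN hx) hxκ
    refine ⟨hxM, G.app (G.C.hD.trans hMD' hxM) hxκ fun α hα => ?_⟩
    have hαM := w.hM.trans w.hκ hα
    have h1 := w.hM.inter_mem hxM hαM
    have h2 : j (x ∩ α) = x ∩ α := w.jbdd h0 h1 hα (fun z hz => (ZFSet.mem_inter.1 hz).2)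
    have h3 : x ∩ α ∈ j V := hW.inter_mem hx (hW.trans hκW hα)
    rw [← h2] at h3
    exact hV' _ |>.1 ((w.el.tr2 (fun a b => a ∈ b) h1 hVM).2 h3) |> SmS.hs_D G.hD
  have hHc : ∀ x ∈ H, x ∈ M ∧ x ∈ D := by
    intro x hx
    obtain ⟨c, hc, hc1, hc2⟩ := hs_code G.C.cp hW hκW ((hH' x).1 hx)
    have := hsubs c hc hc1
    exact ⟨hc2 M w.hM w.hκ this.1, hc2 D G.hD G.hκ this.2⟩
  refine ⟨H, hW, hpow, hWD', hH, hH', hS.model hH hH', (hH' κ).2 (hS.hs_lam (by simp) G.C.ord.isTransitive), fun x hx => (hHc x hx).1, fun x hx => (hHc x hx).2, ?_⟩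
  intro X hXκ hXM hXD
  have h1 : ∀ α ∈ κ, ∃ y ∈ V, (∀ z ∈ y, z ∈ X ∧ z ∈ α) ∧ ∀ z ∈ X, z ∈ α → z ∈ y := fun α hα =>
    ⟨X ∩ α, G.v0_bdd hV' hα (G.hD.inter_mem hXD (G.hD.trans G.hκ hα)) (fun z hz => (ZFSet.mem_inter.1 hz).2), fun z hz => ZFSet.mem_inter.1 hz,
      fun z h1 h2 => ZFSet.mem_inter.2 ⟨h1, h2⟩⟩
  have h2 := (w.el.tr3 (fun κ V X => ∀ α ∈ κ, ∃ y ∈ V, (∀ z ∈ y, z ∈ X ∧ z ∈ α) ∧ ∀ z ∈ X, z ∈ α → z ∈ y) w.hκ hVM hXM).1 h1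
  obtain ⟨y, hy, hy1, hy2⟩ := h2 κ (w.kj h0)
  have : y = X := by
    ext z
    constructor
    · intro hz
      obtain ⟨a, b⟩ := hy1 z hz
      exact (w.jsub h0 hXM b).1 a
    · intro hz
      exact hy2 z ((w.jsub h0 hXM (hXκ hz)).2 hz) (hXκ hz)
  rw [← this]; exact hy

theorem Big.S {κ D D' M U W H p : ZFSet} (B : Big κ D D' M U W H) (hp : CodeP κ p) (hω : omega ⊆ κ) : SmS W {κ} :=
  smS_sing hp B.hW (B.hW.trans B.hHW B.hκ) hω

theorem Gd.uH {κ p D D' δ M U N W H : ZFSet} {j : ZFSet → ZFSet} (G : Gd κ p D D' δ) (w : Wit κ M U N j) (hMD' : M ∈ D')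
    (B : Big κ D D' M U W H) {g : ZFSet} (hg : g ∈ H) (hg1 : IsZFunc κ g) :
    ∃ u ∈ H, ∀ y, y ∈ u ↔ y ∈ U ∧ ∃ ξ ∈ κ, y = fapp g ξ := by
  have h0 := G.C.h0
  have hgM := B.HM hg
  have hgD := B.HD hg
  have hκW := B.hW.trans B.hHW B.hκ
  have hgW := B.hW.trans B.hHW hg
  have hgy : ∀ ξ ∈ κ, fapp g ξ ∈ M := fun ξ hξ => w.hM.fapp_memM hgM hg1 hξ
  have hwa := w.wa (ran g) (w.hM.ran_mem hgM) ⟨g, hgM, hg1, fun y hy => (mem_ran' hg1).1 hy⟩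
  have hX : ZFSet.sep (fun ξ => fapp g ξ ∈ ran g ∩ U) κ ∈ M := sep2 w.hM (P := fun ξ g r => fapp g ξ ∈ r) w.hκ hgM hwa
  set X := ZFSet.sep (fun ξ => fapp g ξ ∈ ran g ∩ U) κ with hXd
  have hX' : ∀ ξ ∈ κ, (ξ ∈ X ↔ fapp g ξ ∈ U) := by
    intro ξ hξ
    rw [hXd, mem_sep, ZFSet.mem_inter]
    exact ⟨fun h => h.2.2, fun h => ⟨hξ, (mem_ran' hg1).2 ⟨ξ, hξ, rfl⟩, h⟩⟩
  have hXκ : X ⊆ κ := fun z hz => (mem_sep.1 hz).1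
  have hXD : X ∈ D := by
    refine G.app (G.C.hD.trans hMD' hX) hXκ fun α hα => ?_
    have hαM := w.hM.trans w.hκ hα
    have hακ := G.C.ord.isTransitive _ hα
    obtain ⟨l, hl, hl'⟩ := (w.el.tr4 (fun κ α X g => ∃ l ∈ κ, ∀ ξ ∈ α, (ξ ∈ X ↔ fapp g ξ ⊆ κ ∧ l ∈ fapp g ξ)) w.hκ hαM hX hgM).2 (by
      refine ⟨κ, w.kj h0, fun ξ hξ => ?_⟩
      rw [w.fixed h0 α hα] at hξ
      have hξκ := hακ hξ
      have e := (w.el.tr3 (fun y f ξ => y = fapp f ξ) (hgy ξ hξκ) hgM (w.hM.trans w.hκ hξκ)).1 rfl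
      rw [w.fixed h0 _ hξκ] at e
      rw [w.jsub h0 hX hξκ, hX' ξ hξκ, ← e, ← w.el.tr2 (fun a b => a ⊆ b) (hgy ξ hξκ) w.hκ]
      constructor
      · intro h
        have := (w.hU.1 _ h).2
        exact ⟨this, (w.ui _ (hgy ξ hξκ) this).1 h⟩
      · rintro ⟨h1, h2⟩
        exact (w.ui _ (hgy ξ hξκ) h1).2 h2)
    have : X ∩ α = ZFSet.sep (fun ξ => fapp g ξ ⊆ κ ∧ l ∈ fapp g ξ) α := by
      ext ξ
      rw [ZFSet.mem_inter]
      exact ⟨fun h => mem_sep.2 ⟨h.2, (hl' ξ h.2).1 h.1⟩, fun h => ⟨(hl' ξ (mem_sep.1 h).1).2 (mem_sep.1 h).2, (mem_sep.1 h).1⟩⟩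
    rw [this]
    exact sep3 G.hD (P := fun ξ g κ l => fapp g ξ ⊆ κ ∧ l ∈ fapp g ξ) (G.hD.trans G.hκ hα) hgD G.hκ (G.hD.trans G.hκ hl)
  have hXW := B.subs X hXκ hX hXD
  have hrW := B.hW.ran_mem hgW
  have S := B.S G.C.cp G.C.hω
  have hu : ZFSet.sep (fun y => ∃ ξ ∈ X, y = fapp g ξ) (ran g) ∈ W := sep2 B.hW (P := fun y X g => ∃ ξ ∈ X, y = fapp g ξ) hrW hXW hgW
  refine ⟨_, (B.hH' _).2 (S.hs_sub ((B.hH' _).1 (B.hH.ran_mem hg)) hu (fun z hz => (mem_sep.1 hz).1)), fun y => ?_⟩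
  rw [mem_sep]
  constructor
  · rintro ⟨_, ξ, hξ, rfl⟩
    exact ⟨(hX' ξ (hXκ hξ)).1 hξ, ξ, hXκ hξ, rfl⟩
  · rintro ⟨h, ξ, hξ, rfl⟩
    exact ⟨(mem_ran' hg1).2 ⟨ξ, hξ, rfl⟩, ξ, (hX' ξ hξ).2 h, rfl⟩

/-! ## Löwenheim–Skolem inside `W` -/

def Upd (w s n x t : ZFSet) : Prop := ∀ m ∈ w, (m = n → fapp t m = x) ∧ (m ≠ n → fapp t m = fapp s m)
def O1 (Om a b z : ZFSet) : Prop := z ⊆ Om ∧ ∀ s ∈ Om, (s ∈ z ↔ fapp s a ∈ fapp s b)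
def O2 (Om a b z : ZFSet) : Prop := z ⊆ Om ∧ ∀ s ∈ Om, (s ∈ z ↔ fapp s a = fapp s b)
def O3 (Om a b z : ZFSet) : Prop := z ⊆ Om ∧ ∀ s ∈ Om, (s ∈ z ↔ (s ∈ a → s ∈ b))
def O4 (Om a z : ZFSet) : Prop := z ⊆ Om ∧ ∀ s ∈ Om, (s ∈ z ↔ ¬ s ∈ a)
def O5 (w H Om a b z : ZFSet) : Prop := z ⊆ Om ∧ ∀ s ∈ Om, (s ∈ z ↔ ∀ x ∈ H, ∀ t ∈ Om, Upd w s a x t → t ∈ b)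
def O6 (w H Om a b c z : ZFSet) : Prop := z ∈ H ∧ ∃ t ∈ Om, Upd w a b z t ∧ ¬ t ∈ c
def O7 (w Om a b c z : ZFSet) : Prop := z ∈ Om ∧ Upd w a b c z

instance UDef.upd (i1 i2 i3 i4 i5 : ℕ) : UDef (fun _ v => Upd (v i1) (v i2) (v i3) (v i4) (v i5)) := by
  unfold Upd; infer_instance
instance UDef.o1 (i1 i2 i3 i4 : ℕ) : UDef (fun _ v => O1 (v i1) (v i2) (v i3) (v i4)) := by
  unfold O1; infer_instance
instance UDef.o2 (i1 i2 i3 i4 : ℕ) : UDef (fun _ v => O2 (v i1) (v i2) (v i3) (v i4)) := by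
  unfold O2; infer_instance
instance UDef.o3 (i1 i2 i3 i4 : ℕ) : UDef (fun _ v => O3 (v i1) (v i2) (v i3) (v i4)) := by
  unfold O3; infer_instance
instance UDef.o4 (i1 i2 i4 : ℕ) : UDef (fun _ v => O4 (v i1) (v i2) (v i4)) := by
  unfold O4; infer_instance
instance UDef.o5 (i1 i2 i3 i4 i5 i6 : ℕ) : UDef (fun _ v => O5 (v i1) (v i2) (v i3) (v i4) (v i5) (v i6)) := by
  unfold O5; infer_instance
instance UDef.o6 (i1 i2 i3 i4 i5 i6 i7 : ℕ) : UDef (fun _ v => O6 (v i1) (v i2) (v i3) (v i4) (v i5) (v i6) (v i7)) := by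
  unfold O6; infer_instance
instance UDef.o7 (i1 i2 i3 i4 i5 i6 : ℕ) : UDef (fun _ v => O7 (v i1) (v i2) (v i3) (v i4) (v i5) (v i6)) := by
  unfold O7; infer_instance

def OpP (w H Om Q a b c y : ZFSet) : Prop :=
  (a ∈ H → a ⊆ y) ∧
  ((∃ z ∈ Q, O1 Om a b z) → ∃ z ∈ y, O1 Om a b z) ∧
  ((∃ z ∈ Q, O2 Om a b z) → ∃ z ∈ y, O2 Om a b z) ∧
  ((∃ z ∈ Q, O3 Om a b z) → ∃ z ∈ y, O3 Om a b z) ∧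
  ((∃ z ∈ Q, O4 Om a z) → ∃ z ∈ y, O4 Om a z) ∧
  ((∃ z ∈ Q, O5 w H Om a b z) → ∃ z ∈ y, O5 w H Om a b z) ∧
  ((∃ z ∈ Q, O6 w H Om a b c z) → ∃ z ∈ y, O6 w H Om a b c z) ∧
  ((∃ z ∈ Q, O7 w Om a b c z) → ∃ z ∈ y, O7 w Om a b c z)

instance UDef.opP (i1 i2 i3 i4 i5 i6 i7 i8 : ℕ) :
    UDef (fun _ v => OpP (v i1) (v i2) (v i3) (v i4) (v i5) (v i6) (v i7) (v i8)) := by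
  unfold OpP; infer_instance

theorem OpP.mono {w H Om Q a b c y y' : ZFSet} (h : OpP w H Om Q a b c y) (hy : y ⊆ y') : OpP w H Om Q a b c y' := by
  obtain ⟨h0, h1, h2, h3, h4, h5, h6, h7⟩ := h
  refine ⟨fun h => fun x hx => hy (h0 h hx), fun h => ?_, fun h => ?_, fun h => ?_, fun h => ?_, fun h => ?_, fun h => ?_, fun h => ?_⟩
  · obtain ⟨z, hz, h⟩ := h1 h; exact ⟨z, hy hz, h⟩
  · obtain ⟨z, hz, h⟩ := h2 h; exact ⟨z, hy hz, h⟩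
  · obtain ⟨z, hz, h⟩ := h3 h; exact ⟨z, hy hz, h⟩
  · obtain ⟨z, hz, h⟩ := h4 h; exact ⟨z, hy hz, h⟩
  · obtain ⟨z, hz, h⟩ := h5 h; exact ⟨z, hy hz, h⟩
  · obtain ⟨z, hz, h⟩ := h6 h; exact ⟨z, hy hz, h⟩
  · obtain ⟨z, hz, h⟩ := h7 h; exact ⟨z, hy hz, h⟩

/-- The ambient data. -/
structure LSd (κ W H Om Q : ZFSet) : Prop where
  S : SmS W {κ}
  hκ : κ ∈ W
  tr : κ.IsTransitive
  hω : omega ⊆ κ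
  pow : PowM W
  hH : H ∈ W
  hH' : ∀ x, x ∈ H ↔ HS W.toSet {κ} x
  hHm : IsTransModel H
  hOm : ∀ s, s ∈ Om ↔ s ∈ W ∧ IsZFunc omega s ∧ ∀ n ∈ omega, fapp s n ∈ H
  hOmW : Om ∈ W
  hQW : Q ∈ W
  hQ : ∀ x, x ∈ Q ↔ x ∈ H ∨ (x ∈ W ∧ x ⊆ Om)

theorem lsd {κ W H : ZFSet} (S : SmS W {κ}) (hκ : κ ∈ W) (tr : κ.IsTransitive) (hω : omega ⊆ κ) (pow : PowM W) (hH : H ∈ W)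
    (hH' : ∀ x, x ∈ H ↔ HS W.toSet {κ} x) (hHm : IsTransModel H) : ∃ Om Q, LSd κ W H Om Q := by
  have hW := S.hD
  have h1 : ∀ s ∈ W, IsZFunc omega s → (∀ n ∈ omega, fapp s n ∈ H) → s ∈ H := fun s hs hs1 hs2 => by
    refine (hH' s).2 (S.hs_func ((hH' _).1 hHm.omega_mem) hs hs1 fun a ha => (hH' _).1 (hs2 a ha))
  have hOmW := sep2 hW (P := fun s w H => IsZFunc w s ∧ ∀ n ∈ w, fapp s n ∈ H) hH hW.omega_mem hH
  set Om := ZFSet.sep (fun s => IsZFunc omega s ∧ ∀ n ∈ omega, fapp s n ∈ H) H with hOmd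
  obtain ⟨P, hP, hP'⟩ := pow Om hOmW
  refine ⟨Om, H ∪ P, S, hκ, tr, hω, pow, hH, hH', hHm, ?_, hOmW, hW.union_mem hH hP, ?_⟩
  · intro s
    rw [hOmd, ZFSet.mem_sep]
    exact ⟨fun h => ⟨hW.trans hH h.1, h.2⟩, fun h => ⟨h1 s h.1 h.2.1 h.2.2, h.2⟩⟩
  · intro x
    rw [ZFSet.mem_union]
    refine or_congr Iff.rfl ⟨fun h => ⟨hW.trans hP h, (hP' x (hW.trans hP h)).1 h⟩, fun h => (hP' x h.1).2 h.2⟩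

namespace LSd
variable {κ W H Om Q : ZFSet}

def Cl (w H Om Q X : ZFSet) : Prop := ∀ a ∈ X, ∀ b ∈ X, ∀ c ∈ X, OpP w H Om Q a b c X
instance UDef.cl (i1 i2 i3 i4 i5 : ℕ) : UDef (fun _ v => Cl (v i1) (v i2) (v i3) (v i4) (v i5)) := by
  unfold Cl; infer_instance

theorem one (L : LSd κ W H Om Q) (P : ZFSet → Prop) : ∃ y ∈ W, y ⊆ Q ∧ Sm W.toSet {κ} y ∧ ((∃ z ∈ Q, P z) → ∃ z ∈ y, P z) := by
  by_cases h : ∃ z ∈ Q, P z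
  · obtain ⟨z, hz, h⟩ := h
    have hzW := L.S.hD.trans L.hQW hz
    exact ⟨{z}, L.S.hD.sing hzW, fun x hx => by rw [mem_singleton] at hx; rwa [hx], L.S.sing hzW, fun _ => ⟨z, by simp, h⟩⟩
  · refine ⟨∅, L.S.hD.empty_mem, by simp, (L.S.sing L.hκ).sub (by simp), fun h' => absurd h' h⟩

set_option maxHeartbeats 1000000 in
theorem opEx (L : LSd κ W H Om Q) {a b c : ZFSet} : ∃ y ∈ W, y ⊆ Q ∧ Im W.toSet κ y ∧ OpP omega H Om Q a b c y := by
  have hW := L.S.hD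
  have h0 : ∃ y ∈ W, y ⊆ Q ∧ Sm W.toSet {κ} y ∧ (a ∈ H → a ⊆ y) := by
    by_cases h : a ∈ H
    · have := (L.hH' a).1 h
      exact ⟨a, hW.trans L.hH h, fun x hx => (L.hQ x).2 (Or.inl (L.hHm.trans h hx)), SmS.hs_sm this, fun _ => fun x hx => hx⟩
    · exact ⟨∅, hW.empty_mem, by simp, (L.S.sing L.hκ).sub (by simp), fun h' => absurd h' h⟩
  obtain ⟨y0, hy0, a0, b0, c0⟩ := h0
  obtain ⟨y1, hy1, a1, b1, c1⟩ := L.one (O1 Om a b)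
  obtain ⟨y2, hy2, a2, b2, c2⟩ := L.one (O2 Om a b)
  obtain ⟨y3, hy3, a3, b3, c3⟩ := L.one (O3 Om a b)
  obtain ⟨y4, hy4, a4, b4, c4⟩ := L.one (O4 Om a)
  obtain ⟨y5, hy5, a5, b5, c5⟩ := L.one (O5 omega H Om a b)
  obtain ⟨y6, hy6, a6, b6, c6⟩ := L.one (O6 omega H Om a b c)
  obtain ⟨y7, hy7, a7, b7, c7⟩ := L.one (O7 omega Om a b c)
  have U : ∀ {x y : ZFSet}, (x ∈ W ∧ x ⊆ Q ∧ Sm W.toSet {κ} x) → (y ∈ W ∧ y ⊆ Q ∧ Sm W.toSet {κ} y) →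
      (x ∪ y ∈ W ∧ x ∪ y ⊆ Q ∧ Sm W.toSet {κ} (x ∪ y)) := fun {x y} h h' =>
    ⟨hW.union_mem h.1 h'.1, fun z hz => by
      rcases ZFSet.mem_union.1 hz with hz | hz
      · exact h.2.1 hz
      · exact h'.2.1 hz, L.S.un h.1 h'.1 h.2.2 h'.2.2⟩
  obtain ⟨h1, h2, h3⟩ := U ⟨hy0, a0, b0⟩ (U ⟨hy1, a1, b1⟩ (U ⟨hy2, a2, b2⟩ (U ⟨hy3, a3, b3⟩ (U ⟨hy4, a4, b4⟩ (U ⟨hy5, a5, b5⟩ (U ⟨hy6, a6, b6⟩ ⟨hy7, a7, b7⟩))))))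
  refine ⟨_, h1, h2, sm_sing.1 h3, fun h x hx => ?_, fun h => ?_, fun h => ?_, fun h => ?_, fun h => ?_, fun h => ?_, fun h => ?_, fun h => ?_⟩
  · have := c0 h hx
    simp only [ZFSet.mem_union, this, true_or]
  · obtain ⟨z, hz, h⟩ := c1 h; exact ⟨z, by simp only [ZFSet.mem_union, hz, true_or, or_true], h⟩
  · obtain ⟨z, hz, h⟩ := c2 h; exact ⟨z, by simp only [ZFSet.mem_union, hz, true_or, or_true], h⟩
  · obtain ⟨z, hz, h⟩ := c3 h; exact ⟨z, by simp only [ZFSet.mem_union, hz, true_or, or_true], h⟩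
  · obtain ⟨z, hz, h⟩ := c4 h; exact ⟨z, by simp only [ZFSet.mem_union, hz, true_or, or_true], h⟩
  · obtain ⟨z, hz, h⟩ := c5 h; exact ⟨z, by simp only [ZFSet.mem_union, hz, true_or, or_true], h⟩
  · obtain ⟨z, hz, h⟩ := c6 h; exact ⟨z, by simp only [ZFSet.mem_union, hz, true_or, or_true], h⟩
  · obtain ⟨z, hz, h⟩ := c7 h; exact ⟨z, by simp only [ZFSet.mem_union, hz, true_or, or_true], h⟩

theorem step (L : LSd κ W H Om Q) {X : ZFSet} (hX : X ∈ W) (hXQ : X ⊆ Q) (hXs : Im W.toSet κ X) :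
    ∃ Y ∈ W, Y ⊆ Q ∧ Im W.toSet κ Y ∧ X ⊆ Y ∧ ∀ a ∈ X, ∀ b ∈ X, ∀ c ∈ X, OpP omega H Om Q a b c Y := by
  have hW := L.S.hD
  have hXX := hW.prod_mem hX (hW.prod_mem hX hX)
  have hXX' := L.S.prod2 hX (hW.prod_mem hX hX) (sm_sing.2 hXs) (L.S.prod2 hX hX (sm_sing.2 hXs) (sm_sing.2 hXs))
  obtain ⟨F, hF, hF1, hF2⟩ := choiceD5 hW (fun D t y κ w H Om Q => y ⊆ Q ∧ Im D κ y ∧ ∀ a ∈ D, ∀ b ∈ D, ∀ c ∈ D, (∃ e ∈ D, e = pair b c ∧ t = pair a e) → OpP w H Om Q a b c y)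
    hXX L.hκ hW.omega_mem L.hH L.hOmW L.hQW (fun t ht => by
      rw [ZFSet.mem_prod] at ht
      obtain ⟨a, ha, e, he, rfl⟩ := ht
      rw [ZFSet.mem_prod] at he
      obtain ⟨b, hb, c, hc, rfl⟩ := he
      obtain ⟨y, hy, h1, h2, h3⟩ := L.opEx (a := a) (b := b) (c := c)
      refine ⟨y, hy, h1, h2, ?_⟩
      rintro a' - b' - c' - ⟨e, -, rfl, h⟩
      obtain ⟨e1, h⟩ := pair_inj.1 h
      obtain ⟨e2, e3⟩ := pair_inj.1 h
      rw [← e1, ← e2, ← e3]; exact h3)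
  have hu := hW.sUnion_mem (hW.ran_mem hF)
  have hs := L.S.union hXX' hF hF1 fun y hy => sm_sing.2 (hF2 y hy).2.2.1
  refine ⟨X ∪ (⋃₀ ran F : ZFSet), hW.union_mem hX hu, ?_, sm_sing.1 (L.S.un hX hu (sm_sing.2 hXs) hs), fun x hx => ZFSet.mem_union.2 (Or.inl hx), ?_⟩
  · intro x hx
    rcases ZFSet.mem_union.1 hx with hx | hx
    · exact hXQ hx
    · obtain ⟨y, hy, hx⟩ := ZFSet.mem_sUnion.1 hx
      obtain ⟨t, ht, rfl⟩ := (mem_ran' hF1).1 hy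
      exact (hF2 t ht).2.1 hx
  · intro a ha b hb c hc
    have ht : pair a (pair b c) ∈ ZFSet.prod X (ZFSet.prod X X) := by simp [ha, hb, hc]
    have := (hF2 _ ht).2.2.2 a (hW.trans hX ha) b (hW.trans hX hb) c (hW.trans hX hc) ⟨_, hW.pair_mem (hW.trans hX hb) (hW.trans hX hc), rfl, rfl⟩
    refine this.mono fun x hx => ZFSet.mem_union.2 (Or.inr (ZFSet.mem_sUnion.2 ⟨_, (mem_ran' hF1).2 ⟨_, ht, rfl⟩, hx⟩))

theorem hull (L : LSd κ W H Om Q) {X : ZFSet} (hX : X ∈ W) (hXQ : X ⊆ Q) (hXs : Im W.toSet κ X) :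
    ∃ Y ∈ W, Im W.toSet κ Y ∧ X ⊆ Y ∧ Cl omega H Om Q Y := by
  have hW := L.S.hD
  obtain ⟨P, hP, hP'⟩ := L.pow Q L.hQW
  have hSW := sepD1 hW (fun D x κ => Im D κ x) hP L.hκ
  set SS := ZFSet.sep (fun x => Im W.toSet κ x) P with hSS
  have hmem : ∀ x, x ∈ SS ↔ x ∈ W ∧ x ⊆ Q ∧ Im W.toSet κ x := fun x => by
    rw [hSS, ZFSet.mem_sep]
    exact ⟨fun h => ⟨hW.trans hP h.1, (hP' x (hW.trans hP h.1)).1 h.1, h.2⟩, fun h => ⟨(hP' x h.1).2 h.2.1, h.2.2⟩⟩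
  obtain ⟨F, hF, hF1, hF2⟩ := choiceD5 hW (fun D X Y SS w H Om Q => Y ∈ SS ∧ X ⊆ Y ∧ ∀ a ∈ X, ∀ b ∈ X, ∀ c ∈ X, OpP w H Om Q a b c Y)
    hSW hSW hW.omega_mem L.hH L.hOmW L.hQW (fun X hX => by
      obtain ⟨h1, h2, h3⟩ := (hmem X).1 hX
      obtain ⟨Y, hY, a, b, c, d⟩ := L.step h1 h2 h3
      exact ⟨Y, hY, (hmem Y).2 ⟨hY, a, b⟩, c, d⟩)
  obtain ⟨s, hs, hs1, hs0, hsS, hsn⟩ := iter hW hF hF1 (fun x hx => (hF2 x hx).2.1) ((hmem X).2 ⟨hX, hXQ, hXs⟩)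
  have hmono : ∀ n k, fapp s (nn n) ⊆ fapp s (nn (n+k)) := by
    intro n k
    induction k with
    | zero => exact fun x hx => hx
    | succ k ih =>
      rw [← add_assoc, hsn (n+k)]
      exact fun x hx => (hF2 _ (hsS _)).2.2.1 (ih hx)
  have hom : Sm W.toSet {κ} omega := sm_sing.2 ((Im.self hW L.hκ).sub L.hω)
  have hU : ∀ x, x ∈ (⋃₀ ran s : ZFSet) ↔ ∃ n, x ∈ fapp s (nn n) := fun x => by
    rw [ZFSet.mem_sUnion]
    constructor
    · rintro ⟨y, hy, hx⟩
      obtain ⟨t, ht, rfl⟩ := (mem_ran' hs1).1 hy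
      obtain ⟨n, rfl⟩ := mem_omega.1 ht
      exact ⟨n, hx⟩
    · rintro ⟨n, hx⟩
      exact ⟨_, (mem_ran' hs1).2 ⟨_, nn_mem n, rfl⟩, hx⟩
  refine ⟨⋃₀ ran s, hW.sUnion_mem (hW.ran_mem hs), sm_sing.1 (L.S.union hom hs hs1 fun y hy => ?_), fun x hx => (hU x).2 ⟨0, ?_⟩, ?_⟩
  · obtain ⟨n, rfl⟩ := mem_omega.1 hy
    exact sm_sing.2 ((hmem _).1 (hsS n)).2.2
  · show x ∈ fapp s ∅
    rwa [hs0]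
  · intro a ha b hb c hc
    obtain ⟨n1, ha⟩ := (hU a).1 ha
    obtain ⟨n2, hb⟩ := (hU b).1 hb
    obtain ⟨n3, hc⟩ := (hU c).1 hc
    have e1 : a ∈ fapp s (nn (n1+n2+n3)) := by rw [add_assoc]; exact hmono _ _ ha
    have e2 : b ∈ fapp s (nn (n1+n2+n3)) := by
      rw [show n1+n2+n3 = n2 + (n1+n3) by omega]; exact hmono _ _ hb
    have e3 : c ∈ fapp s (nn (n1+n2+n3)) := by
      rw [show n1+n2+n3 = n3 + (n1+n2) by omega]; exact hmono _ _ hc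
    refine ((hF2 _ (hsS (n1+n2+n3))).2.2.2 a e1 b e2 c e3).mono fun x hx => (hU x).2 ⟨n1+n2+n3+1, ?_⟩
    rwa [hsn]

theorem updEx (L : LSd κ W H Om Q) {s n x : ZFSet} (hs : s ∈ Om) (hn : n ∈ omega) (hx : x ∈ H) : ∃ t ∈ Om, Upd omega s n x t := by
  have hW := L.S.hD
  obtain ⟨hsW, hs1, hs2⟩ := (L.hOm s).1 hs
  have hxW := hW.trans L.hH hx
  obtain ⟨-, t, ht, ht1, ht2⟩ := replD3 hW (fun D m y n x s => (m = n → y = x) ∧ (m ≠ n → y = fapp s m)) hW.omega_mem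
    (hW.trans hW.omega_mem hn) hxW hsW (fun m => if m = n then x else fapp s m) (fun m hm => by
      split_ifs
      · exact hxW
      · exact hW.trans L.hH (hs2 m hm)) (fun m hm y hy => by split_ifs with h <;> simp [h])
  refine ⟨t, (L.hOm t).2 ⟨ht, ht1, fun m hm => ?_⟩, fun m hm => ⟨fun h => ?_, fun h => ?_⟩⟩
  · rw [ht2 m hm]; split_ifs
    · exact hx
    · exact hs2 m hm
  · rw [ht2 m hm]; simp [h]
  · rw [ht2 m hm]; simp [h]

theorem upd_eq {s t x : ZFSet} {n : ℕ} (h : Upd omega s (nn n) x t) : (fun k => fapp t (nn k)) = Function.update (fun k => fapp s (nn k)) n x := by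
  funext k
  by_cases hk : k = n
  · subst hk; simp [(h _ (nn_mem k)).1 rfl]
  · rw [Function.update_of_ne hk]
    exact (h _ (nn_mem k)).2 fun e => hk (nn_inj e)

def RR (H Om : ZFSet) (φ : Fml) : ZFSet := ZFSet.sep (fun s => Sat H.toSet φ (fun n => fapp s (nn n))) Om

theorem RR_eq {φ : Fml} {z : ZFSet} (hz : z ⊆ Om) (h : ∀ s ∈ Om, (s ∈ z ↔ Sat H.toSet φ (fun n => fapp s (nn n)))) : z = RR H Om φ := by
  ext s
  rw [RR, ZFSet.mem_sep]
  exact ⟨fun hs => ⟨hz hs, (h s (hz hs)).1 hs⟩, fun hs => (h s hs.1).2 hs.2⟩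

theorem RR_mem (L : LSd κ W H Om Q) {X : ZFSet} (hX : Cl omega H Om Q X) (hw : omega ∈ X) (φ : Fml) : RR H Om φ ∈ X := by
  have hW := L.S.hD
  have hsubX : omega ⊆ X := (hX _ hw _ hw _ hw).1 L.hHm.omega_mem
  have hn : ∀ n, nn n ∈ X := fun n => hsubX (nn_mem n)
  have hnW : ∀ n, nn n ∈ W := fun n => hW.trans hW.omega_mem (nn_mem n)
  have key : ∀ {z : ZFSet}, z ∈ W → z ⊆ Om → z ∈ Q := fun h1 h2 => (L.hQ _).2 (Or.inr ⟨h1, h2⟩)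
  suffices h : RR H Om φ ∈ X ∧ RR H Om φ ∈ W from h.1
  have hsep : ∀ {z : ZFSet} {P : ZFSet → Prop}, z = ZFSet.sep P Om → z ⊆ Om ∧ ∀ s ∈ Om, (s ∈ z ↔ P s) := by
    rintro z P rfl
    exact ⟨fun s hs => (ZFSet.mem_sep.1 hs).1, fun s hs => by rw [ZFSet.mem_sep]; exact ⟨fun h => h.2, fun h => ⟨hs, h⟩⟩⟩
  induction φ with
  | mem i j =>
    have e := sep2 hW (P := fun s a b => fapp s a ∈ fapp s b) L.hOmW (hnW i) (hnW j)
    have e' := hsep (rfl : _ = ZFSet.sep (fun s => fapp s (nn i) ∈ fapp s (nn j)) Om)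
    obtain ⟨z, hz, hz'⟩ := (hX _ (hn i) _ (hn j) _ hw).2.1 ⟨_, key e e'.1, e'⟩
    have e2 := RR_eq (H := H) (φ := .mem i j) hz'.1 (fun s hs => (hz'.2 s hs).trans (by simp [Sat]))
    have e3 := RR_eq (H := H) (φ := .mem i j) e'.1 (fun s hs => (e'.2 s hs).trans (by simp [Sat]))
    exact ⟨e2 ▸ hz, e3 ▸ e⟩
  | eq i j =>
    have e := sep2 hW (P := fun s a b => fapp s a = fapp s b) L.hOmW (hnW i) (hnW j)
    have e' := hsep (rfl : _ = ZFSet.sep (fun s => fapp s (nn i) = fapp s (nn j)) Om)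
    obtain ⟨z, hz, hz'⟩ := (hX _ (hn i) _ (hn j) _ hw).2.2.1 ⟨_, key e e'.1, e'⟩
    have e2 := RR_eq (H := H) (φ := .eq i j) hz'.1 (fun s hs => (hz'.2 s hs).trans (by simp [Sat]))
    have e3 := RR_eq (H := H) (φ := .eq i j) e'.1 (fun s hs => (e'.2 s hs).trans (by simp [Sat]))
    exact ⟨e2 ▸ hz, e3 ▸ e⟩
  | impl φ ψ h1 h2 =>
    have e := sep2 hW (P := fun s a b => s ∈ a → s ∈ b) L.hOmW h1.2 h2.2
    have e' := hsep (rfl : _ = ZFSet.sep (fun s => s ∈ RR H Om φ → s ∈ RR H Om ψ) Om)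
    obtain ⟨z, hz, hz'⟩ := (hX _ h1.1 _ h2.1 _ hw).2.2.2.1 ⟨_, key e e'.1, e'⟩
    have c : ∀ s ∈ Om, (s ∈ RR H Om φ → s ∈ RR H Om ψ) ↔ Sat H.toSet (.impl φ ψ) (fun n => fapp s (nn n)) := fun s hs => by
      simp [Sat, RR, hs]
    have e2 := RR_eq (H := H) (φ := .impl φ ψ) hz'.1 (fun s hs => (hz'.2 s hs).trans (c s hs))
    have e3 := RR_eq (H := H) (φ := .impl φ ψ) e'.1 (fun s hs => (e'.2 s hs).trans (c s hs))
    exact ⟨e2 ▸ hz, e3 ▸ e⟩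
  | neg φ h1 =>
    have e := sep1 hW (P := fun s a => ¬ s ∈ a) L.hOmW h1.2
    have e' := hsep (rfl : _ = ZFSet.sep (fun s => ¬ s ∈ RR H Om φ) Om)
    obtain ⟨z, hz, hz'⟩ := (hX _ h1.1 _ hw _ hw).2.2.2.2.1 ⟨_, key e e'.1, e'⟩
    have c : ∀ s ∈ Om, (¬ s ∈ RR H Om φ) ↔ Sat H.toSet (.neg φ) (fun n => fapp s (nn n)) := fun s hs => by
      simp [Sat, RR, hs]
    have e2 := RR_eq (H := H) (φ := .neg φ) hz'.1 (fun s hs => (hz'.2 s hs).trans (c s hs))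
    have e3 := RR_eq (H := H) (φ := .neg φ) e'.1 (fun s hs => (e'.2 s hs).trans (c s hs))
    exact ⟨e2 ▸ hz, e3 ▸ e⟩
  | all n φ h1 =>
    have e := sep5 hW (P := fun s w H Om a b => ∀ x ∈ H, ∀ t ∈ Om, Upd w s a x t → t ∈ b) L.hOmW hW.omega_mem L.hH L.hOmW (hnW n) h1.2
    have e' := hsep (rfl : _ = ZFSet.sep (fun s => ∀ x ∈ H, ∀ t ∈ Om, Upd omega s (nn n) x t → t ∈ RR H Om φ) Om)
    obtain ⟨z, hz, hz'⟩ := (hX _ (hn n) _ h1.1 _ hw).2.2.2.2.2.1 ⟨_, key e e'.1, e'⟩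
    have c : ∀ s ∈ Om, (∀ x ∈ H, ∀ t ∈ Om, Upd omega s (nn n) x t → t ∈ RR H Om φ) ↔ Sat H.toSet (.all n φ) (fun n => fapp s (nn n)) := fun s hs => by
      constructor
      · intro h x hx
        obtain ⟨t, ht, ht'⟩ := L.updEx hs (nn_mem n) (mem_toSet.1 hx)
        have := h x (mem_toSet.1 hx) t ht ht'
        rw [RR, ZFSet.mem_sep, upd_eq ht'] at this
        exact this.2
      · intro h x hx t ht ht'
        rw [RR, ZFSet.mem_sep, upd_eq ht']
        exact ⟨ht, h x (mem_toSet.2 hx)⟩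
    have e2 := RR_eq (H := H) (φ := .all n φ) hz'.1 (fun s hs => (hz'.2 s hs).trans (c s hs))
    have e3 := RR_eq (H := H) (φ := .all n φ) e'.1 (fun s hs => (e'.2 s hs).trans (c s hs))
    exact ⟨e2 ▸ hz, e3 ▸ e⟩

theorem assign (L : LSd κ W H Om Q) {X s0 : ZFSet} (hX : Cl omega H Om Q X) (hw : omega ∈ X) (hs0 : s0 ∈ X) (hs0' : s0 ∈ Om)
    {v : ℕ → ZFSet} (hv : ∀ n, v n ∈ X ∧ v n ∈ H) (N : ℕ) : ∃ s ∈ X, s ∈ Om ∧ ∀ n < N, fapp s (nn n) = v n := by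
  have hsubX : omega ⊆ X := (hX _ hw _ hw _ hw).1 L.hHm.omega_mem
  have hOmQ : ∀ s ∈ Om, s ∈ Q := fun s hs => by
    obtain ⟨a, b, c⟩ := (L.hOm s).1 hs
    exact (L.hQ s).2 (Or.inl ((L.hH' s).2 (L.S.hs_func ((L.hH' _).1 L.hHm.omega_mem) a b fun n hn => (L.hH' _).1 (c n hn))))
  induction N with
  | zero => exact ⟨s0, hs0, hs0', fun n hn => absurd hn (by omega)⟩
  | succ N ih =>
    obtain ⟨s, hs, hs', h⟩ := ih
    obtain ⟨t, ht, ht'⟩ := L.updEx hs' (nn_mem N) (hv N).2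
    obtain ⟨t, htX, ht, ht'⟩ := (hX _ hs _ (hsubX (nn_mem N)) _ (hv N).1).2.2.2.2.2.2.2 ⟨t, hOmQ t ht, ht, ht'⟩
    refine ⟨t, htX, ht, fun n hn => ?_⟩
    rw [show fapp t (nn n) = _ from congrFun (upd_eq ht') n]
    by_cases hc : n = N
    · subst hc; simp
    · rw [Function.update_of_ne hc]; exact h n (by omega)

theorem elem (L : LSd κ W H Om Q) {X s0 m : ZFSet} (hX : Cl omega H Om Q X) (hw : omega ∈ X) (hs0 : s0 ∈ X) (hs0' : s0 ∈ Om)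
    (hm : ∀ x, x ∈ m ↔ x ∈ X ∧ x ∈ H) : ElemSub m.toSet H.toSet := by
  refine ⟨fun x hx => ((hm x).1 hx).2, fun φ => ?_⟩
  have hsubX : omega ⊆ X := (hX _ hw _ hw _ hw).1 L.hHm.omega_mem
  induction φ with
  | mem i j => intro v hv; simp [Sat]
  | eq i j => intro v hv; simp [Sat]
  | impl φ ψ h1 h2 => intro v hv; simp [Sat, h1 v hv, h2 v hv]
  | neg φ h1 => intro v hv; simp [Sat, h1 v hv]
  | all n φ h1 =>
    intro v hv
    have hup : ∀ x ∈ m, ∀ k, Function.update v n x k ∈ m.toSet := fun x hx k => by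
      by_cases hk : k = n
      · subst hk; simpa using hx
      · rw [Function.update_of_ne hk]; exact hv k
    constructor
    · intro h
      by_contra hc
      simp only [Sat, not_forall] at hc
      obtain ⟨x, hx, hc⟩ := hc
      obtain ⟨s, hs, hs', hsv⟩ := L.assign hX hw hs0 hs0' (fun n => (hm _).1 (hv n)) (n+1+φ.bd)
      have cong : ∀ y, Sat H.toSet φ (Function.update v n y) ↔ Sat H.toSet φ (Function.update (fun k => fapp s (nn k)) n y) := fun y => by
        refine sat_congr _ _ _ _ fun k hk => ?_
        by_cases hkn : k = n
        · subst hkn; simp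
        · rw [Function.update_of_ne hkn, Function.update_of_ne hkn, hsv k (by omega)]
      obtain ⟨t, ht, ht'⟩ := L.updEx hs' (nn_mem n) (mem_toSet.1 hx)
      have htR : ¬ t ∈ RR H Om φ := by
        rw [RR, ZFSet.mem_sep, upd_eq ht', ← cong]; exact fun h => hc h.2
      obtain ⟨z, hzX, hzH, t', ht1, ht2, ht3⟩ := (hX _ hs _ (hsubX (nn_mem n)) _ (L.RR_mem hX hw φ)).2.2.2.2.2.2.1
        ⟨x, (L.hQ x).2 (Or.inl hx), hx, t, ht, ht', htR⟩
      apply ht3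
      rw [RR, ZFSet.mem_sep, upd_eq ht2, ← cong]
      have hz : z ∈ m := (hm z).2 ⟨hzX, hzH⟩
      exact ⟨ht1, (h1 _ (hup z hz)).1 (h z hz)⟩
    · intro h x hx
      exact (h1 _ (hup x hx)).2 (h x ((hm x).1 hx).2)

theorem main (L : LSd κ W H Om Q) : ∃ E ∈ W, (∀ g ∈ E, g ∈ H ∧ IsZFunc κ g ∧ (ran g).IsTransitive ∧ ElemSub (ran g).toSet H.toSet) ∧
    ∀ x ∈ H, ∃ g ∈ E, x ∈ ran g := by
  have hW := L.S.hD
  have hE := sepD5 hW (fun D g κ w H Om Q => IsZFunc κ g ∧ ∃ X ∈ D, Cl w H Om Q X ∧ (∃ s ∈ X, s ∈ Om) ∧ w ∈ X ∧ ∀ y ∈ D, ((∃ ξ ∈ κ, fapp g ξ = y) ↔ (y ∈ X ∧ y ∈ H)))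
    L.hH L.hκ hW.omega_mem L.hH L.hOmW L.hQW
  refine ⟨_, hE, ?_, ?_⟩
  · intro g hg
    obtain ⟨hgH, hg1, X, hX, hC, ⟨s, hs, hs'⟩, hw, hr⟩ := ZFSet.mem_sep.1 hg
    have hgW := hW.trans L.hH hgH
    have hm : ∀ x, x ∈ ran g ↔ x ∈ X ∧ x ∈ H := fun x => by
      rw [mem_ran' hg1]
      refine ⟨fun h => (hr x ?_).1 h, fun h => (hr x (hW.trans hX h.1)).2 h⟩
      obtain ⟨ξ, hξ, rfl⟩ := h
      exact hW.fappD hgW hg1 ξ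
    refine ⟨hgH, hg1, fun y hy z hz => ?_, L.elem hC hw hs hs' hm⟩
    have h1 := (hm y).1 hy
    exact (hm z).2 ⟨(hC _ h1.1 _ h1.1 _ h1.1).1 h1.2 hz, L.hHm.trans h1.2 hz⟩
  · intro x hx
    obtain ⟨-, s, hs, hs1, hs2⟩ := replD0 hW (fun D m y => y = ∅) hW.omega_mem (fun m => ∅) (fun m hm => hW.empty_mem) (fun m hm y hy => Iff.rfl)
    have hsOm : s ∈ Om := (L.hOm s).2 ⟨hs, hs1, fun n hn => by rw [hs2 n hn]; exact L.hHm.empty_mem⟩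
    have hsH : s ∈ H := (L.hH' s).2 (L.S.hs_func ((L.hH' _).1 L.hHm.omega_mem) hs hs1 fun n hn => by
      rw [hs2 n hn]; exact (L.hH' _).1 L.hHm.empty_mem)
    have hx0 : ({x, s} : ZFSet) ∪ {omega} ∈ H := L.hHm.union_mem (L.hHm.upair hx hsH) (L.hHm.sing L.hHm.omega_mem)
    obtain ⟨X, hX, hXs, hXsub, hC⟩ := L.hull (hW.trans L.hH hx0) (fun y hy => (L.hQ y).2 (Or.inl (L.hHm.trans hx0 hy)))
      (sm_sing.1 (SmS.hs_sm ((L.hH' _).1 hx0)))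
    have hxX : x ∈ X := hXsub (by simp)
    have hmW := hW.inter_mem hX L.hH
    have hms : Im W.toSet κ (X ∩ H) := hXs.sub fun z hz => (ZFSet.mem_inter.1 hz).1
    obtain ⟨g, hg, hg1, hg2⟩ := Im.surj hW L.hκ hmW (ZFSet.mem_inter.2 ⟨hxX, hx⟩) hms
    have hgH : g ∈ H := (L.hH' g).2 (L.S.hs_func (L.S.hs_lam (by simp) L.tr) hg hg1 fun a ha =>
      (L.hH' _).1 (ZFSet.mem_inter.1 (hg2.1 a ha)).2)
    refine ⟨g, ZFSet.mem_sep.2 ⟨hgH, hg1, X, hX, hC, ⟨s, hXsub (by simp), hsOm⟩, hXsub (by simp), fun y hy => ⟨?_, fun h => ?_⟩⟩, ?_⟩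
    · rintro ⟨ξ, hξ, rfl⟩
      exact ZFSet.mem_inter.1 (hg2.1 ξ hξ)
    · exact hg2.2 y (ZFSet.mem_inter.2 h)
    · exact (mem_ran' hg1).2 (hg2.2 x (ZFSet.mem_inter.2 ⟨hxX, hx⟩))

end LSd

/-! ## The chain of elementary submodels -/

theorem ElemSub.model {m H : ZFSet.{u}} (hH : IsTransModel H) (ht : m.IsTransitive) (h0 : ∅ ∈ m) (h : ElemSub m.toSet H.toSet) : IsTransModel m :=
  transModel_transfer hH ht h0 fun σ hσ => (h.2 σ _ fun _ => h0).2 hσ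

structure Ch (κ D U H : ZFSet) (g u m : ℕ → ZFSet) : Prop where
  hH : IsTransModel H
  fn : ∀ n, IsZFunc κ (g n)
  rg : ∀ n, m n = ran (g n)
  tr : ∀ n, (m n).IsTransitive
  es : ∀ n, ElemSub (m n).toSet H.toSet
  gm : ∀ n, g n ∈ m (n+1)
  um : ∀ n, u n ∈ m (n+1)
  hu : ∀ n y, y ∈ u n ↔ y ∈ U ∧ y ∈ m n
  hκ : κ ∈ m 0
  gs : ∃ s ∈ D, IsZFunc omega s ∧ ∀ n, fapp s (nn n) = g n
  us : ∃ s ∈ D, IsZFunc omega s ∧ ∀ n, fapp s (nn n) = u n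

theorem Gd.chain {κ p D D' δ M U N W H A : ZFSet.{u}} {j : ZFSet.{u} → ZFSet.{u}} (G : Gd κ p D D' δ) (w : Wit κ M U N j) (hMD' : M ∈ D')
    (hUD' : U ∈ D') (B : Big κ D D' M U W H) (hseq : OmegaSeqClosedPair D D') (hA : A ∈ H) :
    ∃ g u m, Ch κ D U H g u m ∧ A ∈ m 0 := by
  have hD' := G.C.hD
  have hS := B.S G.C.cp G.C.hω
  have hκW := B.hW.trans B.hHW B.hκ
  obtain ⟨Om, Q, L⟩ := lsd hS hκW G.C.ord.isTransitive G.C.hω B.pow B.hHW B.hH' B.hH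
  obtain ⟨E, hE, hE1, hE2⟩ := L.main
  have hED' := hD'.trans B.hWD' hE
  have hHD' := hD'.trans B.hWD' B.hHW
  obtain ⟨F, hF, hF1, hF2⟩ := choiceD3 hD' (fun D g g' κ E U => g' ∈ E ∧ (∃ ξ ∈ κ, fapp g' ξ = g) ∧
      ∃ u ∈ D, (∃ ξ ∈ κ, fapp g' ξ = u) ∧ ∀ y ∈ D, (y ∈ u ↔ y ∈ U ∧ ∃ ξ ∈ κ, fapp g ξ = y)) hED' G.C.hκ hED' hUD' (fun g hg => by
    obtain ⟨a, b, c, d⟩ := hE1 g hg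
    obtain ⟨v, hv, hv'⟩ := G.uH w hMD' B a b
    obtain ⟨g', hg', hx⟩ := hE2 (pair g v) (B.hH.pair_mem a hv)
    obtain ⟨a', b', c', d'⟩ := hE1 g' hg'
    have e := fun y => mem_ran' (b := y) b'
    have hh : g ∈ ran g' ∧ v ∈ ran g' := by
      have h1 : ({g, v} : ZFSet) ∈ ran g' := c' _ hx (by simp [pair])
      exact ⟨c' _ h1 (by simp), c' _ h1 (by simp)⟩
    refine ⟨g', hD'.trans hED' hg', hg', (e _).1 hh.1, v, hD'.trans hHD' hv, (e _).1 hh.2, fun y hy => ?_⟩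
    rw [hv' y]
    simp only [eq_comm])
  obtain ⟨g0, hg0, hx0⟩ := hE2 (pair A κ) (B.hH.pair_mem hA B.hκ)
  obtain ⟨s, hs, hs1, hs0, hsS, hsn⟩ := iter hD' hF hF1 (fun x hx => (hF2 x hx).2.1) hg0
  have hg := fun n => hE1 _ (hsS n)
  obtain ⟨-, us, hus, hus1, hus2⟩ := replD3 hD' (fun D n y s κ U => ∃ g ∈ D, g = fapp s n ∧ ∀ z ∈ D, (z ∈ y ↔ z ∈ U ∧ ∃ ξ ∈ κ, fapp g ξ = z)) hD'.omega_mem hs G.C.hκ hUD'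
    (fun n => ZFSet.sep (fun z => ∃ ξ ∈ κ, fapp (fapp s n) ξ = z) U) (fun n hn => by
      exact sep2 hD' (P := fun z g κ => ∃ ξ ∈ κ, fapp g ξ = z) hUD' (hD'.fappD hs hs1 n) G.C.hκ) (fun n hn y hy => by
      constructor
      · rintro ⟨g, hg, rfl, h⟩
        ext z
        rw [ZFSet.mem_sep]
        exact ⟨fun hz => (h z (hD'.trans hy hz)).1 hz, fun hz => (h z (hD'.trans hUD' hz.1)).2 hz⟩
      · rintro rfl
        exact ⟨_, hD'.fappD hs hs1 n, rfl, fun z hz => by rw [ZFSet.mem_sep]⟩)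
  have hu : ∀ n y, y ∈ fapp us (nn n) ↔ y ∈ U ∧ y ∈ ran (fapp s (nn n)) := fun n y => by
    rw [hus2 _ (nn_mem n), ZFSet.mem_sep, mem_ran' (hg n).2.1]
  have hstep : ∀ n, fapp s (nn n) ∈ ran (fapp s (nn (n+1))) ∧ fapp us (nn n) ∈ ran (fapp s (nn (n+1))) := fun n => by
    have hr := fun y => mem_ran' (b := y) (hg (n+1)).2.1
    obtain ⟨-, -, h1, v, hv, h2, h3⟩ := hF2 _ (hsS n)
    rw [← hsn] at h1 h2
    refine ⟨(hr _).2 h1, ?_⟩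
    have : fapp us (nn n) = v := by
      ext z
      rw [hu, mem_ran' (hg n).2.1]
      exact ⟨fun hz => (h3 z (hD'.trans hUD' hz.1)).2 hz, fun hz => (h3 z (hD'.trans hv hz)).1 hz⟩
    rw [this]; exact (hr _).2 h2
  have hz : A ∈ ran g0 ∧ κ ∈ ran g0 := by
    have c' := (hE1 g0 hg0).2.2.1
    have h1 : ({A, κ} : ZFSet) ∈ ran g0 := c' _ hx0 (by simp [pair])
    exact ⟨c' _ h1 (by simp), c' _ h1 (by simp)⟩
  have e0 : fapp s (nn 0) = g0 := hs0
  refine ⟨fun n => fapp s (nn n), fun n => fapp us (nn n), fun n => ran (fapp s (nn n)),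
    ⟨B.hH, fun n => (hg n).2.1, fun n => rfl, fun n => (hg n).2.2.1, fun n => (hg n).2.2.2, fun n => (hstep n).1, fun n => (hstep n).2, hu, ?_, ?_, ?_⟩, ?_⟩
  · rw [e0]; exact hz.2
  · refine ⟨s, hseq s hs hs1 fun n hn => ?_, hs1, fun _ => rfl⟩
    obtain ⟨n, rfl⟩ := mem_omega.1 hn
    exact B.HD (hg n).1
  · refine ⟨us, hseq us hus hus1 fun n hn => ?_, hus1, fun _ => rfl⟩
    obtain ⟨n, rfl⟩ := mem_omega.1 hn
    exact B.HD ((hg (n+1)).2.2.2.1 (hstep n).2)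
  · show A ∈ ran (fapp s (nn 0))
    rw [e0]; exact hz.1

/-! ## Elementary chains and embeddings -/

theorem UDef.allN (N : ℕ) {P : Set ZFSet → (ℕ → ZFSet) → Prop} (h : UDef P) :
    UDef (fun D v => ∀ w : ℕ → ZFSet, (∀ n, w n ∈ D) → P D (fun n => if n < N then w n else v (n - N))) := by
  induction N with
  | zero =>
    refine h.congr fun D hD v hv => ?_
    simp only [Nat.not_lt_zero, if_false, Nat.sub_zero]
    exact ⟨fun h _ _ => h, fun h => h v hv⟩
  | succ N ih =>
    have ih' : UDef (fun D v => ∀ x ∈ D, (fun (D : Set ZFSet) (x : ZFSet) (v : ℕ → ZFSet) => ∀ w : ℕ → ZFSet, (∀ n, w n ∈ D) → P D (fun n => if n < N then w n else cons' x v (n - N))) D x v) := by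
      refine @UDef.allD _ (ih.congr fun D hD v hv => ?_)
      have : cons' (v 0) (fun n => v (n+1)) = v := by funext n; cases n <;> rfl
      simp only [this]
    refine ih'.congr fun D hD v hv => ?_
    constructor
    · intro H w hw
      have := H _ (hw N) w hw
      convert this using 2 with n
      by_cases h1 : n < N
      · simp [h1, Nat.lt_succ_of_lt h1]
      · by_cases h2 : n = N
        · subst h2; simp
        · rw [if_neg (by omega), if_neg h1]
          obtain ⟨k, rfl⟩ : ∃ k, n = N + 1 + k := ⟨n - (N+1), by omega⟩
          rw [show N + 1 + k - N = k + 1 by omega, cons'_succ]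
          congr 1; omega
    · intro H x hx w hw
      have := H (fun n => if n = N then x else w n) (fun n => by
        show (if n = N then x else w n) ∈ D
        split_ifs; exacts [hx, hw n])
      convert this using 2 with n
      by_cases h1 : n < N
      · simp [h1, Nat.lt_succ_of_lt h1, h1.ne]
      · by_cases h2 : n = N
        · subst h2; simp
        · rw [if_neg h1, if_neg (show ¬ n < N+1 by omega)]
          obtain ⟨k, rfl⟩ : ∃ k, n = N + 1 + k := ⟨n - (N+1), by omega⟩
          rw [show N + 1 + k - N = k + 1 by omega, cons'_succ]
          congr 1; omega

theorem UDef.allLt (N : ℕ) {P : ℕ → Set ZFSet → (ℕ → ZFSet) → Prop} (h : ∀ k, UDef (P k)) :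
    UDef (fun D v => ∀ k < N, P k D v) := by
  induction N with
  | zero => exact (inferInstance : UDef (fun D v => v 0 = v 0)).congr fun D hD v hv => by simp
  | succ N ih =>
    have := h N
    exact (inferInstance : UDef (fun D v => (∀ k < N, P k D v) ∧ P N D v)).congr fun D hD v hv =>
      ⟨fun h k hk => by
        by_cases e : k = N
        · subst e; exact h.2
        · exact h.1 k (by omega), fun h => ⟨fun k hk => h k (by omega), h N (by omega)⟩⟩

structure EC (a : ℕ → ZFSet) (T : ZFSet) : Prop where
  sub : ∀ n, a n ⊆ a (n+1)
  tr : ∀ n, (a n).IsTransitive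
  es : ∀ n (φ : Fml) (v : ℕ → ZFSet), (∀ k, v k ∈ a n) → (Sat (a n).toSet φ v ↔ Sat (a (n+1)).toSet φ v)
  hT : ∀ x, x ∈ T ↔ ∃ n, x ∈ a n

theorem EC.mono {a : ℕ → ZFSet} {T : ZFSet} (h : EC a T) (n k : ℕ) : a n ⊆ a (n+k) := by
  induction k with
  | zero => exact fun x hx => hx
  | succ k ih => exact fun x hx => h.sub _ (ih hx)

theorem EC.mono' {a : ℕ → ZFSet} {T : ZFSet} (h : EC a T) {n k : ℕ} (hk : n ≤ k) : a n ⊆ a k := by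
  obtain ⟨d, rfl⟩ := Nat.exists_eq_add_of_le hk
  exact h.mono n d

theorem EC.trT {a : ℕ → ZFSet} {T : ZFSet} (h : EC a T) : T.IsTransitive := fun x hx y hy => by
  obtain ⟨n, hx⟩ := (h.hT x).1 hx
  exact (h.hT y).2 ⟨n, h.tr n _ hx hy⟩

theorem EC.es' {a : ℕ → ZFSet} {T : ZFSet} (h : EC a T) {n k : ℕ} (hk : n ≤ k) (φ : Fml) (v : ℕ → ZFSet) (hv : ∀ k, v k ∈ a n) :
    Sat (a n).toSet φ v ↔ Sat (a k).toSet φ v := by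
  obtain ⟨d, rfl⟩ := Nat.exists_eq_add_of_le hk
  clear hk
  induction d with
  | zero => rfl
  | succ d ih => rw [ih, ← add_assoc]; exact h.es _ φ v fun k => h.mono n d (hv k)

theorem upd_mem {m : ZFSet} {v : ℕ → ZFSet} {x : ZFSet} (hv : ∀ n, v n ∈ m) (hx : x ∈ m) (n : ℕ) : ∀ k, Function.update v n x k ∈ m := fun k => by
  by_cases hk : k = n
  · subst hk; simpa using hx
  · rw [Function.update_of_ne hk]; exact hv k

theorem EC.elem {a : ℕ → ZFSet} {T : ZFSet} (h : EC a T) (n : ℕ) : ElemSub (a n).toSet T.toSet := by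
  refine ⟨fun x hx => (h.hT x).2 ⟨n, hx⟩, fun φ => ?_⟩
  induction φ generalizing n with
  | mem i j => intro v hv; simp [Sat]
  | eq i j => intro v hv; simp [Sat]
  | impl φ ψ h1 h2 => intro v hv; simp [Sat, h1 n v hv, h2 n v hv]
  | neg φ h1 => intro v hv; simp [Sat, h1 n v hv]
  | all i φ h1 =>
    intro v hv
    constructor
    · intro H x hx
      obtain ⟨k, hk⟩ := (h.hT x).1 hx
      have hx' : x ∈ a (n+k) := h.mono' (by omega) hk
      have := (h.es' (show n ≤ n+k by omega) _ v hv).1 H x hx'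
      exact (h1 (n+k) _ (upd_mem (fun j => h.mono n k (hv j)) hx' i)).1 this
    · intro H x hx
      exact (h1 n _ (upd_mem hv hx i)).2 (H x ((h.hT x).2 ⟨n, hx⟩))

theorem EC.model {a : ℕ → ZFSet.{u}} {T : ZFSet.{u}} (h : EC a T) (h0 : IsTransModel (a 0)) : IsTransModel T :=
  transModel_transfer h0 h.trT ((h.hT _).2 ⟨0, h0.empty_mem⟩) fun σ hσ => ((h.elem 0).2 σ _ fun _ => h0.empty_mem).1 hσ

theorem EC.map {a : ℕ → ZFSet.{u}} {T T' M N : ZFSet.{u}} {j : ZFSet.{u} → ZFSet.{u}} (h : EC a T) (hj : El M N j) (ha : ∀ n, a n ∈ M)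
    (h0 : ∀ n, ∃ x, x ∈ a n) (hT' : ∀ x, x ∈ T' ↔ ∃ n, x ∈ j (a n)) : EC (fun n => j (a n)) T' := by
  refine ⟨fun n => (hj.tr2 (fun x y => x ⊆ y) (ha n) (ha (n+1))).1 (h.sub n), fun n => (hj.tr1 (fun x => x.IsTransitive) (ha n)).1 (h.tr n), ?_, hT'⟩
  intro n φ v hv
  set B := φ.bd with hB
  have I : UDef (fun (D : Set ZFSet) w => (∀ k < B, w k ∈ w B) → (Sat (w B).toSet φ (fun k => w k) ↔ Sat (w (B+1)).toSet φ (fun k => w k))) := by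
    have := UDef.allLt B (P := fun k _ w => w k ∈ w B) (fun k => inferInstance)
    have i1 : UDef (fun (D : Set ZFSet) w => Sat (w B).toSet φ (fun k => w k)) := UDef.satIn φ B id
    have i2 : UDef (fun (D : Set ZFSet) w => Sat (w (B+1)).toSet φ (fun k => w k)) := UDef.satIn φ (B+1) id
    infer_instance
  have I' := UDef.allN B I
  have key := (hj.trv _ (h := I') (cons' (a n) (fun _ => a (n+1))) (cons'_mem (mem_toSet.2 (ha n)) (fun _ => ha (n+1)))).1 (by
    intro w hw H
    simp only [lt_irrefl, if_false, Nat.sub_self, show ¬ (B + 1 < B) by omega, show B + 1 - B = 1 by omega] at H ⊢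
    obtain ⟨x0, hx0⟩ := h0 n
    have hc : ∀ k < B, (if k < B then w k else cons' (a n) (fun _ => a (n+1)) (k - B)) = (if w k ∈ a n then w k else x0) := fun k hk => by
      have := H k hk
      rw [if_pos hk] at this ⊢
      exact (if_pos this).symm
    rw [sat_congr _ φ _ _ hc, sat_congr (cons' (a n) (fun _ => a (n+1)) 1).toSet φ _ _ hc]
    refine h.es n φ _ fun k => ?_
    show (if w k ∈ a n then w k else x0) ∈ a n
    split_ifs with hh
    · exact hh
    · exact hx0)
  have key2 := key v fun k => hj.trN _ (hj.maps _ (ha n)) (hv k)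
  simp only [lt_irrefl, if_false, Nat.sub_self, show ¬ (B + 1 < B) by omega, show B + 1 - B = 1 by omega] at key2
  have key3 := key2 (fun k hk => by rw [if_pos hk]; exact hv k)
  have hc : ∀ k < B, (if k < B then v k else j (cons' (a n) (fun _ => a (n+1)) (k - B))) = v k := fun k hk => if_pos hk
  rw [sat_congr _ φ _ _ hc, sat_congr (j (cons' (a n) (fun _ => a (n+1)) 1)).toSet φ _ _ hc] at key3
  exact key3

theorem EC.bd {a : ℕ → ZFSet} {T : ZFSet} (h : EC a T) (v : ℕ → ZFSet) (hv : ∀ n, v n ∈ T) (N : ℕ) : ∃ n, ∀ k < N, v k ∈ a n := by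
  induction N with
  | zero => exact ⟨0, fun k hk => absurd hk (by omega)⟩
  | succ N ih =>
    obtain ⟨n, hn⟩ := ih
    obtain ⟨n', hn'⟩ := (h.hT _).1 (hv N)
    refine ⟨n + n', fun k hk => ?_⟩
    by_cases e : k = N
    · subst e; exact h.mono' (by omega) hn'
    · exact h.mono _ _ (hn k (by omega))

theorem EC.el {a : ℕ → ZFSet.{u}} {T T' M N : ZFSet.{u}} {j : ZFSet.{u} → ZFSet.{u}} (h : EC a T) (hj : El M N j) (ha : ∀ n, a n ∈ M)
    (h' : EC (fun n => j (a n)) T') : El T T' j := by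
  refine ⟨h.trT, h'.trT, fun x hx => ?_, fun φ v hv => ?_⟩
  · obtain ⟨n, hn⟩ := (h.hT x).1 hx
    exact (h'.hT _).2 ⟨n, (hj.tr2 (fun x y => x ∈ y) (hj.trM _ (ha n) hn) (ha n)).1 hn⟩
  · obtain ⟨n, hn⟩ := h.bd v hv (φ.bd + 1)
    set w : ℕ → ZFSet := fun k => if k < φ.bd + 1 then v k else v 0
    have hw : ∀ k, w k ∈ a n := fun k => by
      show (if k < φ.bd + 1 then v k else v 0) ∈ a n
      split_ifs with hk
      · exact hn k hk
      · exact hn 0 (by omega)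
    have hwM : ∀ k, w k ∈ M := fun k => hj.trM _ (ha n) (hw k)
    have hvw : ∀ k < φ.bd, v k = w k := fun k hk => (if_pos (show k < φ.bd + 1 by omega)).symm
    have e1 := sat_congr T.toSet φ v w hvw
    have e2 := sat_congr T'.toSet φ (fun k => j (v k)) (fun k => j (w k)) (fun k hk => by simp only [hvw k hk])
    rw [e1, e2, ← (h.elem n).2 φ w hw]
    have I : UDef (fun (D : Set ZFSet) w => Sat (w 0).toSet φ (fun k => w (k+1))) := UDef.satIn φ 0 (fun k => k+1)
    have e3 := hj.trv _ (h := I) (cons' (a n) w) (cons'_mem (mem_toSet.2 (ha n)) hwM)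
    refine e3.trans ?_
    refine ((h'.elem n).2 φ (fun k => j (w k)) fun k => ?_)
    exact (hj.tr2 (fun x y => x ∈ y) (hwM k) (ha n)).1 (hw k)

/-! ## Skolem hulls -/

def ExT : ℕ → (Set ZFSet → (ℕ → ZFSet) → Prop) → Set ZFSet → ZFSet → (ℕ → ZFSet) → Prop
  | 0, P, D, t, v => P D v
  | N+1, P, D, t, v => ∃ a ∈ D, ∃ b ∈ D, t = pair a b ∧ ExT N P D a (Function.update v N b)

theorem UDef.exT {P : Set ZFSet → (ℕ → ZFSet) → Prop} (h : UDef P) (N : ℕ) : UDef (fun D w => ExT N P D (w 0) (fun n => w (n+1))) := by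
  induction N with
  | zero => exact h.comp (fun n => n+1)
  | succ N ih =>
    have h1 := ih.comp (fun k => if k = 0 then 1 else if k = N+1 then 0 else k + 2)
    have h2 : UDef (fun D w => ∃ a ∈ D, ∃ b ∈ D, w 0 = pair a b ∧ (fun (D : Set ZFSet) (a b : ZFSet) (w : ℕ → ZFSet) => ExT N P D a (Function.update (fun n => w (n+1)) N b)) D a b w) := by
      have h3 : UDef (fun D v => ExT N P D (v 1) (Function.update (fun n => v (n+1+1+1)) N (v 0))) := by
        refine h1.congr fun D hD v hv => ?_
        simp only [if_true]
        have : (fun n => v (if n + 1 = 0 then 1 else if n + 1 = N + 1 then 0 else n + 1 + 2)) = Function.update (fun n => v (n+1+1+1)) N (v 0) := by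
          funext n
          by_cases e : n = N
          · subst e; simp
          · simp [e]
        rw [this]
      infer_instance
    exact h2

def tup (v : ℕ → ZFSet) : ℕ → ZFSet
  | 0 => v 0
  | N+1 => pair (tup v N) (v N)

theorem tup_mem {K : ZFSet} (hK : ∀ a ∈ K, ∀ b ∈ K, pair a b ∈ K) {v : ℕ → ZFSet} (hv : ∀ n, v n ∈ K) (N : ℕ) : tup v N ∈ K := by
  induction N with
  | zero => exact hv 0
  | succ N ih => exact hK _ ih _ (hv N)

theorem exT_tup {P : Set ZFSet → (ℕ → ZFSet) → Prop} {D : Set ZFSet} {v : ℕ → ZFSet} (hv : ∀ n, v n ∈ D) (ht : ∀ n, tup v n ∈ D) (N : ℕ) (w : ℕ → ZFSet) :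
    ExT N P D (tup v N) w ↔ P D (fun k => if k < N then v k else w k) := by
  induction N generalizing w with
  | zero => simp [ExT]
  | succ N ih =>
    have e : (fun k => if k < N then v k else Function.update w N (v N) k) = (fun k => if k < N+1 then v k else w k) := by
      funext k
      by_cases h1 : k < N
      · simp [h1, Nat.lt_succ_of_lt h1]
      · by_cases h2 : k = N
        · subst h2; simp
        · rw [if_neg h1, if_neg (by omega), Function.update_of_ne h2]
    rw [← e, ← ih]
    constructor
    · rintro ⟨a, ha, b, hb, h, h'⟩
      obtain ⟨h1, h2⟩ := pair_inj.1 (show pair (tup v N) (v N) = pair a b from h)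
      rw [h1, h2]; exact h'
    · intro h
      exact ⟨_, ht N, _, hv N, rfl, h⟩

theorem skol {Mb T a : ZFSet.{u}} {i : ZFSet.{u} → ZFSet.{u}} (hM : IsTransModel Mb) (hi : El Mb T i) (Q : Set ZFSet.{u} → ZFSet.{u} → ZFSet.{u} → Prop)
    (hQ : UDef (fun D v => Q D (v 0) (v 1))) (ha : a ∈ Mb) : ∃ f ∈ Mb, IsZFunc a f ∧ ∀ t ∈ i a, (∃ x ∈ i a, Q T.toSet x t) → Q T.toSet (fapp (i f) t) t := by
  haveI I : ∀ p q, UDef (fun D v => Q D (v p) (v q)) := fun p q => hQ.comp (fun n => if n = 0 then p else q)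
  obtain ⟨f, hf, hf1, hf2⟩ := choiceD1 hM (fun D t y a => (∃ x ∈ a, Q D x t) → Q D y t) ha ha (fun t ht => by
    by_cases h : ∃ x ∈ a, Q Mb.toSet x t
    · obtain ⟨x, hx, h⟩ := h
      exact ⟨x, hM.trans ha hx, fun _ => h⟩
    · exact ⟨∅, hM.empty_mem, fun h' => absurd h' h⟩)
  refine ⟨f, hf, hf1, ?_⟩
  have key := (hi.trv (fun D v => ∀ t ∈ v 0, (∃ x ∈ v 0, Q D x t) → ∃ y ∈ D, y = fapp (v 1) t ∧ Q D y t) (cons' a (fun _ => f))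
    (cons'_mem (mem_toSet.2 ha) (fun _ => hf))).1 (fun t ht h => ⟨_, (hf2 t ht).1, rfl, (hf2 t ht).2 h⟩)
  intro t ht h
  obtain ⟨y, -, rfl, h⟩ := key t ht h
  exact h

theorem hull_elem {Mb T K : ZFSet.{u}} {m : ℕ → ZFSet.{u}} {i : ZFSet.{u} → ZFSet.{u}} (hM : IsTransModel Mb) (hi : El Mb T i) (hm : ∀ n, m n ∈ Mb)
    (hE : EC (fun n => i (m n)) T) (hKT : K ⊆ T) (hp : ∀ a ∈ K, ∀ b ∈ K, pair a b ∈ K)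
    (ha : ∀ f ∈ Mb, ∀ d ∈ Mb, IsZFunc d f → ∀ a ∈ K, a ∈ i d → fapp (i f) a ∈ K) : ElemSub K.toSet T.toSet := by
  refine ⟨hKT, fun φ => ?_⟩
  induction φ with
  | mem i j => intro v hv; simp [Sat]
  | eq i j => intro v hv; simp [Sat]
  | impl φ ψ h1 h2 => intro v hv; simp [Sat, h1 v hv, h2 v hv]
  | neg φ h1 => intro v hv; simp [Sat, h1 v hv]
  | all n φ h1 =>
    intro v hv
    constructor
    · intro h
      by_contra hc
      simp only [Sat, not_forall] at hc
      obtain ⟨x, hx, hc⟩ := hc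
      set N := n + 1 + φ.bd with hN
      set P : Set ZFSet.{u} → (ℕ → ZFSet.{u}) → Prop := fun D w => ¬ Sat D φ (fun k => w (if k = n then N else k)) with hP
      have hPd : UDef P := by
        have := UDef.satD φ (fun k => if k = n then N else k)
        exact UDef.not
      set Q : Set ZFSet.{u} → ZFSet.{u} → ZFSet.{u} → Prop := fun D x t => ExT N P D t (fun _ => x) with hQ
      have hQd : UDef (fun D v => Q D (v 0) (v 1)) := (hPd.exT N).comp (fun k => if k = 0 then 1 else 0)
      have htK : ∀ k, tup v k ∈ K := fun k => tup_mem hp hv k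
      have hQx : ∀ x, Q T.toSet x (tup v N) ↔ ¬ Sat T.toSet φ (Function.update v n x) := fun x => by
        rw [hQ]
        simp only
        rw [exT_tup (P := P) (D := T.toSet) (v := v) (fun k => mem_toSet.2 (hKT (hv k))) (fun k => mem_toSet.2 (hKT (htK k))) N, hP]
        simp only
        rw [not_iff_not]
        refine sat_congr _ _ _ _ fun k hk => ?_
        by_cases e : k = n
        · subst e; simp
        · rw [Function.update_of_ne e]
          simp only [e, if_false]
          rw [if_pos (by omega)]
      obtain ⟨k1, hk1⟩ := (hE.hT _).1 hx
      obtain ⟨k2, hk2⟩ := (hE.hT _).1 (hKT (htK N))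
      have hk1 : x ∈ i (m (k1 + k2)) := hE.mono _ _ hk1
      have hk2 : tup v N ∈ i (m (k1 + k2)) := by have := hE.mono _ k1 hk2; rwa [add_comm] at this
      obtain ⟨f, hf, hf1, hf2⟩ := skol hM hi Q hQd (hm (k1+k2))
      have h3 := hf2 _ hk2 ⟨x, hk1, (hQx x).2 hc⟩
      have h4 : fapp (i f) (tup v N) ∈ K := ha f hf _ (hm _) hf1 _ (htK N) hk2
      exact (hQx _).1 h3 ((h1 _ (upd_mem hv h4 n)).1 (h _ h4))
    · intro h x hx
      exact (h1 _ (upd_mem hv hx n)).2 (h x (hKT hx))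

/-! ## Collapses of elementary substructures -/

theorem ElemSub.exv {K T : ZFSet.{u}} (h : ElemSub K.toSet T.toSet) (hT : T.IsTransitive) (P : Set ZFSet.{u} → (ℕ → ZFSet.{u}) → Prop) [hP : UDef P]
    (v : ℕ → ZFSet.{u}) (hv : ∀ n, v n ∈ K) (H : ∃ x ∈ T, P T.toSet (cons' x v)) : ∃ x ∈ K, P T.toSet (cons' x v) := by
  obtain ⟨φ, hφ⟩ := hP.out
  obtain ⟨x, hx, H⟩ := H
  have hc : ∀ n, cons' (v 0) v n ∈ K := cons'_mem (D := K.toSet) (mem_toSet.2 (hv 0)) (fun n => mem_toSet.2 (hv n))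
  have up : ∀ y, Function.update (cons' (v 0) v) 0 y = cons' y v := fun y => by
    funext n
    cases n with
    | zero => simp [cons']
    | succ n => rw [Function.update_of_ne (by omega)]; rfl
  by_contra hcon
  have h1 : Sat K.toSet (.all 0 (.neg φ)) (cons' (v 0) v) := by
    intro y hy hs
    rw [up] at hs
    have hcy : ∀ n, cons' y v n ∈ K.toSet := cons'_mem (D := K.toSet) hy (fun n => mem_toSet.2 (hv n))
    refine hcon ⟨y, mem_toSet.1 hy, ?_⟩
    exact (hφ T.toSet (trS_of hT) _ fun n => h.1 (hcy n)).1 ((h.2 φ _ hcy).1 hs)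
  have h2 := (h.2 _ _ fun n => mem_toSet.2 (hc n)).1 h1 x (mem_toSet.2 hx)
  apply h2
  rw [up]
  exact (hφ T.toSet (trS_of hT) _ (cons'_mem (mem_toSet.2 hx) (fun n => h.1 (mem_toSet.2 (hv n))))).2 H

theorem ElemSub.ex2 {K T p1 p2 : ZFSet.{u}} (h : ElemSub K.toSet T.toSet) (hT : T.IsTransitive) (P : ZFSet.{u} → ZFSet.{u} → ZFSet.{u} → Prop) [hP : UDef (fun _ v => P (v 0) (v 1) (v 2))]
    (h1 : p1 ∈ K) (h2 : p2 ∈ K) (H : ∃ x ∈ T, P x p1 p2) : ∃ x ∈ K, P x p1 p2 :=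
  h.exv hT (fun _ v => P (v 0) (v 1) (v 2)) (cons' p1 (fun _ => p2)) (cons'_mem (D := K.toSet) (mem_toSet.2 h1) (fun _ => mem_toSet.2 h2)) H

theorem ElemSub.ex3 {K T p1 p2 p3 : ZFSet.{u}} (h : ElemSub K.toSet T.toSet) (hT : T.IsTransitive) (P : ZFSet.{u} → ZFSet.{u} → ZFSet.{u} → ZFSet.{u} → Prop) [hP : UDef (fun _ v => P (v 0) (v 1) (v 2) (v 3))]
    (h1 : p1 ∈ K) (h2 : p2 ∈ K) (h3 : p3 ∈ K) (H : ∃ x ∈ T, P x p1 p2 p3) : ∃ x ∈ K, P x p1 p2 p3 :=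
  h.exv hT (fun _ v => P (v 0) (v 1) (v 2) (v 3)) (cons' p1 (cons' p2 (fun _ => p3))) (cons'_mem (D := K.toSet) (mem_toSet.2 h1) (cons'_mem (D := K.toSet) (mem_toSet.2 h2) (fun _ => mem_toSet.2 h3))) H

theorem ElemSub.ex4 {K T p1 p2 p3 p4 : ZFSet.{u}} (h : ElemSub K.toSet T.toSet) (hT : T.IsTransitive) (P : ZFSet.{u} → ZFSet.{u} → ZFSet.{u} → ZFSet.{u} → ZFSet.{u} → Prop) [hP : UDef (fun _ v => P (v 0) (v 1) (v 2) (v 3) (v 4))]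
    (h1 : p1 ∈ K) (h2 : p2 ∈ K) (h3 : p3 ∈ K) (h4 : p4 ∈ K) (H : ∃ x ∈ T, P x p1 p2 p3 p4) : ∃ x ∈ K, P x p1 p2 p3 p4 :=
  h.exv hT (fun _ v => P (v 0) (v 1) (v 2) (v 3) (v 4)) (cons' p1 (cons' p2 (cons' p3 (fun _ => p4)))) (cons'_mem (D := K.toSet) (mem_toSet.2 h1) (cons'_mem (D := K.toSet) (mem_toSet.2 h2) (cons'_mem (D := K.toSet) (mem_toSet.2 h3) (fun _ => mem_toSet.2 h4)))) H

def col (K : ZFSet.{u}) : ZFSet.{u} → ZFSet.{u} :=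
  ZFSet.mem_wf.fix fun x ih => (⋃₀ (ZFSet.range (fun y : x => if y.1 ∈ K then ({ih y.1 y.2} : ZFSet.{u}) else ∅)) : ZFSet.{u})

theorem mem_col {K x z : ZFSet.{u}} : z ∈ col K x ↔ ∃ y ∈ x, y ∈ K ∧ z = col K y := by
  rw [col, WellFounded.fix_eq]
  simp only [mem_sUnion, mem_range]
  constructor
  · rintro ⟨w, ⟨y, rfl⟩, hz⟩
    split_ifs at hz with hK
    · exact ⟨_, y.2, hK, mem_singleton.1 hz⟩
    · exact absurd hz (notMem_empty _)
  · rintro ⟨y, hy, hK, rfl⟩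
    refine ⟨_, ⟨⟨y, hy⟩, rfl⟩, ?_⟩
    simp only [hK, if_true, mem_singleton]

theorem col_id {K : ZFSet.{u}} (hK : K.IsTransitive) (x : ZFSet.{u}) : x ⊆ K → col K x = x := by
  induction x using ZFSet.inductionOn with
  | _ x ih =>
    intro hx
    ext z
    rw [mem_col]
    constructor
    · rintro ⟨y, hy, hyK, rfl⟩
      rwa [ih y hy (hK y hyK)]
    · intro hz
      exact ⟨z, hz, hx hz, (ih z hz (hK z (hx hz))).symm⟩

def rho (K z : ZFSet.{u}) : ZFSet.{u} := if h : ∃ x ∈ K, col K x = z then h.choose else ∅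

structure CK (K T : ZFSet.{u}) : Prop where
  es : ElemSub K.toSet T.toSet
  tr : T.IsTransitive

namespace CK
variable {K T : ZFSet.{u}}

theorem sub (h : CK K T) {x : ZFSet.{u}} (hx : x ∈ K) : x ∈ T := mem_toSet.1 (h.es.1 (mem_toSet.2 hx))

theorem inj (h : CK K T) : ∀ x ∈ K, ∀ y ∈ K, col K x = col K y → x = y := by
  intro x
  induction x using ZFSet.inductionOn with
  | _ x ih =>
    intro hx y hy hxy
    by_contra hne
    have : (∃ z ∈ T, z ∈ x ∧ z ∉ y) ∨ (∃ z ∈ T, z ∈ y ∧ z ∉ x) := by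
      by_contra hcon
      push Not at hcon
      exact hne (ZFSet.ext fun z => ⟨fun hz => hcon.1 z (h.tr _ (h.sub hx) hz) hz, fun hz => hcon.2 z (h.tr _ (h.sub hy) hz) hz⟩)
    rcases this with H | H
    · obtain ⟨z, hzK, hzx, hzy⟩ := h.es.ex2 h.tr (fun z x y => z ∈ x ∧ z ∉ y) hx hy H
      have : col K z ∈ col K y := hxy ▸ mem_col.2 ⟨z, hzx, hzK, rfl⟩
      obtain ⟨w, hw, hwK, e⟩ := mem_col.1 this
      rw [ih z hzx hzK w hwK e] at hzy
      exact hzy hw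
    · obtain ⟨z, hzK, hzx, hzy⟩ := h.es.ex2 h.tr (fun z x y => z ∈ y ∧ z ∉ x) hx hy H
      have : col K z ∈ col K x := hxy ▸ mem_col.2 ⟨z, hzx, hzK, rfl⟩
      obtain ⟨w, hw, hwK, e⟩ := mem_col.1 this
      rw [← ih w hw hwK z hzK e.symm] at hzy
      exact hzy hw

theorem mem (h : CK K T) {x y : ZFSet.{u}} (hx : x ∈ K) (hy : y ∈ K) : col K x ∈ col K y ↔ x ∈ y := by
  rw [mem_col]
  constructor
  · rintro ⟨w, hw, hwK, e⟩
    rwa [h.inj x hx w hwK e]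
  · intro hxy
    exact ⟨x, hxy, hx, rfl⟩

theorem memK {z : ZFSet.{u}} : z ∈ col K K ↔ ∃ x ∈ K, z = col K x := by
  rw [mem_col]
  exact ⟨fun ⟨x, h, _, e⟩ => ⟨x, h, e⟩, fun ⟨x, h, e⟩ => ⟨x, h, h, e⟩⟩

theorem trans : (col K K).IsTransitive := fun x hx y hy => by
  obtain ⟨x, hx, rfl⟩ := memK.1 hx
  obtain ⟨y, hy, hyK, rfl⟩ := mem_col.1 hy
  exact memK.2 ⟨y, hyK, rfl⟩

theorem rho (h : CK K T) {x : ZFSet.{u}} (hx : x ∈ K) : MPaper.rho K (col K x) = x := by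
  have h' : ∃ x' ∈ K, col K x' = col K x := ⟨x, hx, rfl⟩
  rw [MPaper.rho, dif_pos h']
  exact h.inj _ h'.choose_spec.1 _ hx h'.choose_spec.2

theorem rho_mem (h : CK K T) {z : ZFSet.{u}} (hz : z ∈ col K K) : MPaper.rho K z ∈ K ∧ col K (MPaper.rho K z) = z := by
  obtain ⟨x, hx, rfl⟩ := memK.1 hz
  rw [h.rho hx]
  exact ⟨hx, rfl⟩

theorem satK (h : CK K T) (φ : Fml) : ∀ v : ℕ → ZFSet.{u}, (∀ n, v n ∈ K) → (Sat K.toSet φ v ↔ Sat (col K K).toSet φ (fun n => col K (v n))) := by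
  induction φ with
  | mem i j => intro v hv; simp only [Sat]; exact (h.mem (hv _) (hv _)).symm
  | eq i j => intro v hv; simp only [Sat]; exact ⟨fun e => by rw [e], h.inj _ (hv _) _ (hv _)⟩
  | impl φ ψ h1 h2 => intro v hv; simp [Sat, h1 v hv, h2 v hv]
  | neg φ h1 => intro v hv; simp [Sat, h1 v hv]
  | all i φ h1 =>
    intro v hv
    have up : ∀ x, (fun n => col K (Function.update v i x n)) = Function.update (fun n => col K (v n)) i (col K x) := fun x => by
      funext n
      by_cases e : n = i
      · subst e; simp
      · simp [e]
    constructor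
    · intro H z hz
      obtain ⟨x, hx, rfl⟩ := memK.1 (mem_toSet.1 hz)
      rw [← up]
      exact (h1 _ (upd_mem hv hx i)).1 (H x (mem_toSet.2 hx))
    · intro H x hx
      refine (h1 _ (upd_mem hv (mem_toSet.1 hx) i)).2 ?_
      rw [up]
      exact H _ (mem_toSet.2 (memK.2 ⟨x, mem_toSet.1 hx, rfl⟩))

theorem el (h : CK K T) : El (col K K) T (MPaper.rho K) := by
  refine ⟨trans, h.tr, fun x hx => h.sub (h.rho_mem hx).1, fun φ v hv => ?_⟩
  have := h.satK φ (fun n => MPaper.rho K (v n)) (fun n => (h.rho_mem (hv n)).1)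
  have e : (fun n => col K (MPaper.rho K (v n))) = v := funext fun n => (h.rho_mem (hv n)).2
  rw [e] at this
  rw [← this]
  exact h.es.2 φ _ fun n => mem_toSet.2 (h.rho_mem (hv n)).1

end CK

/-! ## The iteration restricted to the union of the chain -/

structure Lc (κ M U Mb : ZFSet.{u}) (m u : ℕ → ZFSet.{u}) : Prop where
  hU : IsMUltrafilter κ M U
  ec : EC m Mb
  md : ∀ n, IsTransModel (m n)
  mm : ∀ n, m n ∈ m (n+1)
  um : ∀ n, u n ∈ m (n+1)
  hu : ∀ n y, y ∈ u n ↔ y ∈ U ∧ y ∈ m n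
  hκ : κ ∈ m 0
  MbM : Mb ⊆ M
  ord : κ.IsOrdinal
  suc : ∀ a ∈ κ, insert a a ∈ κ
  ne : (∅ : ZFSet.{u}) ∈ κ

namespace Lc
variable {κ M U Mb : ZFSet.{u}} {m u : ℕ → ZFSet.{u}}

theorem model (h : Lc κ M U Mb m u) : IsTransModel Mb := h.ec.model (h.md 0)
theorem inMb (h : Lc κ M U Mb m u) {n : ℕ} {x : ZFSet.{u}} (hx : x ∈ m n) : x ∈ Mb := (h.ec.hT _).2 ⟨n, hx⟩
theorem mMb (h : Lc κ M U Mb m u) (n : ℕ) : m n ∈ Mb := h.inMb (h.mm n)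
theorem uMb (h : Lc κ M U Mb m u) (n : ℕ) : u n ∈ Mb := h.inMb (h.um n)
theorem κMb (h : Lc κ M U Mb m u) : κ ∈ Mb := h.inMb h.hκ
theorem κm (h : Lc κ M U Mb m u) (n : ℕ) : κ ∈ m n := h.ec.mono' (Nat.zero_le n) h.hκ
theorem mM (h : Lc κ M U Mb m u) (n : ℕ) : m n ∈ M := h.MbM (h.mMb n)
theorem uM (h : Lc κ M U Mb m u) (n : ℕ) : u n ∈ M := h.MbM (h.uMb n)
theorem κM (h : Lc κ M U Mb m u) : κ ∈ M := h.MbM h.κMb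

theorem t1 (h : Lc κ M U Mb m u) (n : ℕ) : ∀ y ∈ u n, y ⊆ κ := fun y hy => (h.hU.1 y ((h.hu n y).1 hy).1).2

theorem t2 (h : Lc κ M U Mb m u) (n : ℕ) : ∀ γ ∈ κ, ∃ T ∈ u n, ∀ ξ ∈ T, γ ∈ ξ := fun γ hγ => by
  refine ⟨_, (h.hu n _).2 ⟨h.hU.2.1 _ (h.suc γ hγ), ?_⟩, ?_⟩
  · have h1 : γ ∈ m n := (h.md n).trans (h.κm n) hγ
    exact sepD1 (h.md n) (fun _ x p => x ∉ p) (h.κm n) ((h.md n).insert_mem h1 h1)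
  · intro ξ hξ
    obtain ⟨hξ, h2⟩ := mem_sep.1 hξ
    rcases ((h.ord.mem hγ).mem_trichotomous (h.ord.mem hξ)) with h3 | h3 | h3
    · exact h3
    · subst h3; exact absurd (mem_insert _ _) h2
    · exact absurd (mem_insert_of_mem _ h3) h2

theorem t3 (h : Lc κ M U Mb m u) (n : ℕ) : ∀ f ∈ m n, IsZFunc κ f → (∃ S ∈ u n, ∀ ξ ∈ S, fapp f ξ ∈ ξ) →
    ∃ γ ∈ κ, ∃ T ∈ u n, ∀ ξ ∈ T, fapp f ξ = γ := fun f hf hf1 ⟨S, hS, hS1⟩ => by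
  have hfM : f ∈ M := h.MbM (h.inMb hf)
  have h1 : ZFSet.sep (fun ξ => fapp f ξ ∈ ξ) κ ∈ m n := sepD1 (h.md n) (fun _ x f => fapp f x ∈ x) (h.κm n) hf
  obtain ⟨γ, hγ, h2⟩ := h.hU.2.2.2.2.2.2 f hfM hf1 (h.hU.2.2.2.2.1 S ((h.hu n _).1 hS).1 _ (h.MbM (h.inMb h1)) (fun x hx => (mem_sep.1 hx).1)
    (fun ξ hξ => mem_sep.2 ⟨h.t1 n S hS hξ, hS1 ξ hξ⟩))
  refine ⟨γ, hγ, _, (h.hu n _).2 ⟨h2, ?_⟩, fun ξ hξ => (mem_sep.1 hξ).2⟩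
  have := sepD2 (h.md n) (fun _ x f γ => γ = fapp f x) (h.κm n) hf ((h.md n).trans (h.κm n) hγ)
  have e : (fun ξ => fapp f ξ = γ) = (fun ξ => γ = fapp f ξ) := funext fun _ => propext eq_comm
  rw [e]; exact this

end Lc

structure It (κ M U : ZFSet.{u}) (α : Ordinal.{v}) (Mod cr Us : Ordinal.{v} → ZFSet.{u}) (e : Ordinal.{v} → Ordinal.{v} → ZFSet.{u} → ZFSet.{u}) : Prop where
  m0 : Mod 0 = M
  c0 : cr 0 = κ
  u0 : Us 0 = U
  idd : ∀ β ≤ α, ∀ x ∈ Mod β, e β β x = x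
  comp : ∀ β γ ρ, β ≤ γ → γ ≤ ρ → ρ ≤ α → ∀ x ∈ Mod β, e γ ρ (e β γ x) = e β ρ x
  el : ∀ β γ, β ≤ γ → γ ≤ α → El (Mod β) (Mod γ) (e β γ)
  ui : ∀ β, β + 1 ≤ α → ∀ A ∈ Mod β, A ⊆ cr β → (A ∈ Us β ↔ cr β ∈ e β (β+1) A)
  cs : ∀ β, β + 1 ≤ α → cr (β+1) = e β (β+1) (cr β)
  us : ∀ β, β + 1 ≤ α → ∀ A, A ∈ Us (β + 1) ↔ ∃ X ∈ Mod β, X ∩ Us β ∈ Mod β ∧ A ∈ e β (β + 1) (X ∩ Us β)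
  ml : ∀ lam, lam ≤ α → lam ≠ 0 → (∀ β < lam, β + 1 < lam) → ∀ x ∈ Mod lam, ∃ β < lam, ∃ y ∈ Mod β, e β lam y = x
  cl : ∀ lam, lam ≤ α → lam ≠ 0 → (∀ β < lam, β + 1 < lam) → cr lam = e 0 lam κ
  ul : ∀ lam, lam ≤ α → lam ≠ 0 → (∀ β < lam, β + 1 < lam) → ∀ A, A ∈ Us lam ↔ ∃ β < lam, ∃ B, B ∈ Us β ∧ e β lam B = A

theorem IsAlphaIterable.it {κ M U : ZFSet.{u}} {α : Ordinal.{v}} (h : IsAlphaIterable κ M U α) : ∃ Mod cr Us e, It κ M U α Mod cr Us e := by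
  obtain ⟨Mod, cr, Us, e, h0, h1, h2, h3, h4, h5, h6, h7, h8⟩ := h
  exact ⟨Mod, cr, Us, e, h0, h1, h2, h4, h5, fun β γ h h' => ⟨h3 β (h.trans h'), h3 γ h', (h6 β γ h h').1, (h6 β γ h h').2⟩,
    fun β hβ => (h7 β hβ).1.2.2.2.2, fun β hβ => (h7 β hβ).2.1, fun β hβ => (h7 β hβ).2.2,
    fun l a b c => (h8 l a b c).1, fun l a b c => (h8 l a b c).2.1, fun l a b c => (h8 l a b c).2.2⟩

theorem ord_ind {P : Ordinal.{v} → Prop} {α : Ordinal.{v}} (h0 : P 0) (hs : ∀ β, β + 1 ≤ α → P β → P (β+1))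
    (hl : ∀ lam, lam ≤ α → lam ≠ 0 → (∀ β < lam, β + 1 < lam) → (∀ β < lam, P β) → P lam) : ∀ β ≤ α, P β := by
  intro β
  induction β using WellFoundedLT.induction with
  | _ β ih =>
    intro hβ
    by_cases e0 : β = 0
    · subst e0; exact h0
    · by_cases hlim : ∀ γ < β, γ + 1 < β
      · exact hl β hβ e0 hlim fun γ hγ => ih γ hγ (hγ.le.trans hβ)
      · push Not at hlim
        obtain ⟨γ, hγ, hγ'⟩ := hlim
        have : β = γ + 1 := le_antisymm hγ' (Order.add_one_le_of_lt hγ)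
        subst this
        exact hs γ hβ (ih γ hγ (hγ.le.trans hβ))

structure Sit (κ M U Mb : ZFSet.{u}) (m u : ℕ → ZFSet.{u}) (α : Ordinal.{v}) (Mod cr Us : Ordinal.{v} → ZFSet.{u}) (e : Ordinal.{v} → Ordinal.{v} → ZFSet.{u} → ZFSet.{u}) : Prop where
  L : Lc κ M U Mb m u
  I : It κ M U α Mod cr Us e

def TT (m : ℕ → ZFSet.{u}) (Mod : Ordinal.{v} → ZFSet.{u}) (e : Ordinal.{v} → Ordinal.{v} → ZFSet.{u} → ZFSet.{u}) (β : Ordinal.{v}) : ZFSet.{u} :=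
  ZFSet.sep (fun x => ∃ n, x ∈ e 0 β (m n)) (Mod β)

namespace Sit
variable {κ M U Mb : ZFSet.{u}} {m u : ℕ → ZFSet.{u}} {α β γ : Ordinal.{v}} {Mod cr Us : Ordinal.{v} → ZFSet.{u}} {e : Ordinal.{v} → Ordinal.{v} → ZFSet.{u} → ZFSet.{u}}

theorem le1 (h : β + 1 ≤ α) : β ≤ α := (Order.le_succ β).trans h
theorem le2 (β : Ordinal.{v}) : β ≤ β + 1 := Order.le_succ β

theorem el0 (S : Sit κ M U Mb m u α Mod cr Us e) (h : β ≤ α) : El M (Mod β) (e 0 β) := by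
  have := S.I.el 0 β (zero_le (a := β)) h
  rwa [S.I.m0] at this

theorem e00 (S : Sit κ M U Mb m u α Mod cr Us e) {x : ZFSet.{u}} (hx : x ∈ M) : e 0 0 x = x :=
  S.I.idd 0 (zero_le (a := α)) x (by rwa [S.I.m0])

theorem cmp (S : Sit κ M U Mb m u α Mod cr Us e) (h : β ≤ γ) (h' : γ ≤ α) {x : ZFSet.{u}} (hx : x ∈ M) : e β γ (e 0 β x) = e 0 γ x :=
  S.I.comp 0 β γ (zero_le (a := β)) h h' x (by rwa [S.I.m0])

theorem cr_eq (S : Sit κ M U Mb m u α Mod cr Us e) : ∀ β ≤ α, cr β = e 0 β κ := by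
  refine ord_ind ?_ ?_ ?_
  · rw [S.I.c0, S.e00 S.L.κM]
  · intro β hβ ih
    rw [S.I.cs β hβ, ih, S.cmp (le2 β) hβ S.L.κM]
  · intro l h1 h2 h3 _
    exact S.I.cl l h1 h2 h3

theorem mMod (S : Sit κ M U Mb m u α Mod cr Us e) (h : β ≤ α) (n : ℕ) : e 0 β (m n) ∈ Mod β := (S.el0 h).maps _ (S.L.mM n)
theorem uMod (S : Sit κ M U Mb m u α Mod cr Us e) (h : β ≤ α) (n : ℕ) : e 0 β (u n) ∈ Mod β := (S.el0 h).maps _ (S.L.uM n)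

theorem FG (S : Sit κ M U Mb m u α Mod cr Us e) : ∀ β ≤ α, (∀ A ∈ Us β, A ∈ Mod β) ∧ ∀ n y, y ∈ e 0 β (u n) ↔ y ∈ Us β ∧ y ∈ e 0 β (m n) := by
  refine ord_ind ?_ ?_ ?_
  · rw [S.I.u0, S.I.m0]
    refine ⟨fun A hA => (S.L.hU.1 A hA).1, fun n y => ?_⟩
    rw [S.e00 (S.L.uM n), S.e00 (S.L.mM n)]
    exact S.L.hu n y
  · intro β hβ ih
    have E := S.I.el β (β+1) (le2 β) hβ
    refine ⟨fun A hA => ?_, fun n y => ?_⟩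
    · obtain ⟨X, hX, h1, h2⟩ := (S.I.us β hβ A).1 hA
      exact E.trN _ (E.maps _ h1) h2
    · have hmβ := S.mMod (le1 hβ) n
      have huβ := S.uMod (le1 hβ) n
      have e1 : e 0 β (m n) ∩ Us β = e 0 β (u n) := by
        ext y; rw [mem_inter, ih.2 n y, and_comm]
      rw [← S.cmp (le2 β) hβ (S.L.uM n), ← S.cmp (le2 β) hβ (S.L.mM n)]
      constructor
      · intro hy
        refine ⟨(S.I.us β hβ y).2 ⟨_, hmβ, by rwa [e1], by rwa [e1]⟩, ?_⟩
        have : e 0 β (u n) ⊆ e 0 β (m n) := fun y hy => ((ih.2 n y).1 hy).2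
        exact ((E.tr2 (fun x y => x ⊆ y) huβ hmβ).1 this) hy
      · rintro ⟨hy, hy2⟩
        obtain ⟨X, hX, h1, h2⟩ := (S.I.us β hβ y).1 hy
        have : ∀ z ∈ X ∩ Us β, z ∈ e 0 β (m n) → z ∈ e 0 β (u n) := fun z hz hz2 => (ih.2 n z).2 ⟨(mem_inter.1 hz).2, hz2⟩
        exact (E.tr3 (fun a b c => ∀ z ∈ a, z ∈ b → z ∈ c) h1 hmβ huβ).1 this y h2 hy2
  · intro l h1 h2 h3 ih
    have hl := S.I.ul l h1 h2 h3
    refine ⟨fun A hA => ?_, fun n y => ?_⟩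
    · obtain ⟨β, hβ, B, hB, rfl⟩ := (hl A).1 hA
      exact (S.I.el β l hβ.le h1).maps _ ((ih β hβ).1 B hB)
    · have tr : ∀ β < l, ∀ z ∈ Mod β, (z ∈ e 0 β (m n) ↔ e β l z ∈ e 0 l (m n)) ∧ (z ∈ e 0 β (u n) ↔ e β l z ∈ e 0 l (u n)) := fun β hβ z hz => by
        have hβα := hβ.le.trans h1
        have E := S.I.el β l hβ.le h1
        rw [← S.cmp hβ.le h1 (S.L.uM n), ← S.cmp hβ.le h1 (S.L.mM n)]
        exact ⟨E.tr2 (fun x y => x ∈ y) hz (S.mMod hβα n), E.tr2 (fun x y => x ∈ y) hz (S.uMod hβα n)⟩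
      constructor
      · intro hy
        obtain ⟨β, hβ, z, hz, rfl⟩ := S.I.ml l h1 h2 h3 y ((S.el0 h1).trN _ (S.uMod h1 n) hy)
        have h4 := ((ih β hβ).2 n z).1 (((tr β hβ z hz).2).2 hy)
        exact ⟨(hl _).2 ⟨β, hβ, z, h4.1, rfl⟩, ((tr β hβ z hz).1).1 h4.2⟩
      · rintro ⟨hy, hy2⟩
        obtain ⟨β, hβ, B, hB, rfl⟩ := (hl y).1 hy
        have hBM := (ih β hβ).1 B hB
        exact ((tr β hβ B hBM).2).1 (((ih β hβ).2 n B).2 ⟨hB, ((tr β hβ B hBM).1).2 hy2⟩)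

theorem F (S : Sit κ M U Mb m u α Mod cr Us e) (h : β ≤ α) (n : ℕ) (y : ZFSet.{u}) : y ∈ e 0 β (u n) ↔ y ∈ Us β ∧ y ∈ e 0 β (m n) := (S.FG β h).2 n y

theorem ecT (S : Sit κ M U Mb m u α Mod cr Us e) (h : β ≤ α) : EC (fun n => e 0 β (m n)) (TT m Mod e β) := by
  refine S.L.ec.map (S.el0 h) S.L.mM (fun n => ⟨_, (S.L.md n).empty_mem⟩) fun x => ?_
  rw [TT, mem_sep]
  exact ⟨fun h => h.2, fun ⟨n, hn⟩ => ⟨(S.el0 h).trN _ (S.mMod h n) hn, n, hn⟩⟩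

theorem elT0 (S : Sit κ M U Mb m u α Mod cr Us e) (h : β ≤ α) : El Mb (TT m Mod e β) (e 0 β) :=
  S.L.ec.el (S.el0 h) S.L.mM (S.ecT h)

theorem elT (S : Sit κ M U Mb m u α Mod cr Us e) (h : β ≤ γ) (h' : γ ≤ α) : El (TT m Mod e β) (TT m Mod e γ) (e β γ) := by
  refine (S.ecT (h.trans h')).el (S.I.el β γ h h') (fun n => S.mMod (h.trans h') n) ?_
  have := S.ecT h'
  have e1 : (fun n => e β γ (e 0 β (m n))) = (fun n => e 0 γ (m n)) := funext fun n => S.cmp h h' (S.L.mM n)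
  rw [e1]; exact this

theorem mT (S : Sit κ M U Mb m u α Mod cr Us e) (h : β ≤ α) : IsTransModel (TT m Mod e β) := by
  refine transModel_transfer S.L.model (S.elT0 h).trN ?_ fun σ hσ => ?_
  · have := (S.elT0 h).maps _ S.L.model.empty_mem
    rwa [((S.elT0 h).tr1 (fun x => x = ∅) S.L.model.empty_mem).1 rfl] at this
  · have h1 := ((S.elT0 h).el σ _ fun _ => S.L.model.empty_mem).1 hσ
    rw [((S.elT0 h).tr1 (fun x => x = ∅) S.L.model.empty_mem).1 rfl] at h1
    exact h1

theorem TMod {x : ZFSet.{u}} (hx : x ∈ TT m Mod e β) : x ∈ Mod β := (mem_sep.1 hx).1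

end Sit

/-! ## The hulls -/

inductive KK (Mb : ZFSet.{u}) (cr : Ordinal.{v} → ZFSet.{u}) (e : Ordinal.{v} → Ordinal.{v} → ZFSet.{u} → ZFSet.{u}) (β : Ordinal.{v}) : ZFSet.{u} → Prop
  | base (x : ZFSet.{u}) (hx : x ∈ Mb) : KK Mb cr e β (e 0 β x)
  | crit (ξ : Ordinal.{v}) (hξ : ξ < β) : KK Mb cr e β (e (ξ+1) β (cr ξ))
  | prr (a b : ZFSet.{u}) (ha : KK Mb cr e β a) (hb : KK Mb cr e β b) : KK Mb cr e β (pair a b)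
  | app (f d a : ZFSet.{u}) (hf : f ∈ Mb) (hd : d ∈ Mb) (h : IsZFunc d f) (ha : KK Mb cr e β a) (ha' : a ∈ e 0 β d) : KK Mb cr e β (fapp (e 0 β f) a)

def KS (Mb : ZFSet.{u}) (m : ℕ → ZFSet.{u}) (Mod cr : Ordinal.{v} → ZFSet.{u}) (e : Ordinal.{v} → Ordinal.{v} → ZFSet.{u} → ZFSet.{u}) (β : Ordinal.{v}) : ZFSet.{u} :=
  ZFSet.sep (KK Mb cr e β) (TT m Mod e β)

namespace Sit
variable {κ M U Mb : ZFSet.{u}} {m u : ℕ → ZFSet.{u}} {α β γ : Ordinal.{v}} {Mod cr Us : Ordinal.{v} → ZFSet.{u}} {e : Ordinal.{v} → Ordinal.{v} → ZFSet.{u} → ZFSet.{u}}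

theorem crT (S : Sit κ M U Mb m u α Mod cr Us e) (h : β ≤ α) : cr β ∈ TT m Mod e β := by
  rw [S.cr_eq β h]; exact (S.elT0 h).maps _ S.L.κMb
theorem uT (S : Sit κ M U Mb m u α Mod cr Us e) (h : β ≤ α) (n : ℕ) : e 0 β (u n) ∈ TT m Mod e β := (S.elT0 h).maps _ (S.L.uMb n)
theorem mmT (S : Sit κ M U Mb m u α Mod cr Us e) (h : β ≤ α) (n : ℕ) : e 0 β (m n) ∈ TT m Mod e β := (S.elT0 h).maps _ (S.L.mMb n)

theorem s1 (S : Sit κ M U Mb m u α Mod cr Us e) (h : β ≤ α) (n : ℕ) : ∀ y ∈ e 0 β (u n), y ⊆ cr β := by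
  rw [S.cr_eq β h]
  exact ((S.elT0 h).tr2 (fun u κ => ∀ y ∈ u, y ⊆ κ) (S.L.uMb n) S.L.κMb).1 (S.L.t1 n)

theorem s2 (S : Sit κ M U Mb m u α Mod cr Us e) (h : β ≤ α) (n : ℕ) : ∀ γ ∈ cr β, ∃ T ∈ e 0 β (u n), ∀ ξ ∈ T, γ ∈ ξ := by
  rw [S.cr_eq β h]
  exact ((S.elT0 h).tr2 (fun u κ => ∀ γ ∈ κ, ∃ T ∈ u, ∀ ξ ∈ T, γ ∈ ξ) (S.L.uMb n) S.L.κMb).1 (S.L.t2 n)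

theorem s3 (S : Sit κ M U Mb m u α Mod cr Us e) (h : β ≤ α) (n : ℕ) : ∀ f ∈ e 0 β (m n), IsZFunc (cr β) f → (∃ S ∈ e 0 β (u n), ∀ ξ ∈ S, fapp f ξ ∈ ξ) →
    ∃ γ ∈ cr β, ∃ T ∈ e 0 β (u n), ∀ ξ ∈ T, γ = fapp f ξ := by
  rw [S.cr_eq β h]
  refine ((S.elT0 h).tr3 (fun u κ m => ∀ f ∈ m, IsZFunc κ f → (∃ S ∈ u, ∀ ξ ∈ S, fapp f ξ ∈ ξ) → ∃ γ ∈ κ, ∃ T ∈ u, ∀ ξ ∈ T, γ = fapp f ξ) (S.L.uMb n) S.L.κMb (S.L.mMb n)).1 ?_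
  intro f hf h1 h2
  obtain ⟨γ, hγ, T, hT, h3⟩ := S.L.t3 n f hf h1 h2
  exact ⟨γ, hγ, T, hT, fun ξ hξ => (h3 ξ hξ).symm⟩

theorem crtr (S : Sit κ M U Mb m u α Mod cr Us e) (h : β ≤ α) : (cr β).IsTransitive := by
  rw [S.cr_eq β h]
  exact ((S.elT0 h).tr1 (fun x => x.IsTransitive) S.L.κMb).1 S.L.ord.isTransitive

/-- Measure one sets contain the critical point in their image. -/
theorem uc (S : Sit κ M U Mb m u α Mod cr Us e) (h : β + 1 ≤ α) {n : ℕ} {T : ZFSet.{u}} (hT : T ∈ e 0 β (u n)) : cr β ∈ e β (β+1) T :=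
  (S.I.ui β h T ((S.el0 (le1 h)).trN _ (S.uMod (le1 h) n) hT) (S.s1 (le1 h) n T hT)).1 ((S.F (le1 h) n T).1 hT).1

theorem cne (S : Sit κ M U Mb m u α Mod cr Us e) (h : β ≤ α) : ∃ x, x ∈ cr β := by
  rw [S.cr_eq β h]
  have := ((S.elT0 h).tr1 (fun k => ∃ x ∈ k, x = x) S.L.κMb).1 ⟨_, S.L.ne, rfl⟩
  exact ⟨this.choose, this.choose_spec.1⟩

theorem cc (S : Sit κ M U Mb m u α Mod cr Us e) (h : β + 1 ≤ α) : cr β ∈ e β (β+1) (cr β) := by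
  obtain ⟨x, hx⟩ := S.cne (le1 h)
  obtain ⟨T, hT, -⟩ := S.s2 (le1 h) 0 x hx
  have h1 : T ⊆ cr β := S.s1 (le1 h) 0 T hT
  exact ((S.elT (le2 β) h).tr2 (fun x y => x ⊆ y) ((S.mT (le1 h)).trans (S.uT (le1 h) 0) hT) (S.crT (le1 h))).1 h1 (S.uc h hT)

theorem crT1 (S : Sit κ M U Mb m u α Mod cr Us e) (h : β + 1 ≤ α) : cr β ∈ TT m Mod e (β+1) :=
  (S.mT h).trans ((S.elT (le2 β) h).maps _ (S.crT (le1 h))) (S.cc h)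

theorem lt1 (h : γ < β) (hβ : β ≤ α) : γ + 1 ≤ α := (Order.add_one_le_of_lt h).trans hβ
theorem lt1' (h : γ < β) : γ + 1 ≤ β := (Order.add_one_le_of_lt h)

theorem fnT (S : Sit κ M U Mb m u α Mod cr Us e) (h : β ≤ α) {f d : ZFSet.{u}} (hf : f ∈ Mb) (hd : d ∈ Mb) (hfd : IsZFunc d f) : IsZFunc (e 0 β d) (e 0 β f) :=
  ((S.elT0 h).tr2 (fun d f => IsZFunc d f) hd hf).1 hfd

theorem KT (S : Sit κ M U Mb m u α Mod cr Us e) (h : β ≤ α) {x : ZFSet.{u}} (hx : KK Mb cr e β x) : x ∈ TT m Mod e β := by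
  induction hx with
  | base x hx => exact (S.elT0 h).maps _ hx
  | crit ξ hξ => exact (S.elT (lt1' hξ) h).maps _ (S.crT1 (lt1 hξ h))
  | prr a b _ _ ha hb => exact (S.mT h).pair_mem ha hb
  | app f d a hf hd hfd _ ha' ha => exact (S.mT h).fappD ((S.elT0 h).maps _ hf) (S.fnT h hf hd hfd) a

theorem memKS (S : Sit κ M U Mb m u α Mod cr Us e) (h : β ≤ α) {x : ZFSet.{u}} : x ∈ KS Mb m Mod cr e β ↔ KK Mb cr e β x := by
  rw [KS, mem_sep]; exact ⟨fun h => h.2, fun hx => ⟨S.KT h hx, hx⟩⟩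

theorem ck (S : Sit κ M U Mb m u α Mod cr Us e) (h : β ≤ α) : CK (KS Mb m Mod cr e β) (TT m Mod e β) := by
  refine ⟨hull_elem S.L.model (S.elT0 h) S.L.mMb (S.ecT h) (fun x hx => (mem_sep.1 hx).1) ?_ ?_, (S.mT h).tr⟩
  · intro a ha b hb
    rw [S.memKS h] at *
    exact .prr a b ha hb
  · intro f hf d hd hfd a ha ha'
    rw [S.memKS h] at *
    exact .app f d a hf hd hfd ha ha'

theorem e_pair {T T' a b : ZFSet.{u}} {j : ZFSet.{u} → ZFSet.{u}} (E : El T T' j) (hT : IsTransModel T) (ha : a ∈ T) (hb : b ∈ T) : j (pair a b) = pair (j a) (j b) :=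
  (E.tr3 (fun z x y => z = pair x y) (hT.pair_mem ha hb) ha hb).1 rfl

theorem e_fapp {T T' f a : ZFSet.{u}} {j : ZFSet.{u} → ZFSet.{u}} (E : El T T' j) (hf : f ∈ T) (ha : a ∈ T) (hb : fapp f a ∈ T) : j (fapp f a) = fapp (j f) (j a) :=
  (E.tr3 (fun z x y => z = fapp x y) hb hf ha).1 rfl

theorem Kmap (S : Sit κ M U Mb m u α Mod cr Us e) (h : β ≤ γ) (h' : γ ≤ α) {x : ZFSet.{u}} (hx : KK Mb cr e β x) : KK Mb cr e γ (e β γ x) := by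
  have hβ := h.trans h'
  have E := S.elT h h'
  induction hx with
  | base x hx => rw [S.cmp h h' (S.L.MbM hx)]; exact .base x hx
  | crit ξ hξ =>
    rw [S.I.comp (ξ+1) β γ (lt1' hξ) h h' _ (TMod (S.crT1 (lt1 hξ hβ)))]
    exact .crit ξ (hξ.trans_le h)
  | prr a b ha hb iha ihb =>
    rw [e_pair E (S.mT hβ) (S.KT hβ ha) (S.KT hβ hb)]
    exact .prr _ _ iha ihb
  | app f d a hf hd hfd ha ha' ih =>
    have hfT := (S.elT0 hβ).maps _ hf
    rw [e_fapp E hfT (S.KT hβ ha) ((S.mT hβ).fappD hfT (S.fnT hβ hf hd hfd) a), S.cmp h h' (S.L.MbM hf)]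
    refine .app f d _ hf hd hfd ih ?_
    rw [← S.cmp h h' (S.L.MbM hd)]
    exact (E.tr2 (fun x y => x ∈ y) (S.KT hβ ha) ((S.elT0 hβ).maps _ hd)).1 ha'

theorem Klim (S : Sit κ M U Mb m u α Mod cr Us e) {l : Ordinal.{v}} (h1 : l ≤ α) (h2 : l ≠ 0) (h3 : ∀ β < l, β + 1 < l) {x : ZFSet.{u}} (hx : KK Mb cr e l x) :
    ∃ β < l, ∃ y, KK Mb cr e β y ∧ e β l y = x := by
  induction hx with
  | base x hx => exact ⟨0, pos_iff_ne_zero.2 h2, _, .base x hx, S.cmp (zero_le (a := l)) h1 (S.L.MbM hx)⟩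
  | crit ξ hξ =>
    refine ⟨ξ+1, h3 ξ hξ, _, .crit ξ (Order.lt_add_one_iff.2 le_rfl), ?_⟩
    rw [S.I.idd (ξ+1) (lt1 hξ h1) _ (TMod (S.crT1 (lt1 hξ h1)))]
  | prr a b ha hb iha ihb =>
    obtain ⟨β, hβ, a, ha1, rfl⟩ := iha
    obtain ⟨γ, hγ, b, hb1, rfl⟩ := ihb
    have hd : max β γ < l := max_lt hβ hγ
    have hdα := hd.le.trans h1
    refine ⟨max β γ, hd, _, .prr _ _ (S.Kmap (le_max_left β γ) hdα ha1) (S.Kmap (le_max_right β γ) hdα hb1), ?_⟩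
    rw [e_pair (S.elT hd.le h1) (S.mT hdα) (S.KT hdα (S.Kmap (le_max_left β γ) hdα ha1)) (S.KT hdα (S.Kmap (le_max_right β γ) hdα hb1)),
      S.I.comp β _ l (le_max_left β γ) hd.le h1 _ (TMod (S.KT (hβ.le.trans h1) ha1)), S.I.comp γ _ l (le_max_right β γ) hd.le h1 _ (TMod (S.KT (hγ.le.trans h1) hb1))]
  | app f d a hf hd hfd ha ha' ih =>
    obtain ⟨β, hβ, a, ha1, rfl⟩ := ih
    have hβα := hβ.le.trans h1
    have E := S.elT hβ.le h1
    refine ⟨β, hβ, _, .app f d a hf hd hfd ha1 ?_, ?_⟩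
    · rw [← S.cmp hβ.le h1 (S.L.MbM hd)] at ha'
      exact (E.tr2 (fun x y => x ∈ y) (S.KT hβα ha1) ((S.elT0 hβα).maps _ hd)).2 ha'
    · have hfT := (S.elT0 hβα).maps _ hf
      rw [e_fapp E hfT (S.KT hβα ha1) ((S.mT hβα).fappD hfT (S.fnT hβα hf hd hfd) a), S.cmp hβ.le h1 (S.L.MbM hf)]

end Sit

/-! ## Generation and the collapse of the critical point -/

theorem ElemSub.exD3 {K T p1 p2 p3 : ZFSet.{u}} (h : ElemSub K.toSet T.toSet) (hT : T.IsTransitive) (P : Set ZFSet.{u} → ZFSet.{u} → ZFSet.{u} → ZFSet.{u} → ZFSet.{u} → Prop) [hP : UDef (fun D v => P D (v 0) (v 1) (v 2) (v 3))]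
    (h1 : p1 ∈ K) (h2 : p2 ∈ K) (h3 : p3 ∈ K) (H : ∃ x ∈ T, P T.toSet x p1 p2 p3) : ∃ x ∈ K, P T.toSet x p1 p2 p3 :=
  h.exv hT (fun D v => P D (v 0) (v 1) (v 2) (v 3)) (cons' p1 (cons' p2 (fun _ => p3))) (cons'_mem (D := K.toSet) (mem_toSet.2 h1) (cons'_mem (D := K.toSet) (mem_toSet.2 h2) (fun _ => mem_toSet.2 h3))) H

theorem El.trD4 {M N : ZFSet.{u}} {j : ZFSet.{u} → ZFSet.{u}} (hj : El M N j) (P : Set ZFSet.{u} → ZFSet.{u} → ZFSet.{u} → ZFSet.{u} → ZFSet.{u} → Prop)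
    [UDef (fun D v => P D (v 0) (v 1) (v 2) (v 3))] {p1 p2 p3 p4 : ZFSet.{u}} (h1 : p1 ∈ M) (h2 : p2 ∈ M) (h3 : p3 ∈ M) (h4 : p4 ∈ M) : P M.toSet p1 p2 p3 p4 ↔ P N.toSet (j p1) (j p2) (j p3) (j p4) :=
  hj.trv (fun D v => P D (v 0) (v 1) (v 2) (v 3)) (cons' p1 (cons' p2 (cons' p3 (fun _ => p4)))) (cons'_mem (mem_toSet.2 h1) (cons'_mem (mem_toSet.2 h2) (cons'_mem (mem_toSet.2 h3) (fun _ => h4))))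

def PairP (D : Set ZFSet.{u}) (h c f g : ZFSet.{u}) : Prop :=
  IsZFunc c h ∧ ∀ ξ ∈ c, ∃ s ∈ D, ∃ t ∈ D, ∃ y ∈ D, s = fapp f ξ ∧ t = fapp g ξ ∧ y = fapp h ξ ∧ y = pair s t

instance : UDef (fun D v => PairP D (v 0) (v 1) (v 2) (v 3)) := by unfold PairP; infer_instance

def CompP (D : Set ZFSet.{u}) (h c f g : ZFSet.{u}) : Prop :=
  IsZFunc c h ∧ ∀ ξ ∈ c, ∃ s ∈ D, ∃ y ∈ D, s = fapp f ξ ∧ y = fapp h ξ ∧ y = fapp g s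

instance : UDef (fun D v => CompP D (v 0) (v 1) (v 2) (v 3)) := by unfold CompP; infer_instance

namespace Sit
variable {κ M U Mb : ZFSet.{u}} {m u : ℕ → ZFSet.{u}} {α β γ : Ordinal.{v}} {Mod cr Us : Ordinal.{v} → ZFSet.{u}} {e : Ordinal.{v} → Ordinal.{v} → ZFSet.{u} → ZFSet.{u}}

theorem crK (S : Sit κ M U Mb m u α Mod cr Us e) (h : β ≤ α) : KK Mb cr e β (cr β) := by
  rw [S.cr_eq β h]; exact .base _ S.L.κMb

theorem inK (S : Sit κ M U Mb m u α Mod cr Us e) (h : β ≤ α) {x : ZFSet.{u}} (hx : KK Mb cr e β x) : x ∈ KS Mb m Mod cr e β := (S.memKS h).2 hx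

theorem genc (S : Sit κ M U Mb m u α Mod cr Us e) (h : β + 1 ≤ α) {y : ZFSet.{u}} (hy : KK Mb cr e β y) :
    ∃ f, KK Mb cr e β f ∧ IsZFunc (cr β) f ∧ e β (β+1) y = fapp (e β (β+1) f) (cr β) := by
  have hβ := le1 h
  obtain ⟨f, hf, h1, h2⟩ := (S.ck hβ).es.ex2 (S.ck hβ).tr (fun f c y => IsZFunc c f ∧ ∀ ξ ∈ c, y = fapp f ξ) (S.inK hβ (S.crK hβ)) (S.inK hβ hy) (by
    obtain ⟨f, hf, h1, h2⟩ := (replD1 (S.mT hβ) (fun _ x z y => z = y) (S.crT hβ) (S.KT hβ hy) (fun _ => y) (fun _ _ => S.KT hβ hy) (fun _ _ _ _ => Iff.rfl)).2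
    exact ⟨f, hf, h1, fun ξ hξ => (h2 ξ hξ).symm⟩)
  have hfK := (S.memKS hβ).1 hf
  exact ⟨f, hfK, h1, ((S.elT (le2 β) h).tr3 (fun f c y => ∀ ξ ∈ c, y = fapp f ξ) (S.KT hβ hfK) (S.crT hβ) (S.KT hβ hy)).1 h2 _ (S.cc h)⟩

theorem gen (S : Sit κ M U Mb m u α Mod cr Us e) (h : β + 1 ≤ α) {b : ZFSet.{u}} (hb : KK Mb cr e (β+1) b) :
    ∃ f, KK Mb cr e β f ∧ IsZFunc (cr β) f ∧ b = fapp (e β (β+1) f) (cr β) := by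
  have hβ := le1 h
  have E := S.elT (le2 β) h
  induction hb with
  | base x hx =>
    rw [← S.cmp (le2 β) h (S.L.MbM hx)]
    exact S.genc h (.base x hx)
  | crit ξ hξ =>
    rcases (Order.lt_add_one_iff.1 hξ).lt_or_eq with h1 | h1
    · rw [← S.I.comp (ξ+1) β (β+1) (lt1' h1) (le2 β) h _ (TMod (S.crT1 (lt1 h1 hβ)))]
      exact S.genc h (.crit ξ h1)
    · subst h1
      rw [S.I.idd _ h _ (TMod (S.crT1 h))]
      obtain ⟨f, hf, h1, h2⟩ := (S.ck hβ).es.ex2 (S.ck hβ).tr (fun f c y => IsZFunc c f ∧ ∀ ξ ∈ c, ξ = fapp f ξ) (S.inK hβ (S.crK hβ)) (S.inK hβ (S.crK hβ)) (by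
        obtain ⟨f, hf, h1, h2⟩ := (replD0 (S.mT hβ) (fun _ x z => z = x) (S.crT hβ) (fun x => x) (fun x hx => (S.mT hβ).trans (S.crT hβ) hx) (fun _ _ _ _ => Iff.rfl)).2
        exact ⟨f, hf, h1, fun ξ hξ => (h2 ξ hξ).symm⟩)
      have hfK := (S.memKS hβ).1 hf
      exact ⟨f, hfK, h1, (E.tr2 (fun f c => ∀ ξ ∈ c, ξ = fapp f ξ) (S.KT hβ hfK) (S.crT hβ)).1 h2 _ (S.cc h)⟩
  | prr a b ha hb iha ihb =>
    obtain ⟨f, hf, hf1, hf2⟩ := iha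
    obtain ⟨g, hg, hg1, hg2⟩ := ihb
    have hfT := S.KT hβ hf
    have hgT := S.KT hβ hg
    have T := S.mT hβ
    obtain ⟨k, hk, hk1⟩ := (S.ck hβ).es.exD3 (S.ck hβ).tr PairP (S.inK hβ (S.crK hβ)) (S.inK hβ hf) (S.inK hβ hg) (by
      obtain ⟨k, hk, h1, h2⟩ := (replD2 T (fun D x y f g => ∃ s ∈ D, ∃ t ∈ D, s = fapp f x ∧ t = fapp g x ∧ y = pair s t) (S.crT hβ) hfT hgT
        (fun x => pair (fapp f x) (fapp g x)) (fun x hx => T.pair_mem (T.fappD hfT hf1 x) (T.fappD hgT hg1 x)) (fun x _ y _ => by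
          constructor
          · rintro ⟨s, _, t, _, rfl, rfl, rfl⟩; rfl
          · rintro rfl; exact ⟨_, T.fappD hfT hf1 x, _, T.fappD hgT hg1 x, rfl, rfl, rfl⟩)).2
      exact ⟨k, hk, h1, fun ξ hξ => ⟨_, T.fappD hfT hf1 ξ, _, T.fappD hgT hg1 ξ, _, T.fappD hk h1 ξ, rfl, rfl, rfl, h2 ξ hξ⟩⟩)
    have hkK := (S.memKS hβ).1 hk
    refine ⟨k, hkK, hk1.1, ?_⟩
    obtain ⟨s, _, t, _, y, _, h1, h2, h3, h4⟩ := ((E.trD4 PairP (S.KT hβ hkK) (S.crT hβ) hfT hgT).1 hk1).2 _ (S.cc h)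
    rw [← h3, h4, h1, h2, hf2, hg2]
  | app F d a hF hd hFd ha ha' ih =>
    obtain ⟨f, hf, hf1, hf2⟩ := ih
    have hfT := S.KT hβ hf
    have hgT := (S.elT0 hβ).maps _ hF
    have hg1 := S.fnT hβ hF hd hFd
    have T := S.mT hβ
    obtain ⟨k, hk, hk1⟩ := (S.ck hβ).es.exD3 (S.ck hβ).tr CompP (S.inK hβ (S.crK hβ)) (S.inK hβ hf) (S.inK hβ (.base F hF)) (by
      obtain ⟨k, hk, h1, h2⟩ := (replD2 T (fun D x y f g => ∃ s ∈ D, s = fapp f x ∧ y = fapp g s) (S.crT hβ) hfT hgT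
        (fun x => fapp (e 0 β F) (fapp f x)) (fun x hx => T.fappD hgT hg1 _) (fun x _ y _ => by
          constructor
          · rintro ⟨s, _, rfl, rfl⟩; rfl
          · rintro rfl; exact ⟨_, T.fappD hfT hf1 x, rfl, rfl⟩)).2
      exact ⟨k, hk, h1, fun ξ hξ => ⟨_, T.fappD hfT hf1 ξ, _, T.fappD hk h1 ξ, rfl, rfl, h2 ξ hξ⟩⟩)
    have hkK := (S.memKS hβ).1 hk
    refine ⟨k, hkK, hk1.1, ?_⟩
    obtain ⟨s, _, y, _, h1, h3, h4⟩ := ((E.trD4 CompP (S.KT hβ hkK) (S.crT hβ) hfT hgT).1 hk1).2 _ (S.cc h)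
    rw [← h3, h4, h1, ← hf2, S.cmp (le2 β) h (S.L.MbM hF)]

theorem fixa (S : Sit κ M U Mb m u α Mod cr Us e) (h : β + 1 ≤ α) {x : ZFSet.{u}} (hx : x ∈ cr β) : e β (β+1) x ∈ cr β := by
  have hβ := le1 h
  obtain ⟨T, hT, h1⟩ := S.s2 hβ 0 x hx
  exact ((S.elT (le2 β) h).tr2 (fun T x => ∀ ξ ∈ T, x ∈ ξ) ((S.mT hβ).trans (S.uT hβ 0) hT) ((S.mT hβ).trans (S.crT hβ) hx)).1 h1 _ (S.uc h hT)

theorem fixb (S : Sit κ M U Mb m u α Mod cr Us e) (h : β + 1 ≤ α) {a : ZFSet.{u}} (ha : KK Mb cr e (β+1) a) (hac : a ∈ cr β) :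
    ∃ x, KK Mb cr e β x ∧ x ∈ cr β ∧ a = e β (β+1) x := by
  have hβ := le1 h
  have E := S.elT (le2 β) h
  obtain ⟨f, hf, hf1, rfl⟩ := S.gen h ha
  have hfT := S.KT hβ hf
  have hS : ZFSet.sep (fun ξ => fapp f ξ ∈ ξ) (cr β) ∈ TT m Mod e β := sepD1 (S.mT hβ) (fun _ x f => fapp f x ∈ x) (S.crT hβ) hfT
  set Q := ZFSet.sep (fun ξ => fapp f ξ ∈ ξ) (cr β) with hQ
  have h1 : cr β ∈ e β (β+1) Q := (E.tr3 (fun Q f c => ∀ ξ ∈ c, fapp f ξ ∈ ξ → ξ ∈ Q) hS hfT (S.crT hβ)).1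
    (fun ξ hξ h => mem_sep.2 ⟨hξ, h⟩) _ (S.cc h) hac
  have h2 : Q ∈ Us β := (S.I.ui β h Q (TMod hS) (fun x hx => (mem_sep.1 hx).1)).2 h1
  obtain ⟨n1, hn1⟩ := ((S.ecT hβ).hT _).1 hfT
  obtain ⟨n2, hn2⟩ := ((S.ecT hβ).hT _).1 hS
  have hn1 : f ∈ e 0 β (m (max n1 n2)) := (S.ecT hβ).mono' (le_max_left n1 n2) hn1
  have hn2 : Q ∈ e 0 β (m (max n1 n2)) := (S.ecT hβ).mono' (le_max_right n1 n2) hn2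
  obtain ⟨γ, hγ, T, hT, h3⟩ := S.s3 hβ _ f hn1 hf1 ⟨Q, (S.F hβ _ _).2 ⟨h2, hn2⟩, fun ξ hξ => (mem_sep.1 hξ).2⟩
  obtain ⟨γ, hγK, hγ, T, hT, h3⟩ := (S.ck hβ).es.ex3 (S.ck hβ).tr (fun γ c u f => γ ∈ c ∧ ∃ T ∈ u, ∀ ξ ∈ T, γ = fapp f ξ) (S.inK hβ (S.crK hβ)) (S.inK hβ (.base _ (S.L.uMb (max n1 n2)))) (S.inK hβ hf)
    ⟨γ, (S.mT hβ).trans (S.crT hβ) hγ, hγ, T, hT, h3⟩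
  refine ⟨γ, (S.memKS hβ).1 hγK, hγ, ?_⟩
  exact ((E.tr3 (fun T γ f => ∀ ξ ∈ T, γ = fapp f ξ) ((S.mT hβ).trans (S.uT hβ _) hT) ((S.mT hβ).trans (S.crT hβ) hγ) hfT).1 h3 _ (S.uc h hT)).symm

theorem colb (S : Sit κ M U Mb m u α Mod cr Us e) (h : β + 1 ≤ α) (x : ZFSet.{u}) : KK Mb cr e β x → x ∈ cr β →
    col (KS Mb m Mod cr e (β+1)) (e β (β+1) x) = col (KS Mb m Mod cr e β) x := by
  have hβ := le1 h
  have E := S.elT (le2 β) h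
  induction x using ZFSet.inductionOn with
  | _ x ih =>
    intro hx hxc
    ext z
    rw [mem_col, mem_col]
    constructor
    · rintro ⟨y, hy, hyK, rfl⟩
      obtain ⟨y, hy1, hy2, rfl⟩ := S.fixb h ((S.memKS h).1 hyK) (S.crtr hβ _ (S.fixa h hxc) hy)
      have hyx := (E.tr2 (fun x y => x ∈ y) (S.KT hβ hy1) (S.KT hβ hx)).2 hy
      exact ⟨y, hyx, S.inK hβ hy1, ih y hyx hy1 hy2⟩
    · rintro ⟨y, hy, hyK, rfl⟩
      have hy1 := (S.memKS hβ).1 hyK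
      exact ⟨_, (E.tr2 (fun x y => x ∈ y) (S.KT hβ hy1) (S.KT hβ hx)).1 hy, S.inK h (S.Kmap (le2 β) h hy1),
        (ih y hy hy1 (S.crtr hβ _ hxc hy)).symm⟩

theorem colc (S : Sit κ M U Mb m u α Mod cr Us e) (h : β + 1 ≤ α) : col (KS Mb m Mod cr e (β+1)) (cr β) = col (KS Mb m Mod cr e β) (cr β) := by
  have hβ := le1 h
  ext z
  rw [mem_col, mem_col]
  constructor
  · rintro ⟨y, hy, hyK, rfl⟩
    obtain ⟨y, hy1, hy2, rfl⟩ := S.fixb h ((S.memKS h).1 hyK) hy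
    exact ⟨y, hy2, S.inK hβ hy1, S.colb h y hy1 hy2⟩
  · rintro ⟨y, hy, hyK, rfl⟩
    have hy1 := (S.memKS hβ).1 hyK
    exact ⟨_, S.fixa h hy, S.inK h (S.Kmap (le2 β) h hy1), (S.colb h y hy1 hy).symm⟩

theorem crK1 (S : Sit κ M U Mb m u α Mod cr Us e) (h : β + 1 ≤ α) : KK Mb cr e (β+1) (cr β) := by
  have : KK Mb cr e (β+1) (e (β+1) (β+1) (cr β)) := .crit β (Order.lt_add_one_iff.2 le_rfl)
  rwa [S.I.idd _ h _ (TMod (S.crT1 h))] at this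

end Sit

/-! ## The collapsed iteration -/

namespace Sit
variable {κ M U Mb : ZFSet.{u}} {m u : ℕ → ZFSet.{u}} {α β γ : Ordinal.{v}} {Mod cr Us : Ordinal.{v} → ZFSet.{u}} {e : Ordinal.{v} → Ordinal.{v} → ZFSet.{u} → ZFSet.{u}}

theorem K0 (S : Sit κ M U Mb m u α Mod cr Us e) : KS Mb m Mod cr e 0 = Mb := by
  ext x
  rw [S.memKS (zero_le (a := α))]
  constructor
  · intro hx
    obtain ⟨n, hn⟩ := ((S.ecT (zero_le (a := α))).hT _).1 (S.KT (zero_le (a := α)) hx)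
    simp only [S.e00 (S.L.mM n)] at hn
    exact S.L.inMb hn
  · intro hx
    rw [← S.e00 (S.L.MbM hx)]
    exact .base x hx

theorem memM' (S : Sit κ M U Mb m u α Mod cr Us e) (h : β ≤ α) {z : ZFSet.{u}} : z ∈ col (KS Mb m Mod cr e β) (KS Mb m Mod cr e β) ↔ ∃ y, KK Mb cr e β y ∧ z = col (KS Mb m Mod cr e β) y := by
  rw [CK.memK]
  exact exists_congr fun y => by rw [S.memKS h]

theorem memU' (S : Sit κ M U Mb m u α Mod cr Us e) (h : β ≤ α) {z : ZFSet.{u}} : z ∈ col (KS Mb m Mod cr e β) (ZFSet.sep (fun y => y ∈ Us β) (KS Mb m Mod cr e β)) ↔ ∃ y, KK Mb cr e β y ∧ y ∈ Us β ∧ z = col (KS Mb m Mod cr e β) y := by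
  rw [mem_col]
  refine exists_congr fun y => ?_
  rw [mem_sep, S.memKS h]
  tauto

theorem trU (S : Sit κ M U Mb m u α Mod cr Us e) (h : β ≤ γ) (h' : γ ≤ α) {y : ZFSet.{u}} (hy : y ∈ TT m Mod e β) : y ∈ Us β ↔ e β γ y ∈ Us γ := by
  have hβ := h.trans h'
  have E := S.elT h h'
  obtain ⟨n, hn⟩ := ((S.ecT hβ).hT _).1 hy
  have hn' := (E.tr2 (fun x y => x ∈ y) hy (S.mmT hβ n)).1 hn
  have h2 := (E.tr2 (fun x y => x ∈ y) hy (S.uT hβ n))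
  rw [S.cmp h h' (S.L.mM n)] at hn'
  rw [S.cmp h h' (S.L.uM n), S.F hβ, S.F h'] at h2
  tauto

theorem iter (S : Sit κ M U Mb m u α Mod cr Us e) {Ub : ZFSet.{u}} (hUb : ∀ y, y ∈ Ub ↔ y ∈ U ∧ y ∈ Mb) : IsAlphaIterable κ Mb Ub α := by
  set K := KS Mb m Mod cr e with hK
  set e' : Ordinal.{v} → Ordinal.{v} → ZFSet.{u} → ZFSet.{u} := fun β γ z => col (K γ) (e β γ (rho (K β) z)) with he'
  have C : ∀ {β}, β ≤ α → CK (K β) (TT m Mod e β) := fun h => S.ck h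
  have ee : ∀ {β γ}, β ≤ α → ∀ {x}, KK Mb cr e β x → e' β γ (col (K β) x) = col (K γ) (e β γ x) := fun {β γ} h {x} hx => by
    show col (K γ) (e β γ (rho (K β) (col (K β) x))) = _
    rw [(C h).rho (S.inK h hx)]
  have h00 : (0 : Ordinal.{v}) ≤ α := zero_le (a := α)
  have K0 : K 0 = Mb := S.K0
  have id0 : ∀ x, x ⊆ Mb → col (K 0) x = x := fun x hx => by rw [K0]; exact col_id S.L.ec.trT x hx
  have elem : ∀ β γ, β ≤ γ → γ ≤ α → (∀ x ∈ col (K β) (K β), e' β γ x ∈ col (K γ) (K γ)) ∧ ∀ (φ : Fml) (v : ℕ → ZFSet.{u}), (∀ n, v n ∈ col (K β) (K β)) →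
      (Sat (col (K β) (K β)).toSet φ v ↔ Sat (col (K γ) (K γ)).toSet φ (fun n => e' β γ (v n))) := by
    intro β γ h h'
    have hβ := h.trans h'
    refine ⟨fun x hx => ?_, fun φ v hv => ?_⟩
    · obtain ⟨y, hy, rfl⟩ := (S.memM' hβ).1 hx
      rw [ee hβ hy]
      exact (S.memM' h').2 ⟨_, S.Kmap h h' hy, rfl⟩
    · have hr : ∀ n, rho (K β) (v n) ∈ K β := fun n => ((C hβ).rho_mem (hv n)).1
      have hr' : ∀ n, e β γ (rho (K β) (v n)) ∈ K γ := fun n => S.inK h' (S.Kmap h h' ((S.memKS hβ).1 (hr n)))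
      rw [(C hβ).el.el φ v hv, (S.elT h h').el φ _ (fun n => (C hβ).sub (hr n)), ← (C h').es.2 φ _ (fun n => mem_toSet.2 (hr' n)), (C h').satK φ _ hr']
  refine ⟨fun β => col (K β) (K β), fun β => col (K β) (cr β), fun β => col (K β) (ZFSet.sep (fun y => y ∈ Us β) (K β)), e', ?_, ?_, ?_, ?_, ?_, ?_, elem, ?_, ?_⟩
  · show col (K 0) (K 0) = Mb
    rw [id0 _ (by rw [K0]), K0]
  · show col (K 0) (cr 0) = κ
    rw [S.I.c0]; exact id0 _ (S.L.ec.trT _ S.L.κMb)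
  · show col (K 0) (ZFSet.sep (fun y => y ∈ Us 0) (K 0)) = Ub
    rw [id0 _ (by rw [K0]; exact fun x hx => (mem_sep.1 hx).1), K0, S.I.u0]
    ext y
    rw [mem_sep, hUb]; tauto
  · intro β _; exact CK.trans
  · intro β hβ x hx
    obtain ⟨y, hy, rfl⟩ := (S.memM' hβ).1 hx
    rw [ee hβ hy, S.I.idd β hβ _ (TMod (S.KT hβ hy))]
  · intro β γ ρ h1 h2 h3 x hx
    have hγ := h2.trans h3
    have hβ := h1.trans hγ
    obtain ⟨y, hy, rfl⟩ := (S.memM' hβ).1 hx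
    rw [ee hβ hy, ee hβ hy, ee hγ (S.Kmap h1 hγ hy), S.I.comp β γ ρ h1 h2 h3 _ (TMod (S.KT hβ hy))]
  · intro β h
    have hβ := le1 h
    have E := S.elT (le2 β) h
    refine ⟨⟨CK.trans, (elem β (β+1) (le2 β) h).1, (elem β (β+1) (le2 β) h).2, ?_, ?_⟩, ?_, ?_⟩
    · intro a ha
      obtain ⟨b, hb, rfl⟩ := (S.memM' h).1 ha
      obtain ⟨f, hf, hf1, hf2⟩ := S.gen h hb
      have hfM : col (K β) f ∈ col (K β) (K β) := (S.memM' hβ).2 ⟨f, hf, rfl⟩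
      have hcM : col (K β) (cr β) ∈ col (K β) (K β) := (S.memM' hβ).2 ⟨_, S.crK hβ, rfl⟩
      have hfn : IsZFunc (col (K β) (cr β)) (col (K β) f) := by
        refine ((C hβ).el.tr2 (fun c f => IsZFunc c f) hcM hfM).2 ?_
        rw [(C hβ).rho (S.inK hβ (S.crK hβ)), (C hβ).rho (S.inK hβ hf)]
        exact hf1
      refine ⟨_, mem_toSet.2 hfM, hfn, fun x hx => ?_, ?_⟩
      · have := CK.trans _ hfM (fapp_mem hfn hx)
        have h1 : ({x, fapp (col (K β) f) x} : ZFSet.{u}) ∈ pair x (fapp (col (K β) f) x) := by simp [pair]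
        have h2 := CK.trans _ this h1
        exact CK.trans _ h2 (by simp)
      · rw [ee hβ hf]
        show fapp _ (col (K β) (cr β)) = _
        rw [show col (K β) (cr β) = col (K (β+1)) (cr β) from (S.colc h).symm]
        symm
        have hf' := S.Kmap (le2 β) h hf
        refine ((C h).el.tr3 (fun b f c => b = fapp f c) ((S.memM' h).2 ⟨_, hb, rfl⟩) ((S.memM' h).2 ⟨_, hf', rfl⟩) ((S.memM' h).2 ⟨_, S.crK1 h, rfl⟩)).2 ?_
        rw [(C h).rho (S.inK h hb), (C h).rho (S.inK h hf'), (C h).rho (S.inK h (S.crK1 h))]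
        exact hf2
    · intro A hA hAc
      obtain ⟨a, ha, rfl⟩ := (S.memM' hβ).1 hA
      have hac : a ⊆ cr β := by
        have := ((C hβ).el.tr2 (fun c f => c ⊆ f) hA ((S.memM' hβ).2 ⟨_, S.crK hβ, rfl⟩)).1 hAc
        rwa [(C hβ).rho (S.inK hβ (S.crK hβ)), (C hβ).rho (S.inK hβ ha)] at this
      rw [ee hβ ha]
      show _ ∈ col (K β) _ ↔ col (K β) (cr β) ∈ _
      rw [show col (K β) (cr β) = col (K (β+1)) (cr β) from (S.colc h).symm, (C h).mem (S.inK h (S.crK1 h)) (S.inK h (S.Kmap (le2 β) h ha)),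
        ← S.I.ui β h a (TMod (S.KT hβ ha)) hac]
      refine (S.memU' hβ).trans ⟨?_, fun h => ⟨a, ha, h, rfl⟩⟩
      rintro ⟨y, hy, hyU, h1⟩
      rwa [(C hβ).inj a (S.inK hβ ha) y (S.inK hβ hy) h1]
    · show col (K (β+1)) (cr (β+1)) = _
      rw [ee hβ (S.crK hβ), S.I.cs β h]
    · intro A
      show A ∈ col (K (β+1)) _ ↔ _
      rw [show (A ∈ col (K (β+1)) (ZFSet.sep (fun y => y ∈ Us (β+1)) (K (β+1))) ↔ _) from S.memU' h]
      constructor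
      · rintro ⟨a, ha, haU, rfl⟩
        obtain ⟨n, hn⟩ := ((S.ecT h).hT _).1 (S.KT h ha)
        have han := (S.F h n a).2 ⟨haU, hn⟩
        have hmK : KK Mb cr e β (e 0 β (m n)) := .base _ (S.L.mMb n)
        have huK : KK Mb cr e β (e 0 β (u n)) := .base _ (S.L.uMb n)
        have huK' : KK Mb cr e (β+1) (e 0 (β+1) (u n)) := .base _ (S.L.uMb n)
        have hcap : col (K β) (e 0 β (m n)) ∩ col (K β) (ZFSet.sep (fun y => y ∈ Us β) (K β)) = col (K β) (e 0 β (u n)) := by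
          ext z
          rw [mem_inter, show (z ∈ col (K β) (ZFSet.sep (fun y => y ∈ Us β) (K β)) ↔ _) from S.memU' hβ, mem_col, mem_col]
          constructor
          · rintro ⟨⟨y, hy, hyK, rfl⟩, w, hwK, hwU, h1⟩
            have := (C hβ).inj y hyK w (S.inK hβ hwK) h1
            subst this
            exact ⟨y, (S.F hβ n y).2 ⟨hwU, hy⟩, hyK, rfl⟩
          · rintro ⟨y, hy, hyK, rfl⟩
            have := (S.F hβ n y).1 hy
            exact ⟨⟨y, this.2, hyK, rfl⟩, y, (S.memKS hβ).1 hyK, this.1, rfl⟩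
        refine ⟨col (K β) (e 0 β (m n)), mem_toSet.2 ((S.memM' hβ).2 ⟨_, hmK, rfl⟩), ?_, ?_⟩
        · rw [hcap]; exact (S.memM' hβ).2 ⟨_, huK, rfl⟩
        · rw [hcap, ee hβ huK, S.cmp (le2 β) h (S.L.uM n)]
          exact ((C h).mem (S.inK h ha) (S.inK h huK')).2 han
      · rintro ⟨X, hX, hXU, hA⟩
        obtain ⟨y, hy, h1⟩ := (S.memM' hβ).1 hXU
        rw [h1, ee hβ hy] at hA
        obtain ⟨z, hz, hzK, rfl⟩ := mem_col.1 hA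
        have hyT := S.KT hβ hy
        obtain ⟨n, hn⟩ := ((S.ecT hβ).hT _).1 hyT
        have hsub : y ⊆ e 0 β (u n) := by
          by_contra hcon
          obtain ⟨w, hw, hw1, hw2⟩ := (C hβ).es.ex2 (C hβ).tr (fun w y u => w ∈ y ∧ w ∉ u) (S.inK hβ hy) (S.inK hβ (.base _ (S.L.uMb n))) (by
            by_contra hc
            push Not at hc
            exact hcon fun w hw => hc w ((S.mT hβ).trans hyT hw) hw)
          have hwy : col (K β) w ∈ col (K β) y := mem_col.2 ⟨w, hw1, hw, rfl⟩
          rw [← h1] at hwy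
          obtain ⟨w', hw', hwU, h2⟩ := (S.memU' hβ).1 (mem_inter.1 hwy).2
          have := (C hβ).inj w hw w' (S.inK hβ hw') h2
          subst this
          exact hw2 ((S.F hβ n w).2 ⟨hwU, (S.ecT hβ).tr n _ hn hw1⟩)
        have h3 := (E.tr2 (fun x y => x ⊆ y) hyT (S.uT hβ n)).1 hsub hz
        rw [S.cmp (le2 β) h (S.L.uM n)] at h3
        exact ⟨z, (S.memKS h).1 hzK, ((S.F h n z).1 h3).1, rfl⟩
  · intro l h1 h2 h3
    refine ⟨fun x hx => ?_, ?_, fun A => ?_⟩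
    · obtain ⟨y, hy, rfl⟩ := (S.memM' h1).1 hx
      obtain ⟨β, hβ, w, hw, rfl⟩ := S.Klim h1 h2 h3 hy
      have hβα := hβ.le.trans h1
      exact ⟨β, hβ, _, mem_toSet.2 ((S.memM' hβα).2 ⟨w, hw, rfl⟩), ee hβα hw⟩
    · have hκ0 : KK Mb cr e 0 κ := (S.memKS h00).1 (by rw [S.K0]; exact S.L.κMb)
      have := ee (γ := l) h00 hκ0
      rw [id0 κ (S.L.ec.trT _ S.L.κMb)] at this
      rw [this]
      show col (K l) (cr l) = _
      rw [S.I.cl l h1 h2 h3]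
    · rw [show (A ∈ col (K l) (ZFSet.sep (fun y => y ∈ Us l) (K l)) ↔ _) from S.memU' h1]
      constructor
      · rintro ⟨y, hy, hyU, rfl⟩
        obtain ⟨β, hβ, w, hw, rfl⟩ := S.Klim h1 h2 h3 hy
        have hβα := hβ.le.trans h1
        exact ⟨β, hβ, _, (S.memU' hβα).2 ⟨w, hw, (S.trU hβ.le h1 (S.KT hβα hw)).2 hyU, rfl⟩, ee hβα hw⟩
      · rintro ⟨β, hβ, B, hB, rfl⟩
        have hβα := hβ.le.trans h1
        obtain ⟨w, hw, hwU, rfl⟩ := (S.memU' hβα).1 hB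
        rw [ee hβα hw]
        exact ⟨_, S.Kmap hβ.le h1 hw, (S.trU hβ.le h1 (S.KT hβα hw)).1 hwU, rfl⟩

end Sit

theorem empty_mem_of_tr {x y : ZFSet.{u}} (ht : x.IsTransitive) (hy : y ∈ x) : (∅ : ZFSet.{u}) ∈ x := by
  obtain ⟨z, hz, h⟩ := ZFSet.regularity x (by rintro rfl; exact ZFSet.notMem_empty _ hy)
  have : z = ∅ := by
    refine (ZFSet.eq_empty z).2 fun t hz' => ?_
    have : t ∈ x ∩ z := ZFSet.mem_inter.2 ⟨ht z hz hz', hz'⟩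
    rw [h] at this
    exact ZFSet.notMem_empty _ this
  exact this ▸ hz

theorem Ch.fin {κ p D D' M U H A : ZFSet.{u}} {g u m : ℕ → ZFSet.{u}} {α : Ordinal.{v}} (C : Cx κ p D') (hD : IsTransModel D) (hκD : κ ∈ D)
    (c : Ch κ D U H g u m) (hA : A ∈ m 0) (hHM : H ⊆ M) (hU : IsMUltrafilter κ M U) (hit : IsAlphaIterable κ M U α) :
    ∃ M ∈ D.toSet, A ∈ M ∧ IsTransModel M ∧ κ ∈ M ∧ (∃ f ∈ D.toSet, IsZFunc κ f ∧ SurjOnto f κ M) ∧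
      ∃ U ∈ D.toSet, IsMUltrafilter κ M U ∧ WeaklyAmenable κ M U ∧ IsAlphaIterable κ M U α := by
  have h0 : ∀ n, (∅ : ZFSet.{u}) ∈ m n := fun n => by
    cases n with
    | zero => exact empty_mem_of_tr (c.tr 0) c.hκ
    | succ n => exact empty_mem_of_tr (c.tr _) (c.gm n)
  have md : ∀ n, IsTransModel (m n) := fun n => (c.es n).model c.hH (c.tr n) (h0 n)
  have mm : ∀ n, m n ∈ m (n+1) := fun n => by
    rw [c.rg n]; exact (md (n+1)).ran_mem (c.gm n)
  have ms : ∀ n, m n ⊆ m (n+1) := fun n => c.tr (n+1) _ (mm n)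
  obtain ⟨s, hs, hs1, hs2⟩ := c.gs
  obtain ⟨t, ht, ht1, ht2⟩ := c.us
  have hgD : ∀ n, g n ∈ D := fun n => by rw [← hs2 n]; exact hD.fapp_memM hs hs1 (nn_mem n)
  obtain ⟨F, hF, hF1, hF2⟩ := (replD1 hD (fun D x y f => ∃ z ∈ D, z = fapp f x ∧ y = ran z) hD.omega_mem hs (fun x => ran (fapp s x))
    (fun x hx => hD.ran_mem (hD.fapp_memM hs hs1 hx)) (fun x hx y _ => ⟨fun ⟨z, _, hz, hy⟩ => hz ▸ hy,
      fun hy => ⟨_, hD.fapp_memM hs hs1 hx, rfl, hy⟩⟩)).2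
  have hF3 : ∀ n, fapp F (nn n) = m n := fun n => by rw [hF2 _ (nn_mem n), hs2, c.rg]
  have hMb : ∀ x, x ∈ ⋃₀ (ran F) ↔ ∃ n, x ∈ m n := by
    intro x
    simp only [mem_sUnion, mem_ran' hF1]
    constructor
    · rintro ⟨z, ⟨a, ha, rfl⟩, hx⟩
      obtain ⟨n, rfl⟩ := mem_omega.1 ha
      exact ⟨n, hF3 n ▸ hx⟩
    · rintro ⟨n, hx⟩
      exact ⟨m n, ⟨_, nn_mem n, hF3 n⟩, hx⟩
  have hUb' : ∀ x, x ∈ ⋃₀ (ran t) ↔ ∃ n, x ∈ u n := by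
    intro x
    simp only [mem_sUnion, mem_ran' ht1]
    constructor
    · rintro ⟨z, ⟨a, ha, rfl⟩, hx⟩
      obtain ⟨n, rfl⟩ := mem_omega.1 ha
      exact ⟨n, ht2 n ▸ hx⟩
    · rintro ⟨n, hx⟩
      exact ⟨u n, ⟨_, nn_mem n, ht2 n⟩, hx⟩
  have hMbD : ⋃₀ (ran F) ∈ D := hD.sUnion_mem (hD.ran_mem hF)
  have hUbD : ⋃₀ (ran t) ∈ D := hD.sUnion_mem (hD.ran_mem ht)
  have S := smS_sing C.cp hD hκD C.hω
  have hIm : Im D.toSet κ (⋃₀ (ran F)) := by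
    refine sm_sing.1 (S.union (sm_sing.2 ((Im.self hD hκD).sub C.hω)) hF hF1 ?_)
    intro y hy
    obtain ⟨n, rfl⟩ := mem_omega.1 hy
    rw [hF3, c.rg]
    exact sm_sing.2 ((Im.self hD hκD).comp hD hκD (hgD n) (c.fn n))
  generalize ⋃₀ (ran F) = Mb at hMb hMbD hIm
  generalize ⋃₀ (ran t) = Ub at hUb' hUbD
  have hUb : ∀ y, y ∈ Ub ↔ y ∈ U ∧ y ∈ Mb := by
    intro y
    rw [hUb', hMb]
    simp only [c.hu]
    exact ⟨fun ⟨n, h1, h2⟩ => ⟨h1, n, h2⟩, fun ⟨h1, n, h2⟩ => ⟨n, h1, h2⟩⟩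
  have L : Lc κ M U Mb m u := by
    refine ⟨hU, ⟨ms, c.tr, ?_, hMb⟩, md, mm, c.um, c.hu, c.hκ, ?_, C.ord, C.suc, C.h0⟩
    · intro n φ v hv
      exact ((c.es n).2 φ v hv).trans ((c.es (n+1)).2 φ v fun k => ms n (hv k)).symm
    · intro x hx
      obtain ⟨n, hn⟩ := (hMb x).1 hx
      exact hHM ((c.es n).1 hn)
  have hAMb : A ∈ Mb := (hMb A).2 ⟨0, hA⟩
  have hm := L.model
  obtain ⟨q, hq, hq1, hq2⟩ := Im.surj hD hκD hMbD hAMb hIm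
  refine ⟨Mb, hMbD, hAMb, hm, L.κMb, ⟨q, hq, hq1, hq2⟩, Ub, hUbD, ?_, ?_, ?_⟩
  · obtain ⟨u1, u2, u3, u4, u5, u6, u7⟩ := hU
    refine ⟨?_, ?_, ?_, ?_, ?_, ?_, ?_⟩
    · intro A hA
      obtain ⟨h1, h2⟩ := (hUb A).1 hA
      exact ⟨h2, (u1 A h1).2⟩
    · intro a ha
      exact (hUb _).2 ⟨u2 a ha, sepD1 hm (fun _ x p => x ∉ p) L.κMb (hm.trans L.κMb ha)⟩
    · exact fun h => u3 ((hUb _).1 h).1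
    · intro A hA B hB
      obtain ⟨h1, h2⟩ := (hUb A).1 hA
      obtain ⟨h3, h4⟩ := (hUb B).1 hB
      exact (hUb _).2 ⟨u4 A h1 B h3, hm.inter_mem h2 h4⟩
    · intro A hA B hB hBκ hAB
      exact (hUb _).2 ⟨u5 A ((hUb A).1 hA).1 B (L.MbM hB) hBκ hAB, hB⟩
    · intro B hB hBκ
      rcases u6 B (L.MbM hB) hBκ with h | h
      · exact Or.inl ((hUb _).2 ⟨h, hB⟩)
      · exact Or.inr ((hUb _).2 ⟨h, sepD1 hm (fun _ x p => x ∉ p) L.κMb hB⟩)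
    · intro f hf hf1 h
      obtain ⟨γ, hγ, h2⟩ := u7 f (L.MbM hf) hf1 ((hUb _).1 h).1
      refine ⟨γ, hγ, (hUb _).2 ⟨h2, ?_⟩⟩
      have := sepD2 hm (fun _ x f γ => γ = fapp f x) L.κMb hf (hm.trans L.κMb hγ)
      have e : (fun ξ => fapp f ξ = γ) = (fun ξ => γ = fapp f ξ) := funext fun _ => propext eq_comm
      rw [e]; exact this
  · intro X hX _
    obtain ⟨n, hn⟩ := (hMb X).1 hX
    have e : X ∩ Ub = X ∩ u n := by
      ext y
      rw [ZFSet.mem_inter, ZFSet.mem_inter, hUb, c.hu]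
      exact ⟨fun ⟨h1, h2, _⟩ => ⟨h1, h2, c.tr n X hn h1⟩, fun ⟨h1, h2, h3⟩ => ⟨h1, h2, L.inMb h3⟩⟩
    rw [e]
    exact hm.inter_mem hX (L.inMb (c.um n))
  · obtain ⟨Mod, cr, Us, e, I⟩ := hit.it
    exact Sit.iter ⟨L, I⟩ hUb

theorem IsAlphaIterable.wit {κ M U : ZFSet.{u}} {α : Ordinal.{v}} (h : IsAlphaIterable κ M U α) (hα : 1 ≤ α) (hM : IsTransModel M)
    (hκ : κ ∈ M) (ord : κ.IsOrdinal) (hU : IsMUltrafilter κ M U) (wa : WeaklyAmenable κ M U) : ∃ N j, Wit κ M U N j := by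
  obtain ⟨Mod, cr, Us, e, h0, h1, h2, h3, h4, h5, h6, h7, h8⟩ := h
  have h := (h7 0 (by rwa [zero_add])).1
  rw [h0, h1, h2] at h
  obtain ⟨a1, a2, a3, a4, a5⟩ := h
  exact ⟨_, _, hM, hκ, ord, hU, wa, ⟨hM.1, a1, a2, a3⟩, fun a ha => by
    obtain ⟨f, hf, hf1, _, hf2⟩ := a4 a ha
    exact ⟨f, hf, hf1, hf2⟩, a5⟩

theorem rank_pairs {κ x : ZFSet.{u}} (hs : ∀ a ∈ κ, insert a a ∈ κ) (ho : κ.IsOrdinal) (h : x ⊆ ZFSet.prod κ κ) : rank x < rank κ + 3 := by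
  have hl : ∀ o < rank κ, o + 1 < rank κ := by
    intro o h
    obtain ⟨a, ha, h1⟩ := ZFSet.lt_rank_iff.1 h
    have h2 := ZFSet.rank_lt_of_mem (hs a ha)
    refine lt_of_le_of_lt ?_ h2
    have h3 : rank a < rank (insert a a) := ZFSet.rank_lt_of_mem (ZFSet.mem_insert _ _)
    exact Order.add_one_le_of_lt (lt_of_le_of_lt h1 h3)
  have h1 : rank x ≤ rank κ := by
    rw [ZFSet.rank_le_iff]
    intro y hy
    obtain ⟨a, ha, b, hb, rfl⟩ := ZFSet.mem_prod.1 (h hy)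
    have ha := ZFSet.rank_lt_of_mem ha
    have hb := ZFSet.rank_lt_of_mem hb
    have h2 : rank ({a, b} : ZFSet.{u}) < rank κ := by
      rw [ZFSet.rank_pair]
      exact max_lt (hl _ ha) (hl _ hb)
    have h3 : rank ({a} : ZFSet.{u}) < rank κ := by
      rw [ZFSet.rank_singleton]; exact hl _ ha
    rw [ZFSet.pair, ZFSet.rank_pair]
    exact max_lt (hl _ h3) (hl _ h2)
  refine lt_of_le_of_lt h1 ?_
  exact lt_add_of_pos_right _ (by norm_num)

theorem main_thm (κ δ ℳ ℳ' : ZFSet.{u}) (hκ : IsCard κ) (α : Ordinal.{v}) (hα1 : 1 ≤ α)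
    (hM : Practical κ ℳ) (hM' : Practical κ ℳ') (hsub : ℳ ⊆ ℳ') (hreg : IsRegularIn ℳ'.toSet δ)
    (happ : ApproxProperty δ ℳ.toSet ℳ'.toSet) (hseq : OmegaSeqClosedPair ℳ ℳ') (hδκ : δ ∈ κ) (h : AlphaIterableCardIn ℳ' κ α) :
    AlphaIterableCardIn ℳ κ α := by
  obtain ⟨hD, hκD, v, hv, hv'⟩ := hM
  obtain ⟨hD', hκD', -⟩ := hM'
  have ho : κ.IsOrdinal := isOrd_iff.1 hκ.1
  have hωδ : omega ⊆ δ := hreg.2.1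
  have hω : omega ⊆ κ := fun x hx => ho.isTransitive δ hδκ (hωδ hx)
  obtain ⟨p, p1, p2, p3, p4, p5⟩ := GP hκ hω hD hκD
  have cp : CodeP κ p := ⟨p1, p2, p3, p4, p5⟩
  have hs : ∀ a ∈ κ, insert a a ∈ κ := fun a ha => hκ.succ_mem hω ha
  have C : Cx κ p ℳ' := ⟨hD', hκD', ho, hs, hω, cp, fun A hA hAκ => by
    obtain ⟨M, hM, hAM, hMt, hκM, -, U, hU, u1, u2, u3⟩ := h A hA hAκ
    obtain ⟨N, j, w⟩ := u3.wit hα1 hMt hκM ho u1 u2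
    exact ⟨M, U, N, j, w, hAM⟩⟩
  have G : Gd κ p ℳ ℳ' δ := by
    refine ⟨C, hD, hsub, hκD, happ, hδκ, hωδ, _, sepD1 hD (fun _ x p => x ⊆ p) hv (hD.prod_mem hκD hκD), fun c => ?_⟩
    rw [mem_sep, hv']
    exact ⟨fun ⟨⟨h1, _⟩, h2⟩ => ⟨h1, h2⟩, fun ⟨h1, h2⟩ => ⟨⟨h1, rank_pairs hs ho h2⟩, h2⟩⟩
  intro A hA hAκ
  replace hA : A ∈ ℳ := hA
  obtain ⟨V, hV, hV'⟩ := G.v0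
  have S' := smS_sing cp hD' hκD' hω
  have hAS : HS ℳ'.toSet {κ} A := S'.hs_sub (S'.hs_lam (ZFSet.mem_singleton.2 rfl) ho.isTransitive) (hsub hA) hAκ
  have hVS : HS ℳ'.toSet {κ} V := by
    have hIm : Im ℳ'.toSet κ V := by
      obtain ⟨f, hf, h⟩ := G.v0_im hV hV'
      exact ⟨f, hsub hf, h⟩
    refine S'.hs_of (hsub hV) (fun y hy => ⟨V, hsub hV, (G.S.model hV hV').1, hy, sm_sing.2 hIm⟩) (sm_sing.2 hIm)
  obtain ⟨c, hc, hcκ, hc'⟩ := hs_code cp hD' hκD' (S'.hs_pair hAS hVS)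
  obtain ⟨M, hM, hcM, hMt, hκM, -, U, hU, u1, u2, u3⟩ := h c hc hcκ
  have hP := hc' M hMt hκM hcM
  have hAM : A ∈ M := IsTransModel.of_pair_left hMt hP
  have hVM : V ∈ M := IsTransModel.of_pair_right hMt hP
  obtain ⟨N, j, w⟩ := u3.wit hα1 hMt hκM ho u1 u2
  obtain ⟨H, B⟩ := G.big w hM hU hV hV' hVM
  have SW := B.S cp hω
  have hAH : A ∈ H := (B.hH' A).2 (SW.hs_sub (SW.hs_lam (ZFSet.mem_singleton.2 rfl) ho.isTransitive) (B.subs A hAκ hAM hA) hAκ)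
  obtain ⟨g, u, m, ch, hAm⟩ := G.chain w hM hU B hseq hAH
  exact ch.fin C hD hκD hAm B.HM u1 u3

/-- Suppose `ℳ` and `ℳ'` are practical for `κ`, the pair `ℳ ⊆ ℳ'` has the
`δ`-cover and `δ`-approximation properties for some regular cardinal `δ` of `ℳ'`, `ℳ` and
`ℳ'` have the same ordinals, and `ℳ^ω ⊆ ℳ` holds in `ℳ'`. If `κ > δ` is `α`-iterable in
`ℳ'`, then `κ` was already `α`-iterable in `ℳ`. -/
theorem no_new_alpha_iterable (κ δ ℳ ℳ' : ZFSet) (hκ : IsCard κ)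
    (α : Ordinal) (hα1 : 1 ≤ α) (hαω1 : α ≤ (Cardinal.aleph 1).ord)
    (hM : Practical κ ℳ) (hM' : Practical κ ℳ') (hsub : ℳ ⊆ ℳ')
    (hreg : IsRegularIn ℳ'.toSet δ)
    (hcov : CoverProperty δ ℳ.toSet ℳ'.toSet)
    (happ : ApproxProperty δ ℳ.toSet ℳ'.toSet)
    (hord : SameOrdinals ℳ.toSet ℳ'.toSet)
    (hseq : OmegaSeqClosedPair ℳ ℳ')
    (hδκ : δ ∈ κ) :
    AlphaIterableCardIn ℳ' κ α → AlphaIterableCardIn ℳ κ α := by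
  exact main_thm κ δ ℳ ℳ' hκ α hα1 hM hM' hsub hreg happ hseq hδκ

end MPaper
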